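/- Let f be a transcendental entire function whose nonlinearity 𝒩_f = f″/f′ is a rational function (i.e. there exist polynomials P, Q over ℂ with Q ≠ 0 and f″(z)·Q(z) = f′(z)·P(z) for all z ∈ ℂ). If g is a transcendental entire function topologically equivalent to f, then ρ(g) = ρ(f). -/

import Mathlib

open Complex Set Filter Topology Metric MeasureTheory
open scoped ENNReal Real

noncomputable def logPlus (x : ℝ) : ℝ := max 0 (Real.log x)

noncomputable def entireOrder (f : ℂ → ℂ) : ℝ≥0∞ :=
  Filter.limsup
    (fun z : ℂ => ENNReal.ofReal (logPlus (logPlus ‖f z‖) / Real.log ‖z‖))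
    (Filter.comap (fun z : ℂ => ‖z‖) Filter.atTop)

def IsRegularValue (f : ℂ → ℂ) (w : ℂ) : Prop :=
  ∃ U : Set ℂ, IsOpen U ∧ w ∈ U ∧
    ∀ z ∈ f ⁻¹' U,
      ∃ e : ↥(connectedComponentIn (f ⁻¹' U) z) ≃ₜ ↥U,
        ∀ x : ↥(connectedComponentIn (f ⁻¹' U) z), (e x : ℂ) = f ↑x

def singularSet (f : ℂ → ℂ) : Set ℂ := {w : ℂ | ¬ IsRegularValue f w}

def TranscendentalEntire (f : ℂ → ℂ) : Prop :=
  Differentiable ℂ f ∧ ¬ ∃ p : Polynomial ℂ, ∀ z, f z = p.eval z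

def TopEquiv (f g : ℂ → ℂ) : Prop :=
  ∃ φ ψ : ℂ ≃ₜ ℂ, ∀ z, ψ (f z) = g (φ z)

noncomputable def cylArea (A : Set ℂ) : ℝ≥0∞ :=
  ∫⁻ z in A, ENNReal.ofReal (1 / ‖z‖ ^ 2)

def AreaProperty (f : ℂ → ℂ) : Prop :=
  ∀ K : Set ℂ, IsCompact K → K ⊆ (singularSet f)ᶜ →
    cylArea (f ⁻¹' K \ Metric.ball (0 : ℂ) 1) < ⊤

/-- Holomorphic change of variables. -/
theorem lintegral_image_of_hasDerivAt {U : Set ℂ} (hU : MeasurableSet U) {F F' : ℂ → ℂ}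
    (hF : ∀ z ∈ U, HasDerivAt F (F' z) z) (hinj : InjOn F U) (φ : ℂ → ℝ≥0∞) :
    ∫⁻ w in F '' U, φ w = ∫⁻ z in U, ‖F' z‖ₑ ^ 2 * φ (F z) := by
  have h := lintegral_image_eq_lintegral_abs_det_fderiv_mul volume hU
    (f' := fun z => (ContinuousLinearMap.toSpanSingleton ℂ (F' z)).restrictScalars ℝ)
    (fun z hz => ((hF z hz).hasFDerivAt.restrictScalars ℝ).hasFDerivWithinAt) hinj φ
  rw [h]
  refine setLIntegral_congr_fun hU fun z _ => ?_
  have hdet : ((ContinuousLinearMap.toSpanSingleton ℂ (F' z)).restrictScalars ℝ).det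
      = ‖F' z‖ ^ 2 := by
    have h1 := LinearMap.det_restrictScalars (R := ℝ) (S := ℂ) (A := ℂ)
      (f := (ContinuousLinearMap.toSpanSingleton ℂ (F' z)).toLinearMap)
    have h2 : LinearMap.det (ContinuousLinearMap.toSpanSingleton ℂ (F' z)).toLinearMap = F' z := by
      rw [LinearMap.det_ring]; simp
    rw [h2, Algebra.norm_complex_eq] at h1
    rw [← Complex.normSq_eq_norm_sq]
    exact h1
  simp only [hdet, abs_of_nonneg (sq_nonneg ‖F' z‖)]
  rw [ENNReal.ofReal_pow (norm_nonneg _), ofReal_norm]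

theorem cylArea_image_exp_comp {U : Set ℂ} (hU : MeasurableSet U) {A A' : ℂ → ℂ}
    (hA : ∀ z ∈ U, HasDerivAt A (A' z) z) (hinj : InjOn (fun z => exp (A z)) U) :
    cylArea ((fun z => exp (A z)) '' U) = ∫⁻ z in U, ‖A' z‖ₑ ^ 2 := by
  rw [cylArea, lintegral_image_of_hasDerivAt hU (fun z hz => (hA z hz).cexp) hinj]
  refine setLIntegral_congr_fun hU fun z _ => ?_
  have hpos : 0 < ‖exp (A z)‖ := norm_pos_iff.2 (exp_ne_zero _)
  rw [← ofReal_norm, ← ofReal_norm, ← ENNReal.ofReal_pow (norm_nonneg _),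
    ← ENNReal.ofReal_pow (norm_nonneg _), ← ENNReal.ofReal_mul (by positivity), norm_mul]
  congr 1
  field_simp

theorem lintegral_complex_eq (f : ℂ → ℝ≥0∞) (hf : Measurable f) :
    ∫⁻ z, f z = ∫⁻ x : ℝ, ∫⁻ y : ℝ, f (x + y * I) := by
  rw [← (Complex.volume_preserving_equiv_real_prod.symm measurableEquivRealProd).lintegral_comp_emb
    (MeasurableEquiv.measurableEmbedding _), Measure.volume_eq_prod, lintegral_prod]
  · simp [measurableEquivRealProd_symm_apply, mk_eq_add_mul_I]
  · exact (hf.comp (MeasurableEquiv.measurable _)).aemeasurable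

theorem setLIntegral_reProdIm (f : ℂ → ℝ≥0∞) (hf : Measurable f) {S T : Set ℝ}
    (hS : MeasurableSet S) (hT : MeasurableSet T) :
    ∫⁻ z in S ×ℂ T, f z = ∫⁻ x in S, ∫⁻ y in T, f (x + y * I) := by
  have hm : MeasurableSet (S ×ℂ T) :=
    (measurable_re hS).inter (measurable_im hT)
  rw [← lintegral_indicator hm, lintegral_complex_eq _ (hf.indicator hm),
    ← lintegral_indicator hS]
  refine lintegral_congr fun x => ?_
  by_cases hx : x ∈ S
  · rw [indicator_of_mem hx, ← lintegral_indicator hT]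
    refine lintegral_congr fun y => ?_
    by_cases hy : y ∈ T <;> simp [indicator, mem_reProdIm, hx, hy]
  · simp [indicator, mem_reProdIm, hx]

theorem volume_reProdIm {S T : Set ℝ} (hS : MeasurableSet S) (hT : MeasurableSet T) :
    volume (S ×ℂ T) = volume S * volume T := by
  have := setLIntegral_reProdIm (fun _ => 1) measurable_const hS hT
  simpa [mul_comm] using this

theorem cylArea_annulus_le (s M : ℝ) :
    cylArea {z : ℂ | Real.exp s ≤ ‖z‖ ∧ ‖z‖ ≤ Real.exp M}
      ≤ ENNReal.ofReal (2 * π * (M - s)) := by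
  have hm : MeasurableSet (Icc s M ×ℂ Ioc (-π) π) :=
    (measurable_re measurableSet_Icc).inter (measurable_im measurableSet_Ioc)
  have hinj : InjOn (fun z => exp (id z)) (Icc s M ×ℂ Ioc (-π) π) := by
    intro x hx y hy h
    exact Complex.exp_inj_of_neg_pi_lt_of_le_pi hx.2.1 hx.2.2 hy.2.1 hy.2.2 h
  have hsub : {z : ℂ | Real.exp s ≤ ‖z‖ ∧ ‖z‖ ≤ Real.exp M} ⊆
      (fun z => exp (id z)) '' (Icc s M ×ℂ Ioc (-π) π) := by
    rintro z ⟨h1, h2⟩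
    have hpos : 0 < ‖z‖ := (Real.exp_pos s).trans_le h1
    refine ⟨log z, ⟨⟨?_, ?_⟩, ⟨?_, ?_⟩⟩, exp_log (norm_pos_iff.1 hpos)⟩
    · rw [log_re]; exact (Real.le_log_iff_exp_le hpos).2 h1
    · rw [log_re]; exact (Real.log_le_iff_le_exp hpos).2 h2
    · exact neg_pi_lt_log_im z
    · exact log_im_le_pi z
  calc cylArea _ ≤ cylArea ((fun z => exp (id z)) '' (Icc s M ×ℂ Ioc (-π) π)) :=
        lintegral_mono_set hsub
    _ = ∫⁻ z in (Icc s M ×ℂ Ioc (-π) π), ‖(1 : ℂ)‖ₑ ^ 2 :=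
        cylArea_image_exp_comp hm (fun z _ => hasDerivAt_id z) hinj
    _ ≤ _ := by
        simp only [enorm_one, one_pow, lintegral_one, Measure.restrict_apply_univ]
        rw [volume_reProdIm measurableSet_Icc measurableSet_Ioc, Real.volume_Icc,
          Real.volume_Ioc, ← ENNReal.ofReal_mul' (by linarith [Real.pi_pos])]
        apply le_of_eq; congr 1; ring

theorem lintegral_sq_le_mul {α : Type*} [MeasurableSpace α] (μ : Measure α) {f : α → ℝ≥0∞}
    (hf : AEMeasurable f μ) :
    (∫⁻ x, f x ∂μ) ^ 2 ≤ μ univ * ∫⁻ x, f x ^ 2 ∂μ := by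
  have h := ENNReal.lintegral_mul_le_Lp_mul_Lq μ Real.HolderConjugate.two_two hf
    (aemeasurable_const (b := 1))
  simp only [Pi.mul_apply, mul_one, one_pow, lintegral_one, ENNReal.rpow_two] at h
  calc (∫⁻ x, f x ∂μ) ^ 2 ≤ ((∫⁻ x, f x ^ 2 ∂μ) ^ (1 / 2 : ℝ) * (μ univ) ^ (1 / 2 : ℝ)) ^ 2 := by
        gcongr
    _ = _ := by
        rw [mul_pow, ← ENNReal.rpow_natCast, ← ENNReal.rpow_natCast, ← ENNReal.rpow_mul,
          ← ENNReal.rpow_mul]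
        norm_num [mul_comm]

/-- The oscillation of a curve is at most the integral of its speed. -/
theorem enorm_sub_le_lintegral {E : Type*} [NormedAddCommGroup E] [NormedSpace ℝ E]
    [CompleteSpace E] {γ γ' : ℝ → E} {a b : ℝ} (hab : a ≤ b)
    (h : ∀ x ∈ Icc a b, HasDerivAt γ (γ' x) x) (hγ' : ContinuousOn γ' (Icc a b)) :
    ‖γ b - γ a‖ₑ ≤ ∫⁻ x in Ioo a b, ‖γ' x‖ₑ := by
  have h1 : ∫ x in a..b, γ' x = γ b - γ a := by
    apply intervalIntegral.integral_eq_sub_of_hasDerivAt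
    · rwa [uIcc_of_le hab]
    · apply ContinuousOn.intervalIntegrable; rwa [uIcc_of_le hab]
  rw [← h1, intervalIntegral.integral_of_le hab, ← restrict_Ioo_eq_restrict_Ioc]
  exact enorm_integral_le_lintegral_enorm _

theorem lintegral_ball_polar (f : ℂ → ℝ≥0∞) (hf : Measurable f) (R : ℝ) :
    ∫⁻ z in ball (0 : ℂ) R, f z = ∫⁻ ρ in Ioo 0 R, ∫⁻ θ in Ioo (-π) π,
      ENNReal.ofReal ρ * f (ρ * exp (θ * I)) := by
  rw [← lintegral_indicator measurableSet_ball, ← Complex.lintegral_comp_polarCoord_symm,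
    polarCoord_target, Measure.volume_eq_prod, ← Measure.prod_restrict, lintegral_prod]
  · rw [← lintegral_indicator measurableSet_Ioi, ← lintegral_indicator measurableSet_Ioo]
    refine lintegral_congr fun ρ => ?_
    by_cases h0 : 0 < ρ
    · by_cases h1 : ρ < R
      · rw [indicator_of_mem (show ρ ∈ Ioi 0 from h0),
          indicator_of_mem (show ρ ∈ Ioo 0 R from ⟨h0, h1⟩)]
        refine lintegral_congr fun θ => ?_
        rw [indicator_of_mem]
        · simp [exp_mul_I]
        · simpa [Complex.norm_polarCoord_symm, abs_of_pos h0] using h1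
      · rw [indicator_of_notMem (show ρ ∉ Ioo 0 R from fun h => h1 h.2),
          indicator_of_mem (show ρ ∈ Ioi 0 from h0)]
        convert lintegral_zero with θ
        rw [indicator_of_notMem, smul_zero]
        simpa [Complex.norm_polarCoord_symm, abs_of_pos h0] using h1
    · rw [indicator_of_notMem (show ρ ∉ Ioi 0 from h0),
        indicator_of_notMem (show ρ ∉ Ioo 0 R from fun h => h0 h.1)]
  · have hm : Measurable fun p : ℝ × ℝ => ENNReal.ofReal p.1 •
        (ball (0 : ℂ) R).indicator f (Complex.polarCoord.symm p) := by
      apply Measurable.mul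
      · fun_prop
      · refine (hf.indicator measurableSet_ball).comp ?_
        exact Complex.measurableEquivRealProd.symm.measurable.comp
          continuous_polarCoord_symm.measurable
    exact hm.aemeasurable

theorem enorm_sq_le_lintegral_ball {G : ℂ → ℂ} (hGm : Measurable G) {ξ : ℂ}
    (hG : DifferentiableOn ℂ G (ball ξ 1)) :
    ‖G ξ‖ₑ ^ 2 ≤ ∫⁻ z in ball ξ 1, ‖G z‖ₑ ^ 2 := by
  have htr : ∫⁻ z in ball ξ 1, ‖G z‖ₑ ^ 2 = ∫⁻ z in ball (0 : ℂ) 1, ‖G (ξ + z)‖ₑ ^ 2 := by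
    rw [← lintegral_indicator measurableSet_ball, ← lintegral_indicator measurableSet_ball,
      ← lintegral_add_left_eq_self _ ξ]
    refine lintegral_congr fun z => ?_
    simp [indicator]
  have hcirc : ∀ ρ ∈ Ioo (0 : ℝ) 1, ENNReal.ofReal (2 * π) * ‖G ξ‖ₑ ^ 2 ≤
      ∫⁻ θ in Ioo (-π) π, ‖G (ξ + ρ * exp (θ * I))‖ₑ ^ 2 := by
    intro ρ hρ
    have hd : DiffContOnCl ℂ G (ball ξ |ρ|) := by
      rw [abs_of_pos hρ.1]
      apply DifferentiableOn.diffContOnCl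
      apply hG.mono
      rw [closure_ball _ hρ.1.ne']
      exact closedBall_subset_ball hρ.2
    have h1 := hd.circleAverage
    rw [Real.circleAverage_eq_integral_add (-π),
      intervalIntegral.integral_comp_add_right (fun θ => G (circleMap ξ ρ θ)),
      show 0 + -π = -π by ring, show 2 * π + -π = π by ring,
      intervalIntegral.integral_of_le (by linarith [Real.pi_pos]),
      ← restrict_Ioo_eq_restrict_Ioc] at h1
    have h2 : ENNReal.ofReal (2 * π) * ‖G ξ‖ₑ ≤
        ∫⁻ θ in Ioo (-π) π, ‖G (ξ + ρ * exp (θ * I))‖ₑ := by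
      rw [← h1, enorm_smul, enorm_inv (by positivity), Real.enorm_eq_ofReal (by positivity),
        ← mul_assoc, ENNReal.mul_inv_cancel (by simp [Real.pi_pos]) ENNReal.ofReal_ne_top, one_mul]
      exact enorm_integral_le_lintegral_enorm _
    have h3 := lintegral_sq_le_mul (volume.restrict (Ioo (-π) π))
      (f := fun θ : ℝ => ‖G (ξ + ρ * exp (θ * I))‖ₑ)
      ((hGm.comp (by fun_prop : Measurable fun θ : ℝ => ξ + ρ * exp (θ * I))).enorm.aemeasurable)
    rw [Measure.restrict_apply_univ, Real.volume_Ioo, show π - -π = 2 * π by ring] at h3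
    have h4 := (pow_le_pow_left' h2 2).trans h3
    have hp : ENNReal.ofReal (2 * π) ≠ 0 := by simp [Real.pi_pos]
    rw [mul_pow, sq (ENNReal.ofReal _), mul_assoc] at h4
    exact (ENNReal.mul_le_mul_iff_right hp ENNReal.ofReal_ne_top).1 h4
  rw [htr, lintegral_ball_polar _ (by fun_prop)]
  calc ‖G ξ‖ₑ ^ 2 ≤ ENNReal.ofReal (1 / 2) * (ENNReal.ofReal (1 / 2) *
        (ENNReal.ofReal (2 * π) * ‖G ξ‖ₑ ^ 2)) := by
        rw [← mul_assoc, ← mul_assoc, ← ENNReal.ofReal_mul (by norm_num),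
          ← ENNReal.ofReal_mul (by norm_num)]
        refine le_mul_of_one_le_left' ?_
        rw [ENNReal.one_le_ofReal]; linarith [Real.pi_gt_three]
    _ = ∫⁻ ρ in Ioo (1 / 2 : ℝ) 1, (ENNReal.ofReal (1 / 2) *
        (ENNReal.ofReal (2 * π) * ‖G ξ‖ₑ ^ 2)) := by
        rw [lintegral_const, Measure.restrict_apply_univ, Real.volume_Ioo, mul_comm]
        norm_num
    _ ≤ ∫⁻ ρ in Ioo (1 / 2 : ℝ) 1, ∫⁻ θ in Ioo (-π) π,
          ENNReal.ofReal ρ * ‖G (ξ + ρ * exp (θ * I))‖ₑ ^ 2 := by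
        refine setLIntegral_mono' measurableSet_Ioo fun ρ hρ => ?_
        rw [lintegral_const_mul _ (by fun_prop)]
        exact mul_le_mul' (ENNReal.ofReal_le_ofReal hρ.1.le)
          (hcirc ρ ⟨by linarith [hρ.1], hρ.2⟩)
    _ ≤ _ := lintegral_mono_set (Ioo_subset_Ioo_left (by norm_num))

theorem exists_sphericalArea_bound :
    ∃ S : ℝ, 0 ≤ S ∧ ∫⁻ z : ℂ, ENNReal.ofReal ((1 + ‖z‖) ^ (-4 : ℝ)) ≤ ENNReal.ofReal S := by
  have h := finite_integral_one_add_norm (E := ℂ) (μ := volume) (r := 4)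
    (by rw [Complex.finrank_real_complex]; norm_num)
  refine ⟨(∫⁻ z : ℂ, ENNReal.ofReal ((1 + ‖z‖) ^ (-4 : ℝ))).toReal, ENNReal.toReal_nonneg, ?_⟩
  rw [ENNReal.ofReal_toReal h.ne]

/-- A Koebe type estimate: on discs where `exp ∘ A` is injective, `A'` is bounded by the inverse
radius. -/
theorem exists_koebe_bound : ∃ C₀ : ℝ, 0 < C₀ ∧ ∀ (A : ℂ → ℂ) (c : ℂ) (R : ℝ), 0 < R →
    DifferentiableOn ℂ A (ball c R) → InjOn (fun z => exp (A z)) (ball c R) →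
    ‖deriv A c‖ ≤ C₀ / R := by
  obtain ⟨S, hS0, hS⟩ := exists_sphericalArea_bound
  set ε : ℝ := Real.exp (-(72 * π * (S + 1))) with hε
  have hε0 : 0 < ε := Real.exp_pos _
  have hε1 : ε < 1 := by
    rw [hε, Real.exp_lt_one_iff]; have := Real.pi_pos; nlinarith
  have key : ∀ A : ℂ → ℂ, DifferentiableOn ℂ A (ball 0 1) →
      InjOn (fun z => exp (A z)) (ball 0 1) → A 0 = 0 → ‖deriv A 0‖ ≤ 2 / ε := by
    intro A hA hinj hA0
    have hsub : ∀ ρ < (1 : ℝ), closedBall (0 : ℂ) ρ ⊆ ball 0 1 :=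
      fun ρ hρ => closedBall_subset_ball hρ
    have hAd : ∀ z ∈ ball (0 : ℂ) 1, HasDerivAt A (deriv A z) z := fun z hz =>
      (hA.differentiableAt (isOpen_ball.mem_nhds hz)).hasDerivAt
    have hdiffc : ∀ (F : ℂ → ℂ), DifferentiableOn ℂ F (ball 0 1) → ∀ ρ : ℝ, 0 < ρ → ρ < 1 →
        DiffContOnCl ℂ F (ball 0 ρ) := by
      intro F hF ρ h0 h1
      apply DifferentiableOn.diffContOnCl
      apply hF.mono
      rw [closure_ball _ h0.ne']
      exact hsub ρ h1
    have hFd : DifferentiableOn ℂ (fun z => exp (A z)) (ball 0 1) := hA.cexp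
    by_cases hsmall : ∀ z ∈ closedBall (0 : ℂ) ε, (A z).re ≤ Real.log 2
    · have h1 := norm_deriv_le_of_forall_mem_sphere_norm_le hε0 (hdiffc _ hFd ε hε0 hε1)
        (C := 2) fun z hz => by
          rw [norm_exp]
          have := Real.exp_le_exp.2 (hsmall z (sphere_subset_closedBall hz))
          rwa [Real.exp_log two_pos] at this
      have h2 : HasDerivAt (fun z => exp (A z)) (exp (A 0) * deriv A 0) 0 :=
        (hAd 0 (mem_ball_self one_pos)).cexp
      rwa [h2.deriv, hA0, exp_zero, one_mul] at h1
    exfalso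
    push Not at hsmall
    obtain ⟨ζ₀, hζ₀, hbig⟩ := hsmall
    set w : ℂ → ℝ≥0∞ := fun z =>
      ENNReal.ofReal (‖deriv A z‖ * (Real.exp (A z).re / (1 + Real.exp (A z).re) ^ 2)) with hw
    set w' : ℂ → ℝ≥0∞ := (ball (0 : ℂ) 1).indicator w with hw'
    have hwm : Measurable w' := by
      have h1 : ContinuousOn (fun z =>
          Real.exp (A z).re / (1 + Real.exp (A z).re) ^ 2) (ball 0 1) := by
        apply ContinuousOn.div
        · exact Real.continuous_exp.comp_continuousOn
            (continuous_re.comp_continuousOn hA.continuousOn)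
        · exact (continuousOn_const.add (Real.continuous_exp.comp_continuousOn
            (continuous_re.comp_continuousOn hA.continuousOn))).pow 2
        · intro z _; positivity
      have h2 : ContinuousOn (deriv A) (ball 0 1) :=
        (hA.deriv isOpen_ball).continuousOn
      have h3 : ContinuousOn w (ball 0 1) :=
        ENNReal.continuous_ofReal.comp_continuousOn (h2.norm.mul h1)
      classical
      rw [hw', ← piecewise_eq_indicator]
      exact h3.measurable_piecewise continuousOn_const measurableSet_ball
    have hcirc : ∀ ρ ∈ Ioo ε 1, ENNReal.ofReal (1 / 6) ≤
        ENNReal.ofReal ρ * ∫⁻ θ in Ioo (-π) π, w' (ρ * exp (θ * I)) := by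
      intro ρ hρ
      have hρ0 : 0 < ρ := hε0.trans hρ.1
      have hin : ∀ θ : ℝ, (ρ * exp (θ * I) : ℂ) ∈ ball (0 : ℂ) 1 := by
        intro θ
        rw [mem_ball_zero_iff, norm_mul, norm_exp_ofReal_mul_I, mul_one, norm_real,
          Real.norm_eq_abs, abs_of_pos hρ0]
        exact hρ.2
      have hparam : ∀ z ∈ frontier (ball (0 : ℂ) ρ), ∃ θ ∈ Icc (-π) π,
          z = ρ * exp (θ * I) := by
        intro z hz
        rw [frontier_ball _ hρ0.ne', mem_sphere_zero_iff_norm] at hz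
        refine ⟨arg z, ⟨(neg_pi_lt_arg z).le, arg_le_pi z⟩, ?_⟩
        rw [← hz, norm_mul_exp_arg_mul_I]
      set p : ℝ → ℝ := fun θ => (1 + Real.exp (A (ρ * exp (θ * I))).re)⁻¹ with hp
      set p' : ℝ → ℝ := fun θ => -(Real.exp (A (ρ * exp (θ * I))).re *
        (deriv A (ρ * exp (θ * I)) * (ρ * (exp (θ * I) * I))).re) /
          (1 + Real.exp (A (ρ * exp (θ * I))).re) ^ 2 with hp'
      have hder : ∀ θ : ℝ, HasDerivAt p (p' θ) θ := by
        intro θ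
        have h1 : HasDerivAt (fun θ : ℝ => (ρ * exp (θ * I) : ℂ))
            (ρ * (exp (θ * I) * I)) θ := by
          have h0 : HasDerivAt (fun θ : ℝ => (θ * I : ℂ)) I θ := by
            simpa using (ofRealCLM.hasDerivAt (x := θ)).mul_const I
          exact h0.cexp.const_mul _
        have h2 : HasDerivAt (fun θ : ℝ => A (ρ * exp (θ * I)))
            (deriv A (ρ * exp (θ * I)) * (ρ * (exp (θ * I) * I))) θ :=
          (hAd _ (hin θ)).comp θ h1
        have h3 : HasDerivAt (fun θ : ℝ => (A (ρ * exp (θ * I))).re)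
            (deriv A (ρ * exp (θ * I)) * (ρ * (exp (θ * I) * I))).re θ :=
          reCLM.hasFDerivAt.comp_hasDerivAt θ h2
        exact (h3.exp.const_add 1).inv (by positivity)
      have hp'c : Continuous p' := by
        have hA1 : Continuous fun θ : ℝ => A (ρ * exp (θ * I)) :=
          hA.continuousOn.comp_continuous (by fun_prop) hin
        have hA2 : Continuous fun θ : ℝ => deriv A (ρ * exp (θ * I)) :=
          (hA.deriv isOpen_ball).continuousOn.comp_continuous (by fun_prop) hin
        rw [hp']
        have hE : Continuous fun θ : ℝ => Real.exp (A (ρ * exp (θ * I))).re :=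
          Real.continuous_exp.comp (continuous_re.comp hA1)
        have hR : Continuous fun θ : ℝ =>
            (deriv A (ρ * exp (θ * I)) * (ρ * (exp (θ * I) * I))).re :=
          continuous_re.comp (hA2.mul (by fun_prop))
        exact (hE.mul hR).neg.div ((hE.const_add 1).pow 2) fun θ => by positivity
      have hbd : ∀ θ, ‖p' θ‖ₑ ≤ ENNReal.ofReal ρ * w' (ρ * exp (θ * I)) := by
        intro θ
        rw [hw', indicator_of_mem (hin θ), hw, ← ofReal_norm, ← ENNReal.ofReal_mul hρ0.le]
        apply ENNReal.ofReal_le_ofReal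
        have h1 : |(deriv A (ρ * exp (θ * I)) * (ρ * (exp (θ * I) * I))).re| ≤
            ‖deriv A (ρ * exp (θ * I))‖ * ρ := by
          refine (abs_re_le_norm _).trans ?_
          simp [norm_exp_ofReal_mul_I, abs_of_pos hρ0]
        rw [hp', Real.norm_eq_abs, abs_div, abs_neg, abs_mul, abs_of_pos (Real.exp_pos _),
          abs_of_pos (by positivity : 0 < (1 + Real.exp (A (ρ * exp (θ * I))).re) ^ 2)]
        calc _ ≤ Real.exp (A (ρ * exp (θ * I))).re * (‖deriv A (ρ * exp (θ * I))‖ * ρ) /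
              (1 + Real.exp (A (ρ * exp (θ * I))).re) ^ 2 := by gcongr
          _ = _ := by ring
      have hosc : ∀ a ∈ Icc (-π) π, ∀ b ∈ Icc (-π) π, a ≤ b → ‖p b - p a‖ₑ ≤
          ENNReal.ofReal ρ * ∫⁻ θ in Ioo (-π) π, w' (ρ * exp (θ * I)) := by
        intro a ha b hb hab
        refine (enorm_sub_le_lintegral hab (fun x _ => hder x) hp'c.continuousOn).trans ?_
        rw [← lintegral_const_mul _ (by fun_prop)]
        exact (lintegral_mono_set (Ioo_subset_Ioo ha.1 hb.2)).trans (lintegral_mono hbd)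
      obtain ⟨z₁, hz₁, hm₁⟩ := Complex.exists_mem_frontier_isMaxOn_norm isBounded_ball
        ⟨0, mem_ball_self hρ0⟩ (hdiffc (fun z => exp (-A z)) hA.neg.cexp ρ hρ0 hρ.2)
      obtain ⟨z₂, hz₂, hm₂⟩ := Complex.exists_mem_frontier_isMaxOn_norm isBounded_ball
        ⟨0, mem_ball_self hρ0⟩ (hdiffc (fun z => exp (A z)) hFd ρ hρ0 hρ.2)
      obtain ⟨θ₁, hθ₁, rfl⟩ := hparam _ hz₁
      obtain ⟨θ₂, hθ₂, rfl⟩ := hparam _ hz₂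
      have hu₁ : (A (ρ * exp (θ₁ * I))).re ≤ 0 := by
        have h := hm₁ (subset_closure (mem_ball_self hρ0))
        simpa [norm_exp, hA0] using h
      have hu₂ : Real.log 2 ≤ (A (ρ * exp (θ₂ * I))).re := by
        have h := hm₂ (subset_closure (closedBall_subset_ball hρ.1 hζ₀))
        simp only [Function.comp, norm_exp, mem_ofPred_eq, Real.exp_le_exp] at h
        exact hbig.le.trans h
      have hp₁ : 1 / 2 ≤ p θ₁ := by
        have := Real.exp_le_one_iff.2 hu₁
        rw [hp, one_div]
        exact inv_anti₀ (by positivity) (by linarith)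
      have hp₂ : p θ₂ ≤ 1 / 3 := by
        have := Real.exp_le_exp.2 hu₂
        rw [Real.exp_log two_pos] at this
        rw [hp, one_div]
        exact inv_anti₀ (by positivity) (by linarith)
      have hd : ENNReal.ofReal (1 / 6) ≤ ‖p θ₁ - p θ₂‖ₑ := by
        rw [Real.enorm_eq_ofReal_abs]
        exact ENNReal.ofReal_le_ofReal ((by linarith : 1 / 6 ≤ p θ₁ - p θ₂).trans (le_abs_self _))
      rcases le_total θ₁ θ₂ with h | h
      · rw [← neg_sub, enorm_neg] at hd
        exact hd.trans (hosc _ hθ₁ _ hθ₂ h)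
      · exact hd.trans (hosc _ hθ₂ _ hθ₁ h)
    have htotal : ∫⁻ z in ball (0 : ℂ) 1, w' z ^ 2 ≤ ENNReal.ofReal S := by
      have h1 := lintegral_image_of_hasDerivAt measurableSet_ball
        (fun z hz => (hAd z hz).cexp) hinj (fun z => ENNReal.ofReal ((1 + ‖z‖) ^ (-4 : ℝ)))
      have h2 : ∫⁻ z in ball (0 : ℂ) 1, w' z ^ 2 = ∫⁻ z in ball (0 : ℂ) 1,
          ‖exp (A z) * deriv A z‖ₑ ^ 2 * ENNReal.ofReal ((1 + ‖exp (A z)‖) ^ (-4 : ℝ)) := by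
        refine setLIntegral_congr_fun measurableSet_ball fun z hz => ?_
        simp only [hw', indicator_of_mem hz, hw]
        rw [← ofReal_norm, ← ENNReal.ofReal_pow (by positivity),
          ← ENNReal.ofReal_pow (by positivity),
          ← ENNReal.ofReal_mul (by positivity), norm_mul, norm_exp]
        congr 1
        rw [show (-4 : ℝ) = -((4 : ℕ) : ℝ) by norm_num, Real.rpow_neg (by positivity),
          Real.rpow_natCast]
        field_simp
      rw [h2, ← h1]
      exact (setLIntegral_le_lintegral _ _).trans hS
    have hlow : ∀ ρ ∈ Ioo ε 1, ENNReal.ofReal (1 / (72 * π) * ρ⁻¹) ≤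
        ∫⁻ θ in Ioo (-π) π, ENNReal.ofReal ρ * w' (ρ * exp (θ * I)) ^ 2 := by
      intro ρ hρ
      have hρ0 : 0 < ρ := hε0.trans hρ.1
      have h1 := lintegral_sq_le_mul (volume.restrict (Ioo (-π) π))
        (f := fun θ : ℝ => w' (ρ * exp (θ * I))) (by fun_prop)
      rw [Measure.restrict_apply_univ, Real.volume_Ioo, show π - -π = 2 * π by ring] at h1
      have h2 := pow_le_pow_left' (hcirc ρ hρ) 2
      rw [mul_pow] at h2
      have h3 := h2.trans (mul_le_mul_right h1 _)
      rw [lintegral_const_mul _ (by fun_prop)]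
      set J := ∫⁻ θ in Ioo (-π) π, w' (ρ * exp (θ * I)) ^ 2
      rw [← ENNReal.ofReal_pow hρ0.le, ← ENNReal.ofReal_pow (by norm_num), ← mul_assoc,
        ← ENNReal.ofReal_mul (by positivity), show ρ ^ 2 * (2 * π) = (2 * π * ρ) * ρ by ring,
        ENNReal.ofReal_mul (by positivity), mul_assoc] at h3
      have hc : 0 < 2 * π * ρ := by positivity
      rw [← ENNReal.mul_le_mul_iff_right (a := ENNReal.ofReal (2 * π * ρ))
        (by simpa using hc) ENNReal.ofReal_ne_top]
      refine le_trans (le_of_eq ?_) h3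
      rw [← ENNReal.ofReal_mul hc.le]
      congr 1
      field_simp
      norm_num
    have hfin : ENNReal.ofReal (S + 1) ≤ ENNReal.ofReal S := by
      calc ENNReal.ofReal (S + 1) = ∫⁻ ρ in Ioo ε 1, ENNReal.ofReal (1 / (72 * π) * ρ⁻¹) := by
            have hInt : IntegrableOn (fun ρ : ℝ => 1 / (72 * π) * ρ⁻¹) (Ioo ε 1) := by
              apply IntegrableOn.mono_set (t := Icc ε 1) _ Ioo_subset_Icc_self
              apply ContinuousOn.integrableOn_Icc
              apply continuousOn_const.mul
              exact continuousOn_inv₀.mono fun x hx => (hε0.trans_le hx.1).ne'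
            rw [← ofReal_integral_eq_lintegral_ofReal hInt]
            · congr 1
              rw [restrict_Ioo_eq_restrict_Ioc, ← intervalIntegral.integral_of_le hε1.le,
                intervalIntegral.integral_const_mul, integral_inv_of_pos hε0 one_pos,
                Real.log_div one_ne_zero hε0.ne', Real.log_one, hε, Real.log_exp]
              field_simp
              ring
            · filter_upwards [ae_restrict_mem measurableSet_Ioo] with ρ hρ
              have : 0 < ρ := hε0.trans hρ.1
              simp only [Pi.zero_apply]; positivity
        _ ≤ ∫⁻ ρ in Ioo ε 1, ∫⁻ θ in Ioo (-π) π,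
              ENNReal.ofReal ρ * w' (ρ * exp (θ * I)) ^ 2 :=
            setLIntegral_mono' measurableSet_Ioo hlow
        _ ≤ ∫⁻ ρ in Ioo 0 1, ∫⁻ θ in Ioo (-π) π,
              ENNReal.ofReal ρ * w' (ρ * exp (θ * I)) ^ 2 :=
            lintegral_mono_set (Ioo_subset_Ioo_left hε0.le)
        _ = ∫⁻ z in ball (0 : ℂ) 1, w' z ^ 2 :=
            (lintegral_ball_polar (fun z => w' z ^ 2) (hwm.pow_const 2) 1).symm
        _ ≤ _ := htotal
    rw [ENNReal.ofReal_le_ofReal_iff hS0] at hfin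
    linarith
  refine ⟨2 / ε, by positivity, fun A c R hR hA hinj => ?_⟩
  have hmem : ∀ z ∈ ball (0 : ℂ) 1, c + R * z ∈ ball c R := by
    intro z hz
    rw [mem_ball_zero_iff] at hz
    simp only [mem_ball, dist_self_add_left, norm_mul, norm_real, Real.norm_eq_abs, abs_of_pos hR]
    nlinarith
  have hRc : (R : ℂ) ≠ 0 := by exact_mod_cast hR.ne'
  have h := key (fun z => A (c + R * z) - A c)
    ((hA.comp (by fun_prop) hmem).sub_const _) ?_ (by simp)
  · have hd : HasDerivAt (fun z => A (c + R * z) - A c) (deriv A c * R) 0 := by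
      have h1 : HasDerivAt A (deriv A c) (c + R * 0) := by
        simpa using (hA.differentiableAt (isOpen_ball.mem_nhds (mem_ball_self hR))).hasDerivAt
      have h2 : HasDerivAt (fun z : ℂ => c + R * z) (R : ℂ) 0 := by
        simpa using ((hasDerivAt_id (0 : ℂ)).const_mul (R : ℂ)).const_add c
      exact (h1.comp 0 h2).sub_const _
    rw [hd.deriv, norm_mul, norm_real, Real.norm_eq_abs, abs_of_pos hR] at h
    rwa [le_div_iff₀ hR]
  · intro x hx y hy hxy
    simp only [exp_sub] at hxy
    have h1 := (div_left_inj' (exp_ne_zero (A c))).1 hxy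
    simpa [hRc] using hinj (hmem x hx) (hmem y hy) h1

/-- A description of a neighbourhood of infinity by `2 * d` holomorphic half-planes glued
along strips, in logarithmic coordinates. -/
structure TractSystem (d : ℕ) where
  A : ℕ → ℂ → ℂ
  B : ℕ → ℂ → ℂ
  X : ℝ
  Y : ℝ
  C : ℝ
  s : ℤ
  d_pos : 0 < d
  two_lt_X : 2 < X
  C_nonneg : 0 ≤ C
  s_ne : s ≠ 0
  A_diff : ∀ i < 2 * d, DifferentiableOn ℂ (A i) {ζ | -1 < ζ.re}
  A_inj : ∀ i < 2 * d, ∀ i' < 2 * d, ∀ ζ ζ' : ℂ, -1 < ζ.re → -1 < ζ'.re →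
    exp (A i ζ) = exp (A i' ζ') → i = i' ∧ ζ = ζ'
  B_diff : ∀ i < 2 * d, DifferentiableOn ℂ (B i) {ξ | |ξ.re| < X ∧ Y < ξ.im}
  B_inj : ∀ i < 2 * d, InjOn (fun ξ => exp (B i ξ)) {ξ | |ξ.re| < X ∧ Y < ξ.im}
  A_close : ∀ ζ, A (2 * d) ζ = A 0 ζ + 2 * π * I * s
  link : ∃ r₀ : ℝ, ∀ i < 2 * d, ∀ r : ℝ, r₀ ≤ r → ∃ ξ ξ' : ℂ,
    (|ξ.re| ≤ X - 2 ∧ |ξ.im - r| ≤ C) ∧ (|ξ'.re| ≤ X - 2 ∧ |ξ'.im - r| ≤ C) ∧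
    A i (r * I) = B i ξ ∧ A (i + 1) (-(r * I)) = B i ξ'
  cover : ∃ R₀ : ℝ, ∀ z : ℂ, R₀ ≤ ‖z‖ →
    (∃ i < 2 * d, ∃ ζ : ℂ, 0 < ζ.re ∧ z = exp (A i ζ)) ∨
    (∃ i < 2 * d, ∃ ξ : ℂ, |ξ.re| < X - 2 ∧ Y + 1 < ξ.im ∧ z = exp (B i ξ))
  overlapAB : ∀ i < 2 * d, ∀ i' < 2 * d, ∀ ζ ξ : ℂ, 0 < ζ.re → |ξ.re| < X - 2 → Y + 1 < ξ.im →
    exp (A i ζ) = exp (B i' ξ) → |‖ζ‖ - ξ.im| ≤ C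
  overlapBB : ∀ i < 2 * d, ∀ i' < 2 * d, ∀ ξ ξ' : ℂ, |ξ.re| < X - 2 → Y + 1 < ξ.im →
    |ξ'.re| < X - 2 → Y + 1 < ξ'.im → exp (B i ξ) = exp (B i' ξ') → |ξ.im - ξ'.im| ≤ C
  properA : ∀ M : ℝ, ∃ r₀ : ℝ, ∀ i < 2 * d, ∀ ζ : ℂ, -1 < ζ.re → r₀ ≤ ‖ζ‖ → M ≤ (A i ζ).re
  properB : ∀ M : ℝ, ∃ r₀ : ℝ, ∀ i < 2 * d, ∀ ξ : ℂ, |ξ.re| < X → Y < ξ.im → r₀ ≤ ξ.im →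
    M ≤ (B i ξ).re

theorem norm_sub_le_of_deriv_le {f : ℂ → ℂ} {U s : Set ℂ} (hU : IsOpen U)
    (hf : DifferentiableOn ℂ f U) (hsU : s ⊆ U) (hs : Convex ℝ s) {K : ℝ}
    (hK : ∀ z ∈ s, ‖deriv f z‖ ≤ K) {x y : ℂ} (hx : x ∈ s) (hy : y ∈ s) :
    ‖f y - f x‖ ≤ K * ‖y - x‖ :=
  hs.norm_image_sub_le_of_norm_deriv_le
    (fun _ hz => hf.differentiableAt (hU.mem_nhds (hsU hz))) hK hx hy

theorem re_le_re_add_norm_sub (a b : ℂ) : a.re ≤ b.re + ‖a - b‖ := by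
  have := re_le_norm (a - b)
  rw [sub_re] at this
  linarith

theorem ENNReal.add_sq_le {η : ℝ} (hη : 0 < η) (p q : ℝ≥0∞) :
    (p + q) ^ 2 ≤ ENNReal.ofReal (1 + η) * p ^ 2 + ENNReal.ofReal (1 + η⁻¹) * q ^ 2 := by
  have h1 : ENNReal.ofReal (1 + η) ≠ 0 := by simp; linarith
  have h2 : ENNReal.ofReal (1 + η⁻¹) ≠ 0 := by
    have := inv_pos.2 hη
    simp; linarith
  by_cases hp : p = ∞
  · simp [hp, ENNReal.mul_top h1]
  by_cases hq : q = ∞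
  · simp [hq, ENNReal.mul_top h2]
  lift p to NNReal using hp
  lift q to NNReal using hq
  rw [← ENNReal.ofReal_coe_nnreal, ← ENNReal.ofReal_coe_nnreal (p := q),
    ← ENNReal.ofReal_add (by positivity) (by positivity), ← ENNReal.ofReal_pow (by positivity),
    ← ENNReal.ofReal_pow (by positivity), ← ENNReal.ofReal_pow (by positivity),
    ← ENNReal.ofReal_mul (by positivity), ← ENNReal.ofReal_mul (by positivity),
    ← ENNReal.ofReal_add (by positivity) (by positivity)]
  apply ENNReal.ofReal_le_ofReal
  have h : (1 + η) * (p : ℝ) ^ 2 + (1 + η⁻¹) * (q : ℝ) ^ 2 - (p + q) ^ 2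
      = η⁻¹ * (η * p - q) ^ 2 := by
    field_simp
    ring
  have := mul_nonneg (inv_pos.2 hη).le (sq_nonneg (η * (p : ℝ) - q))
  linarith

theorem ENNReal.sum_sq_le (n : ℕ) (x : ℕ → ℝ≥0∞) :
    (∑ i ∈ Finset.range n, x i) ^ 2 ≤ n * ∑ i ∈ Finset.range n, x i ^ 2 := by
  have h := ENNReal.rpow_sum_le_const_mul_sum_rpow (Finset.range n) x (p := 2) (by norm_num)
  norm_num at h
  exact h

namespace TractSystem

variable {d : ℕ} (S : TractSystem d)

theorem isOpen_halfPlane : IsOpen {ζ : ℂ | -1 < ζ.re} := isOpen_lt continuous_const continuous_re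

theorem isOpen_strip (X Y : ℝ) : IsOpen {ξ : ℂ | |ξ.re| < X ∧ Y < ξ.im} :=
  (isOpen_lt continuous_re.abs continuous_const).inter (isOpen_lt continuous_const continuous_im)

theorem convex_strip (X Y : ℝ) : Convex ℝ {ξ : ℂ | |ξ.re| ≤ X ∧ Y < ξ.im} := by
  have h : {ξ : ℂ | |ξ.re| ≤ X ∧ Y < ξ.im} = reLm ⁻¹' Icc (-X) X ∩ imLm ⁻¹' Ioi Y := by
    ext ξ; simp [abs_le]
  rw [h]
  exact ((convex_Icc _ _).linear_preimage _).inter ((convex_Ioi _).linear_preimage _)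

theorem exists_deriv_bounds : ∃ K : ℝ, 0 < K ∧ ∀ i < 2 * d,
    (∀ ζ : ℂ, 0 ≤ ζ.re → ‖deriv (S.A i) ζ‖ ≤ K / (ζ.re + 1)) ∧
    (∀ ξ : ℂ, |ξ.re| ≤ S.X - 1 → S.Y + 1 < ξ.im → ‖deriv (S.B i) ξ‖ ≤ K) := by
  obtain ⟨K, hK, h⟩ := exists_koebe_bound
  refine ⟨K, hK, fun i hi => ⟨fun ζ hζ => ?_, fun ξ h1 h2 => ?_⟩⟩
  · have hsub : ball ζ (ζ.re + 1) ⊆ {ζ | -1 < ζ.re} := by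
      intro w hw
      rw [mem_ball, dist_comm, dist_eq_norm] at hw
      have := re_le_re_add_norm_sub ζ w
      simp only [mem_ofPred_eq]; linarith
    exact h _ _ _ (by linarith) ((S.A_diff i hi).mono hsub)
      fun x hx y hy hxy => (S.A_inj i hi i hi x y (hsub hx) (hsub hy) hxy).2
  · have hsub : ball ξ 1 ⊆ {ξ | |ξ.re| < S.X ∧ S.Y < ξ.im} := by
      intro w hw
      rw [mem_ball, dist_eq_norm] at hw
      have h3 := (abs_re_le_norm (w - ξ)).trans_lt hw
      have h4 := (abs_im_le_norm (w - ξ)).trans_lt hw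
      rw [sub_re, abs_lt] at h3
      rw [sub_im, abs_lt] at h4
      rw [abs_le] at h1
      exact ⟨abs_lt.2 ⟨by linarith, by linarith⟩, by linarith⟩
    simpa using h _ _ _ one_pos ((S.B_diff i hi).mono hsub) ((S.B_inj i hi).mono hsub)

theorem norm_sub_horizontal {A : ℂ → ℂ} {K : ℝ}
    (hA : DifferentiableOn ℂ A {ζ | -1 < ζ.re})
    (hd : ∀ ζ : ℂ, 0 ≤ ζ.re → ‖deriv A ζ‖ ≤ K / (ζ.re + 1)) {x y : ℝ} (hx : 0 ≤ x) :
    ‖A (x + y * I) - A (y * I)‖ ≤ K * Real.log (x + 1) := by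
  have hder : ∀ s : ℝ, 0 ≤ s → HasDerivAt (fun s : ℝ => A (s + y * I) - A (y * I))
      (deriv A (s + y * I)) s := by
    intro s hs
    have h1 : HasDerivAt A (deriv A (s + y * I)) (s + y * I) :=
      (hA.differentiableAt (isOpen_halfPlane.mem_nhds (by simp; linarith))).hasDerivAt
    have h2 : HasDerivAt (fun s : ℝ => (s + y * I : ℂ)) 1 s :=
      (ofRealCLM.hasDerivAt (x := s)).add_const _
    simpa using (h1.comp s h2).sub_const (A (y * I))
  have hlog : ∀ s ∈ Icc 0 x, HasDerivAt (fun s : ℝ => K * Real.log (s + 1)) (K / (s + 1)) s := by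
    intro s hs
    have := ((hasDerivAt_id s).add_const 1).log (by simp; linarith [hs.1])
    simpa [div_eq_mul_inv] using this.const_mul K
  have := image_norm_le_of_norm_deriv_right_le_deriv_boundary' (a := 0) (b := x)
    (f := fun s : ℝ => A (s + y * I) - A (y * I))
    (fun s hs => (hder s hs.1).continuousAt.continuousWithinAt)
    (fun s hs => (hder s hs.1).hasDerivWithinAt)
    (B := fun s => K * Real.log (s + 1)) (by simp)
    (fun s hs => (hlog s hs).continuousAt.continuousWithinAt)
    (fun s hs => (hlog s ⟨hs.1, hs.2.le⟩).hasDerivWithinAt)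
    (fun s hs => by simpa using hd (s + y * I) (by simpa using hs.1)) (x := x) ⟨hx, le_rfl⟩
  exact this

theorem norm_sub_zero_le {A : ℂ → ℂ} {K : ℝ} (hK : 0 < K)
    (hA : DifferentiableOn ℂ A {ζ | -1 < ζ.re})
    (hd : ∀ ζ : ℂ, 0 ≤ ζ.re → ‖deriv A ζ‖ ≤ K / (ζ.re + 1)) {ζ : ℂ} (hζ : 0 ≤ ζ.re) :
    ‖A ζ - A 0‖ ≤ 3 * K * (1 + Real.log (‖ζ‖ + 1)) := by
  set r := ‖ζ‖ with hr
  have hr0 : 0 ≤ r := norm_nonneg _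
  have h1 := norm_sub_horizontal hA hd (x := ζ.re) (y := ζ.im) hζ
  have h2 := norm_sub_horizontal hA hd (x := r) (y := ζ.im) hr0
  have h3 := norm_sub_horizontal hA hd (x := r) (y := 0) hr0
  have h4 : ‖A (r + ζ.im * I) - A r‖ ≤ K / (r + 1) * ‖(r + ζ.im * I : ℂ) - r‖ := by
    refine norm_sub_le_of_deriv_le (s := {z : ℂ | r ≤ z.re}) isOpen_halfPlane hA ?_
      (convex_halfSpace_re_ge r) ?_ (by simp) (by simp)
    · intro z hz
      simp only [mem_ofPred_eq] at hz ⊢; linarith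
    · intro z hz
      simp only [mem_ofPred_eq] at hz
      refine (hd z (by linarith)).trans ?_
      gcongr
  rw [re_add_im] at h1
  simp only [ofReal_zero, zero_mul, add_zero] at h3
  have h5 : K / (r + 1) * ‖(r + ζ.im * I : ℂ) - r‖ ≤ K := by
    rw [add_sub_cancel_left, norm_mul, norm_I, mul_one, norm_real, Real.norm_eq_abs,
      div_mul_eq_mul_div, div_le_iff₀ (by linarith)]
    have := abs_im_le_norm ζ
    nlinarith
  have hlog : Real.log (ζ.re + 1) ≤ Real.log (r + 1) :=
    Real.log_le_log (by linarith) (by linarith [re_le_norm ζ])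
  have h6 : ‖A ζ - A 0‖ ≤ ‖A ζ - A (ζ.im * I)‖ + ‖A (r + ζ.im * I) - A (ζ.im * I)‖ +
      ‖A (r + ζ.im * I) - A r‖ + ‖A r - A 0‖ := by
    have e : A ζ - A 0 = (A ζ - A (ζ.im * I)) - (A (r + ζ.im * I) - A (ζ.im * I)) +
      (A (r + ζ.im * I) - A r) + (A r - A 0) := by ring
    rw [e]
    refine (norm_add_le _ _).trans (add_le_add ((norm_add_le _ _).trans
      (add_le_add (norm_sub_le _ _) le_rfl)) le_rfl)
  nlinarith

theorem exists_growth_bound : ∃ K r₀ : ℝ, 0 < K ∧ 1 ≤ r₀ ∧ ∀ i < 2 * d,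
    (∀ ζ : ℂ, 0 ≤ ζ.re → (S.A i ζ).re ≤ K * (1 + Real.log (‖ζ‖ + 1))) ∧
    (∀ ξ : ℂ, |ξ.re| ≤ S.X - 1 → r₀ ≤ ξ.im → (S.B i ξ).re ≤ K * (1 + Real.log (ξ.im + 1))) := by
  obtain ⟨K, hK, hd⟩ := S.exists_deriv_bounds
  obtain ⟨r₁, hr₁⟩ := S.link
  set N := ∑ i ∈ Finset.range (2 * d), ‖S.A i 0‖ with hN
  have hN0 : 0 ≤ N := Finset.sum_nonneg fun _ _ => norm_nonneg _
  have hA : ∀ i < 2 * d, ∀ ζ : ℂ, 0 ≤ ζ.re →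
      (S.A i ζ).re ≤ (3 * K + N) * (1 + Real.log (‖ζ‖ + 1)) := by
    intro i hi ζ hζ
    have h1 := norm_sub_zero_le hK (S.A_diff i hi) (hd i hi).1 hζ
    have h2 : ‖S.A i 0‖ ≤ N := Finset.single_le_sum (f := fun i => ‖S.A i 0‖)
      (fun _ _ => norm_nonneg _) (Finset.mem_range.2 hi)
    have h3 := re_le_re_add_norm_sub (S.A i ζ) (S.A i 0)
    have h4 := re_le_norm (S.A i 0)
    have h5 : 0 ≤ Real.log (‖ζ‖ + 1) := Real.log_nonneg (by linarith [norm_nonneg ζ])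
    nlinarith
  have hC := S.C_nonneg
  have hX := S.two_lt_X
  refine ⟨3 * K + N + K * (2 * S.X + S.C), max 1 (max r₁ (S.Y + 2 + S.C)), by positivity,
    le_max_left _ _, fun i hi => ⟨fun ζ hζ => ?_, fun ξ h1 h2 => ?_⟩⟩
  · refine (hA i hi ζ hζ).trans ?_
    have h5 : 0 ≤ Real.log (‖ζ‖ + 1) := Real.log_nonneg (by linarith [norm_nonneg ζ])
    have : 0 ≤ K * (2 * S.X + S.C) := by positivity
    exact mul_le_mul_of_nonneg_right (by linarith) (by linarith)
  · have hm1 : 1 ≤ ξ.im := (le_max_left _ _).trans h2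
    have hm2 : r₁ ≤ ξ.im := (le_max_left _ _).trans ((le_max_right _ _).trans h2)
    have hm3 : S.Y + 2 + S.C ≤ ξ.im := (le_max_right _ _).trans ((le_max_right _ _).trans h2)
    obtain ⟨ξ₁, -, ⟨h3, h4⟩, -, h5, -⟩ := hr₁ i hi ξ.im hm2
    have h6 := hA i hi (ξ.im * I) (by simp)
    rw [h5, norm_mul, norm_I, mul_one, norm_real, Real.norm_eq_abs, abs_of_pos (by linarith)] at h6
    have h4' := abs_le.1 h4
    have h3' := abs_le.1 h3
    have h1' := abs_le.1 h1
    have h7 : ‖S.B i ξ - S.B i ξ₁‖ ≤ K * ‖ξ - ξ₁‖ := by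
      refine norm_sub_le_of_deriv_le (isOpen_strip _ _) (S.B_diff i hi) ?_
        (convex_strip (S.X - 1) (S.Y + 1)) (fun z hz => (hd i hi).2 z hz.1 hz.2) ⟨?_, ?_⟩ ⟨h1, ?_⟩
      · rintro z ⟨ha, hb⟩
        exact ⟨by linarith, by linarith⟩
      · linarith
      · linarith
      · linarith
    have h8 : ‖ξ - ξ₁‖ ≤ 2 * S.X + S.C := by
      refine (norm_le_abs_re_add_abs_im _).trans ?_
      rw [sub_re, sub_im, abs_sub_comm ξ.im]
      refine add_le_add (abs_le.2 ⟨by linarith, by linarith⟩) h4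
    have h9 := re_le_re_add_norm_sub (S.B i ξ) (S.B i ξ₁)
    have h10 : 0 ≤ Real.log (ξ.im + 1) := Real.log_nonneg (by linarith)
    have h11 : K * ‖ξ - ξ₁‖ ≤ K * (2 * S.X + S.C) := by gcongr
    have h12 : 0 ≤ K * (2 * S.X + S.C) := by positivity
    nlinarith

end TractSystem

theorem isOpen_image_exp_comp {A : ℂ → ℂ} {U V : Set ℂ} (hU : IsOpen U)
    (hA : DifferentiableOn ℂ A U) (hinj : InjOn (fun z => exp (A z)) U) (hV : IsOpen V)
    (hVU : V ⊆ U) : IsOpen ((fun z => exp (A z)) '' V) := by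
  rw [isOpen_iff_mem_nhds]
  rintro _ ⟨z, hz, rfl⟩
  have han : AnalyticAt ℂ (fun z => exp (A z)) z :=
    (hA.cexp).analyticAt (hU.mem_nhds (hVU hz))
  rcases han.eventually_constant_or_nhds_le_map_nhds with h | h
  · exfalso
    have h1 : ∀ᶠ w in 𝓝 z, w ∈ U := hU.mem_nhds (hVU hz)
    have h2 : ∀ᶠ w in 𝓝 z, w = z := by
      filter_upwards [h, h1] with w hw hwU
      exact hinj hwU (hVU hz) hw
    have h3 : ({z} : Set ℂ) ∈ 𝓝 z := h2
    exact not_isOpen_singleton z (isOpen_iff_mem_nhds.2 (by rintro w rfl; exact h3))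
  · exact h (image_mem_map (hV.mem_nhds hz))

namespace TractSystem

variable {d : ℕ} (S : TractSystem d)

/-- The real parts of the boundary curve of size `r`. -/
def Gam (r : ℝ) : Set ℝ :=
  {x | (∃ i < 2 * d, ∃ ζ : ℂ, 0 < ζ.re ∧ ‖ζ‖ = r ∧ x = (S.A i ζ).re) ∨
    (∃ i < 2 * d, ∃ ξ : ℂ, |ξ.re| < S.X - 2 ∧ S.Y + 1 < ξ.im ∧ |ξ.im - r| ≤ S.C ∧
      x = (S.B i ξ).re)}

theorem exists_mem_Gam_of_isPreconnected : ∃ r₀ : ℝ, ∀ r ≥ r₀, ∀ T : Set ℂ, IsPreconnected T →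
    (∃ i < 2 * d, ∃ ζ : ℂ, 0 < ζ.re ∧ r < ‖ζ‖ ∧ exp (S.A i ζ) ∈ T) →
    ((0 : ℂ) ∈ T ∨ ∃ i < 2 * d, ∃ ζ : ℂ, 0 < ζ.re ∧ ‖ζ‖ < r ∧ exp (S.A i ζ) ∈ T) →
    ∃ z ∈ T, ∃ x ∈ S.Gam r, ‖z‖ = Real.exp x := by
  obtain ⟨R, hR⟩ := S.cover
  obtain ⟨r₁, hr₁⟩ := S.properA (Real.log (max R 1))
  obtain ⟨r₂, hr₂⟩ := S.properB (Real.log (max R 1))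
  have hX := S.two_lt_X
  have hexp : Real.exp (Real.log (max R 1)) = max R 1 :=
    Real.exp_log (lt_max_of_lt_right one_pos)
  refine ⟨max r₁ r₂, fun r hr T hT h1 h2 => ?_⟩
  have hrr₁ : r₁ ≤ r := (le_max_left _ _).trans hr
  have hrr₂ : r₂ ≤ r := (le_max_right _ _).trans hr
  set UA : ℕ → Set ℂ := fun i => (fun ζ => exp (S.A i ζ)) '' {ζ | 0 < ζ.re ∧ r < ‖ζ‖} with hUA
  set UB : ℕ → Set ℂ := fun i => (fun ξ => exp (S.B i ξ)) ''
    {ξ | (|ξ.re| < S.X - 2 ∧ S.Y + 1 < ξ.im) ∧ r < ξ.im} with hUB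
  set VA : ℕ → Set ℂ := fun i => (fun ζ => exp (S.A i ζ)) '' {ζ | 0 < ζ.re ∧ ‖ζ‖ < r} with hVA
  set VB : ℕ → Set ℂ := fun i => (fun ξ => exp (S.B i ξ)) ''
    {ξ | (|ξ.re| < S.X - 2 ∧ S.Y + 1 < ξ.im) ∧ ξ.im < r} with hVB
  have hore : IsOpen {ζ : ℂ | 0 < ζ.re} := isOpen_lt continuous_const continuous_re
  have hopA : ∀ i < 2 * d, ∀ V : Set ℂ, IsOpen V → V ⊆ {ζ | 0 < ζ.re} →
      IsOpen ((fun ζ => exp (S.A i ζ)) '' V) := by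
    intro i hi V hV hsub
    refine isOpen_image_exp_comp isOpen_halfPlane (S.A_diff i hi)
      (fun x hx y hy h => (S.A_inj i hi i hi x y hx hy h).2) hV fun z hz => ?_
    have := hsub hz
    simp only [mem_ofPred_eq] at this ⊢; linarith
  have hopB : ∀ i < 2 * d, ∀ V : Set ℂ, IsOpen V →
      V ⊆ {ξ | |ξ.re| < S.X - 2 ∧ S.Y + 1 < ξ.im} → IsOpen ((fun ζ => exp (S.B i ζ)) '' V) := by
    intro i hi V hV hsub
    refine isOpen_image_exp_comp (isOpen_strip _ _) (S.B_diff i hi) (S.B_inj i hi) hV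
      fun z hz => ?_
    have := hsub hz
    simp only [mem_ofPred_eq] at this ⊢
    exact ⟨by linarith, by linarith⟩
  set U : Set ℂ := ⋃ i ∈ Finset.range (2 * d), (UA i ∪ UB i) with hU
  set V : Set ℂ := (⋃ i ∈ Finset.range (2 * d), (VA i ∪ VB i)) ∪ ball 0 R with hV
  have hUo : IsOpen U := by
    refine isOpen_biUnion fun i hi => ?_
    have hi := Finset.mem_range.1 hi
    exact (hopA i hi _ (hore.inter (isOpen_lt continuous_const continuous_norm))
      fun z hz => hz.1).union (hopB i hi _ ((isOpen_strip _ _).inter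
        (isOpen_lt continuous_const continuous_im)) fun z hz => hz.1)
  have hVo : IsOpen V := by
    refine IsOpen.union (isOpen_biUnion fun i hi => ?_) isOpen_ball
    have hi := Finset.mem_range.1 hi
    exact (hopA i hi _ (hore.inter (isOpen_lt continuous_norm continuous_const))
      fun z hz => hz.1).union (hopB i hi _ ((isOpen_strip _ _).inter
        (isOpen_lt continuous_im continuous_const)) fun z hz => hz.1)
  by_contra! hno
  have hnoA : ∀ i < 2 * d, ∀ ζ : ℂ, 0 < ζ.re → ‖ζ‖ = r → exp (S.A i ζ) ∉ T :=
    fun i hi ζ h0 hζ hT => hno _ hT _ (Or.inl ⟨i, hi, ζ, h0, hζ, rfl⟩) (norm_exp _)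
  have hnoB : ∀ i < 2 * d, ∀ ξ : ℂ, |ξ.re| < S.X - 2 → S.Y + 1 < ξ.im → |ξ.im - r| ≤ S.C →
      exp (S.B i ξ) ∉ T :=
    fun i hi ξ h0 h1 h2 hT => hno _ hT _ (Or.inr ⟨i, hi, ξ, h0, h1, h2, rfl⟩) (norm_exp _)
  have hcov : T ⊆ U ∪ V := by
    intro z hz
    by_cases hzR : ‖z‖ < R
    · exact Or.inr (Or.inr (by simpa using hzR))
    rcases hR z (not_lt.1 hzR) with ⟨i, hi, ζ, h0, rfl⟩ | ⟨i, hi, ξ, ha, hb, rfl⟩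
    · rcases lt_trichotomy ‖ζ‖ r with h | h | h
      · exact Or.inr (Or.inl (mem_biUnion (Finset.mem_range.2 hi) (Or.inl ⟨ζ, ⟨h0, h⟩, rfl⟩)))
      · exact absurd hz (hnoA i hi ζ h0 h)
      · exact Or.inl (mem_biUnion (Finset.mem_range.2 hi) (Or.inl ⟨ζ, ⟨h0, h⟩, rfl⟩))
    · rcases lt_trichotomy ξ.im r with h | h | h
      · exact Or.inr (Or.inl (mem_biUnion (Finset.mem_range.2 hi)
          (Or.inr ⟨ξ, ⟨⟨ha, hb⟩, h⟩, rfl⟩)))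
      · exact absurd hz (hnoB i hi ξ ha hb (by simpa [h] using S.C_nonneg))
      · exact Or.inl (mem_biUnion (Finset.mem_range.2 hi) (Or.inr ⟨ξ, ⟨⟨ha, hb⟩, h⟩, rfl⟩))
  have hTU : (T ∩ U).Nonempty := by
    obtain ⟨i, hi, ζ, h0, h, hm⟩ := h1
    exact ⟨_, hm, mem_biUnion (Finset.mem_range.2 hi) (Or.inl ⟨ζ, ⟨h0, h⟩, rfl⟩)⟩
  have hTV : (T ∩ V).Nonempty := by
    rcases h2 with hm | ⟨i, hi, ζ, h0, h, hm⟩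
    · refine ⟨0, hm, Or.inr (mem_ball_self ?_)⟩
      by_contra hR0
      rcases hR 0 (by simpa using hR0) with ⟨i, hi, ζ, h0, h⟩ | ⟨i, hi, ξ, ha, hb, h⟩
      · exact exp_ne_zero _ h.symm
      · exact exp_ne_zero _ h.symm
    · exact ⟨_, hm, Or.inl (mem_biUnion (Finset.mem_range.2 hi) (Or.inl ⟨ζ, ⟨h0, h⟩, rfl⟩))⟩
  obtain ⟨z, hzT, hzU, hzV⟩ := hT U V hUo hVo hcov hTU hTV
  have hbig : R ≤ ‖z‖ := by
    simp only [hU, mem_iUnion] at hzU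
    obtain ⟨i, hi, hz⟩ := hzU
    have hi := Finset.mem_range.1 hi
    rcases hz with ⟨ζ, ⟨ha, hb⟩, rfl⟩ | ⟨ξ, ⟨⟨ha, hb⟩, hc⟩, rfl⟩
    · have := Real.exp_le_exp.2 (hr₁ i hi ζ (by linarith) (by linarith))
      rw [hexp] at this
      simpa only [norm_exp] using (le_max_left R 1).trans this
    · have := Real.exp_le_exp.2 (hr₂ i hi ξ (by linarith) (by linarith) (by linarith))
      rw [hexp] at this
      simpa only [norm_exp] using (le_max_left R 1).trans this
  rcases hzV with hzV | hzV
  swap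
  · rw [mem_ball_zero_iff] at hzV; linarith
  simp only [hU, mem_iUnion] at hzU
  simp only [mem_iUnion] at hzV
  obtain ⟨i, hi, hz⟩ := hzU
  obtain ⟨i', hi', hz'⟩ := hzV
  have hi := Finset.mem_range.1 hi
  have hi' := Finset.mem_range.1 hi'
  rcases hz with ⟨ζ, ⟨ha, hb⟩, rfl⟩ | ⟨ξ, ⟨⟨ha, hb⟩, hc⟩, rfl⟩
  · rcases hz' with ⟨ζ', ⟨ha', hb'⟩, he⟩ | ⟨ξ', ⟨⟨ha', hb'⟩, hc'⟩, he⟩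
    · have := (S.A_inj i' hi' i hi ζ' ζ (by linarith) (by linarith) he).2
      rw [this] at hb'; linarith
    · have := abs_le.1 (S.overlapAB i hi i' hi' ζ ξ' ha ha' hb' he.symm)
      refine hnoB i' hi' ξ' ha' hb' (abs_le.2 ⟨by linarith, by linarith [S.C_nonneg]⟩) ?_
      have he' : exp (S.B i' ξ') = exp (S.A i ζ) := he
      rw [he']; exact hzT
  · rcases hz' with ⟨ζ', ⟨ha', hb'⟩, he⟩ | ⟨ξ', ⟨⟨ha', hb'⟩, hc'⟩, he⟩
    · have := abs_le.1 (S.overlapAB i' hi' i hi ζ' ξ ha' ha hb he)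
      exact hnoB i hi ξ ha hb (abs_le.2 ⟨by linarith [S.C_nonneg], by linarith⟩) hzT
    · have := abs_le.1 (S.overlapBB i hi i' hi' ξ ξ' ha hb ha' hb' he.symm)
      exact hnoB i hi ξ ha hb (abs_le.2 ⟨by linarith [S.C_nonneg], by linarith⟩) hzT

theorem isPreconnected_norm_ge (s : ℝ) : IsPreconnected {z : ℂ | Real.exp s ≤ ‖z‖} := by
  have h : {z : ℂ | Real.exp s ≤ ‖z‖} = exp '' {w | s ≤ w.re} := by
    ext z
    constructor
    · intro hz
      have hpos : 0 < ‖z‖ := (Real.exp_pos s).trans_le hz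
      refine ⟨log z, ?_, exp_log (norm_pos_iff.1 hpos)⟩
      simp only [mem_ofPred_eq, log_re]
      exact (Real.le_log_iff_exp_le hpos).2 hz
    · rintro ⟨w, hw, rfl⟩
      simpa [norm_exp] using hw
  rw [h]
  exact (convex_halfSpace_re_ge s).isPreconnected.image _ continuous_exp.continuousOn

theorem exists_Gam_le : ∃ r₀ : ℝ, ∀ r ≥ r₀, ∀ i < 2 * d, ∀ ζ : ℂ, 0 < ζ.re →
    (r < ‖ζ‖ → ∃ x ∈ S.Gam r, x ≤ (S.A i ζ).re) ∧
    (‖ζ‖ < r → ∃ x ∈ S.Gam r, (S.A i ζ).re ≤ x) := by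
  obtain ⟨r₀, h⟩ := S.exists_mem_Gam_of_isPreconnected
  refine ⟨r₀, fun r hr i hi ζ h0 => ⟨fun hζ => ?_, fun hζ => ?_⟩⟩
  · obtain ⟨z, hz, x, hx, hzx⟩ := h r hr (closedBall 0 (Real.exp (S.A i ζ).re))
      (convex_closedBall _ _).isPreconnected ⟨i, hi, ζ, h0, hζ, by simp [norm_exp]⟩
      (Or.inl (by simp [Real.exp_nonneg]))
    refine ⟨x, hx, ?_⟩
    rw [mem_closedBall_zero_iff, hzx] at hz
    exact Real.exp_le_exp.1 hz
  · obtain ⟨r₁, hr₁⟩ := S.properA (S.A i ζ).re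
    have hm : max (max r₁ r) 0 + 1 = ‖((max (max r₁ r) 0 + 1 : ℝ) : ℂ)‖ := by
      rw [norm_real, Real.norm_eq_abs, abs_of_nonneg (by positivity)]
    obtain ⟨z, hz, x, hx, hzx⟩ := h r hr _ (isPreconnected_norm_ge (S.A i ζ).re)
      ⟨i, hi, ((max (max r₁ r) 0 + 1 : ℝ) : ℂ), by rw [ofReal_re]; positivity, by
        rw [← hm]; linarith [le_max_left (max r₁ r) 0, le_max_right r₁ r], by
        rw [mem_ofPred_eq, norm_exp, Real.exp_le_exp]
        apply hr₁ i hi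
        · rw [ofReal_re]; linarith [le_max_right (max r₁ r) 0]
        · rw [← hm]; linarith [le_max_left (max r₁ r) 0, le_max_left r₁ r]⟩
      (Or.inr ⟨i, hi, ζ, h0, hζ, by simp [norm_exp]⟩)
    refine ⟨x, hx, ?_⟩
    rw [mem_ofPred_eq, hzx] at hz
    exact Real.exp_le_exp.1 hz

end TractSystem

theorem measurableSet_reProdIm {S T : Set ℝ} (hS : MeasurableSet S) (hT : MeasurableSet T) :
    MeasurableSet (S ×ℂ T) := (measurable_re hS).inter (measurable_im hT)

/-- If the `exp ∘ A i` are jointly injective, the areas of the `A i` add up to at most the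
cylindrical area of an annulus containing the images. -/
theorem sum_lintegral_deriv_le {n : ℕ} {A : ℕ → ℂ → ℂ} {U : Set ℂ} (hU : MeasurableSet U)
    (hA : ∀ i < n, ∀ z ∈ U, DifferentiableAt ℂ (A i) z)
    (hinj : ∀ i < n, ∀ i' < n, ∀ z ∈ U, ∀ z' ∈ U, exp (A i z) = exp (A i' z') → i = i' ∧ z = z')
    {M : ℝ} (h0 : ∀ i < n, ∀ z ∈ U, 0 ≤ (A i z).re) (hM : ∀ i < n, ∀ z ∈ U, (A i z).re ≤ M) :
    ∑ i ∈ Finset.range n, ∫⁻ z in U, ‖deriv (A i) z‖ₑ ^ 2 ≤ ENNReal.ofReal (2 * π * M) := by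
  have hin : ∀ i < n, InjOn (fun z => exp (A i z)) U :=
    fun i hi x hx y hy h => (hinj i hi i hi x hx y hy h).2
  calc ∑ i ∈ Finset.range n, ∫⁻ z in U, ‖deriv (A i) z‖ₑ ^ 2
      = ∑ i ∈ Finset.range n, cylArea ((fun z => exp (A i z)) '' U) := by
        refine Finset.sum_congr rfl fun i hi => ?_
        have hi := Finset.mem_range.1 hi
        exact (cylArea_image_exp_comp hU (fun z hz => (hA i hi z hz).hasDerivAt) (hin i hi)).symm
    _ = cylArea (⋃ i ∈ Finset.range n, (fun z => exp (A i z)) '' U) := by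
        rw [cylArea, lintegral_biUnion_finset]
        · rfl
        · intro i hi j hj hij
          rw [Function.onFun, disjoint_left]
          rintro _ ⟨z, hz, rfl⟩ ⟨z', hz', h⟩
          exact hij (hinj j (by simpa using hj) i (by simpa using hi) z' hz' z hz h).1.symm
        · intro i hi
          have hi := Finset.mem_range.1 hi
          exact hU.image_of_continuousOn_injOn
            (fun z hz => (hA i hi z hz).cexp.continuousAt.continuousWithinAt) (hin i hi)
    _ ≤ cylArea {z : ℂ | Real.exp 0 ≤ ‖z‖ ∧ ‖z‖ ≤ Real.exp M} := by
        refine lintegral_mono_set (iUnion₂_subset fun i hi => ?_)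
        have hi := Finset.mem_range.1 hi
        rintro _ ⟨z, hz, rfl⟩
        simp only [mem_ofPred_eq, norm_exp, Real.exp_le_exp]
        exact ⟨h0 i hi z hz, hM i hi z hz⟩
    _ ≤ _ := by simpa using cylArea_annulus_le 0 M

namespace TractSystem

variable {d : ℕ} (S : TractSystem d)

/-- The half-plane maps in logarithmic coordinates. -/
noncomputable def Ah (i : ℕ) (w : ℂ) : ℂ := S.A i (exp w)

/-- The area density over the arc `|ζ| = exp t`. -/
noncomputable def arcArea (t : ℝ) : ℝ≥0∞ :=
  ∑ i ∈ Finset.range (2 * d), ∫⁻ θ in Ioo (-(π / 2)) (π / 2), ‖deriv (S.Ah i) (t + θ * I)‖ₑ ^ 2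

/-- The area of the strips near height `r`. -/
noncomputable def stripArea (r : ℝ) : ℝ≥0∞ :=
  ∑ i ∈ Finset.range (2 * d), ∫⁻ ξ in {ξ : ℂ | |ξ.re| < S.X - 1 ∧ |ξ.im - r| < S.C + 2},
    ‖deriv (S.B i) ξ‖ₑ ^ 2

theorem exp_re_nonneg {t θ : ℝ} (hθ : θ ∈ Icc (-(π / 2)) (π / 2)) :
    0 ≤ (exp (t + θ * I)).re := by
  rw [exp_re]
  have := Real.cos_nonneg_of_mem_Icc hθ
  simpa using mul_nonneg (Real.exp_pos t).le this

theorem exp_re_pos {t θ : ℝ} (hθ : θ ∈ Ioo (-(π / 2)) (π / 2)) :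
    0 < (exp (t + θ * I)).re := by
  rw [exp_re]
  have := Real.cos_pos_of_mem_Ioo hθ
  simpa using mul_pos (Real.exp_pos t) this

theorem norm_exp_add (t θ : ℝ) : ‖exp (t + θ * I)‖ = Real.exp t := by
  simp [norm_exp]

theorem hasDerivAt_Ah {i : ℕ} (hi : i < 2 * d) {w : ℂ} (hw : -1 < (exp w).re) :
    HasDerivAt (S.Ah i) (deriv (S.Ah i) w) w := by
  have h1 : DifferentiableAt ℂ (S.A i) (exp w) :=
    (S.A_diff i hi).differentiableAt (isOpen_halfPlane.mem_nhds hw)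
  exact (DifferentiableAt.comp w h1 differentiableAt_exp).hasDerivAt

theorem continuousAt_deriv_Ah {i : ℕ} (hi : i < 2 * d) {w : ℂ} (hw : -1 < (exp w).re) :
    ContinuousAt (deriv (S.Ah i)) w := by
  have ho : IsOpen {w : ℂ | -1 < (exp w).re} :=
    isOpen_lt continuous_const (continuous_re.comp continuous_exp)
  have hd : DifferentiableOn ℂ (S.Ah i) {w : ℂ | -1 < (exp w).re} :=
    fun w hw => (S.hasDerivAt_Ah hi hw).differentiableAt.differentiableWithinAt
  exact (hd.deriv ho).continuousOn.continuousAt (ho.mem_nhds hw)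

theorem enorm_arc_sub_le {i : ℕ} (hi : i < 2 * d) {t a b : ℝ} (ha : -(π / 2) ≤ a) (hab : a ≤ b)
    (hb : b ≤ π / 2) :
    ‖S.Ah i (t + b * I) - S.Ah i (t + a * I)‖ₑ ≤
      ∫⁻ θ in Ioo (-(π / 2)) (π / 2), ‖deriv (S.Ah i) (t + θ * I)‖ₑ := by
  have hmem : ∀ θ ∈ Icc a b, -1 < (exp (t + θ * I)).re := fun θ hθ =>
    lt_of_lt_of_le (by norm_num) (exp_re_nonneg ⟨ha.trans hθ.1, hθ.2.trans hb⟩)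
  have hd : ∀ θ : ℝ, HasDerivAt (fun θ : ℝ => (t + θ * I : ℂ)) I θ := fun θ => by
    simpa using ((ofRealCLM.hasDerivAt (x := θ)).mul_const I).const_add (t : ℂ)
  have hcomp : ∀ θ ∈ Icc a b, HasDerivAt (fun θ : ℝ => S.Ah i (t + θ * I))
      (deriv (S.Ah i) (t + θ * I) * I) θ := fun θ hθ =>
    HasDerivAt.comp (h₂ := S.Ah i) (h := fun θ : ℝ => (t + θ * I : ℂ)) θ
      (S.hasDerivAt_Ah hi (hmem θ hθ)) (hd θ)
  have hcont : ∀ θ ∈ Icc a b, ContinuousAt (fun θ : ℝ => deriv (S.Ah i) (t + θ * I)) θ :=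
    fun θ hθ => ContinuousAt.comp (g := deriv (S.Ah i)) (f := fun θ : ℝ => (t + θ * I : ℂ))
      (S.continuousAt_deriv_Ah hi (hmem θ hθ)) (hd θ).continuousAt
  refine (enorm_sub_le_lintegral hab hcomp ?_).trans ?_
  · exact fun θ hθ => ((hcont θ hθ).mul continuousAt_const).continuousWithinAt
  · simp only [enorm_mul, show ‖I‖ₑ = 1 by rw [← ofReal_norm]; simp, mul_one]
    exact lintegral_mono_set (Ioo_subset_Ioo ha hb)

theorem arc_sum_sq_le (t : ℝ) :
    (∑ i ∈ Finset.range (2 * d), ∫⁻ θ in Ioo (-(π / 2)) (π / 2),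
      ‖deriv (S.Ah i) (t + θ * I)‖ₑ) ^ 2 ≤ ENNReal.ofReal (2 * π * d) * S.arcArea t := by
  refine (ENNReal.sum_sq_le _ _).trans ?_
  have h : ∀ i, (∫⁻ θ in Ioo (-(π / 2)) (π / 2), ‖deriv (S.Ah i) (t + θ * I)‖ₑ) ^ 2 ≤
      ENNReal.ofReal π * ∫⁻ θ in Ioo (-(π / 2)) (π / 2), ‖deriv (S.Ah i) (t + θ * I)‖ₑ ^ 2 := by
    intro i
    have hm : Measurable fun θ : ℝ => ‖deriv (S.Ah i) (t + θ * I)‖ₑ :=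
      ((measurable_deriv _).comp (by fun_prop)).enorm
    have := lintegral_sq_le_mul (volume.restrict (Ioo (-(π / 2)) (π / 2))) hm.aemeasurable
    rwa [Measure.restrict_apply_univ, Real.volume_Ioo, show π / 2 - -(π / 2) = π by ring] at this
  calc _ ≤ ((2 * d : ℕ) : ℝ≥0∞) * ∑ i ∈ Finset.range (2 * d), ENNReal.ofReal π *
        ∫⁻ θ in Ioo (-(π / 2)) (π / 2), ‖deriv (S.Ah i) (t + θ * I)‖ₑ ^ 2 := by
        gcongr with i hi; exact h i
    _ = _ := by
        rw [← Finset.mul_sum, ← mul_assoc, arcArea, ← ENNReal.ofReal_natCast,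
          ← ENNReal.ofReal_mul (by positivity)]
        congr 2; push_cast; ring

theorem exists_strip_bound : ∃ c r₀ : ℝ, 0 < c ∧ ∀ i < 2 * d, ∀ r ≥ r₀, ∀ ξ ξ' : ℂ,
    |ξ.re| ≤ S.X - 2 → |ξ.im - r| ≤ S.C → |ξ'.re| ≤ S.X - 2 → |ξ'.im - r| ≤ S.C →
    ‖S.B i ξ - S.B i ξ'‖ₑ ^ 2 ≤ ENNReal.ofReal c *
      ∫⁻ ξ in {ξ : ℂ | |ξ.re| < S.X - 1 ∧ |ξ.im - r| < S.C + 2}, ‖deriv (S.B i) ξ‖ₑ ^ 2 := by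
  have hX := S.two_lt_X
  have hC := S.C_nonneg
  have hc : 0 < 2 * S.X + 2 * S.C := by linarith
  refine ⟨(2 * S.X + 2 * S.C) ^ 2, S.Y + S.C + 3, by positivity,
    fun i hi r hr ξ ξ' h1 h2 h3 h4 => ?_⟩
  set J := ∫⁻ ξ in {ξ : ℂ | |ξ.re| < S.X - 1 ∧ |ξ.im - r| < S.C + 2}, ‖deriv (S.B i) ξ‖ₑ ^ 2
    with hJ
  by_cases hJt : J = ∞
  · rw [hJt, ENNReal.mul_top]
    · exact le_top
    · simp only [ne_eq, ENNReal.ofReal_eq_zero, not_le]; positivity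
  set V : Set ℂ := {ξ : ℂ | |ξ.re| < S.X ∧ S.Y < ξ.im} with hV
  have hd : DifferentiableOn ℂ (deriv (S.B i)) V := (S.B_diff i hi).deriv (isOpen_strip _ _)
  set s : Set ℂ := (Icc (-(S.X - 2)) (S.X - 2)) ×ℂ (Icc (r - S.C) (r + S.C)) with hs
  have hsc : Convex ℝ s := by
    have : s = reLm ⁻¹' Icc (-(S.X - 2)) (S.X - 2) ∩ imLm ⁻¹' Icc (r - S.C) (r + S.C) := rfl
    rw [this]
    exact ((convex_Icc _ _).linear_preimage _).inter ((convex_Icc _ _).linear_preimage _)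
  have hsV : s ⊆ V := by
    rintro z ⟨ha, hb⟩
    simp only [mem_preimage, mem_Icc] at ha hb
    exact ⟨abs_lt.2 ⟨by linarith, by linarith⟩, by linarith⟩
  have hder : ∀ z ∈ s, ‖deriv (S.B i) z‖ ≤ √J.toReal := by
    rintro z ⟨ha, hb⟩
    simp only [mem_preimage, mem_Icc] at ha hb
    have hsub : ball z 1 ⊆ {ξ : ℂ | |ξ.re| < S.X - 1 ∧ |ξ.im - r| < S.C + 2} := by
      intro w hw
      rw [mem_ball, dist_eq_norm] at hw
      have h3 := (abs_re_le_norm (w - z)).trans_lt hw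
      have h4 := (abs_im_le_norm (w - z)).trans_lt hw
      rw [sub_re, abs_lt] at h3
      rw [sub_im, abs_lt] at h4
      exact ⟨abs_lt.2 ⟨by linarith, by linarith⟩, abs_lt.2 ⟨by linarith, by linarith⟩⟩
    have hsub2 : ball z 1 ⊆ V := fun w hw => by
      have h := hsub hw
      have := abs_lt.1 h.2
      exact ⟨by linarith [h.1], by linarith⟩
    have h5 := (enorm_sq_le_lintegral_ball (measurable_deriv _) (hd.mono hsub2)).trans
      (lintegral_mono_set hsub)
    apply Real.le_sqrt_of_sq_le
    rw [← hJ, ← ofReal_norm, ← ENNReal.ofReal_pow (norm_nonneg _)] at h5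
    exact (ENNReal.ofReal_le_iff_le_toReal hJt).1 h5
  have h2' := abs_le.1 h2
  have h4' := abs_le.1 h4
  have h1' := abs_le.1 h1
  have h3' := abs_le.1 h3
  have h6 := norm_sub_le_of_deriv_le (isOpen_strip _ _) (S.B_diff i hi) hsV hsc hder
    (x := ξ') (y := ξ) ⟨⟨by linarith, by linarith⟩, ⟨by linarith, by linarith⟩⟩
    ⟨⟨by linarith, by linarith⟩, ⟨by linarith, by linarith⟩⟩
  have h7 : ‖ξ - ξ'‖ ≤ 2 * S.X + 2 * S.C := by
    refine (norm_le_abs_re_add_abs_im _).trans ?_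
    rw [sub_re, sub_im]
    exact add_le_add (abs_le.2 ⟨by linarith, by linarith⟩) (abs_le.2 ⟨by linarith, by linarith⟩)
  rw [← ENNReal.ofReal_toReal hJt, ← ENNReal.ofReal_mul (by positivity), ← ofReal_norm,
    ← ENNReal.ofReal_pow (norm_nonneg _)]
  apply ENNReal.ofReal_le_ofReal
  calc ‖S.B i ξ - S.B i ξ'‖ ^ 2 ≤ (√J.toReal * (2 * S.X + 2 * S.C)) ^ 2 := by
        gcongr; exact h6.trans (by gcongr)
    _ = _ := by rw [mul_pow, Real.sq_sqrt ENNReal.toReal_nonneg]; ring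

end TractSystem

theorem enorm_re_sub_le (a b : ℂ) : ‖a.re - b.re‖ₑ ≤ ‖a - b‖ₑ := by
  rw [← ofReal_norm, ← ofReal_norm, ← sub_re]
  exact ENNReal.ofReal_le_ofReal (abs_re_le_norm _)

theorem enorm_sub_le_add {E : Type*} [NormedAddCommGroup E] (a b c : E) :
    ‖a - c‖ₑ ≤ ‖a - b‖ₑ + ‖b - c‖ₑ := by
  have h := enorm_add_le (a - b) (b - c)
  rwa [sub_add_sub_cancel] at h

theorem exists_eq_exp_of_re_pos {ζ : ℂ} (hζ : 0 < ζ.re) {t : ℝ} (ht : ‖ζ‖ = Real.exp t) :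
    ∃ θ ∈ Ioo (-(π / 2)) (π / 2), ζ = exp (t + θ * I) := by
  refine ⟨ζ.arg, abs_lt.1 (abs_arg_lt_pi_div_two_iff.2 (Or.inl hζ)), ?_⟩
  rw [exp_add, ← ofReal_exp, ← ht, norm_mul_exp_arg_mul_I]

theorem ENNReal.sqrt_sq (x : ℝ≥0∞) : (x ^ (1 / 2 : ℝ)) ^ 2 = x := by
  rw [← ENNReal.rpow_natCast, ← ENNReal.rpow_mul]
  norm_num

theorem ENNReal.le_sqrt_of_sq_le {x y : ℝ≥0∞} (h : x ^ 2 ≤ y) : x ≤ y ^ (1 / 2 : ℝ) := by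
  rw [← ENNReal.sqrt_sq y] at h
  exact (ENNReal.pow_right_strictMono two_ne_zero).le_iff_le.1 h

namespace TractSystem

variable {d : ℕ} (S : TractSystem d)

/-- The total length of the images of the arcs `|ζ| = exp t`. -/
noncomputable def arcLen (t : ℝ) : ℝ≥0∞ :=
  ∑ i ∈ Finset.range (2 * d), ∫⁻ θ in Ioo (-(π / 2)) (π / 2), ‖deriv (S.Ah i) (t + θ * I)‖ₑ

theorem exists_length_bounds : ∃ c r₀ : ℝ, 0 < c ∧ ∀ t : ℝ, r₀ ≤ Real.exp t → ∃ β : ℝ≥0∞,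
    β ^ 2 ≤ ENNReal.ofReal c * S.stripArea (Real.exp t) ∧
    ENNReal.ofReal (2 * π) ≤ S.arcLen t + β ∧
    ∃ x₀ : ℝ, ∀ x ∈ S.Gam (Real.exp t), ‖x - x₀‖ₑ ≤ 3 * (S.arcLen t + β) := by
  obtain ⟨c, r₁, hc, hcb⟩ := S.exists_strip_bound
  obtain ⟨r₂, hlink⟩ := S.link
  have hd := S.d_pos
  refine ⟨(2 * d : ℕ) * c, max r₁ r₂, by positivity, fun t ht => ?_⟩
  set r := Real.exp t with hr
  set b : ℕ → ℝ≥0∞ := fun i =>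
    ∫⁻ ξ in {ξ : ℂ | |ξ.re| < S.X - 1 ∧ |ξ.im - r| < S.C + 2}, ‖deriv (S.B i) ξ‖ₑ ^ 2 with hb
  set β : ℕ → ℝ≥0∞ := fun i => (ENNReal.ofReal c * b i) ^ (1 / 2 : ℝ) with hβ
  set α : ℕ → ℝ≥0∞ := fun i =>
    ∫⁻ θ in Ioo (-(π / 2)) (π / 2), ‖deriv (S.Ah i) (t + θ * I)‖ₑ with hα
  have hβle : ∀ i < 2 * d, ∀ ξ ξ' : ℂ, |ξ.re| ≤ S.X - 2 → |ξ.im - r| ≤ S.C →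
      |ξ'.re| ≤ S.X - 2 → |ξ'.im - r| ≤ S.C → ‖S.B i ξ - S.B i ξ'‖ₑ ≤ β i :=
    fun i hi ξ ξ' h1 h2 h3 h4 => ENNReal.le_sqrt_of_sq_le
      (hcb i hi r ((le_max_left _ _).trans ht) ξ ξ' h1 h2 h3 h4)
  have hup : exp (t + (π / 2 : ℝ) * I) = r * I := by
    rw [exp_add, ofReal_div, ofReal_ofNat, exp_pi_div_two_mul_I, hr, ofReal_exp]
  have hdn : exp (t + (-(π / 2) : ℝ) * I) = -(r * I) := by
    rw [exp_add, ofReal_neg, ofReal_div, ofReal_ofNat, ← neg_div, exp_neg_pi_div_two_mul_I, hr, ofReal_exp]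
    ring
  have hαpm : ∀ i < 2 * d, ‖S.A i (r * I) - S.A i (-(r * I))‖ₑ ≤ α i := fun i hi => by
    have := S.enorm_arc_sub_le hi (t := t) le_rfl (b := π / 2) (by linarith [Real.pi_pos]) le_rfl
    rwa [Ah, Ah, hup, hdn] at this
  have htel : ∀ k ≤ 2 * d, ‖S.A k (-(r * I)) - S.A 0 (-(r * I))‖ₑ ≤
      ∑ i ∈ Finset.range k, (α i + β i) := by
    intro k
    induction k with
    | zero => simp
    | succ k ih =>
      intro hk
      obtain ⟨ξ, ξ', ⟨h1, h2⟩, ⟨h3, h4⟩, h5, h6⟩ := hlink k (by omega) r ((le_max_right _ _).trans ht)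
      have e1 := hβle k (by omega) ξ' ξ h3 h4 h1 h2
      rw [← h5, ← h6] at e1
      have e2 := hαpm k (by omega)
      rw [Finset.sum_range_succ]
      refine (enorm_sub_le_add _ (S.A k (-(r * I))) _).trans ?_
      rw [add_comm]
      refine add_le_add (ih (by omega)) ?_
      refine (enorm_sub_le_add _ (S.A k (r * I)) _).trans ?_
      rw [add_comm]
      exact add_le_add e2 e1
  have hsum : ∀ k ≤ 2 * d, ∑ i ∈ Finset.range k, (α i + β i) ≤
      S.arcLen t + ∑ i ∈ Finset.range (2 * d), β i := by
    intro k hk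
    rw [arcLen, ← Finset.sum_add_distrib]
    exact Finset.sum_le_sum_of_subset (Finset.range_mono hk)
  have hi_le : ∀ i < 2 * d, α i + β i ≤ S.arcLen t + ∑ i ∈ Finset.range (2 * d), β i :=
    fun i hi => (Finset.single_le_sum (f := fun i => α i + β i) (fun _ _ => zero_le)
      (Finset.mem_range.2 hi)).trans (hsum _ le_rfl)
  refine ⟨∑ i ∈ Finset.range (2 * d), β i, ?_, ?_, (S.A 0 (-(r * I))).re, ?_⟩
  · refine (ENNReal.sum_sq_le _ _).trans ?_
    rw [ENNReal.ofReal_mul (by positivity), ENNReal.ofReal_natCast, mul_assoc, stripArea]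
    gcongr
    rw [Finset.mul_sum]
    simp only [hβ, ENNReal.sqrt_sq]
    exact le_rfl
  · have h := (htel _ le_rfl).trans (hsum _ le_rfl)
    refine le_trans ?_ h
    rw [S.A_close, add_sub_cancel_left, ← ofReal_norm]
    apply ENNReal.ofReal_le_ofReal
    simp only [norm_mul, norm_I, mul_one, norm_intCast, RCLike.norm_ofNat, norm_real,
      Real.norm_eq_abs, abs_of_pos Real.pi_pos]
    have : (1 : ℝ) ≤ |(S.s : ℝ)| := by exact_mod_cast Int.one_le_abs S.s_ne
    nlinarith [Real.pi_pos]
  · have key : ∀ i < 2 * d, ∀ x : ℂ, ‖x - S.A i (-(r * I))‖ₑ ≤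
        S.arcLen t + ∑ i ∈ Finset.range (2 * d), β i →
        ‖x.re - (S.A 0 (-(r * I))).re‖ₑ ≤ 2 * (S.arcLen t + ∑ i ∈ Finset.range (2 * d), β i) := by
      intro i hi x hx
      refine (enorm_re_sub_le _ _).trans ((enorm_sub_le_add _ (S.A i (-(r * I))) _).trans ?_)
      rw [two_mul]
      exact add_le_add hx ((htel i hi.le).trans (hsum i hi.le))
    have h23 : 2 * (S.arcLen t + ∑ i ∈ Finset.range (2 * d), β i) ≤
        3 * (S.arcLen t + ∑ i ∈ Finset.range (2 * d), β i) := by gcongr; norm_num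
    rintro x (⟨i, hi, ζ, h0, h1, rfl⟩ | ⟨i, hi, ξ, h1, _, h2, rfl⟩)
    · refine (key i hi _ ?_).trans h23
      obtain ⟨θ, hθ, rfl⟩ := exists_eq_exp_of_re_pos h0 h1
      have := S.enorm_arc_sub_le hi (t := t) le_rfl hθ.1.le hθ.2.le
      rw [Ah, Ah, hdn] at this
      exact this.trans ((le_self_add).trans (hi_le i hi))
    · refine (key i hi _ ?_).trans h23
      obtain ⟨ξ₁, ξ', ⟨h3, h4⟩, -, h5, -⟩ := hlink i hi r ((le_max_right _ _).trans ht)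
      refine (enorm_sub_le_add _ (S.A i (r * I)) _).trans (le_trans ?_ (hi_le i hi))
      rw [add_comm]
      refine add_le_add (hαpm i hi) ?_
      rw [h5]
      exact hβle i hi _ _ h1.le h2 h3 h4

/-- A length-area inequality for the curve of size `exp t`. -/
theorem exists_arcArea_lower {η : ℝ} (hη : 0 < η) : ∃ K t₀ : ℝ, 0 < K ∧ ∀ t ≥ t₀,
    ENNReal.ofReal ((2 * π) ^ 2) ≤ ENNReal.ofReal ((1 + η) * (2 * π * d)) * S.arcArea t +
      ENNReal.ofReal K * S.stripArea (Real.exp t) := by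
  obtain ⟨c, r₀, hc, h⟩ := S.exists_length_bounds
  have hη' := inv_pos.2 hη
  refine ⟨(1 + η⁻¹) * c, r₀, by positivity, fun t ht => ?_⟩
  obtain ⟨β, h1, h2, -⟩ := h t (by linarith [Real.add_one_le_exp t])
  calc ENNReal.ofReal ((2 * π) ^ 2) = ENNReal.ofReal (2 * π) ^ 2 := by
        rw [ENNReal.ofReal_pow (by positivity)]
    _ ≤ (S.arcLen t + β) ^ 2 := by gcongr
    _ ≤ _ := ENNReal.add_sq_le hη _ _
    _ ≤ _ := by
        rw [ENNReal.ofReal_mul (p := 1 + η) (by positivity),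
          ENNReal.ofReal_mul (p := 1 + η⁻¹) (by positivity),
          mul_assoc (ENNReal.ofReal (1 + η)), mul_assoc (ENNReal.ofReal (1 + η⁻¹))]
        gcongr
        exact S.arc_sum_sq_le t

theorem exists_Gam_diam : ∃ K t₀ : ℝ, 0 < K ∧ ∀ t ≥ t₀, ∀ x ∈ S.Gam (Real.exp t),
    ∀ y ∈ S.Gam (Real.exp t), ENNReal.ofReal ((x - y) ^ 2) ≤
      ENNReal.ofReal K * (S.arcArea t + S.stripArea (Real.exp t)) := by
  obtain ⟨c, r₀, hc, h⟩ := S.exists_length_bounds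
  have hd : (0 : ℝ) < d := by exact_mod_cast S.d_pos
  refine ⟨36 * 2 * (2 * π * d + c), r₀, by positivity, fun t ht x hx y hy => ?_⟩
  obtain ⟨β, h1, -, x₀, h2⟩ := h t (by linarith [Real.add_one_le_exp t])
  have h3 : ‖x - y‖ₑ ≤ 6 * (S.arcLen t + β) := by
    refine (enorm_sub_le_add x x₀ y).trans ?_
    rw [enorm_sub_rev x₀ y]
    refine (add_le_add (h2 x hx) (h2 y hy)).trans (le_of_eq ?_)
    ring
  calc ENNReal.ofReal ((x - y) ^ 2) = ‖x - y‖ₑ ^ 2 := by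
        rw [← ofReal_norm, ← ENNReal.ofReal_pow (norm_nonneg _), Real.norm_eq_abs, sq_abs]
    _ ≤ (6 * (S.arcLen t + β)) ^ 2 := by gcongr
    _ = 36 * (S.arcLen t + β) ^ 2 := by ring
    _ ≤ 36 * (2 * S.arcLen t ^ 2 + 2 * β ^ 2) := by
        gcongr
        have := ENNReal.add_sq_le one_pos (S.arcLen t) β
        norm_num at this
        exact this
    _ ≤ 36 * (2 * (ENNReal.ofReal (2 * π * d + c) * S.arcArea t) +
          2 * (ENNReal.ofReal (2 * π * d + c) * S.stripArea (Real.exp t))) := by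
        gcongr 36 * (2 * ?_ + 2 * ?_)
        · refine (S.arc_sum_sq_le t).trans ?_
          gcongr; linarith
        · refine h1.trans ?_
          gcongr
          have : 0 < 2 * π * d := by positivity
          linarith
    _ = _ := by
        rw [ENNReal.ofReal_mul (p := 36 * 2) (by positivity),
          show ENNReal.ofReal (36 * 2) = 36 * 2 by
            rw [ENNReal.ofReal_mul (by positivity)]; simp]
        ring

end TractSystem

theorem volume_setOf_abs_sub_exp_lt_le (y c T₁ T₂ : ℝ) :
    volume {t : ℝ | t ∈ Ioo T₁ T₂ ∧ |y - Real.exp t| < c} ≤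
      ENNReal.ofReal (2 * c * Real.exp (-T₁)) := by
  refine (Real.volume_le_diam _).trans (Metric.ediam_le fun t ht t' ht' => ?_)
  wlog h : t ≤ t' generalizing t t'
  · rw [edist_comm]; exact this t' ht' t ht (le_of_not_ge h)
  rw [edist_dist]
  apply ENNReal.ofReal_le_ofReal
  rw [Real.dist_eq, abs_sub_comm, abs_of_nonneg (by linarith)]
  have h1 := abs_lt.1 ht.2
  have h2 := abs_lt.1 ht'.2
  have h3 : Real.exp T₁ * (t' - t) ≤ 2 * c := by
    have h4 : Real.exp t' = Real.exp t * Real.exp (t' - t) := by rw [← Real.exp_add]; ring_nf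
    have h5 := Real.add_one_le_exp (t' - t)
    have h6 : Real.exp T₁ ≤ Real.exp t := Real.exp_le_exp.2 ht.1.1.le
    have h7 : Real.exp T₁ * (t' - t) ≤ Real.exp t * (t' - t) :=
      mul_le_mul_of_nonneg_right h6 (by linarith)
    nlinarith [Real.exp_pos t]
  rw [Real.exp_neg, ← div_eq_mul_inv, le_div_iff₀ (Real.exp_pos _)]
  linarith

namespace TractSystem

variable {d : ℕ} (S : TractSystem d)

theorem measurable_arcArea : Measurable S.arcArea := by
  unfold arcArea
  refine Finset.measurable_sum _ fun i _ => ?_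
  refine Measurable.lintegral_prod_right' (f := fun p : ℝ × ℝ =>
    ‖deriv (S.Ah i) (p.1 + p.2 * I)‖ₑ ^ 2) ?_
  exact ((measurable_deriv _).comp (by fun_prop)).enorm.pow_const 2

theorem exists_lintegral_arcArea_le : ∃ T₀ : ℝ, ∀ T₁ ≥ T₀, ∀ T₂ M : ℝ,
    (∀ x ∈ S.Gam (Real.exp T₂), x ≤ M) →
    ∫⁻ t in Ioo T₁ T₂, S.arcArea t ≤ ENNReal.ofReal (2 * π * M) := by
  obtain ⟨r₁, h1⟩ := S.properA 0
  obtain ⟨r₂, h2⟩ := S.exists_Gam_le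
  refine ⟨max r₁ r₂, fun T₁ hT₁ T₂ M hM => ?_⟩
  rcases le_or_gt T₂ T₁ with h | h
  · simp [Ioo_eq_empty_of_le h]
  have hr : ∀ t, T₁ < t → r₁ ≤ Real.exp t ∧ r₂ ≤ Real.exp t := fun t ht => by
    have := Real.add_one_le_exp t
    have h3 := le_max_left r₁ r₂
    have h4 := le_max_right r₁ r₂
    constructor <;> linarith
  unfold arcArea
  rw [lintegral_finsetSum]
  · have hms : ∀ i, Measurable fun z => ‖deriv (S.Ah i) z‖ₑ ^ 2 := fun i =>
      (measurable_deriv _).enorm.pow_const 2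
    simp_rw [← setLIntegral_reProdIm _ (hms _) (S := Ioo T₁ T₂) (T := Ioo (-(π / 2)) (π / 2))
      measurableSet_Ioo measurableSet_Ioo]
    have hre : ∀ z ∈ Ioo T₁ T₂ ×ℂ Ioo (-(π / 2)) (π / 2), 0 < (exp z).re ∧
        ‖exp z‖ = Real.exp z.re := by
      rintro z ⟨hz1, hz2⟩
      rw [← re_add_im z]
      refine ⟨exp_re_pos hz2, ?_⟩
      rw [norm_exp_add]; simp
    refine sum_lintegral_deriv_le (measurableSet_reProdIm measurableSet_Ioo measurableSet_Ioo)
      ?_ ?_ ?_ ?_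
    · intro i hi z hz
      exact (S.hasDerivAt_Ah hi (by linarith [(hre z hz).1])).differentiableAt
    · intro i hi i' hi' z hz z' hz' h
      obtain ⟨h5, h6⟩ := S.A_inj i hi i' hi' _ _ (by linarith [(hre z hz).1])
        (by linarith [(hre z' hz').1]) h
      have hz2 : z.im ∈ Ioo (-(π / 2)) (π / 2) := hz.2
      have hz2' : z'.im ∈ Ioo (-(π / 2)) (π / 2) := hz'.2
      have := Real.pi_pos
      exact ⟨h5, exp_inj_of_neg_pi_lt_of_le_pi (by linarith [hz2.1]) (by linarith [hz2.2])
        (by linarith [hz2'.1]) (by linarith [hz2'.2]) h6⟩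
    · intro i hi z hz
      have hz1 : z.re ∈ Ioo T₁ T₂ := hz.1
      exact h1 i hi _ (by linarith [(hre z hz).1]) ((hr z.re hz1.1).1.trans (hre z hz).2.ge)
    · intro i hi z hz
      have hz1 : z.re ∈ Ioo T₁ T₂ := hz.1
      obtain ⟨x, hx, hx'⟩ := (h2 (Real.exp T₂) (hr T₂ h).2 i hi (exp z) (hre z hz).1).2
        (by rw [(hre z hz).2]; exact Real.exp_lt_exp.2 hz1.2)
      exact hx'.trans (hM x hx)
  · intro i _
    refine Measurable.lintegral_prod_right' (f := fun p : ℝ × ℝ =>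
      ‖deriv (S.Ah i) (p.1 + p.2 * I)‖ₑ ^ 2) ?_
    exact ((measurable_deriv _).comp (by fun_prop)).enorm.pow_const 2

theorem exists_lintegral_strip_le : ∃ K r₀ : ℝ, 0 < K ∧ 1 ≤ r₀ ∧ ∀ i < 2 * d, ∀ a b : ℝ, r₀ ≤ a →
    a ≤ b → ∫⁻ ξ in Ioo (-(S.X - 1)) (S.X - 1) ×ℂ Ioo a b, ‖deriv (S.B i) ξ‖ₑ ^ 2 ≤
      ENNReal.ofReal (K * (1 + Real.log (b + 1))) := by
  obtain ⟨K, r₀, hK, hr₀, h⟩ := S.exists_growth_bound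
  obtain ⟨r₁, h1⟩ := S.properB 0
  refine ⟨2 * π * K, max r₀ (max r₁ S.Y), by positivity, hr₀.trans (le_max_left _ _),
    fun i hi a b ha hab => ?_⟩
  have ha0 := (le_max_left _ _).trans ha
  have ha1 := (le_max_left r₁ S.Y).trans ((le_max_right _ _).trans ha)
  have ha2 := (le_max_right r₁ S.Y).trans ((le_max_right _ _).trans ha)
  have hU : ∀ ξ ∈ Ioo (-(S.X - 1)) (S.X - 1) ×ℂ Ioo a b, |ξ.re| < S.X - 1 ∧ a < ξ.im ∧ ξ.im < b :=
    fun ξ hξ => ⟨abs_lt.2 hξ.1, hξ.2.1, hξ.2.2⟩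
  have hUV : ∀ ξ ∈ Ioo (-(S.X - 1)) (S.X - 1) ×ℂ Ioo a b, |ξ.re| < S.X ∧ S.Y < ξ.im :=
    fun ξ hξ => ⟨by linarith [(hU ξ hξ).1], by linarith [(hU ξ hξ).2.1]⟩
  have := sum_lintegral_deriv_le (n := 1) (A := fun _ => S.B i)
    (U := Ioo (-(S.X - 1)) (S.X - 1) ×ℂ Ioo a b)
    (M := K * (1 + Real.log (b + 1)))
    (measurableSet_reProdIm measurableSet_Ioo measurableSet_Ioo)
    (fun _ _ z hz => (S.B_diff i hi).differentiableAt ((isOpen_strip _ _).mem_nhds (hUV z hz)))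
    (fun j hj j' hj' z hz z' hz' h => ⟨by omega, S.B_inj i hi (hUV z hz) (hUV z' hz') h⟩)
    (fun _ _ z hz => h1 i hi z (hUV z hz).1 (hUV z hz).2 (by linarith [(hU z hz).2.1]))
    (fun _ _ z hz => ((h i hi).2 z (hU z hz).1.le (by linarith [(hU z hz).2.1])).trans (by
      have := (hU z hz).2
      gcongr <;> linarith))
  simpa [mul_assoc] using this

theorem stripArea_exp_eq (t : ℝ) : S.stripArea (Real.exp t) = ∑ i ∈ Finset.range (2 * d),
    ∫⁻ ξ : ℂ, {p : ℝ × ℂ | |p.2.re| < S.X - 1 ∧ |p.2.im - Real.exp p.1| < S.C + 2}.indicator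
      (fun p => ‖deriv (S.B i) p.2‖ₑ ^ 2) (t, ξ) := by
  unfold stripArea
  refine Finset.sum_congr rfl fun i _ => ?_
  rw [← lintegral_indicator]
  · rfl
  · exact (isOpen_lt (f := fun ξ : ℂ => |ξ.re|) (by fun_prop) continuous_const).measurableSet.inter
      (isOpen_lt (f := fun ξ : ℂ => |ξ.im - Real.exp t|) (by fun_prop)
        continuous_const).measurableSet

theorem measurable_strip_indicator (i : ℕ) : Measurable
    ({p : ℝ × ℂ | |p.2.re| < S.X - 1 ∧ |p.2.im - Real.exp p.1| < S.C + 2}.indicator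
      (fun p => ‖deriv (S.B i) p.2‖ₑ ^ 2)) := by
  refine Measurable.indicator (((measurable_deriv _).comp measurable_snd).enorm.pow_const 2) ?_
  exact (isOpen_lt (f := fun p : ℝ × ℂ => |p.2.re|) (by fun_prop)
      continuous_const).measurableSet.inter
    (isOpen_lt (f := fun p : ℝ × ℂ => |p.2.im - Real.exp p.1|) (by fun_prop)
      continuous_const).measurableSet

theorem measurable_stripArea_exp : Measurable fun t => S.stripArea (Real.exp t) := by
  simp_rw [stripArea_exp_eq]
  exact Finset.measurable_sum _ fun i _ => (S.measurable_strip_indicator i).lintegral_prod_right'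

theorem exists_lintegral_stripArea_le : ∃ K T₀ : ℝ, 0 < K ∧ ∀ T₁ ≥ T₀, ∀ T₂ ≥ T₁,
    ∫⁻ t in Ioo T₁ T₂, S.stripArea (Real.exp t) ≤
      ENNReal.ofReal (K * (1 + T₂) * Real.exp (-T₁)) := by
  obtain ⟨K, r₀, hK, hr₀, h⟩ := S.exists_lintegral_strip_le
  have hC := S.C_nonneg
  have hd : (0 : ℝ) < d := by exact_mod_cast S.d_pos
  set L := Real.log (S.C + 4) with hL
  have hL0 : 0 ≤ L := Real.log_nonneg (by linarith)
  refine ⟨2 * d * (2 * (S.C + 2)) * K * (1 + L), r₀ + S.C + 2, by positivity,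
    fun T₁ hT₁ T₂ hT₂ => ?_⟩
  have hT0 : 0 ≤ T₁ := by linarith
  have hexp : 1 ≤ Real.exp T₂ := Real.one_le_exp (by linarith)
  have hlog : Real.log (Real.exp T₂ + (S.C + 2) + 1) ≤ T₂ + L := by
    calc Real.log (Real.exp T₂ + (S.C + 2) + 1) ≤ Real.log (Real.exp T₂ * (S.C + 4)) := by
          apply Real.log_le_log (by positivity)
          nlinarith
      _ = _ := by rw [Real.log_mul (by positivity) (by positivity), Real.log_exp]
  simp_rw [stripArea_exp_eq]
  rw [lintegral_finsetSum _ fun i _ => (S.measurable_strip_indicator i).lintegral_prod_right']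
  have key : ∀ i ∈ Finset.range (2 * d), ∫⁻ t in Ioo T₁ T₂, ∫⁻ ξ : ℂ,
      {p : ℝ × ℂ | |p.2.re| < S.X - 1 ∧ |p.2.im - Real.exp p.1| < S.C + 2}.indicator
      (fun p => ‖deriv (S.B i) p.2‖ₑ ^ 2) (t, ξ) ≤
      ENNReal.ofReal (2 * (S.C + 2) * Real.exp (-T₁)) *
        ENNReal.ofReal (K * (1 + Real.log (Real.exp T₂ + (S.C + 2) + 1))) := by
    intro i hi
    rw [lintegral_lintegral_swap (f := fun t ξ =>
      {p : ℝ × ℂ | |p.2.re| < S.X - 1 ∧ |p.2.im - Real.exp p.1| < S.C + 2}.indicator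
      (fun p => ‖deriv (S.B i) p.2‖ₑ ^ 2) (t, ξ)) (S.measurable_strip_indicator i).aemeasurable]
    have hle := h i (Finset.mem_range.1 hi) (Real.exp T₁ - (S.C + 2)) (Real.exp T₂ + (S.C + 2))
      (by linarith [Real.add_one_le_exp T₁]) (by linarith [Real.exp_le_exp.2 hT₂])
    refine le_trans ?_ (mul_le_mul_right hle _)
    have hWm : MeasurableSet (Ioo (-(S.X - 1)) (S.X - 1) ×ℂ
      Ioo (Real.exp T₁ - (S.C + 2)) (Real.exp T₂ + (S.C + 2))) :=
      measurableSet_reProdIm measurableSet_Ioo measurableSet_Ioo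
    rw [← lintegral_const_mul _ ((measurable_deriv _).enorm.pow_const 2),
      ← lintegral_indicator hWm]
    refine lintegral_mono fun ξ => ?_
    by_cases hξ : ξ ∈ Ioo (-(S.X - 1)) (S.X - 1) ×ℂ
      Ioo (Real.exp T₁ - (S.C + 2)) (Real.exp T₂ + (S.C + 2))
    · rw [indicator_of_mem hξ]
      calc _ ≤ ∫⁻ t in Ioo T₁ T₂, {t : ℝ | |ξ.im - Real.exp t| < S.C + 2}.indicator
            (fun _ => ‖deriv (S.B i) ξ‖ₑ ^ 2) t := by
            refine lintegral_mono fun t => ?_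
            by_cases h3 : |ξ.im - Real.exp t| < S.C + 2
            · simp only [indicator, mem_ofPred_eq, h3, and_true, if_true]
              split_ifs
              exacts [le_rfl, zero_le]
            · rw [indicator_of_notMem (fun h4 => h3 h4.2)]
              exact zero_le
        _ = ‖deriv (S.B i) ξ‖ₑ ^ 2 * volume {t : ℝ | t ∈ Ioo T₁ T₂ ∧ |ξ.im - Real.exp t| < S.C + 2} := by
            have hm : MeasurableSet {t : ℝ | |ξ.im - Real.exp t| < S.C + 2} :=
              measurableSet_lt (by fun_prop) (by fun_prop)
            rw [lintegral_indicator_const hm, Measure.restrict_apply hm, inter_comm]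
            rfl
        _ ≤ _ := by
            rw [mul_comm]
            gcongr
            exact volume_setOf_abs_sub_exp_lt_le _ _ _ _
    · rw [indicator_of_notMem hξ]
      refine ((setLIntegral_congr_fun measurableSet_Ioo fun t ht => ?_).trans lintegral_zero).le
      refine indicator_of_notMem (fun h4 => hξ ?_) _
      have h5 := abs_lt.1 h4.2
      have h6 := Real.exp_lt_exp.2 ht.1
      have h7 := Real.exp_lt_exp.2 ht.2
      exact ⟨abs_lt.1 h4.1, by simp only at h5; linarith, by simp only at h5; linarith⟩
  refine (Finset.sum_le_sum key).trans ?_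
  rw [Finset.sum_const, Finset.card_range, nsmul_eq_mul, ← ENNReal.ofReal_natCast,
    ← ENNReal.ofReal_mul (by positivity), ← ENNReal.ofReal_mul (by positivity)]
  apply ENNReal.ofReal_le_ofReal
  push_cast
  have h8 : 1 + Real.log (Real.exp T₂ + (S.C + 2) + 1) ≤ (1 + L) * (1 + T₂) := by nlinarith
  calc 2 * (d : ℝ) * (2 * (S.C + 2) * Real.exp (-T₁) *
        (K * (1 + Real.log (Real.exp T₂ + (S.C + 2) + 1))))
      ≤ 2 * (d : ℝ) * (2 * (S.C + 2) * Real.exp (-T₁) * (K * ((1 + L) * (1 + T₂)))) := by gcongr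
    _ = _ := by ring

end TractSystem

namespace TractSystem

variable {d : ℕ} (S : TractSystem d)

theorem exists_le_of_Gam_le {η : ℝ} (hη : 0 < η) : ∃ C t₁ : ℝ, ∀ t ≥ t₁, ∀ M : ℝ, 0 ≤ M →
    (∀ x ∈ S.Gam (Real.exp t), x ≤ M) → (1 - η) * t ≤ (1 + η) * (d * M) + C := by
  obtain ⟨K, t₀, hK, h1⟩ := S.exists_arcArea_lower hη
  obtain ⟨T₀, h2⟩ := S.exists_lintegral_arcArea_le
  obtain ⟨K', T₀', hK', h3⟩ := S.exists_lintegral_stripArea_le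
  have hlim : Tendsto (fun T : ℝ => K * K' * Real.exp (-T)) atTop (𝓝 0) := by
    simpa using Real.tendsto_exp_neg_atTop_nhds_zero.const_mul (K * K')
  have hpos : 0 < η * (2 * π) ^ 2 := by positivity
  obtain ⟨T, hT, hTt, hT0, hT0'⟩ := ((hlim.eventually_lt_const hpos).and
    ((eventually_ge_atTop t₀).and ((eventually_ge_atTop T₀).and
      (eventually_ge_atTop (max T₀' 0))))).exists
  have hT1 := (le_max_left _ _).trans hT0'
  have hT2 := (le_max_right _ _).trans hT0'
  refine ⟨T + η, T, fun t ht M hM0 hM => ?_⟩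
  have e1 : ENNReal.ofReal ((2 * π) ^ 2 * (t - T)) ≤
      ENNReal.ofReal ((1 + η) * (2 * π * d)) * ENNReal.ofReal (2 * π * M) +
      ENNReal.ofReal K * ENNReal.ofReal (K' * (1 + t) * Real.exp (-T)) := by
    calc ENNReal.ofReal ((2 * π) ^ 2 * (t - T))
        = ∫⁻ s in Ioo T t, ENNReal.ofReal ((2 * π) ^ 2) := by
          rw [setLIntegral_const, Real.volume_Ioo, ENNReal.ofReal_mul (by positivity)]
      _ ≤ ∫⁻ s in Ioo T t, (ENNReal.ofReal ((1 + η) * (2 * π * d)) * S.arcArea s +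
            ENNReal.ofReal K * S.stripArea (Real.exp s)) :=
          setLIntegral_mono' measurableSet_Ioo fun s hs => h1 s (by linarith [hs.1])
      _ = _ := by
          rw [lintegral_add_left (S.measurable_arcArea.const_mul _),
            lintegral_const_mul _ S.measurable_arcArea,
            lintegral_const_mul _ S.measurable_stripArea_exp]
      _ ≤ _ := by
          gcongr
          · exact h2 T hT0 t M hM
          · exact h3 T hT1 t ht
  have ht0 : 0 ≤ 1 + t := by linarith
  rw [← ENNReal.ofReal_mul (by positivity), ← ENNReal.ofReal_mul (by positivity),
    ← ENNReal.ofReal_add (by positivity) (by positivity),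
    ENNReal.ofReal_le_ofReal_iff (by positivity)] at e1
  have e2 : K * (K' * (1 + t) * Real.exp (-T)) ≤ η * (2 * π) ^ 2 * (1 + t) := by
    calc _ = (K * K' * Real.exp (-T)) * (1 + t) := by ring
      _ ≤ _ := by gcongr
  have e3 : (2 * π) ^ 2 * (t - T) ≤ (2 * π) ^ 2 * ((1 + η) * (d * M) + η * (1 + t)) := by
    refine e1.trans ((add_le_add_right e2 _).trans (le_of_eq ?_))
    ring
  have := le_of_mul_le_mul_left e3 (by positivity)
  linarith

theorem exists_Gam_upper : ∃ K t₁ : ℝ, 0 < K ∧ ∀ t ≥ t₁, ∀ x ∈ S.Gam (Real.exp t),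
    x ≤ K * (1 + t) := by
  obtain ⟨K, r₀, hK, hr₀, h⟩ := S.exists_growth_bound
  have hC := S.C_nonneg
  set L := Real.log (S.C + 2) with hL
  have hL0 : 0 ≤ L := Real.log_nonneg (by linarith)
  refine ⟨K * (1 + L), r₀ + S.C, by positivity, fun t ht x hx => ?_⟩
  have ht0 : 0 ≤ t := by linarith
  have hexp : 1 ≤ Real.exp t := Real.one_le_exp ht0
  have key : ∀ y : ℝ, 0 ≤ y → y ≤ Real.exp t + S.C →
      K * (1 + Real.log (y + 1)) ≤ K * (1 + L) * (1 + t) := by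
    intro y hy0 hy
    have : Real.log (y + 1) ≤ t + L := by
      calc Real.log (y + 1) ≤ Real.log (Real.exp t * (S.C + 2)) := by
            apply Real.log_le_log (by positivity)
            nlinarith
        _ = _ := by rw [Real.log_mul (by positivity) (by positivity), Real.log_exp]
    rw [mul_assoc]
    gcongr
    nlinarith
  rcases hx with ⟨i, hi, ζ, h0, h1, rfl⟩ | ⟨i, hi, ξ, h1, _, h2, rfl⟩
  · exact ((h i hi).1 ζ h0.le).trans (key _ (norm_nonneg _) (by linarith))
  · have h3 := abs_le.1 h2
    have h4 := Real.add_one_le_exp t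
    exact ((h i hi).2 ξ (by linarith) (by linarith)).trans (key _ (by linarith) (by linarith))

/-- In every interval `[T, (1 + η) * T]` there is a good curve of bounded oscillation. -/
theorem exists_good_radius {η : ℝ} (hη : 0 < η) : ∃ K T₁ : ℝ, 0 ≤ K ∧ ∀ T ≥ T₁,
    ∃ t ∈ Ioo T ((1 + η) * T), ∀ x ∈ S.Gam (Real.exp t), ∀ y ∈ S.Gam (Real.exp t), x ≤ y + K := by
  obtain ⟨K, t₀, hK, h1⟩ := S.exists_Gam_diam
  obtain ⟨T₀, h2⟩ := S.exists_lintegral_arcArea_le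
  obtain ⟨K', T₀', hK', h3⟩ := S.exists_lintegral_stripArea_le
  obtain ⟨K₁, t₁, hK₁, h4⟩ := S.exists_Gam_upper
  set Q := (2 * π * K₁ + K') * (2 + η) with hQ
  have hQ0 : 0 < Q := by positivity
  refine ⟨√(K * (Q / η)), max (max t₀ T₀) (max (max T₀' t₁) 1), Real.sqrt_nonneg _,
    fun T hT => ?_⟩
  simp only [ge_iff_le, max_le_iff] at hT
  obtain ⟨⟨ht₀, hT₀⟩, ⟨hT₀', ht₁⟩, hT1⟩ := hT
  have hTT : T < (1 + η) * T := by nlinarith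
  have e1 : ∫⁻ t in Ioo T ((1 + η) * T), (S.arcArea t + S.stripArea (Real.exp t)) ≤
      ENNReal.ofReal (Q * T) := by
    rw [lintegral_add_left S.measurable_arcArea]
    have e2 := h2 T hT₀ _ _ (h4 ((1 + η) * T) (by linarith))
    have e3 := h3 T hT₀' ((1 + η) * T) hTT.le
    refine (add_le_add e2 e3).trans ?_
    rw [← ENNReal.ofReal_add (by positivity) (by positivity)]
    apply ENNReal.ofReal_le_ofReal
    have e4 : Real.exp (-T) ≤ 1 := Real.exp_le_one_iff.2 (by linarith)
    have e5 : 1 + (1 + η) * T ≤ (2 + η) * T := by linarith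
    calc 2 * π * (K₁ * (1 + (1 + η) * T)) + K' * (1 + (1 + η) * T) * Real.exp (-T)
        ≤ 2 * π * (K₁ * ((2 + η) * T)) + K' * ((2 + η) * T) * 1 := by gcongr
      _ = _ := by ring
  obtain ⟨t, ht, hle⟩ : ∃ t ∈ Ioo T ((1 + η) * T),
      S.arcArea t + S.stripArea (Real.exp t) ≤ ENNReal.ofReal (Q / η) := by
    by_contra! hcon
    have e2 : ∫⁻ t in Ioo T ((1 + η) * T), ENNReal.ofReal (Q / η) <
        ∫⁻ t in Ioo T ((1 + η) * T), (S.arcArea t + S.stripArea (Real.exp t)) := by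
      refine setLIntegral_strict_mono measurableSet_Ioo ?_
        (S.measurable_arcArea.add S.measurable_stripArea_exp) ?_ (ae_of_all _ hcon)
      · rw [Real.volume_Ioo]; simp; linarith
      · rw [setLIntegral_const, Real.volume_Ioo]
        exact ENNReal.mul_ne_top ENNReal.ofReal_ne_top ENNReal.ofReal_ne_top
    have e3 := e2.trans_le e1
    rw [setLIntegral_const, Real.volume_Ioo, ← ENNReal.ofReal_mul (by positivity)] at e3
    refine lt_irrefl _ (e3.trans_eq ?_)
    congr 1
    field_simp
    ring
  refine ⟨t, ht, fun x hx y hy => ?_⟩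
  have e2 := (h1 t (by linarith [ht.1]) x hx y hy).trans (mul_le_mul_right hle _)
  rw [← ENNReal.ofReal_mul (by positivity), ENNReal.ofReal_le_ofReal_iff (by positivity)] at e2
  have := (abs_le.1 (Real.abs_le_sqrt e2)).2
  linarith

theorem exists_mul_log_norm_le {c : ℝ} (hc0 : 0 < c) (hc : c < 1) : ∃ C r₁ : ℝ, ∀ i < 2 * d,
    ∀ ζ : ℂ, 0 < ζ.re → r₁ ≤ ‖ζ‖ → c * Real.log ‖ζ‖ ≤ d * (S.A i ζ).re + C := by
  set η := (1 - c) / 3 with hη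
  have hη0 : 0 < η := by linarith
  obtain ⟨C, t₁, h1⟩ := S.exists_le_of_Gam_le hη0
  obtain ⟨K, T₁, hK, h2⟩ := S.exists_good_radius hη0
  obtain ⟨r₂, h3⟩ := S.exists_Gam_le
  obtain ⟨r₃, h4⟩ := S.properA 0
  set T₀ := max (max t₁ T₁) (max r₂ 0) with hT₀
  refine ⟨d * K + |C|, max (Real.exp ((1 + η) * T₀)) r₃, fun i hi ζ h0 hζ => ?_⟩
  have hζ1 := (le_max_left _ _).trans hζ
  have hζ2 := (le_max_right _ _).trans hζ
  have hζp : 0 < ‖ζ‖ := (Real.exp_pos _).trans_le hζ1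
  set T := Real.log ‖ζ‖ / (1 + η) with hT
  have hTlog : (1 + η) * T = Real.log ‖ζ‖ := by rw [hT]; field_simp
  have hTT : T₀ ≤ T := by
    have := (Real.le_log_iff_exp_le hζp).2 hζ1
    rw [← hTlog] at this
    exact le_of_mul_le_mul_left this (by linarith)
  have hT1 : t₁ ≤ T ∧ T₁ ≤ T ∧ r₂ ≤ T ∧ 0 ≤ T := by
    have a1 := le_max_left (max t₁ T₁) (max r₂ 0)
    have a2 := le_max_right (max t₁ T₁) (max r₂ 0)
    have a3 := le_max_left t₁ T₁
    have a4 := le_max_right t₁ T₁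
    have a5 := le_max_left r₂ 0
    have a6 := le_max_right r₂ 0
    refine ⟨?_, ?_, ?_, ?_⟩ <;> linarith
  obtain ⟨t, ht, hdiam⟩ := h2 T hT1.2.1
  have hexp : Real.exp t < ‖ζ‖ := by
    rw [← Real.lt_log_iff_exp_lt hζp, ← hTlog]; exact ht.2
  obtain ⟨x, hx, hx'⟩ := (h3 (Real.exp t) (by linarith [Real.add_one_le_exp t, ht.1, hT1.2.2.1])
    i hi ζ h0).1 hexp
  have hA0 : 0 ≤ (S.A i ζ).re := h4 i hi ζ (by linarith) hζ2
  have e1 := h1 t (by linarith [ht.1]) ((S.A i ζ).re + K) (by linarith)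
    (fun y hy => (hdiam y hy x hx).trans (by linarith))
  have e2 : (1 - η) * T ≤ (1 + η) * (d * ((S.A i ζ).re + K) + |C|) := by
    have a1 : (1 - η) * T ≤ (1 - η) * t :=
      mul_le_mul_of_nonneg_left ht.1.le (by linarith)
    have a2 : C ≤ (1 + η) * |C| := by nlinarith [le_abs_self C, abs_nonneg C]
    linarith
  have e3 : (1 + η) * (c * Real.log ‖ζ‖) ≤ (1 - η) * T := by
    rw [← hTlog, show c = 1 - 3 * η by rw [hη]; ring]
    have : (1 + η) * ((1 - 3 * η) * (1 + η)) ≤ 1 - η := by nlinarith [pow_pos hη0 3]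
    nlinarith [hT1.2.2.2]
  have := le_of_mul_le_mul_left (e3.trans e2) (by linarith)
  linarith

theorem lintegral_radial_lower {t₀ t b c : ℝ} (ht : t₀ ≤ t) (hbc : b ≤ c)
    (h1 : ∀ i < 2 * d, ∀ θ ∈ Ioo (-(π / 2)) (π / 2), (S.Ah i (t₀ + θ * I)).re ≤ b)
    (h2 : ∀ i < 2 * d, ∀ θ ∈ Ioo (-(π / 2)) (π / 2), c ≤ (S.Ah i (t + θ * I)).re) :
    ENNReal.ofReal (2 * π * d * (c - b) ^ 2) ≤
      ENNReal.ofReal (t - t₀) * ∫⁻ s in Ioo t₀ t, S.arcArea s := by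
  have hm : ∀ i, Measurable fun p : ℝ × ℝ => ‖deriv (S.Ah i) (p.1 + p.2 * I)‖ₑ := fun i =>
    ((measurable_deriv _).comp (by fun_prop)).enorm
  have hray : ∀ i < 2 * d, ∀ θ ∈ Ioo (-(π / 2)) (π / 2), ENNReal.ofReal ((c - b) ^ 2) ≤
      ENNReal.ofReal (t - t₀) * ∫⁻ s in Ioo t₀ t, ‖deriv (S.Ah i) (s + θ * I)‖ₑ ^ 2 := by
    intro i hi θ hθ
    have hd : ∀ s : ℝ, HasDerivAt (fun s : ℝ => (s + θ * I : ℂ)) 1 s := fun s =>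
      (ofRealCLM.hasDerivAt (x := s)).add_const (θ * I : ℂ)
    have hw : ∀ s : ℝ, -1 < (exp (s + θ * I)).re := fun s => by linarith [exp_re_pos hθ (t := s)]
    have hcomp : ∀ s ∈ Icc t₀ t, HasDerivAt (fun s : ℝ => S.Ah i (s + θ * I))
        (deriv (S.Ah i) (s + θ * I) * 1) s := fun s _ =>
      HasDerivAt.comp (h₂ := S.Ah i) (h := fun s : ℝ => (s + θ * I : ℂ)) s
        (S.hasDerivAt_Ah hi (hw s)) (hd s)
    have hcont : ContinuousOn (fun s : ℝ => deriv (S.Ah i) (s + θ * I) * 1) (Icc t₀ t) :=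
      fun s _ => ((ContinuousAt.comp (g := deriv (S.Ah i)) (f := fun s : ℝ => (s + θ * I : ℂ))
        (S.continuousAt_deriv_Ah hi (hw s)) (hd s).continuousAt).mul
          continuousAt_const).continuousWithinAt
    have e1 := enorm_sub_le_lintegral ht hcomp hcont
    simp only [mul_one] at e1
    have e2 : ENNReal.ofReal (c - b) ≤ ‖S.Ah i (t + θ * I) - S.Ah i (t₀ + θ * I)‖ₑ := by
      rw [← ofReal_norm]
      apply ENNReal.ofReal_le_ofReal
      have a1 := re_le_norm (S.Ah i (t + θ * I) - S.Ah i (t₀ + θ * I))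
      rw [sub_re] at a1
      linarith [h1 i hi θ hθ, h2 i hi θ hθ]
    have e3 := lintegral_sq_le_mul (volume.restrict (Ioo t₀ t))
      ((hm i).comp (measurable_id.prodMk measurable_const) :
        Measurable fun s : ℝ => ‖deriv (S.Ah i) (s + θ * I)‖ₑ).aemeasurable
    rw [Measure.restrict_apply_univ, Real.volume_Ioo] at e3
    calc ENNReal.ofReal ((c - b) ^ 2) = ENNReal.ofReal (c - b) ^ 2 := by
          rw [ENNReal.ofReal_pow (by linarith)]
      _ ≤ (∫⁻ s in Ioo t₀ t, ‖deriv (S.Ah i) (s + θ * I)‖ₑ) ^ 2 := by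
          gcongr; exact e2.trans e1
      _ ≤ _ := e3
  have hi : ∀ i ∈ Finset.range (2 * d), ENNReal.ofReal (π * (c - b) ^ 2) ≤
      ENNReal.ofReal (t - t₀) * ∫⁻ s in Ioo t₀ t, ∫⁻ θ in Ioo (-(π / 2)) (π / 2),
        ‖deriv (S.Ah i) (s + θ * I)‖ₑ ^ 2 := by
    intro i hi
    rw [lintegral_lintegral_swap (f := fun s θ : ℝ => ‖deriv (S.Ah i) (s + θ * I)‖ₑ ^ 2)
      ((hm i).pow_const 2).aemeasurable, ← lintegral_const_mul _
      (((hm i).pow_const 2).lintegral_prod_left' (μ := volume.restrict (Ioo t₀ t)))]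
    calc ENNReal.ofReal (π * (c - b) ^ 2)
        = ∫⁻ θ in Ioo (-(π / 2)) (π / 2), ENNReal.ofReal ((c - b) ^ 2) := by
          rw [setLIntegral_const, Real.volume_Ioo, mul_comm, ENNReal.ofReal_mul (by positivity)]
          congr 2; ring
      _ ≤ _ := setLIntegral_mono' measurableSet_Ioo fun θ hθ =>
          hray i (Finset.mem_range.1 hi) θ hθ
  unfold arcArea
  rw [lintegral_finsetSum _ fun i _ => ((hm i).pow_const 2).lintegral_prod_right', Finset.mul_sum]
  refine le_trans (le_of_eq ?_) (Finset.sum_le_sum hi)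
  rw [Finset.sum_const, Finset.card_range, nsmul_eq_mul, ← ENNReal.ofReal_natCast,
    ← ENNReal.ofReal_mul (by positivity)]
  congr 1
  push_cast
  ring

theorem frequently_mul_re_le : ∃ C : ℝ, ∀ T : ℝ, ∃ t ≥ T,
    d * (S.A 0 (Real.exp t)).re ≤ t + C := by
  obtain ⟨K, T₁, hK, h1⟩ := S.exists_good_radius one_pos
  obtain ⟨K', r₀, hK', hr₀, h2⟩ := S.exists_growth_bound
  obtain ⟨T₀, h3⟩ := S.exists_lintegral_arcArea_le
  obtain ⟨r₁, hp⟩ := S.properA 0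
  have hd : (0 : ℝ) < d := by exact_mod_cast S.d_pos
  have hd2 : 0 < 2 * d := by have := S.d_pos; omega
  set t₀ := max T₀ 0 with ht₀
  have ht₀0 : 0 ≤ t₀ := le_max_right _ _
  set b := K' * (1 + Real.log (Real.exp t₀ + 1)) with hb
  have hb0 : 0 ≤ b := by
    have : 0 ≤ Real.log (Real.exp t₀ + 1) := Real.log_nonneg (by linarith [Real.exp_pos t₀])
    positivity
  refine ⟨d * (K + (2 * b + 2 * K)), fun T => ?_⟩
  obtain ⟨r₂, hp2⟩ := S.properA (b + K)
  obtain ⟨t, ht, hdiam⟩ := h1 (max (max T T₁) (max t₀ (max r₁ r₂))) (by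
    exact (le_max_right _ _).trans (le_max_left _ _))
  obtain ⟨⟨⟨htT, -⟩, htt₀, htr₁, htr₂⟩, -⟩ := (by simpa only [mem_Ioo, max_lt_iff] using ht :
    ((T < t ∧ T₁ < t) ∧ t₀ < t ∧ r₁ < t ∧ r₂ < t) ∧ _)
  refine ⟨t, htT.le, ?_⟩
  have hexp := Real.add_one_le_exp t
  have hre : 0 < ((Real.exp t : ℝ) : ℂ).re := by rw [ofReal_re]; exact Real.exp_pos t
  have hnorm : ‖((Real.exp t : ℝ) : ℂ)‖ = Real.exp t := by
    rw [norm_real, Real.norm_eq_abs, abs_of_pos (Real.exp_pos _)]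
  set x := (S.A 0 (Real.exp t : ℝ)).re with hx
  have hxG : x ∈ S.Gam (Real.exp t) := Or.inl ⟨0, hd2, _, hre, hnorm, rfl⟩
  have hxb : b + K ≤ x := hp2 0 hd2 _ (by linarith) (by rw [hnorm]; linarith)
  have hup : ∀ y ∈ S.Gam (Real.exp t), y ≤ x + K := fun y hy => hdiam y hy x hxG
  have e1 := h3 t₀ (le_max_left _ _) t _ hup
  have e2 := S.lintegral_radial_lower (t₀ := t₀) (t := t) (b := b) (c := x - K) htt₀.le
    (by linarith) (fun i hi θ hθ => ?_) (fun i hi θ hθ => ?_)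
  · have e3 := e2.trans (mul_le_mul_right e1 _)
    rw [← ENNReal.ofReal_mul (by linarith), ENNReal.ofReal_le_ofReal_iff (by
      have : 0 ≤ x + K := by linarith
      have : 0 ≤ t - t₀ := by linarith
      positivity)] at e3
    have e4 : 2 * π * (d * (x - K - b) ^ 2) ≤ 2 * π * (t * (x + K)) := by
      have : (t - t₀) * (2 * π * (x + K)) ≤ t * (2 * π * (x + K)) := by
        have : 0 ≤ x + K := by linarith
        gcongr; linarith
      linarith
    have e5 := le_of_mul_le_mul_left e4 (by positivity)
    have hxK : 0 < x + K ∨ x + K = 0 := (by linarith : 0 ≤ x + K).lt_or_eq.imp_right Eq.symm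
    rcases hxK with hxK | hxK
    · have e6 : (x + K) * (d * (x - 3 * K - 2 * b)) ≤ (x + K) * t := by
        have : (x + K) * (x - 3 * K - 2 * b) ≤ (x - K - b) ^ 2 := by nlinarith
        nlinarith
      have := le_of_mul_le_mul_left e6 hxK
      linarith
    · have : x ≤ 0 := by linarith
      have : d * x ≤ 0 := mul_nonpos_of_nonneg_of_nonpos hd.le this
      have : 0 ≤ d * (K + (2 * b + 2 * K)) := by positivity
      linarith
  · have := (h2 i hi).1 _ (exp_re_pos hθ (t := t₀)).le
    rwa [norm_exp_add] at this
  · have := hdiam x hxG _ (Or.inl ⟨i, hi, _, exp_re_pos hθ, norm_exp_add t θ, rfl⟩)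
    rw [Ah]
    linarith

end TractSystem

theorem logPlus_nonneg (x : ℝ) : 0 ≤ logPlus x := le_max_left _ _

theorem le_logPlus (x : ℝ) : Real.log x ≤ logPlus x := le_max_right _ _

theorem logPlus_le {x y : ℝ} (hx : 0 ≤ x) (hy : 0 ≤ y) (h : x ≤ Real.exp y) : logPlus x ≤ y := by
  refine max_le hy ?_
  rcases hx.eq_or_lt with rfl | hx
  · rwa [Real.log_zero]
  · exact (Real.log_le_iff_le_exp hx).2 h

theorem entireOrder_le {g : ℂ → ℂ} {a : ℝ} (ha : 0 ≤ a)
    (h : ∀ c > a, ∃ C R : ℝ, ∀ w : ℂ, R ≤ ‖w‖ →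
      logPlus (logPlus ‖g w‖) ≤ c * Real.log ‖w‖ + C) : entireOrder g ≤ ENNReal.ofReal a := by
  refine ENNReal.le_of_forall_pos_le_add fun ε hε _ => ?_
  have hε' : (0 : ℝ) < ε := hε
  obtain ⟨C, R, hC⟩ := h (a + ε / 2) (by linarith)
  rw [← ENNReal.ofReal_coe_nnreal, ← ENNReal.ofReal_add ha hε'.le]
  refine limsup_le_of_le (by isBoundedDefault) ?_
  rw [eventually_comap]
  filter_upwards [eventually_ge_atTop R, eventually_gt_atTop 1,
    Real.tendsto_log_atTop.eventually_ge_atTop (2 * C / ε)] with r hr hr1 hrC w hw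
  apply ENNReal.ofReal_le_ofReal
  rw [hw]
  have hl := Real.log_pos hr1
  rw [div_le_iff₀ hl]
  have e1 := hC w (by rw [hw]; exact hr)
  rw [hw] at e1
  rw [div_le_iff₀ hε'] at hrC
  linarith

theorem le_entireOrder {g : ℂ → ℂ} {a C : ℝ}
    (h : ∀ R : ℝ, ∃ w : ℂ, R ≤ ‖w‖ ∧ a * Real.log ‖w‖ ≤ logPlus (logPlus ‖g w‖) + C) :
    ENNReal.ofReal a ≤ entireOrder g := by
  refine ENNReal.le_of_forall_pos_le_add fun ε hε _ => ?_
  have hε' : (0 : ℝ) < ε := hε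
  rw [← tsub_le_iff_right, ← ENNReal.ofReal_coe_nnreal, ← ENNReal.ofReal_sub _ hε'.le]
  refine le_limsup_of_frequently_le ?_ (by isBoundedDefault)
  rw [frequently_comap, frequently_atTop]
  intro R
  obtain ⟨R', h1, h2, h3⟩ := ((eventually_ge_atTop R).and ((eventually_gt_atTop 1).and
    (Real.tendsto_log_atTop.eventually_ge_atTop (C / ε)))).exists
  obtain ⟨w, hw1, hw2⟩ := h R'
  refine ⟨‖w‖, h1.trans hw1, w, rfl, ?_⟩
  apply ENNReal.ofReal_le_ofReal
  have hl := Real.log_pos (h2.trans_le hw1)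
  rw [le_div_iff₀ hl]
  have h4 := h3.trans (Real.log_le_log (by linarith) hw1)
  rw [div_le_iff₀ hε'] at h4
  linarith

namespace TractSystem

variable {d : ℕ} (S : TractSystem d)

theorem entireOrder_eq {g : ℂ → ℂ} {z₀ b : ℂ} {X₁ : ℝ}
    (hR : ∃ R : ℝ, ∀ z : ℂ, R ≤ ‖z‖ → R ≤ ‖g (z₀ + z)‖ → ∃ i < 2 * d, ∃ ζ : ℂ, 0 < ζ.re ∧
      z = exp (S.A i ζ) ∧ g (z₀ + z) = b + exp (ζ + X₁))
    (h0 : ∀ ζ : ℂ, 0 < ζ.re → g (z₀ + exp (S.A 0 ζ)) = b + exp (ζ + X₁)) :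
    entireOrder g = d := by
  have hd : (0 : ℝ) < d := by exact_mod_cast S.d_pos
  rw [← ENNReal.ofReal_natCast]
  apply le_antisymm
  · refine entireOrder_le hd.le fun c hc => ?_
    have hc0 : 0 < c := hd.trans hc
    obtain ⟨R, hR⟩ := hR
    obtain ⟨C, r₁, h1⟩ := S.exists_mul_log_norm_le (c := d / c) (by positivity)
      ((div_lt_one hc0).2 hc)
    -- a lower bound `r` for the modulus from which the estimates hold
    set r := max r₁ 1 with hr
    set E := ‖b‖ + |X₁| + 1 with hE
    have hE1 : 1 ≤ E := by have := norm_nonneg b; have := abs_nonneg X₁; linarith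
    have hlog2 : 0 ≤ Real.log 2 := Real.log_nonneg (by norm_num)
    have hlogE : 0 ≤ Real.log (1 + E) := Real.log_nonneg (by linarith)
    refine ⟨|R| + Real.log (r + E) + (c * Real.log 2 + c / d * |C| + Real.log (1 + E)),
      max (|R| + ‖z₀‖) (‖z₀‖ + 1), fun w hw => ?_⟩
    have hw1 := (le_max_left _ _).trans hw
    have hw2 := (le_max_right _ _).trans hw
    have hwn : 1 ≤ ‖w‖ := by linarith [norm_nonneg z₀]
    have hlw : 0 ≤ c * Real.log ‖w‖ := mul_nonneg hc0.le (Real.log_nonneg hwn)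
    have hlr : 0 ≤ Real.log (r + E) := Real.log_nonneg (by linarith [le_max_right r₁ 1])
    have hrest : 0 ≤ c * Real.log 2 + c / d * |C| + Real.log (1 + E) := by
      have := abs_nonneg C
      positivity
    rcases le_or_gt R ‖g w‖ with hg | hg
    · obtain ⟨i, hi, ζ, hζ, hz, hgz⟩ := hR (w - z₀)
        (by linarith [norm_sub_norm_le w z₀, le_abs_self R]) (by simpa using hg)
      rw [add_sub_cancel] at hgz
      have e1 : logPlus ‖g w‖ ≤ ‖ζ‖ + E := by
        apply logPlus_le (norm_nonneg _) (by linarith [norm_nonneg ζ])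
        rw [hgz]
        refine (norm_add_le _ _).trans ?_
        rw [norm_exp]
        have a1 : (ζ + X₁).re ≤ ‖ζ‖ + |X₁| := by
          rw [add_re, ofReal_re]
          exact add_le_add (re_le_norm ζ) (le_abs_self _)
        have a2 : Real.exp (ζ + X₁).re ≤ Real.exp (‖ζ‖ + |X₁|) := Real.exp_le_exp.2 a1
        have a3 : 1 ≤ Real.exp (‖ζ‖ + |X₁|) := Real.one_le_exp (by positivity)
        have a4 := Real.add_one_le_exp (‖b‖ + 1)
        rw [show ‖ζ‖ + E = (‖ζ‖ + |X₁|) + (‖b‖ + 1) by rw [hE]; ring, Real.exp_add]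
        nlinarith [norm_nonneg b]
      rcases le_or_gt r ‖ζ‖ with hζr | hζr
      · have hζ1 : 1 ≤ ‖ζ‖ := (le_max_right _ _).trans hζr
        have e2 := h1 i hi ζ hζ ((le_max_left _ _).trans hζr)
        have e3 : (S.A i ζ).re ≤ Real.log ‖w‖ + Real.log 2 := by
          rw [← Real.log_exp (S.A i ζ).re, ← norm_exp, ← hz,
            ← Real.log_mul (by positivity) (by norm_num)]
          apply Real.log_le_log
          · rw [hz, norm_exp]; exact Real.exp_pos _
          · linarith [norm_sub_le w z₀]
        have e4 : Real.log ‖ζ‖ ≤ c * (Real.log ‖w‖ + Real.log 2) + c / d * |C| := by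
          calc Real.log ‖ζ‖ = c / d * (d / c * Real.log ‖ζ‖) := by field_simp
            _ ≤ c / d * (d * (Real.log ‖w‖ + Real.log 2) + |C|) := by
                gcongr
                exact e2.trans (add_le_add (by gcongr) (le_abs_self C))
            _ = _ := by field_simp
        have e5 : logPlus (logPlus ‖g w‖) ≤ Real.log ‖ζ‖ + Real.log (1 + E) := by
          apply logPlus_le (logPlus_nonneg _) (by linarith [Real.log_nonneg hζ1])
          rw [← Real.log_mul (by positivity) (by positivity), Real.exp_log (by positivity)]
          nlinarith
        have := abs_nonneg R
        linarith
      · have : logPlus (logPlus ‖g w‖) ≤ Real.log (r + E) := by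
          apply logPlus_le (logPlus_nonneg _) hlr
          rw [Real.exp_log (by linarith [le_max_right r₁ 1])]
          linarith
        have := abs_nonneg R
        linarith
    · have e1 : logPlus ‖g w‖ ≤ |R| := logPlus_le (norm_nonneg _) (abs_nonneg _) (by
        linarith [le_abs_self R, Real.add_one_le_exp |R|])
      have e2 : logPlus (logPlus ‖g w‖) ≤ |R| := logPlus_le (logPlus_nonneg _) (abs_nonneg _) (by
        linarith [Real.add_one_le_exp |R|])
      linarith
  · obtain ⟨C, h1⟩ := S.frequently_mul_re_le
    have hd2 : 0 < 2 * d := by have := S.d_pos; omega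
    set E := |X₁| + ‖b‖ + 1 with hE
    refine le_entireOrder (C := C + Real.log 2 + d * Real.log (1 + ‖z₀‖)) fun R => ?_
    obtain ⟨r₁, hp⟩ := S.properA (|R| + ‖z₀‖)
    obtain ⟨t, ht, hle⟩ := h1 (max r₁ (2 * E))
    have ht1 := (le_max_left _ _).trans ht
    have ht2 := (le_max_right _ _).trans ht
    have hexp := Real.add_one_le_exp t
    have hre : 0 < ((Real.exp t : ℝ) : ℂ).re := by rw [ofReal_re]; exact Real.exp_pos t
    have hnorm : ‖((Real.exp t : ℝ) : ℂ)‖ = Real.exp t := by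
      rw [norm_real, Real.norm_eq_abs, abs_of_pos (Real.exp_pos _)]
    have hE0 : 1 ≤ E := by have := norm_nonneg b; have := abs_nonneg X₁; linarith
    set x := (S.A 0 (Real.exp t : ℝ)).re with hx
    have hx0 : |R| + ‖z₀‖ ≤ x := hp 0 hd2 _ (by linarith) (by rw [hnorm]; linarith)
    have hx1 : 0 ≤ x := by have := norm_nonneg z₀; have := abs_nonneg R; linarith
    have hexpx := Real.add_one_le_exp x
    have hn : ‖exp (S.A 0 (Real.exp t : ℝ))‖ = Real.exp x := norm_exp _
    have hw1 : Real.exp x - ‖z₀‖ ≤ ‖z₀ + exp (S.A 0 (Real.exp t : ℝ))‖ := by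
      have := norm_sub_norm_le (exp (S.A 0 (Real.exp t : ℝ))) (-z₀)
      rw [sub_neg_eq_add, norm_neg, hn, add_comm _ z₀] at this
      exact this
    have hw2 : ‖z₀ + exp (S.A 0 (Real.exp t : ℝ))‖ ≤ Real.exp x * (1 + ‖z₀‖) := by
      refine (norm_add_le _ _).trans ?_
      rw [hn]
      nlinarith [norm_nonneg z₀]
    refine ⟨z₀ + exp (S.A 0 (Real.exp t : ℝ)), by linarith [le_abs_self R], ?_⟩
    have e1 : Real.log ‖z₀ + exp (S.A 0 (Real.exp t : ℝ))‖ ≤ x + Real.log (1 + ‖z₀‖) := by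
      rw [← Real.log_exp x, ← Real.log_mul (by positivity) (by positivity)]
      exact Real.log_le_log (by have := abs_nonneg R; linarith) hw2
    have e2 : Real.exp t / 2 ≤ logPlus ‖g (z₀ + exp (S.A 0 (Real.exp t : ℝ)))‖ := by
      refine le_trans ?_ (le_logPlus _)
      rw [h0 _ hre]
      have a1 : Real.exp (Real.exp t / 2) ≤
          ‖b + exp (((Real.exp t : ℝ) : ℂ) + X₁)‖ := by
        have a2 := norm_sub_norm_le (exp (((Real.exp t : ℝ) : ℂ) + X₁)) (-b)
        rw [sub_neg_eq_add, norm_neg, norm_exp, add_re, ofReal_re, ofReal_re, add_comm _ b] at a2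
        refine le_trans ?_ a2
        have a3 : Real.exp (Real.exp t / 2 + (‖b‖ + 1)) ≤ Real.exp (Real.exp t + X₁) := by
          apply Real.exp_le_exp.2
          have := neg_abs_le X₁
          linarith
        rw [Real.exp_add] at a3
        have a4 := Real.add_one_le_exp (‖b‖ + 1)
        have a5 : 1 ≤ Real.exp (Real.exp t / 2) := Real.one_le_exp (by positivity)
        nlinarith [norm_nonneg b]
      rw [Real.le_log_iff_exp_le ((Real.exp_pos _).trans_le a1)]
      exact a1
    have e3 : t - Real.log 2 ≤ logPlus (logPlus ‖g (z₀ + exp (S.A 0 (Real.exp t : ℝ)))‖) := by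
      refine le_trans ?_ (le_logPlus _)
      rw [← Real.log_exp t, ← Real.log_div (Real.exp_ne_zero _) two_ne_zero, Real.log_exp]
      exact Real.log_le_log (by positivity) e2
    have e4 := mul_le_mul_of_nonneg_left e1 hd.le
    linarith

end TractSystem

theorem exists_int_of_exp_eq_one {X : Type*} [TopologicalSpace X] {s : Set X}
    (hs : IsPreconnected s) {D : X → ℂ} (hD : ContinuousOn D s) (h : ∀ x ∈ s, exp (D x) = 1) :
    ∃ k : ℤ, ∀ x ∈ s, D x = k * (2 * π * I) := by
  rcases s.eq_empty_or_nonempty with rfl | ⟨x₀, hx₀⟩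
  · exact ⟨0, by simp⟩
  have hInt : ∀ x ∈ s, ∃ k : ℤ, D x = k * (2 * π * I) := fun x hx => exp_eq_one_iff.1 (h x hx)
  obtain ⟨k, hk⟩ := hInt x₀ hx₀
  refine ⟨k, fun x hx => ?_⟩
  have hcont : ContinuousOn (fun x => (D x).im / (2 * π)) s :=
    (continuous_im.comp_continuousOn hD).div_const _
  have hpi := Real.pi_pos
  have him : ∀ m : ℤ, ((m : ℂ) * (2 * π * I)).im / (2 * π) = m := by
    intro m
    have : ((m : ℂ) * (2 * π * I)).im = m * (2 * π) := by simp
    rw [this]; field_simp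
  obtain ⟨m, hm⟩ := hInt x hx
  have hconn := (hs.image _ hcont).ordConnected
  by_contra hne
  have hmk : m ≠ k := fun h => hne (by rw [hm, h])
  have key : ∀ a b : ℤ, a < b → (a : ℝ) ∈ (fun x => (D x).im / (2 * π)) '' s →
      (b : ℝ) ∈ (fun x => (D x).im / (2 * π)) '' s → False := by
    intro a b hab ha hb
    have hab' : (a : ℝ) + 1 ≤ b := by exact_mod_cast hab
    obtain ⟨y, hy, hy'⟩ := hconn.out ha hb (show (a : ℝ) + 1 / 2 ∈ Icc (a : ℝ) b from
      ⟨by linarith, by linarith⟩)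
    obtain ⟨n, hn⟩ := hInt y hy
    simp only [hn, him] at hy'
    have h1 : (a : ℝ) < n := by linarith
    have h2 : (n : ℝ) < a + 1 := by linarith
    have h1' : a < n := by exact_mod_cast h1
    have h2' : n < a + 1 := by exact_mod_cast h2
    omega
  have hmem : (m : ℝ) ∈ (fun x => (D x).im / (2 * π)) '' s :=
    ⟨x, hx, by simp only [hm, him]⟩
  have hkem : (k : ℝ) ∈ (fun x => (D x).im / (2 * π)) '' s :=
    ⟨x₀, hx₀, by simp only [hk, him]⟩
  rcases lt_or_gt_of_ne hmk with h1 | h1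
  · exact key _ _ h1 hmem hkem
  · exact key _ _ h1 hkem hmem

/-- A holomorphic self-map close to the identity is expanding up to a factor. -/
theorem norm_sub_sub_le_of_deriv_near_one {U : Set ℂ} (hc : Convex ℝ U) {T T' : ℂ → ℂ}
    (hT : ∀ x ∈ U, HasDerivAt T (T' x) x) {K : ℝ} (h1 : ∀ x ∈ U, ‖T' x - 1‖ ≤ K)
    {x y : ℂ} (hx : x ∈ U) (hy : y ∈ U) : ‖(T x - T y) - (x - y)‖ ≤ K * ‖x - y‖ := by
  have := hc.norm_image_sub_le_of_norm_hasDerivWithin_le (f := fun x => T x - x)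
    (f' := fun x => T' x - 1) (C := K)
    (fun x hx => ((hT x hx).sub (hasDerivAt_id x)).hasDerivWithinAt) h1 hy hx
  rwa [show T x - T y - (x - y) = T x - x - (T y - y) by ring]

theorem norm_sub_le_two_mul_of_near_id {T : ℂ → ℂ} {x y : ℂ}
    (h : ‖(T x - T y) - (x - y)‖ ≤ 1 / 2 * ‖x - y‖) : ‖x - y‖ ≤ 2 * ‖T x - T y‖ := by
  have : ‖x - y‖ ≤ ‖T x - T y‖ + ‖(T x - T y) - (x - y)‖ := by
    calc ‖x - y‖ = ‖(T x - T y) - ((T x - T y) - (x - y))‖ := by congr 1; ring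
      _ ≤ _ := norm_sub_le _ _
  linarith

theorem exists_mem_closedBall_of_near_id {U : Set ℂ} {T : ℂ → ℂ}
    (h : ∀ x ∈ U, ∀ y ∈ U, ‖(T x - T y) - (x - y)‖ ≤ 1 / 2 * ‖x - y‖) {η : ℝ} (hη : 0 ≤ η)
    (hclose : ∀ x ∈ U, ‖T x - x‖ ≤ η) {s : ℂ} (hs : closedBall s η ⊆ U) :
    ∃ x ∈ closedBall s η, T x = s := by
  let P : ℂ → ℂ := fun x => s - (T x - x)
  have hmaps : MapsTo P (closedBall s η) (closedBall s η) := by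
    intro x hx
    rw [mem_closedBall, dist_eq_norm]
    have := hclose x (hs hx)
    simpa [P, norm_sub_rev] using this
  have hcontr : ContractingWith (1 / 2 : NNReal) (hmaps.restrict P _ _) := by
    refine ⟨by rw [← NNReal.coe_lt_coe]; norm_num, LipschitzWith.of_dist_le_mul ?_⟩
    rintro ⟨x, hx⟩ ⟨y, hy⟩
    have := h x (hs hx) y (hs hy)
    rw [Subtype.dist_eq, Subtype.dist_eq, dist_eq_norm, dist_eq_norm]
    simp only [MapsTo.val_restrict_apply, P]
    rw [show s - (T x - x) - (s - (T y - y)) = -((T x - T y) - (x - y)) by ring, norm_neg]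
    simpa using this
  obtain ⟨y, hy, hfix, -⟩ := ContractingWith.exists_fixedPoint' isClosed_closedBall.isComplete
    hmaps hcontr (mem_closedBall_self hη) (edist_ne_top _ _)
  refine ⟨y, hy, ?_⟩
  have : s - (T y - y) = y := hfix
  linear_combination -this

/-- Inverse of a map close to the identity on a convex open set. -/
theorem exists_inverse_of_near_id {U V : Set ℂ} (hc : Convex ℝ U) (hV : IsOpen V) {T T' : ℂ → ℂ}
    (hT : ∀ x ∈ U, HasDerivAt T (T' x) x) (h1 : ∀ x ∈ U, ‖T' x - 1‖ ≤ 1 / 2) {η : ℝ} (hη : 0 ≤ η)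
    (hclose : ∀ x ∈ U, ‖T x - x‖ ≤ η) (hVU : ∀ s ∈ V, closedBall s η ⊆ U) :
    InjOn T U ∧ ∃ S : ℂ → ℂ, (∀ s ∈ V, S s ∈ U ∧ ‖S s - s‖ ≤ η ∧ T (S s) = s ∧
      HasDerivAt S (T' (S s))⁻¹ s) := by
  have h := fun x hx y hy =>
    norm_sub_sub_le_of_deriv_near_one hc hT h1 (x := x) (y := y) hx hy
  have hinj : ∀ x ∈ U, ∀ y ∈ U, ‖x - y‖ ≤ 2 * ‖T x - T y‖ := fun x hx y hy =>
    norm_sub_le_two_mul_of_near_id (h x hx y hy)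
  refine ⟨fun x hx y hy hxy => ?_, ?_⟩
  · have := hinj x hx y hy
    rw [hxy, sub_self, norm_zero, mul_zero] at this
    exact sub_eq_zero.1 (norm_le_zero_iff.1 this)
  have hex : ∀ s : ℂ, ∃ x, s ∈ V → x ∈ closedBall s η ∧ T x = s := by
    intro s
    by_cases hs : s ∈ V
    · obtain ⟨x, hx⟩ := exists_mem_closedBall_of_near_id h hη hclose (hVU s hs)
      exact ⟨x, fun _ => hx⟩
    · exact ⟨0, fun hs' => absurd hs' hs⟩
  choose S hS using hex
  have hSU : ∀ s ∈ V, S s ∈ U := fun s hs => hVU s hs (hS s hs).1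
  refine ⟨S, fun s hs => ⟨hSU s hs, by simpa [dist_eq_norm] using (hS s hs).1, (hS s hs).2, ?_⟩⟩
  have hcont : ContinuousAt S s := by
    have hlip : LipschitzOnWith 2 S V := by
      refine LipschitzOnWith.of_dist_le_mul fun x hx y hy => ?_
      have := hinj _ (hSU x hx) _ (hSU y hy)
      rw [(hS x hx).2, (hS y hy).2] at this
      simpa [dist_eq_norm] using this
    exact hlip.continuousOn.continuousAt (hV.mem_nhds hs)
  refine HasDerivAt.of_local_left_inverse hcont (hT _ (hSU s hs)) ?_ ?_
  · intro h0
    have := h1 _ (hSU s hs)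
    rw [h0] at this
    norm_num at this
  · filter_upwards [hV.mem_nhds hs] with x hx using (hS x hx).2

theorem HasDerivAt.of_comp_strict {A G H : ℂ → ℂ} {z g h : ℂ} (hA : ContinuousAt A z)
    (hG : HasStrictDerivAt G g (A z)) (hg : g ≠ 0) (hH : HasDerivAt H h z)
    (hcomp : ∀ᶠ w in 𝓝 z, G (A w) = H w) : HasDerivAt A (h / g) z := by
  have hz : G (A z) = H z := hcomp.self_of_nhds
  have hinv := hG.hasStrictFDerivAt_equiv hg
  have h1 := (hG.to_localInverse hg).hasDerivAt
  rw [hz] at h1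
  have h2 := h1.comp z hH
  rw [div_eq_inv_mul]
  refine h2.congr_of_eventuallyEq ?_
  have h3 := hA.eventually hinv.eventually_left_inverse
  filter_upwards [h3, hcomp] with w hw1 hw2
  rw [Function.comp_apply, ← hw2]
  exact hw1.symm

/-- A continuous lift of a locally injective holomorphic map through an entire function is
holomorphic. -/
theorem differentiableOn_of_comp {U : Set ℂ} (hU : IsOpen U) {A G H : ℂ → ℂ}
    (hA : ContinuousOn A U) (hG : Differentiable ℂ G) (hH : DifferentiableOn ℂ H U)
    (hH' : ∀ z ∈ U, deriv H z ≠ 0) (hcomp : ∀ z ∈ U, G (A z) = H z) :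
    DifferentiableOn ℂ A U := by
  have hGs : ∀ w, HasStrictDerivAt G (deriv G w) w := fun w =>
    (hG.contDiff (n := 1)).contDiffAt.hasStrictDerivAt one_ne_zero
  have hreg : ∀ z ∈ U, deriv G (A z) ≠ 0 → DifferentiableAt ℂ A z := by
    intro z hz h0
    refine (HasDerivAt.of_comp_strict (hA.continuousAt (hU.mem_nhds hz)) (hGs _) h0
      (hH.differentiableAt (hU.mem_nhds hz)).hasDerivAt ?_).differentiableAt
    filter_upwards [hU.mem_nhds hz] with w hw using hcomp w hw
  intro z hz
  refine DifferentiableAt.differentiableWithinAt ?_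
  by_cases h0 : deriv G (A z) = 0
  swap
  · exact hreg z hz h0
  have hAc : ContinuousAt A z := hA.continuousAt (hU.mem_nhds hz)
  have hHs : HasStrictDerivAt H (deriv H z) z :=
    (hH.analyticAt (hU.mem_nhds hz)).hasStrictDerivAt
  have hHinj : ∀ᶠ w in 𝓝[≠] z, H w ≠ H z := hHs.hasDerivAt.eventually_ne (hH' z hz)
  have hderan : AnalyticAt ℂ (deriv G) (A z) := (hG.analyticAt (A z)).deriv
  have hiso : ∀ᶠ w in 𝓝[≠] (A z), deriv G w ≠ 0 := by
    rcases hderan.eventually_eq_zero_or_eventually_ne_zero with h | h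
    · exfalso
      have h1 : deriv G = 0 := by
        have hg : AnalyticOnNhd ℂ (deriv G) univ := fun w _ => (hG.analyticAt w).deriv
        exact AnalyticOnNhd.eq_of_eventuallyEq hg (fun _ _ => analyticAt_const) h
      have h2 : ∀ w, G w = G (A z) := fun w =>
        is_const_of_deriv_eq_zero hG (fun x => congrFun h1 x) w (A z)
      have h3 : H =ᶠ[𝓝 z] fun _ => H z := by
        filter_upwards [hU.mem_nhds hz] with w hw
        rw [← hcomp w hw, h2, hcomp z hz]
      have := h3.deriv_eq
      rw [deriv_const] at this
      exact hH' z hz this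
    · exact h
  have hAne : ∀ᶠ w in 𝓝[≠] z, A w ≠ A z := by
    filter_upwards [hHinj, nhdsWithin_le_nhds (hU.mem_nhds hz)] with w hw hwU heq
    exact hw (by rw [← hcomp w hwU, heq, hcomp z hz])
  have hA' : Tendsto A (𝓝[≠] z) (𝓝[≠] (A z)) :=
    tendsto_nhdsWithin_iff.2 ⟨hAc.tendsto.mono_left nhdsWithin_le_nhds, hAne⟩
  refine (analyticAt_of_differentiable_on_punctured_nhds_of_continuousAt ?_ hAc).differentiableAt
  filter_upwards [hA'.eventually hiso, nhdsWithin_le_nhds (hU.mem_nhds hz)] with w h1 h2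
  exact hreg w h2 h1

theorem Convex.isSimplyConnected {U : Set ℂ} (hc : Convex ℝ U) (hn : U.Nonempty) :
    IsSimplyConnected U := by
  have := hc.contractibleSpace hn
  exact inferInstanceAs (SimplyConnectedSpace U)

theorem exists_holomorphic_log {U : Set ℂ} (hU : IsOpen U) (hc : Convex ℝ U)
    {W W' : ℂ → ℂ} (hW : ∀ z ∈ U, HasDerivAt W (W' z) z) (h0 : ∀ z ∈ U, W z ≠ 0) :
    ∃ l : ℂ → ℂ, ∀ z ∈ U, exp (l z) = W z ∧ HasDerivAt l (W' z / W z) z := by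
  rcases U.eq_empty_or_nonempty with rfl | hn
  · exact ⟨0, by simp⟩
  obtain ⟨l, hl, hexp⟩ := exists_continuousOn_eqOn_exp_comp (hc.isSimplyConnected hn) hU
    (g := W) (fun z hz => (hW z hz).continuousAt.continuousWithinAt)
    (by rintro ⟨z, hz, hz0⟩; exact h0 z hz hz0)
  refine ⟨l, fun z hz => ⟨hexp hz, ?_⟩⟩
  have h1 : exp (l z) = W z := hexp hz
  rw [← h1]
  refine HasDerivAt.of_comp_strict (hl.continuousAt (hU.mem_nhds hz)) (hasStrictDerivAt_exp _)
    (exp_ne_zero _) (hW z hz) ?_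
  filter_upwards [hU.mem_nhds hz] with w hw using hexp hw

/-- An entire function of polynomial growth is a polynomial. -/
theorem exists_polynomial_of_growth (n : ℕ) : ∀ {f : ℂ → ℂ}, Differentiable ℂ f → ∀ {C : ℝ},
    (∀ z, ‖f z‖ ≤ C * (1 + ‖z‖) ^ n) → ∃ p : Polynomial ℂ, ∀ z, f z = p.eval z := by
  induction n with
  | zero =>
    intro f hf C h
    obtain ⟨c, hc⟩ := hf.exists_const_forall_eq_of_bounded
      ((isBounded_iff_forall_norm_le).2 ⟨C, by rintro _ ⟨z, rfl⟩; simpa using h z⟩)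
    exact ⟨Polynomial.C c, by simpa using hc⟩
  | succ n ih =>
    intro f hf C h
    have hd : Differentiable ℂ (dslope f 0) := by
      rw [← differentiableOn_univ]
      exact (differentiableOn_dslope univ_mem).2 hf.differentiableOn
    obtain ⟨M, hM⟩ := (isCompact_closedBall (0 : ℂ) 1).exists_bound_of_continuousOn
      hd.continuous.continuousOn
    have hC : 0 ≤ C := by
      have := (norm_nonneg _).trans (h 0)
      simpa using this
    have hgrow : ∀ z, ‖dslope f 0 z‖ ≤ (|M| + 4 * C) * (1 + ‖z‖) ^ n := by
      intro z
      have hp : 1 ≤ (1 + ‖z‖) ^ n := one_le_pow₀ (by linarith [norm_nonneg z])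
      rcases le_total ‖z‖ 1 with hz | hz
      · have h1 := (hM z (by simpa using hz)).trans (le_abs_self M)
        nlinarith [abs_nonneg M]
      · have hz0 : z ≠ 0 := by rintro rfl; simp at hz; linarith
        rw [dslope_of_ne _ hz0, slope_def_field, sub_zero, norm_div]
        rw [div_le_iff₀ (by linarith)]
        have h1 : ‖f z - f 0‖ ≤ C * (1 + ‖z‖) ^ (n + 1) + C := by
          have := norm_sub_le (f z) (f 0)
          have h2 := h z
          have h3 := h 0
          simp at h3
          linarith
        have h4 : (1 + ‖z‖) ^ (n + 1) = (1 + ‖z‖) ^ n * (1 + ‖z‖) := pow_succ _ _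
        have h5 : (1 + ‖z‖) ^ n * (1 + ‖z‖) ≤ (1 + ‖z‖) ^ n * (2 * ‖z‖) := by gcongr; linarith
        have h6 : 1 ≤ (1 + ‖z‖) ^ n * ‖z‖ := by nlinarith
        have h7 : 0 ≤ |M| * ((1 + ‖z‖) ^ n * ‖z‖) := by positivity
        nlinarith
    obtain ⟨p, hp⟩ := ih hd hgrow
    refine ⟨Polynomial.X * p + Polynomial.C (f 0), fun z => ?_⟩
    have := sub_smul_dslope f 0 z
    simp only [sub_zero, smul_eq_mul, hp] at this
    simp [this]

/-- Logarithmic coordinates near infinity in which `f` has derivative `exp (l + exp)`. -/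
structure NormalForm (f : ℂ → ℂ) (d : ℕ) where
  N : ℂ → ℂ
  l : ℂ → ℂ
  ρ : ℝ
  C : ℝ
  k : ℤ
  d_pos : 0 < d
  C_nonneg : 0 ≤ C
  N_cont : ContinuousOn N {τ | ρ < τ.re}
  N_inj : InjOn N {τ | ρ < τ.re}
  N_period : ∀ τ : ℂ, ρ < τ.re → N (τ + 2 * π * I * d) = N τ + 2 * π * I
  N_close : ∀ τ : ℂ, ρ < τ.re → ‖N τ - τ / d‖ ≤ C
  N_cover : ∃ R : ℝ, ∀ ω : ℂ, R ≤ ω.re → ∃ τ : ℂ, ρ < τ.re ∧ N τ = ω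
  l_diff : DifferentiableOn ℂ l {τ | ρ < τ.re}
  l_deriv : ∀ τ : ℂ, ρ < τ.re → ‖deriv l τ‖ ≤ C
  l_period : ∀ τ : ℂ, ρ < τ.re → l (τ + 2 * π * I * d) = l τ + 2 * π * I * k
  hasDerivAt : ∀ τ : ℂ, ρ < τ.re →
    HasDerivAt (fun τ => f (exp (N τ))) (exp (l τ + exp τ)) τ

theorem isOpen_reGt (ρ : ℝ) : IsOpen {τ : ℂ | ρ < τ.re} := isOpen_lt continuous_const continuous_re

theorem Polynomial.exists_norm_eval_le (p : Polynomial ℂ) {n : ℕ} (hn : p.natDegree ≤ n) :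
    ∃ M : ℝ, 0 ≤ M ∧ ∀ z : ℂ, 1 ≤ ‖z‖ → ‖p.eval z‖ ≤ M * ‖z‖ ^ n := by
  refine ⟨∑ i ∈ Finset.range (n + 1), ‖p.coeff i‖, Finset.sum_nonneg fun _ _ => norm_nonneg _,
    fun z hz => ?_⟩
  rw [p.eval_eq_sum_range' (by omega : p.natDegree < n + 1), Finset.sum_mul]
  refine (norm_sum_le _ _).trans (Finset.sum_le_sum fun i hi => ?_)
  rw [norm_mul, norm_pow]
  have := Finset.mem_range.1 hi
  have hi' : i ≤ n := by omega
  gcongr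

theorem Polynomial.exists_norm_eval_sub_le (p : Polynomial ℂ) {n : ℕ} (hn : p.natDegree ≤ n) :
    ∃ M : ℝ, 0 ≤ M ∧ ∀ z : ℂ, 1 ≤ ‖z‖ → ‖p.eval z - p.coeff n * z ^ n‖ * ‖z‖ ≤ M * ‖z‖ ^ n := by
  rcases n with _ | n
  · refine ⟨0, le_rfl, fun z _ => ?_⟩
    obtain ⟨c, rfl⟩ : ∃ c, p = Polynomial.C c :=
      ⟨_, Polynomial.eq_C_of_natDegree_le_zero hn⟩
    simp
  · have hdeg : (p - Polynomial.C (p.coeff (n + 1)) * Polynomial.X ^ (n + 1)).natDegree ≤ n := by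
      rw [Polynomial.natDegree_le_iff_coeff_eq_zero]
      intro m hm
      rw [Polynomial.coeff_sub, Polynomial.coeff_C_mul, Polynomial.coeff_X_pow]
      split_ifs with h
      · rw [h]; simp
      · rw [Polynomial.coeff_eq_zero_of_natDegree_lt (by omega)]; simp
    obtain ⟨M, hM, h⟩ := Polynomial.exists_norm_eval_le _ hdeg
    refine ⟨M, hM, fun z hz => ?_⟩
    have := h z hz
    simp only [Polynomial.eval_sub, Polynomial.eval_mul, Polynomial.eval_C, Polynomial.eval_pow,
      Polynomial.eval_X] at this
    rw [pow_succ ‖z‖, ← mul_assoc]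
    gcongr

theorem Polynomial.exists_norm_le_norm_eval {p : Polynomial ℂ} (hp : p ≠ 0) :
    ∃ R : ℝ, 1 ≤ R ∧ ∀ z : ℂ, R ≤ ‖z‖ →
      ‖p.leadingCoeff‖ / 2 * ‖z‖ ^ p.natDegree ≤ ‖p.eval z‖ := by
  obtain ⟨M, hM, h⟩ := Polynomial.exists_norm_eval_sub_le p le_rfl
  have hl : 0 < ‖p.leadingCoeff‖ := by simpa using hp
  refine ⟨max 1 (2 * M / ‖p.leadingCoeff‖), le_max_left _ _, fun z hz => ?_⟩
  have h1 : 1 ≤ ‖z‖ := (le_max_left _ _).trans hz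
  have h2 := (le_max_right _ _).trans hz
  rw [div_le_iff₀ hl] at h2
  have h3 := h z h1
  have h4 : ‖p.eval z - p.coeff p.natDegree * z ^ p.natDegree‖
      ≤ ‖p.leadingCoeff‖ / 2 * ‖z‖ ^ p.natDegree := by
    have : 0 < ‖z‖ := by linarith
    refine le_of_mul_le_mul_right (h3.trans ?_) this
    have : 0 ≤ ‖z‖ ^ p.natDegree := by positivity
    nlinarith
  have h5 := norm_sub_norm_le (p.coeff p.natDegree * z ^ p.natDegree)
    (p.coeff p.natDegree * z ^ p.natDegree - p.eval z)
  rw [norm_sub_rev _ (p.eval z), sub_sub_cancel, norm_mul, norm_pow] at h5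
  have h6 : p.coeff p.natDegree = p.leadingCoeff := rfl
  rw [h6] at h4 h5
  linarith

theorem Polynomial.exists_derivative_eq (p : Polynomial ℂ) :
    ∃ q : Polynomial ℂ, Polynomial.derivative q = p := by
  induction p using Polynomial.induction_on' with
  | add p q hp hq =>
    obtain ⟨a, rfl⟩ := hp
    obtain ⟨b, rfl⟩ := hq
    exact ⟨a + b, by simp⟩
  | monomial n a =>
    refine ⟨Polynomial.monomial (n + 1) (a / (n + 1)), ?_⟩
    have : (n : ℂ) + 1 ≠ 0 := by exact_mod_cast n.succ_ne_zero
    rw [Polynomial.derivative_monomial]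
    simp [this]

theorem norm_le_of_norm_deriv_le_mul {v v' : ℝ → ℂ} {K b : ℝ}
    (hv : ∀ t ∈ Icc 0 b, HasDerivAt v (v' t) t) (h : ∀ t ∈ Icc 0 b, ‖v' t‖ ≤ K * ‖v t‖) :
    ∀ t ∈ Icc 0 b, ‖v t‖ ≤ ‖v 0‖ * Real.exp (K * t) := by
  intro t ht
  have := norm_le_gronwallBound_of_norm_deriv_right_le (f := v) (f' := v') (δ := ‖v 0‖) (K := K)
    (ε := 0) (a := 0) (b := b) (fun t ht => (hv t ht).continuousAt.continuousWithinAt)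
    (fun t ht => (hv t (Ico_subset_Icc_self ht)).hasDerivWithinAt) le_rfl
    (fun t ht => by simpa using h t (Ico_subset_Icc_self ht)) t ht
  simpa [gronwallBound_ε0] using this

section ODE

variable {f : ℂ → ℂ} {P Q : Polynomial ℂ}

theorem deriv_ne_zero_of_ode (hf : TranscendentalEntire f)
    (heq : ∀ z : ℂ, deriv (deriv f) z * Q.eval z = deriv f z * P.eval z) {z : ℂ}
    (hz : Q.eval z ≠ 0) : deriv f z ≠ 0 := by
  intro h0
  obtain ⟨hfd, hfp⟩ := hf
  have hd : Differentiable ℂ (deriv f) := fun w => (hfd.analyticAt w).deriv.differentiableAt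
  have hb : ContinuousAt (fun w => P.eval w / Q.eval w) z :=
    P.continuous.continuousAt.div Q.continuous.continuousAt hz
  have h1 : ∀ᶠ w in 𝓝 z, Q.eval w ≠ 0 ∧ ‖P.eval w / Q.eval w‖ < ‖P.eval z / Q.eval z‖ + 1 :=
    (Q.continuous.continuousAt.eventually_ne hz).and
      (hb.norm.eventually_lt continuousAt_const (by linarith))
  obtain ⟨ε, hε, hball⟩ := Metric.eventually_nhds_iff_ball.1 h1
  have hzero : ∀ᶠ w in 𝓝 z, deriv f w = 0 := by
    filter_upwards [ball_mem_nhds z hε] with w hw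
    have hmem : ∀ t ∈ Icc (0 : ℝ) 1, z + t * (w - z) ∈ ball z ε := by
      intro t ht
      rw [mem_ball, dist_eq_norm] at hw ⊢
      rw [add_sub_cancel_left, norm_mul, norm_real, Real.norm_of_nonneg ht.1]
      nlinarith [norm_nonneg (w - z), ht.2]
    have hder : ∀ t ∈ Icc (0 : ℝ) 1, HasDerivAt (fun t : ℝ => deriv f (z + t * (w - z)))
        (deriv (deriv f) (z + t * (w - z)) * (w - z)) t := by
      intro t _
      have h2 : HasDerivAt (fun t : ℝ => (z + t * (w - z) : ℂ)) (w - z) t := by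
        simpa using ((ofRealCLM.hasDerivAt (x := t)).mul_const (w - z)).const_add z
      exact (hd _).hasDerivAt.comp t h2
    have := norm_le_of_norm_deriv_le_mul hder (K := (‖P.eval z / Q.eval z‖ + 1) * ‖w - z‖)
      (fun t ht => by
        obtain ⟨hQ, hK⟩ := hball _ (hmem t ht)
        have h3 : deriv (deriv f) (z + t * (w - z)) = deriv f (z + t * (w - z)) *
            (P.eval (z + t * (w - z)) / Q.eval (z + t * (w - z))) := by
          rw [← mul_div_assoc, ← heq, mul_div_cancel_right₀ _ hQ]
        rw [h3, norm_mul, norm_mul]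
        calc _ ≤ ‖deriv f (z + t * (w - z))‖ * (‖P.eval z / Q.eval z‖ + 1) * ‖w - z‖ := by
              gcongr
          _ = _ := by ring) 1 ⟨zero_le_one, le_rfl⟩
    simpa [h0] using this
  have hg : AnalyticOnNhd ℂ (deriv f) univ := fun w _ => (hfd.analyticAt w).deriv
  have h2 : deriv f = fun _ => 0 :=
    AnalyticOnNhd.eq_of_eventuallyEq hg (fun _ _ => analyticAt_const) hzero
  refine hfp ⟨Polynomial.C (f 0), fun w => ?_⟩
  simpa using is_const_of_deriv_eq_zero hfd (fun x => congrFun h2 x) w 0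

theorem exists_polynomial_of_deriv {f : ℂ → ℂ} (hf : Differentiable ℂ f)
    (h : ∃ p : Polynomial ℂ, ∀ z, deriv f z = p.eval z) :
    ∃ p : Polynomial ℂ, ∀ z, f z = p.eval z := by
  obtain ⟨p, hp⟩ := h
  obtain ⟨q, rfl⟩ := p.exists_derivative_eq
  have hc : ∀ z, f z - q.eval z = f 0 - q.eval 0 := fun z =>
    is_const_of_deriv_eq_zero (hf.sub q.differentiable) (fun w => by
      rw [deriv_sub hf.differentiableAt q.differentiableAt, hp, Polynomial.deriv, sub_self]) z 0
  refine ⟨q + Polynomial.C (f 0 - q.eval 0), fun z => ?_⟩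
  rw [Polynomial.eval_add, Polynomial.eval_C, ← hc z]
  ring

theorem div_ne_zero_of_ode (hf : TranscendentalEntire f) (hQ : Q ≠ 0)
    (heq : ∀ z : ℂ, deriv (deriv f) z * Q.eval z = deriv f z * P.eval z) : P / Q ≠ 0 := by
  intro h0
  obtain ⟨hfd, hfp⟩ := hf
  have hd : Differentiable ℂ (deriv f) := fun w => (hfd.analyticAt w).deriv.differentiableAt
  have hdeg : P.degree < Q.degree := (Polynomial.div_eq_zero_iff hQ).1 h0
  refine hfp (exists_polynomial_of_deriv hfd ?_)
  have hdeg' : (Polynomial.X * P).natDegree ≤ Q.natDegree := by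
    rcases eq_or_ne P 0 with rfl | hP
    · simp
    rw [Polynomial.natDegree_X_mul hP]
    have := Polynomial.natDegree_lt_natDegree hP hdeg
    omega
  obtain ⟨M, hM, hPM⟩ := Polynomial.exists_norm_eval_le _ hdeg'
  obtain ⟨R, hR, hQR⟩ := Polynomial.exists_norm_le_norm_eval hQ
  have hl : 0 < ‖Q.leadingCoeff‖ := by simpa using hQ
  have hR0 : 0 < R := by linarith
  set K : ℝ := 2 * M / ‖Q.leadingCoeff‖ with hK
  have hbound : ∀ z : ℂ, R ≤ ‖z‖ → ‖deriv (deriv f) z * z‖ ≤ K * ‖deriv f z‖ := by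
    intro z hz
    have h1 := hQR z hz
    have h2 := hPM z (hR.trans hz)
    have h3 : 0 < ‖z‖ ^ Q.natDegree := by have : 0 < ‖z‖ := by linarith
                                          positivity
    have h4 : 0 < ‖Q.eval z‖ := lt_of_lt_of_le (by positivity) h1
    have h5 : ‖deriv (deriv f) z * z‖ * ‖Q.eval z‖ = ‖deriv f z‖ * ‖(Polynomial.X * P).eval z‖ := by
      rw [← norm_mul, ← norm_mul, Polynomial.eval_mul, Polynomial.eval_X]
      congr 1
      linear_combination z * heq z
    refine le_of_mul_le_mul_right ?_ h4
    rw [h5]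
    calc ‖deriv f z‖ * ‖(Polynomial.X * P).eval z‖ ≤ ‖deriv f z‖ * (M * ‖z‖ ^ Q.natDegree) := by
          gcongr
      _ = K * ‖deriv f z‖ * (‖Q.leadingCoeff‖ / 2 * ‖z‖ ^ Q.natDegree) := by
          rw [hK]; field_simp
      _ ≤ _ := by gcongr
  obtain ⟨M', hM'⟩ := (isCompact_closedBall (0 : ℂ) R).exists_bound_of_continuousOn
    hd.continuous.continuousOn
  have hM'0 : 0 ≤ M' := (norm_nonneg _).trans (hM' 0 (by simp; linarith))
  obtain ⟨n, hn⟩ := exists_nat_ge K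
  have hn' : ∀ z, ‖deriv f z‖ ≤ M' * (1 + ‖z‖) ^ n := by
    intro z
    have hp : 1 ≤ (1 + ‖z‖) ^ n := one_le_pow₀ (by linarith [norm_nonneg z])
    rcases le_total ‖z‖ R with hz | hz
    · have := hM' z (by simpa using hz)
      nlinarith
    have hz0 : 0 < ‖z‖ := by linarith
    set u : ℂ := z * (R / ‖z‖ : ℝ) with hu
    have hnu : ‖u‖ = R := by
      rw [hu, norm_mul, norm_real, Real.norm_of_nonneg (by positivity)]
      field_simp
    have hlog : 0 ≤ Real.log (‖z‖ / R) := Real.log_nonneg ((one_le_div hR0).2 hz)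
    have hder : ∀ t ∈ Icc (0 : ℝ) (Real.log (‖z‖ / R)), HasDerivAt
        (fun t : ℝ => deriv f (Real.exp t * u))
        (deriv (deriv f) (Real.exp t * u) * (Real.exp t * u)) t := by
      intro t _
      have h2 : HasDerivAt (fun t : ℝ => ((Real.exp t : ℝ) * u : ℂ)) ((Real.exp t : ℝ) * u) t :=
        (Real.hasDerivAt_exp t).ofReal_comp.mul_const u
      exact (hd _).hasDerivAt.comp t h2
    have := norm_le_of_norm_deriv_le_mul hder (K := K) (fun t ht => hbound _ (by
      rw [norm_mul, norm_real, Real.norm_of_nonneg (Real.exp_pos _).le, hnu]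
      nlinarith [Real.add_one_le_exp t, ht.1])) _ ⟨hlog, le_rfl⟩
    simp only [Real.exp_zero, ofReal_one, one_mul] at this
    have he : (Real.exp (Real.log (‖z‖ / R)) : ℂ) * u = z := by
      rw [Real.exp_log (by positivity), hu]
      push_cast
      have h1 : (R : ℂ) ≠ 0 := by exact_mod_cast hR0.ne'
      have h2 : (‖z‖ : ℂ) ≠ 0 := by exact_mod_cast hz0.ne'
      field_simp
    rw [he] at this
    refine this.trans ?_
    gcongr
    · exact hM' u (by simp [hnu])
    · calc Real.exp (K * Real.log (‖z‖ / R)) ≤ Real.exp (n * Real.log (1 + ‖z‖)) := by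
            refine Real.exp_le_exp.2 ?_
            have : Real.log (‖z‖ / R) ≤ Real.log (1 + ‖z‖) := by
              refine Real.log_le_log (by positivity) ?_
              rw [div_le_iff₀ hR0]; nlinarith
            gcongr
        _ = (1 + ‖z‖) ^ n := by
            rw [mul_comm, Real.exp_mul, Real.exp_log (by positivity), Real.rpow_natCast]
  exact exists_polynomial_of_growth n hd hn'

end ODE

theorem Polynomial.exists_norm_eval_sub_le_mul {p : Polynomial ℂ} {n : ℕ} (hn : p.natDegree ≤ n)
    (hc : p.coeff n ≠ 0) {ε : ℝ} (hε : 0 < ε) :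
    ∃ R : ℝ, 1 ≤ R ∧ ∀ z : ℂ, R ≤ ‖z‖ →
      ‖p.eval z / (p.coeff n * z ^ n) - 1‖ ≤ ε := by
  obtain ⟨M, hM, h⟩ := Polynomial.exists_norm_eval_sub_le p hn
  have hl : 0 < ‖p.coeff n‖ := by simpa using hc
  refine ⟨max 1 (M / (ε * ‖p.coeff n‖)), le_max_left _ _, fun z hz => ?_⟩
  have h1 : 1 ≤ ‖z‖ := (le_max_left _ _).trans hz
  have h0 : 0 < ‖z‖ := by linarith
  have hz0 : z ≠ 0 := norm_pos_iff.1 h0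
  have h2 := (le_max_right _ _).trans hz
  rw [div_le_iff₀ (by positivity)] at h2
  have h3 := h z h1
  have hne : p.coeff n * z ^ n ≠ 0 := mul_ne_zero hc (pow_ne_zero _ hz0)
  rw [div_sub_one hne, norm_div, norm_mul, norm_pow, div_le_iff₀ (by positivity)]
  refine le_of_mul_le_mul_right (h3.trans ?_) h0
  have : 0 ≤ ‖z‖ ^ n := by positivity
  nlinarith

theorem exists_exp_coordinate (q : Polynomial ℂ) (hd : 0 < q.natDegree) (R₀ : ℝ) :
    ∃ (N : ℂ → ℂ) (ρ C : ℝ), 0 ≤ C ∧ InjOn N {τ | ρ < τ.re} ∧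
      (∀ τ : ℂ, ρ < τ.re → N (τ + 2 * π * I * q.natDegree) = N τ + 2 * π * I) ∧
      (∀ τ : ℂ, ρ < τ.re → ‖N τ - τ / q.natDegree‖ ≤ C) ∧
      (∃ R : ℝ, ∀ ω : ℂ, R ≤ ω.re → ∃ τ : ℂ, ρ < τ.re ∧ N τ = ω) ∧
      (∀ τ : ℂ, ρ < τ.re → R₀ ≤ ‖exp (N τ)‖ ∧ ∃ n : ℂ, HasDerivAt N n τ ∧
        n * (exp (N τ) * (Polynomial.derivative q).eval (exp (N τ))) = exp τ ∧
        ‖n‖ ≤ 2 ∧ ‖n⁻¹‖ ≤ 2 * q.natDegree) := by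
  set d := q.natDegree with hdd
  have hq0 : q ≠ 0 := by rintro rfl; simp [d] at hd
  set a := q.leadingCoeff with ha
  have ha0 : a ≠ 0 := Polynomial.leadingCoeff_ne_zero.2 hq0
  have hd0 : (d : ℂ) ≠ 0 := by exact_mod_cast hd.ne'
  have hd1 : (1 : ℝ) ≤ d := by exact_mod_cast hd
  set p : Polynomial ℂ := Polynomial.X * Polynomial.derivative q with hp
  have hpc : p.coeff d = d * a := by
    obtain ⟨m, hm⟩ : ∃ m, d = m + 1 := ⟨d - 1, by omega⟩
    rw [hp, hm, Polynomial.coeff_X_mul, Polynomial.coeff_derivative, ← hm]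
    have h1 : q.coeff d = a := rfl
    rw [h1, hm]
    push_cast
    ring
  have hpd : p.natDegree ≤ d := by
    refine Polynomial.natDegree_mul_le.trans ?_
    have := Polynomial.natDegree_derivative_le q
    have := Polynomial.natDegree_X_le (R := ℂ)
    omega
  obtain ⟨R1, hR1, h1⟩ := Polynomial.exists_norm_eval_sub_le_mul (p := q) le_rfl
    (show q.coeff q.natDegree ≠ 0 from ha0) (show (0 : ℝ) < 1 / 8 by norm_num)
  obtain ⟨R2, hR2, h2⟩ := Polynomial.exists_norm_eval_sub_le_mul hpd
    (by rw [hpc]; exact mul_ne_zero hd0 ha0) (show (0 : ℝ) < 1 / 8 by norm_num)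
  rw [hpc] at h2
  change ∀ z : ℂ, R1 ≤ ‖z‖ → ‖q.eval z / (a * z ^ d) - 1‖ ≤ 1 / 8 at h1
  obtain ⟨ρ₀, hρ₀⟩ : ∃ ρ₀ : ℝ, ∀ ω : ℂ, ρ₀ < ω.re →
      R1 ≤ ‖exp ω‖ ∧ R2 ≤ ‖exp ω‖ ∧ R₀ ≤ ‖exp ω‖ := by
    refine ⟨max (max R1 R2) R₀, fun ω hω => ?_⟩
    rw [norm_exp]
    have := Real.add_one_le_exp ω.re
    have h3 := max_lt_iff.1 hω
    have h4 := max_lt_iff.1 h3.1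
    refine ⟨?_, ?_, ?_⟩ <;> linarith [h3.2, h4.1, h4.2]
  set u : ℂ → ℂ := fun ω => q.eval (exp ω) / (a * exp ω ^ d) with hu
  set T : ℂ → ℂ := fun ω => ω + log (u ω) / d with hTdef
  set T' : ℂ → ℂ := fun ω => exp ω * (Polynomial.derivative q).eval (exp ω) /
    (d * q.eval (exp ω)) with hT'def
  have hu1 : ∀ ω : ℂ, ρ₀ < ω.re → ‖u ω - 1‖ ≤ 1 / 8 := fun ω hω => h1 _ (hρ₀ ω hω).1
  have hu0 : ∀ ω : ℂ, ρ₀ < ω.re → u ω ≠ 0 := by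
    intro ω hω h0
    have := hu1 ω hω
    rw [h0] at this; norm_num at this
  have hqne : ∀ ω : ℂ, ρ₀ < ω.re → q.eval (exp ω) ≠ 0 := by
    intro ω hω h0
    exact hu0 ω hω (by simp [hu, h0])
  have hden : ∀ ω : ℂ, a * exp ω ^ d ≠ 0 := fun ω =>
    mul_ne_zero ha0 (pow_ne_zero _ (exp_ne_zero _))
  have hder : ∀ ω : ℂ, ρ₀ < ω.re → HasDerivAt T (T' ω) ω := by
    intro ω hω
    have e1 : HasDerivAt (fun ω => q.eval (exp ω))
        ((Polynomial.derivative q).eval (exp ω) * exp ω) ω :=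
      HasDerivAt.comp ω (h₂ := fun z => q.eval z) (q.hasDerivAt _) (hasDerivAt_exp ω)
    have e2 : HasDerivAt (fun ω => a * exp ω ^ d) (a * (d * exp ω ^ (d - 1) * exp ω)) ω :=
      ((hasDerivAt_exp ω).pow d).const_mul a
    have hslit : u ω ∈ slitPlane := by
      have h3 : ‖u ω - 1‖ < 1 := by linarith [hu1 ω hω]
      simpa using mem_slitPlane_of_norm_lt_one h3
    have e3 : HasDerivAt (fun ω => log (u ω)) _ ω := (e1.div e2 (hden ω)).clog hslit
    refine ((hasDerivAt_id ω).add (e3.div_const (d : ℂ))).congr_deriv ?_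
    have hpow : exp ω ^ (d - 1) * exp ω = exp ω ^ d := by
      rw [← pow_succ]; congr 1; omega
    have h5 := exp_ne_zero ω
    have h6 := hqne ω hω
    rw [mul_assoc (d : ℂ), hpow]
    simp only [hT'def]
    have h7 := pow_ne_zero d h5
    rw [show ((fun ω => q.eval (exp ω)) / fun ω => a * exp ω ^ d) ω
      = q.eval (exp ω) / (a * exp ω ^ d) from rfl]
    field_simp
    ring
  have hT'1 : ∀ ω : ℂ, ρ₀ < ω.re → ‖T' ω - 1‖ ≤ 1 / 2 := by
    intro ω hω
    have e1 := hu1 ω hω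
    have e2 := h2 _ (hρ₀ ω hω).2.1
    set w := p.eval (exp ω) / (d * a * exp ω ^ d) with hw
    have e3 : T' ω = w / u ω := by
      have h5 := exp_ne_zero ω
      have h6 := hqne ω hω
      simp only [hT'def, hw, hu, hp, Polynomial.eval_mul, Polynomial.eval_X]
      field_simp
    have e4 : 7 / 8 ≤ ‖u ω‖ := by
      have := norm_sub_norm_le 1 (1 - u ω)
      rw [norm_sub_rev 1, sub_sub_cancel, norm_one] at this
      linarith
    have e5 : ‖w - u ω‖ ≤ 1 / 4 := by
      have := norm_sub_le (w - 1) (u ω - 1)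
      rw [sub_sub_sub_cancel_right] at this
      linarith
    rw [e3, div_sub_one (hu0 ω hω), norm_div, div_le_iff₀ (by linarith)]
    linarith
  have hclose : ∀ ω : ℂ, ρ₀ < ω.re → ‖T ω - ω‖ ≤ 1 := by
    intro ω hω
    have e1 := hu1 ω hω
    have e2 := norm_log_one_add_half_le_self (z := u ω - 1) (by linarith)
    rw [add_sub_cancel] at e2
    simp only [hTdef, add_sub_cancel_left, norm_div, Complex.norm_natCast]
    rw [div_le_one (by linarith)]
    linarith
  have hexpT : ∀ ω : ℂ, ρ₀ < ω.re → a * exp (d * T ω) = q.eval (exp ω) := by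
    intro ω hω
    have : (d : ℂ) * T ω = d * ω + log (u ω) := by
      simp only [hTdef]; field_simp
    rw [this, exp_add, exp_log (hu0 ω hω), exp_nat_mul]
    simp only [hu]
    have := exp_ne_zero ω
    field_simp
  have hball : ∀ s : ℂ, ρ₀ + 1 < s.re → closedBall s 1 ⊆ {ω : ℂ | ρ₀ < ω.re} := by
    intro s hs w hw
    rw [mem_closedBall, dist_comm, dist_eq_norm] at hw
    have := re_le_norm (s - w)
    rw [sub_re] at this
    show ρ₀ < w.re
    linarith
  obtain ⟨hTinj, S, hS⟩ := exists_inverse_of_near_id (U := {ω : ℂ | ρ₀ < ω.re})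
    (V := {ω : ℂ | ρ₀ + 1 < ω.re}) (convex_halfSpace_re_gt _) (isOpen_reGt _) hder hT'1
    zero_le_one hclose hball
  have hre : ∀ τ : ℂ, ((τ - log a) / d).re = (τ.re - (log a).re) / d := by
    intro τ
    rw [← sub_re, div_natCast_re]
  have hV : ∀ τ : ℂ, d * (ρ₀ + 1) + (log a).re < τ.re → ρ₀ + 1 < ((τ - log a) / d).re := by
    intro τ hτ
    rw [hre, lt_div_iff₀ (by linarith)]
    linarith
  have hqN : ∀ τ : ℂ, d * (ρ₀ + 1) + (log a).re < τ.re →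
      q.eval (exp (S ((τ - log a) / d))) = exp τ := by
    intro τ hτ
    obtain ⟨s1, -, s2, -⟩ := hS _ (hV τ hτ)
    rw [← hexpT _ s1, s2, mul_div_cancel₀ _ hd0, exp_sub, exp_log ha0]
    field_simp
  refine ⟨fun τ => S ((τ - log a) / d), d * (ρ₀ + 1) + (log a).re, 1 + ‖log a‖, by positivity,
    ?_, ?_, ?_, ?_, ?_⟩
  · intro τ hτ τ' hτ' h
    have e1 := (hS _ (hV τ hτ)).2.2.1
    have e2 := (hS _ (hV τ' hτ')).2.2.1
    have h' : S ((τ - log a) / d) = S ((τ' - log a) / d) := h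
    rw [h', e2] at e1
    have := (div_left_inj' hd0).1 e1
    linear_combination -this
  · intro τ hτ
    have hper : ∀ ω : ℂ, T (ω + 2 * π * I) = T ω + 2 * π * I := by
      intro ω
      simp only [hTdef, hu, exp_periodic ω]
      ring
    have hτ' : d * (ρ₀ + 1) + (log a).re < (τ + 2 * π * I * d).re := by simpa using hτ
    obtain ⟨s1, -, s2, -⟩ := hS _ (hV _ hτ')
    obtain ⟨t1, -, t2, -⟩ := hS _ (hV _ hτ)
    refine hTinj s1 (by simpa using t1) ?_
    rw [s2, hper, t2]
    field_simp
    ring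
  · intro τ hτ
    have e1 := (hS _ (hV τ hτ)).2.1
    have e2 : S ((τ - log a) / d) - τ / d
        = (S ((τ - log a) / d) - (τ - log a) / d) - log a / d := by
      field_simp; ring
    rw [e2]
    refine (norm_sub_le _ _).trans (add_le_add e1 ?_)
    rw [norm_div, Complex.norm_natCast]
    exact div_le_self (norm_nonneg _) hd1
  · refine ⟨ρ₀ + 3, fun ω hω => ⟨d * T ω + log a, ?_, ?_⟩⟩
    · have e1 := hclose ω (by linarith)
      have e2 := re_le_norm (ω - T ω)
      rw [norm_sub_rev, sub_re] at e2
      rw [add_re, show ((d : ℂ) * T ω).re = d * (T ω).re by simp]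
      nlinarith
    · have e1 := hclose ω (by linarith)
      have e2 := re_le_norm (ω - T ω)
      rw [norm_sub_rev, sub_re] at e2
      have e3 : (d * T ω + log a - log a) / d = T ω := by field_simp; ring
      show S ((d * T ω + log a - log a) / d) = ω
      rw [e3]
      obtain ⟨s1, -, s2, -⟩ := hS (T ω) (show ρ₀ + 1 < (T ω).re by linarith)
      exact hTinj s1 (show ρ₀ < ω.re by linarith) s2
  · intro τ hτ
    obtain ⟨s1, -, s2, s3⟩ := hS _ (hV τ hτ)
    refine ⟨(hρ₀ _ s1).2.2, (T' (S ((τ - log a) / d)))⁻¹ * (1 / d), ?_, ?_, ?_, ?_⟩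
    · have e1 : HasDerivAt (fun τ : ℂ => (τ - log a) / d) (1 / d) τ :=
        ((hasDerivAt_id τ).sub_const _).div_const _
      exact HasDerivAt.comp τ (h₂ := S) s3 e1
    · have e1 := hT'1 _ s1
      have e2 : T' (S ((τ - log a) / d)) ≠ 0 := by
        intro h0; rw [h0] at e1; norm_num at e1
      simp only [hT'def, hqN τ hτ] at e2 ⊢
      have e3 := (div_ne_zero_iff.1 e2).1
      have e4 := exp_ne_zero τ
      have e5 := left_ne_zero_of_mul e3
      have e6 := right_ne_zero_of_mul e3
      field_simp
    all_goals
      have e1 := hT'1 _ s1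
      have e2 : 1 / 2 ≤ ‖T' (S ((τ - log a) / d))‖ := by
        have := norm_sub_norm_le 1 (1 - T' (S ((τ - log a) / d)))
        rw [norm_sub_rev 1, sub_sub_cancel, norm_one] at this
        linarith
      have e3 : ‖T' (S ((τ - log a) / d))‖ ≤ 2 := by
        have := norm_add_le 1 (T' (S ((τ - log a) / d)) - 1)
        rw [add_sub_cancel, norm_one] at this
        linarith
    · rw [norm_mul, norm_inv, one_div, norm_inv (d : ℂ), Complex.norm_natCast, ← one_div (d : ℝ)]
      have e4 : ‖T' (S ((τ - log a) / d))‖⁻¹ ≤ 2 := by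
        rw [inv_le_comm₀ (by linarith) (by norm_num)]; linarith
      have e5 : 1 / (d : ℝ) ≤ 1 := by rw [div_le_one (by linarith)]; exact hd1
      have e6 : 0 ≤ 1 / (d : ℝ) := by positivity
      have e7 : 0 ≤ ‖T' (S ((τ - log a) / d))‖⁻¹ := by positivity
      nlinarith
    · rw [mul_inv, inv_inv, norm_mul, one_div, inv_inv, Complex.norm_natCast]
      gcongr

theorem exists_normalForm {f : ℂ → ℂ} {P Q : Polynomial ℂ} (hf : TranscendentalEntire f)
    (hQ : Q ≠ 0) (heq : ∀ z : ℂ, deriv (deriv f) z * Q.eval z = deriv f z * P.eval z) :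
    ∃ d, Nonempty (NormalForm f d) := by
  have hfd := hf.1
  have hd1 : Differentiable ℂ (deriv f) := fun w => (hfd.analyticAt w).deriv.differentiableAt
  obtain ⟨q, hq⟩ := (P / Q).exists_derivative_eq
  have hdq : 0 < q.natDegree := by
    rw [Nat.pos_iff_ne_zero]
    intro h0
    have := div_ne_zero_of_ode hf hQ heq
    rw [← hq, Polynomial.eq_C_of_natDegree_eq_zero h0] at this
    simp at this
  have hdeg' : (Polynomial.X * (P % Q)).natDegree ≤ Q.natDegree := by
    rcases eq_or_ne (P % Q) 0 with h | hP
    · simp [h]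
    rw [Polynomial.natDegree_X_mul hP]
    have := Polynomial.natDegree_lt_natDegree hP (EuclideanDomain.mod_lt P hQ)
    omega
  obtain ⟨M, hM, hPM⟩ := Polynomial.exists_norm_eval_le _ hdeg'
  obtain ⟨R, hR, hQR⟩ := Polynomial.exists_norm_le_norm_eval hQ
  have hl : 0 < ‖Q.leadingCoeff‖ := by simpa using hQ
  set K : ℝ := 2 * M / ‖Q.leadingCoeff‖ with hK
  have hK0 : 0 ≤ K := by positivity
  have hQne : ∀ z : ℂ, R ≤ ‖z‖ → Q.eval z ≠ 0 := by
    intro z hz h0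
    have h1 := hQR z hz
    have : 0 < ‖z‖ := by linarith
    have h2 : 0 < ‖Q.leadingCoeff‖ / 2 * ‖z‖ ^ Q.natDegree := by positivity
    rw [h0, norm_zero] at h1
    linarith
  have hrem : ∀ z : ℂ, R ≤ ‖z‖ → ‖z * (P % Q).eval z / Q.eval z‖ ≤ K := by
    intro z hz
    have h1 := hQR z hz
    have h2 := hPM z (hR.trans hz)
    rw [norm_div, div_le_iff₀ (norm_pos_iff.2 (hQne z hz))]
    simp only [Polynomial.eval_mul, Polynomial.eval_X] at h2
    calc _ ≤ M * ‖z‖ ^ Q.natDegree := h2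
      _ = K * (‖Q.leadingCoeff‖ / 2 * ‖z‖ ^ Q.natDegree) := by rw [hK]; field_simp
      _ ≤ _ := by gcongr
  obtain ⟨N, ρ, C, hC, hinj, hper, hclose, ⟨R', hcover⟩, hN⟩ := exists_exp_coordinate q hdq R
  set d := q.natDegree with hd
  have hder : ∀ τ : ℂ, ρ < τ.re → HasDerivAt N (deriv N τ) τ ∧
      deriv N τ * (exp (N τ) * (P / Q).eval (exp (N τ))) = exp τ ∧
      ‖deriv N τ‖ ≤ 2 ∧ ‖(deriv N τ)⁻¹‖ ≤ 2 * d := by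
    intro τ hτ
    obtain ⟨-, n, h1, h2⟩ := hN τ hτ
    rw [hq] at h2
    rw [h1.deriv]
    exact ⟨h1, h2⟩
  have hNR : ∀ τ : ℂ, ρ < τ.re → R ≤ ‖exp (N τ)‖ := fun τ hτ => (hN τ hτ).1
  have hNd : DifferentiableOn ℂ N {τ | ρ < τ.re} := fun τ hτ =>
    (hder τ hτ).1.differentiableAt.differentiableWithinAt
  have hn0 : ∀ τ : ℂ, ρ < τ.re → deriv N τ ≠ 0 := by
    intro τ hτ h0
    have := (hder τ hτ).2.1
    rw [h0, zero_mul] at this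
    exact exp_ne_zero τ this.symm
  have hn' : DifferentiableOn ℂ (deriv N) {τ | ρ < τ.re} := hNd.deriv (isOpen_reGt ρ)
  have hn'' : ∀ τ : ℂ, ρ + 1 < τ.re → ‖deriv (deriv N) τ‖ ≤ 2 := by
    intro τ hτ
    have hsub : closedBall τ 1 ⊆ {τ : ℂ | ρ < τ.re} := by
      intro w hw
      rw [mem_closedBall, dist_comm, dist_eq_norm] at hw
      have := re_le_norm (τ - w)
      rw [sub_re] at this
      show ρ < w.re
      linarith
    have := norm_deriv_le_of_forall_mem_sphere_norm_le (f := deriv N) (c := τ) (R := 1) (C := 2)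
      one_pos (hn'.diffContOnCl_ball hsub)
      (fun z hz => (hder z (hsub (sphere_subset_closedBall hz))).2.2.1)
    simpa using this
  set W : ℂ → ℂ := fun τ => deriv f (exp (N τ)) * exp (N τ) * deriv N τ with hW
  have hf0 : ∀ τ : ℂ, ρ < τ.re → deriv f (exp (N τ)) ≠ 0 := fun τ hτ =>
    deriv_ne_zero_of_ode hf heq (hQne _ (hNR τ hτ))
  have hWd : ∀ τ ∈ {τ : ℂ | ρ < τ.re}, HasDerivAt W
      ((deriv (deriv f) (exp (N τ)) * (exp (N τ) * deriv N τ) * exp (N τ) +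
        deriv f (exp (N τ)) * (exp (N τ) * deriv N τ)) * deriv N τ +
        deriv f (exp (N τ)) * exp (N τ) * deriv (deriv N) τ) τ := by
    intro τ hτ
    have e1 := (hder τ hτ).1.cexp
    have e2 : HasDerivAt (fun τ => deriv f (exp (N τ)))
        (deriv (deriv f) (exp (N τ)) * (exp (N τ) * deriv N τ)) τ :=
      HasDerivAt.comp τ (h₂ := deriv f) (hd1 _).hasDerivAt e1
    exact (e2.mul e1).mul (hn'.differentiableAt ((isOpen_reGt ρ).mem_nhds hτ)).hasDerivAt
  have hW0 : ∀ τ ∈ {τ : ℂ | ρ < τ.re}, W τ ≠ 0 := fun τ hτ =>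
    mul_ne_zero (mul_ne_zero (hf0 τ hτ) (exp_ne_zero _)) (hn0 τ hτ)
  obtain ⟨l, hl⟩ := exists_holomorphic_log (isOpen_reGt ρ) (convex_halfSpace_re_gt ρ) hWd hW0
  have hld : ∀ τ : ℂ, ρ < τ.re → HasDerivAt (fun τ => l τ - exp τ)
      (exp (N τ) * (P % Q).eval (exp (N τ)) / Q.eval (exp (N τ)) * deriv N τ + deriv N τ
        + deriv (deriv N) τ * (deriv N τ)⁻¹) τ := by
    intro τ hτ
    refine ((hl τ hτ).2.sub (hasDerivAt_exp τ)).congr_deriv ?_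
    have e1 := hf0 τ hτ
    have e2 := exp_ne_zero (N τ)
    have e3 := hn0 τ hτ
    have e4 := hQne _ (hNR τ hτ)
    have e5 := heq (exp (N τ))
    have e6 := (hder τ hτ).2.1
    have e7 : P.eval (exp (N τ)) = Q.eval (exp (N τ)) * (P / Q).eval (exp (N τ))
        + (P % Q).eval (exp (N τ)) := by
      rw [← Polynomial.eval_mul, ← Polynomial.eval_add, EuclideanDomain.div_add_mod]
    have e8 : deriv (deriv f) (exp (N τ)) = deriv f (exp (N τ)) *
        ((P / Q).eval (exp (N τ)) + (P % Q).eval (exp (N τ)) / Q.eval (exp (N τ))) := by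
      rw [eq_div_of_mul_eq e4 e5, e7]
      field_simp
    rw [e8, ← e6]
    simp only [hW]
    field_simp
    ring
  have hexpN : ∀ τ : ℂ, ρ < τ.re → exp (N (τ + 2 * π * I * d)) = exp (N τ) := fun τ hτ => by
    rw [hper τ hτ, exp_periodic]
  have hexpτ : ∀ τ : ℂ, exp (τ + 2 * π * I * d) = exp τ := fun τ => by
    rw [exp_add, mul_comm (2 * π * I : ℂ), exp_nat_mul_two_pi_mul_I, mul_one]
  have hshift : ∀ τ : ℂ, (τ + 2 * π * I * d).re = τ.re := fun τ => by simp
  have hWper : ∀ τ : ℂ, ρ < τ.re → W (τ + 2 * π * I * d) = W τ := by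
    intro τ hτ
    have : deriv N (τ + 2 * π * I * d) = deriv N τ := by
      have e1 := (hder (τ + 2 * π * I * d) (by rwa [hshift])).1
      have e2 := e1.comp_add_const τ (2 * π * I * d)
      have e3 : (fun x => N (x + 2 * π * I * d)) =ᶠ[𝓝 τ] fun x => N x + 2 * π * I := by
        filter_upwards [(isOpen_reGt ρ).mem_nhds hτ] with x hx using hper x hx
      have e4 := e2.congr_of_eventuallyEq e3.symm
      exact e4.unique ((hder τ hτ).1.add_const _)
    simp only [hW, hexpN τ hτ, this]
  obtain ⟨k, hk⟩ := exists_int_of_exp_eq_one (s := {τ : ℂ | ρ < τ.re})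
    (D := fun τ => l (τ + 2 * π * I * d) - l τ)
    (convex_halfSpace_re_gt ρ).isPreconnected
    (by
      have hlc : ContinuousOn l {τ | ρ < τ.re} := fun τ hτ =>
        (hl τ hτ).2.continuousAt.continuousWithinAt
      refine ContinuousOn.sub (hlc.comp (by fun_prop) fun τ hτ => ?_) hlc
      show ρ < _
      rwa [hshift])
    (by
      intro τ hτ
      rw [exp_sub, (hl τ hτ).1, (hl _ (show ρ < _ by rwa [hshift])).1, hWper τ hτ,
        div_self (hW0 τ hτ)])
  have hd1' : (1 : ℝ) ≤ d := by exact_mod_cast hdq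
  have hmono : ∀ τ : ℂ, ρ + 1 < τ.re → ρ < τ.re := fun τ hτ => by linarith
  refine ⟨d, ⟨⟨N, fun τ => l τ - exp τ, ρ + 1, C + (K * 2 + 2 + 2 * (2 * d)), k, hdq,
    by positivity, hNd.continuousOn.mono hmono, hinj.mono hmono,
    fun τ hτ => hper τ (hmono τ hτ), fun τ hτ => (hclose τ (hmono τ hτ)).trans (by
      have : 0 ≤ K * 2 + 2 + 2 * (2 * d) := by positivity
      linarith), ?_,
    fun τ hτ => (hld τ (hmono τ hτ)).differentiableAt.differentiableWithinAt, ?_, ?_, ?_⟩⟩⟩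
  · refine ⟨max R' (|ρ + 1| + 1 + C), fun ω hω => ?_⟩
    obtain ⟨τ, h1, rfl⟩ := hcover ω ((le_max_left _ _).trans hω)
    refine ⟨τ, ?_, rfl⟩
    have h2 := (le_max_right _ _).trans hω
    have h3 := hclose τ h1
    have h4 := re_le_norm (N τ - τ / d)
    rw [sub_re, div_natCast_re] at h4
    have h5 : |ρ + 1| + 1 ≤ τ.re / d := by linarith
    rw [le_div_iff₀ (by linarith)] at h5
    nlinarith [le_abs_self (ρ + 1), abs_nonneg (ρ + 1)]
  · intro τ hτ
    have h1 := hmono τ hτ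
    rw [(hld τ h1).deriv]
    have e1 := hrem _ (hNR τ h1)
    obtain ⟨-, -, e2, e3⟩ := hder τ h1
    have e4 := hn'' τ hτ
    refine (norm_add₃_le).trans ?_
    rw [norm_mul, norm_mul]
    have e5 : ‖exp (N τ) * (P % Q).eval (exp (N τ)) / Q.eval (exp (N τ))‖ * ‖deriv N τ‖ ≤ K * 2 := by
      gcongr
    have e6 : ‖deriv (deriv N) τ‖ * ‖(deriv N τ)⁻¹‖ ≤ 2 * (2 * d) := by gcongr
    linarith
  · intro τ hτ
    have := hk τ (hmono τ hτ)
    simp only [hexpτ]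
    linear_combination this
  · intro τ hτ
    have h1 := hmono τ hτ
    rw [sub_add_cancel, (hl τ h1).1]
    simp only [hW]
    rw [mul_assoc]
    exact HasDerivAt.comp τ (h₂ := f) (hfd _).hasDerivAt (hder τ h1).1.cexp

noncomputable def NormalForm.conj {f : ℂ → ℂ} {d : ℕ} (F : NormalForm f d) :
    NormalForm (fun z => (starRingEnd ℂ) (f ((starRingEnd ℂ) z))) d where
  N τ := (starRingEnd ℂ) (F.N ((starRingEnd ℂ) τ))
  l τ := (starRingEnd ℂ) (F.l ((starRingEnd ℂ) τ))
  ρ := F.ρ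
  C := F.C
  k := F.k
  d_pos := F.d_pos
  C_nonneg := F.C_nonneg
  N_cont := continuous_conj.comp_continuousOn
    (F.N_cont.comp continuous_conj.continuousOn fun τ hτ => by simpa using hτ)
  N_inj τ hτ τ' hτ' h := by
    have := F.N_inj (x₁ := (starRingEnd ℂ) τ) (x₂ := (starRingEnd ℂ) τ')
      (by simpa using hτ) (by simpa using hτ') ((starRingEnd ℂ).injective h)
    exact (starRingEnd ℂ).injective this
  N_period τ hτ := by
    have h := F.N_period ((starRingEnd ℂ) (τ + 2 * π * I * d)) (by simpa using hτ)
    have h1 : (starRingEnd ℂ) (τ + 2 * π * I * d) + 2 * π * I * d = (starRingEnd ℂ) τ := by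
      simp [Complex.conj_ofNat]
    rw [h1] at h
    rw [h]
    simp [Complex.conj_ofNat]
  N_close τ hτ := by
    have := F.N_close ((starRingEnd ℂ) τ) (by simpa using hτ)
    rw [← norm_conj] at this
    simpa using this
  N_cover := by
    obtain ⟨R, hR⟩ := F.N_cover
    refine ⟨R, fun ω hω => ?_⟩
    obtain ⟨τ, h1, h2⟩ := hR ((starRingEnd ℂ) ω) (by simpa using hω)
    exact ⟨(starRingEnd ℂ) τ, by simpa using h1, by simp [h2]⟩
  l_diff τ hτ := by
    have h1 : F.ρ < ((starRingEnd ℂ) τ).re := by simpa using hτ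
    have := (F.l_diff.differentiableAt ((isOpen_reGt F.ρ).mem_nhds h1)).hasDerivAt.conj_conj
    rw [conj_conj] at this
    exact this.differentiableAt.differentiableWithinAt
  l_deriv τ hτ := by
    have h1 : F.ρ < ((starRingEnd ℂ) τ).re := by simpa using hτ
    have := (F.l_diff.differentiableAt ((isOpen_reGt F.ρ).mem_nhds h1)).hasDerivAt.conj_conj
    rw [conj_conj] at this
    have h2 := this.deriv
    have h3 := F.l_deriv _ h1
    rw [← norm_conj, ← h2] at h3
    exact h3
  l_period τ hτ := by
    have h := F.l_period ((starRingEnd ℂ) (τ + 2 * π * I * d)) (by simpa using hτ)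
    have h1 : (starRingEnd ℂ) (τ + 2 * π * I * d) + 2 * π * I * d = (starRingEnd ℂ) τ := by
      simp [Complex.conj_ofNat]
    rw [h1] at h
    rw [h]
    simp [Complex.conj_ofNat]
  hasDerivAt τ hτ := by
    have h1 : F.ρ < ((starRingEnd ℂ) τ).re := by simpa using hτ
    have := (F.hasDerivAt _ h1).conj_conj
    rw [conj_conj] at this
    have e1 : (starRingEnd ℂ) (exp (F.l ((starRingEnd ℂ) τ) + exp ((starRingEnd ℂ) τ)))
        = exp ((starRingEnd ℂ) (F.l ((starRingEnd ℂ) τ)) + exp τ) := by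
      rw [← exp_conj, map_add, ← exp_conj, Complex.conj_conj]
    rw [e1] at this
    refine this.congr_of_eventuallyEq (Eventually.of_forall fun x => ?_)
    simp [exp_conj]

section Ray

variable {c : ℝ} {w : ℂ}

theorem mul_norm_le_norm_add (hc1 : c < 1) (hc0 : 0 ≤ c) (hw : -c * ‖w‖ ≤ w.re) {s : ℝ}
    (hs : 0 ≤ s) : (1 - c) * ‖w‖ ≤ ‖w + s‖ := by
  refine abs_le_of_sq_le_sq' ?_ (norm_nonneg _) |>.2
  have e1 : ‖w + s‖ ^ 2 = ‖w‖ ^ 2 + 2 * s * w.re + s ^ 2 := by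
    rw [← normSq_eq_norm_sq, ← normSq_eq_norm_sq, normSq_apply, normSq_apply]
    simp
    ring
  rw [e1]
  have h2 : 2 * s * (-c * ‖w‖) ≤ 2 * s * w.re := by gcongr
  nlinarith [sq_nonneg (s - c * ‖w‖), norm_nonneg w, mul_nonneg hc0 (sq_nonneg ‖w‖),
    mul_nonneg (mul_nonneg hc0 (sub_nonneg.2 hc1.le)) (sq_nonneg ‖w‖)]

theorem neg_mul_norm_le_re_add (hc1 : c < 1) (hc0 : 0 ≤ c) (hw : -c * ‖w‖ ≤ w.re) {s : ℝ}
    (hs : 0 ≤ s) : -c * ‖w + s‖ ≤ (w + s).re := by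
  have e1 : ‖w + s‖ ^ 2 = ‖w‖ ^ 2 + 2 * s * w.re + s ^ 2 := by
    rw [← normSq_eq_norm_sq, ← normSq_eq_norm_sq, normSq_apply, normSq_apply]
    simp
    ring
  have e2 : (w + s).re = w.re + s := by simp
  rw [e2]
  rcases le_or_gt 0 (w.re + s) with h | h
  · have := mul_nonneg hc0 (norm_nonneg (w + s))
    linarith
  · have h3 : (w.re + s) ^ 2 ≤ (c * ‖w + s‖) ^ 2 := by
      have h4 : w.re ^ 2 ≤ (c * ‖w‖) ^ 2 := by
        have : 0 ≤ -w.re := by linarith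
        nlinarith [norm_nonneg w]
      rw [mul_pow, e1]
      rw [mul_pow] at h4
      have h5 : 2 * s * w.re + s ^ 2 ≤ 0 := by nlinarith
      have h6 : c ^ 2 ≤ 1 := by nlinarith
      nlinarith
    have := abs_le_of_sq_le_sq' h3 (by positivity)
    linarith [this.1]

theorem mem_slitPlane_of_re (hc1 : c < 1) (hw : -c * ‖w‖ ≤ w.re) (h0 : w ≠ 0) :
    w ∈ slitPlane := by
  rw [mem_slitPlane_iff]
  by_contra! h
  have h1 : w = (w.re : ℂ) := by
    apply Complex.ext <;> simp [h.2]
  have h2 : ‖w‖ = -w.re := by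
    rw [h1, norm_real, Real.norm_eq_abs, abs_of_nonpos (by simpa using h.1)]; simp
  have h3 : 0 < ‖w‖ := norm_pos_iff.2 h0
  nlinarith

/-- Asymptotics of a primitive of `exp (l w - κ * w) / w` along rays parallel to the real axis. -/
theorem exists_asymptotic_of_hasDerivAt {F l l' : ℂ → ℂ} {κ : ℂ} {R C : ℝ} (hκ : 0 < κ.re)
    (hC : 0 ≤ C) (hc0 : 0 ≤ c) (hc1 : c < 1) (hR : 0 ≤ R)
    (hF : ∀ w ∈ slitPlane, R < ‖w‖ → HasDerivAt F (exp (l w - κ * w) / w) w)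
    (hl : ∀ w ∈ slitPlane, R < ‖w‖ → HasDerivAt l (l' w) w ∧ ‖l' w‖ ≤ C / ‖w‖) :
    ∃ (a : ℂ) (C' R' : ℝ), 0 ≤ C' ∧ ∀ w : ℂ, R' ≤ ‖w‖ → -c * ‖w‖ ≤ w.re →
      ‖F w - a + κ⁻¹ * (exp (l w - κ * w) / w)‖ ≤ C' / ‖w‖ * ‖exp (l w - κ * w) / w‖ := by
  have hκ0 : κ ≠ 0 := by rintro rfl; simp at hκ
  have hm : 0 < 1 - c := by linarith
  set G : ℂ → ℂ := fun w => exp (l w - κ * w) / w with hG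
  set E : ℂ → ℂ := fun w => F w + κ⁻¹ * G w with hE
  set R₁ : ℝ := (R + 1 + 2 * (C + 1) / κ.re) / (1 - c) with hR₁
  set R₂ : ℝ := R₁ / (1 - c) with hR₂
  have hR₁' : R + 1 + 2 * (C + 1) / κ.re ≤ R₁ := by
    rw [hR₁, le_div_iff₀ hm]
    have : 0 ≤ R + 1 + 2 * (C + 1) / κ.re := by positivity
    nlinarith
  have hR₁0 : 0 < R₁ := lt_of_lt_of_le (by positivity) hR₁'
  have hR₂' : R₁ ≤ R₂ := by rw [hR₂, le_div_iff₀ hm]; nlinarith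
  -- basic facts on the sector
  have hbig : ∀ w : ℂ, R + 1 + 2 * (C + 1) / κ.re ≤ ‖w‖ → R < ‖w‖ ∧ w ≠ 0 ∧
      (C + 1) / ‖w‖ ≤ κ.re / 2 := by
    intro w hw
    have h1 : 0 < 2 * (C + 1) / κ.re := by positivity
    have h2 : 0 < ‖w‖ := by linarith
    refine ⟨by linarith, norm_pos_iff.1 h2, ?_⟩
    rw [div_le_iff₀ h2]
    have h3 : 2 * (C + 1) / κ.re ≤ ‖w‖ := by linarith
    rw [div_le_iff₀ hκ] at h3
    linarith
  have hlog : ∀ w ∈ slitPlane, R < ‖w‖ → HasDerivAt (fun w => l w - κ * w - log w)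
      (l' w - κ - w⁻¹) w := by
    intro w hw hRw
    refine (((hl w hw hRw).1.sub ((hasDerivAt_id w).const_mul κ)).sub
      (hasDerivAt_log hw)).congr_deriv ?_
    simp
  have hGexp : ∀ w : ℂ, w ≠ 0 → G w = exp (l w - κ * w - log w) := by
    intro w hw
    rw [exp_sub _ (log w), exp_log hw]
  have hGd : ∀ w ∈ slitPlane, R < ‖w‖ → HasDerivAt G (G w * (l' w - κ - w⁻¹)) w := by
    intro w hw hRw
    have h0 := slitPlane_ne_zero hw
    rw [hGexp w h0]
    refine (hlog w hw hRw).cexp.congr_of_eventuallyEq ?_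
    filter_upwards [isOpen_ne.mem_nhds h0] with z hz using hGexp z hz
  have hEd : ∀ w ∈ slitPlane, R < ‖w‖ → HasDerivAt E (κ⁻¹ * (G w * (l' w - w⁻¹))) w := by
    intro w hw hRw
    refine ((hF w hw hRw).add ((hGd w hw hRw).const_mul κ⁻¹)).congr_deriv ?_
    change G w + _ = _
    field_simp
    ring
  have hlw : ∀ w ∈ slitPlane, R < ‖w‖ → ‖l' w - w⁻¹‖ ≤ (C + 1) / ‖w‖ := by
    intro w hw hRw
    have h1 := (hl w hw hRw).2
    have h2 := norm_sub_le (l' w) w⁻¹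
    rw [norm_inv] at h2
    rw [add_div, one_div]
    linarith
  have hreg : ∀ w : ℂ, R₁ ≤ ‖w‖ → -c * ‖w‖ ≤ w.re → ∀ s : ℝ, 0 ≤ s →
      (1 - c) * ‖w‖ ≤ ‖w + s‖ ∧ w + s ∈ slitPlane ∧ R < ‖w + s‖ ∧
        (C + 1) / ‖w + s‖ ≤ κ.re / 2 := by
    intro w hw hcw s hs
    have h1 := mul_norm_le_norm_add hc1 hc0 hcw hs
    have h2 : R + 1 + 2 * (C + 1) / κ.re ≤ ‖w + s‖ := by
      refine le_trans ?_ h1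
      rw [hR₁, div_le_iff₀ hm] at hw
      linarith
    obtain ⟨h3, h4, h5⟩ := hbig _ h2
    exact ⟨h1, mem_slitPlane_of_re hc1 (neg_mul_norm_le_re_add hc1 hc0 hcw hs) h4, h3, h5⟩
  have hline : ∀ (w : ℂ) (s : ℝ), HasDerivAt (fun s : ℝ => w + (s : ℂ)) 1 s := fun w s =>
    (ofRealCLM.hasDerivAt (x := s)).const_add w
  have hGdecay : ∀ w : ℂ, R₁ ≤ ‖w‖ → -c * ‖w‖ ≤ w.re → ∀ s : ℝ, 0 ≤ s →
      ‖G (w + s)‖ ≤ ‖G w‖ * Real.exp (-(κ.re / 2) * s) := by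
    intro w hw hcw s hs
    have hd : ∀ t : ℝ, 0 ≤ t → HasDerivAt
        (fun t : ℝ => (l (w + t) - κ * (w + t) - log (w + t)).re)
        (l' (w + t) - κ - (w + t)⁻¹).re t := by
      intro t ht
      obtain ⟨-, h1, h2, -⟩ := hreg w hw hcw t ht
      have h3 := HasDerivAt.comp t (h₂ := fun w => l w - κ * w - log w) (h := fun s : ℝ => w + s)
        (hlog _ h1 h2) (hline w t)
      rw [mul_one] at h3
      exact (reCLM.hasFDerivAt.comp_hasDerivAt t h3)
    have hmain := (convex_Ici (0 : ℝ)).image_sub_le_mul_sub_of_deriv_le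
      (f := fun t : ℝ => (l (w + t) - κ * (w + t) - log (w + t)).re)
      (fun t ht => (hd t ht).continuousAt.continuousWithinAt)
      (fun t ht => (hd t (interior_subset ht)).differentiableAt.differentiableWithinAt)
      (C := -(κ.re / 2)) (fun t ht => by
        have ht' : (0 : ℝ) ≤ t := interior_subset ht
        obtain ⟨-, h1, h2, h3⟩ := hreg w hw hcw t ht'
        rw [(hd t ht').deriv]
        have h4 := (re_le_norm (l' (w + t) - (w + t)⁻¹)).trans (hlw _ h1 h2)
        have h5 : (l' (w + t) - κ - (w + t)⁻¹).re = (l' (w + t) - (w + t)⁻¹).re - κ.re := by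
          simp only [sub_re]; ring
        rw [h5]; linarith) 0 self_mem_Ici s hs hs
    have h0 := slitPlane_ne_zero (hreg w hw hcw s hs).2.1
    have h0' := slitPlane_ne_zero (hreg w hw hcw 0 le_rfl).2.1
    rw [ofReal_zero, add_zero] at h0'
    rw [hGexp _ h0, hGexp _ h0', norm_exp, norm_exp, ← Real.exp_add, Real.exp_le_exp]
    simp only [ofReal_zero, add_zero, sub_zero] at hmain
    linarith
  have hEdiff : ∀ w : ℂ, R₁ ≤ ‖w‖ → -c * ‖w‖ ≤ w.re → ∀ s : ℝ, 0 ≤ s →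
      ‖E (w + s) - E w‖ ≤ (‖κ⁻¹‖ * ((C + 1) / (1 - c)) * (2 / κ.re)) / ‖w‖ * ‖G w‖ := by
    intro w hw hcw s hs
    have hw0 : 0 < ‖w‖ := hR₁0.trans_le hw
    set K : ℝ := ‖κ⁻¹‖ * ((C + 1) / ((1 - c) * ‖w‖)) * ‖G w‖ with hK
    have hd : ∀ t : ℝ, 0 ≤ t → HasDerivAt (fun t : ℝ => E (w + t) - E w)
        (κ⁻¹ * (G (w + t) * (l' (w + t) - (w + t)⁻¹))) t := by
      intro t ht
      obtain ⟨-, h1, h2, -⟩ := hreg w hw hcw t ht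
      have h3 := HasDerivAt.comp t (h₂ := E) (h := fun s : ℝ => w + s)
        (hEd _ h1 h2) (hline w t)
      rw [mul_one] at h3
      exact h3.sub_const _
    have hb : ∀ t : ℝ, HasDerivAt
        (fun t : ℝ => K * (2 / κ.re) * (1 - Real.exp (-(κ.re / 2) * t)))
        (K * Real.exp (-(κ.re / 2) * t)) t := by
      intro t
      have h1 := (((hasDerivAt_id t).const_mul (-(κ.re / 2))).exp.const_sub 1).const_mul
        (K * (2 / κ.re))
      refine h1.congr_deriv ?_
      simp only [id]
      field_simp
    have := image_norm_le_of_norm_deriv_right_le_deriv_boundary' (a := 0) (b := s)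
      (f := fun t : ℝ => E (w + t) - E w)
      (fun t ht => (hd t ht.1).continuousAt.continuousWithinAt)
      (fun t ht => (hd t ht.1).hasDerivWithinAt)
      (B := fun t : ℝ => K * (2 / κ.re) * (1 - Real.exp (-(κ.re / 2) * t))) (by simp)
      (fun t ht => (hb t).continuousAt.continuousWithinAt)
      (fun t ht => (hb t).hasDerivWithinAt)
      (fun t ht => by
        obtain ⟨h0, h1, h2, -⟩ := hreg w hw hcw t ht.1
        have h3 := hlw _ h1 h2
        have h4 := hGdecay w hw hcw t ht.1
        have h5 : (C + 1) / ‖w + t‖ ≤ (C + 1) / ((1 - c) * ‖w‖) := by gcongr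
        rw [norm_mul, norm_mul]
        calc _ ≤ ‖κ⁻¹‖ * ((‖G w‖ * Real.exp (-(κ.re / 2) * t)) *
              ((C + 1) / ((1 - c) * ‖w‖))) := by
                gcongr; exact h3.trans h5
          _ = _ := by rw [hK]; ring) (show s ∈ Icc 0 s from ⟨hs, le_rfl⟩)
    refine this.trans ?_
    have h1 : 1 - Real.exp (-(κ.re / 2) * s) ≤ 1 := by linarith [Real.exp_pos (-(κ.re / 2) * s)]
    have h2 : 0 ≤ K * (2 / κ.re) := by positivity
    calc _ ≤ K * (2 / κ.re) * 1 := by gcongr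
      _ = _ := by rw [hK]; field_simp
  set K' : ℝ := ‖κ⁻¹‖ * ((C + 1) / (1 - c)) * (2 / κ.re) with hK'
  have hK'0 : 0 ≤ K' := by positivity
  have hexp0 : ∀ B : ℝ, Tendsto (fun s : ℝ => B * Real.exp (-(κ.re / 2) * s)) atTop (𝓝 0) := by
    intro B
    have h1 : Tendsto (fun s : ℝ => -(κ.re / 2) * s) atTop atBot :=
      tendsto_id.const_mul_atTop_of_neg (by linarith)
    simpa using (Real.tendsto_exp_atBot.comp h1).const_mul B
  -- the limit along a fixed ray
  have hlim : ∀ w : ℂ, R₂ ≤ ‖w‖ → -c * ‖w‖ ≤ w.re →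
      ∃ b : ℂ, Tendsto (fun s : ℝ => E (w + s)) atTop (𝓝 b) ∧
        ‖E w - b‖ ≤ K' / ‖w‖ * ‖G w‖ := by
    intro w hw hcw
    have hw1 : R₁ ≤ ‖w‖ := hR₂'.trans hw
    have hC1 : CauchySeq (fun s : ℝ => E (w + s)) := by
      rw [Metric.cauchySeq_iff']
      intro ε hε
      obtain ⟨N, hN, hN0⟩ := (((hexp0 (K' / R₁ * ‖G w‖)).eventually_lt_const hε).and
        (eventually_ge_atTop 0)).exists
      refine ⟨N, fun t ht => ?_⟩
      have h1 : R₁ ≤ ‖w + N‖ := by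
        refine le_trans ?_ (mul_norm_le_norm_add hc1 hc0 hcw hN0)
        rw [hR₂, div_le_iff₀ hm] at hw
        linarith
      have h2 := hEdiff (w + N) h1 (neg_mul_norm_le_re_add hc1 hc0 hcw hN0) (t - N)
        (sub_nonneg.2 ht)
      have h3 : w + N + ((t - N : ℝ) : ℂ) = w + t := by push_cast; ring
      rw [h3] at h2
      rw [dist_eq_norm]
      refine (h2.trans ?_).trans_lt hN
      have h4 := hGdecay w hw1 hcw N hN0
      calc _ ≤ K' / R₁ * (‖G w‖ * Real.exp (-(κ.re / 2) * N)) := by gcongr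
        _ = _ := by ring
    obtain ⟨b, hb⟩ := cauchySeq_tendsto_of_complete hC1
    refine ⟨b, hb, ?_⟩
    rw [norm_sub_rev]
    refine le_of_tendsto ((hb.sub_const (E w)).norm) ?_
    filter_upwards [eventually_ge_atTop 0] with s hs using hEdiff w hw1 hcw s hs
  have hw₀ : R₂ ≤ ‖(R₂ : ℂ)‖ ∧ -c * ‖(R₂ : ℂ)‖ ≤ (R₂ : ℂ).re := by
    have h0 : 0 ≤ R₂ := hR₁0.le.trans hR₂'
    rw [norm_real, Real.norm_of_nonneg h0, ofReal_re]
    exact ⟨le_rfl, by nlinarith⟩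
  obtain ⟨a, ha, -⟩ := hlim _ hw₀.1 hw₀.2
  refine ⟨a, K', R₂, hK'0, fun w hw hcw => ?_⟩
  obtain ⟨b, hb, hb'⟩ := hlim w hw hcw
  have hab : b = a := by
    set s₀ : ℝ := R₁ + 2 * ‖w - R₂‖ with hs₀
    have hre : ∀ z ∈ closedBall ((R₂ : ℂ) + s₀) ‖w - R₂‖, R₁ ≤ z.re := by
      intro z hz
      rw [mem_closedBall, dist_eq_norm] at hz
      have h1 := neg_abs_le (z - (R₂ + s₀)).re
      have h2 := abs_re_le_norm (z - (R₂ + s₀))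
      simp only [sub_re, add_re, ofReal_re] at h1 h2
      linarith [norm_nonneg (w - R₂)]
    have hz : ∀ z ∈ closedBall ((R₂ : ℂ) + s₀) ‖w - R₂‖, R₁ ≤ ‖z‖ ∧ -c * ‖z‖ ≤ z.re := by
      intro z hz
      have h1 := hre z hz
      refine ⟨h1.trans (re_le_norm z), ?_⟩
      have := mul_nonneg hc0 (norm_nonneg z)
      linarith
    obtain ⟨M, hM⟩ := (isCompact_closedBall ((R₂ : ℂ) + s₀) ‖w - R₂‖).exists_bound_of_continuousOn
      (f := G) (fun z hz' => by
        obtain ⟨-, h1, h2, -⟩ := hreg z (hz z hz').1 (hz z hz').2 0 le_rfl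
        rw [ofReal_zero, add_zero] at h1 h2
        exact (hGd z h1 h2).continuousAt.continuousWithinAt)
    have hbd : ∀ s : ℝ, 0 ≤ s → ‖E (w + s₀ + s) - E (R₂ + s₀ + s)‖ ≤
        ‖κ⁻¹‖ * (κ.re / 2) * M * ‖w - R₂‖ * Real.exp (-(κ.re / 2) * s) := by
      intro s hs
      have h1 := (convex_closedBall ((R₂ : ℂ) + s₀) ‖w - R₂‖).norm_image_sub_le_of_norm_hasDerivWithin_le
        (f := fun z => E (z + s)) (f' := fun z => κ⁻¹ * (G (z + s) * (l' (z + s) - (z + s)⁻¹)))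
        (C := ‖κ⁻¹‖ * (κ.re / 2) * M * Real.exp (-(κ.re / 2) * s)) (fun z hz' => by
          obtain ⟨-, h1, h2, -⟩ := hreg z (hz z hz').1 (hz z hz').2 s hs
          exact ((hEd _ h1 h2).comp_add_const z s).hasDerivWithinAt) (fun z hz' => by
          obtain ⟨-, h1, h2, h3⟩ := hreg z (hz z hz').1 (hz z hz').2 s hs
          have h4 := (hlw _ h1 h2).trans h3
          have h5 := hGdecay z (hz z hz').1 (hz z hz').2 s hs
          have h6 := hM z hz'
          have h7 : ‖G (z + s)‖ ≤ M * Real.exp (-(κ.re / 2) * s) := h5.trans (by gcongr)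
          have h8 := (norm_nonneg _).trans h7
          rw [norm_mul, norm_mul]
          calc _ ≤ ‖κ⁻¹‖ * ((M * Real.exp (-(κ.re / 2) * s)) * (κ.re / 2)) := by gcongr
            _ = _ := by ring) (mem_closedBall_self (norm_nonneg _))
        (show w + s₀ ∈ _ by
          rw [mem_closedBall, dist_eq_norm, add_sub_add_right_eq_sub])
      refine h1.trans (le_of_eq ?_)
      rw [add_sub_add_right_eq_sub]; ring
    have hshift : ∀ (z y : ℂ), Tendsto (fun s : ℝ => E (z + s)) atTop (𝓝 y) →
        Tendsto (fun s : ℝ => E (z + s₀ + s)) atTop (𝓝 y) := by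
      intro z y h
      have := h.comp (tendsto_atTop_add_const_left atTop s₀ tendsto_id)
      refine this.congr fun s => ?_
      simp only [Function.comp_apply, id]
      push_cast
      rw [add_assoc]
    have h1 := (hshift _ _ hb).sub (hshift _ _ ha)
    have h2 : Tendsto (fun s : ℝ => E (w + s₀ + s) - E (R₂ + s₀ + s)) atTop (𝓝 0) := by
      refine squeeze_zero_norm' ?_ (hexp0 (‖κ⁻¹‖ * (κ.re / 2) * M * ‖w - R₂‖))
      filter_upwards [eventually_ge_atTop 0] with s hs using hbd s hs
    exact sub_eq_zero.1 (tendsto_nhds_unique h1 h2)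
  rw [hab] at hb'
  have : F w - a + κ⁻¹ * (exp (l w - κ * w) / w) = E w - a := by
    simp only [hE, hG]; ring
  rw [this]
  exact hb'

end Ray

section Center

variable {h l : ℂ → ℂ} {ρ C c : ℝ}

theorem exists_asymptotic_sector {β : ℝ} (hC : 0 ≤ C) (hl : DifferentiableOn ℂ l {τ | ρ < τ.re})
    (hlC : ∀ τ : ℂ, ρ < τ.re → ‖deriv l τ‖ ≤ C)
    (hh : ∀ τ : ℂ, ρ < τ.re → HasDerivAt h (exp (l τ + exp τ)) τ)
    (hc : exp (c * I) = -1) (hβ : |β| < π / 2) :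
    ∃ (a : ℂ) (C' ρ' : ℝ), 0 ≤ C' ∧ ∀ τ : ℂ, ρ' ≤ τ.re → |τ.im - c - β| ≤ 7 * π / 8 →
      ‖h τ - a - exp (exp τ + l τ - τ)‖ ≤
        C' * Real.exp (-τ.re) * ‖exp (exp τ + l τ - τ)‖ := by
  set κ : ℂ := exp (β * I) with hκ
  set σ : ℂ := (c + β) * I with hσ
  have hκre : 0 < κ.re := by
    rw [hκ, exp_ofReal_mul_I_re]
    exact Real.cos_pos_of_mem_Ioo (by rw [abs_lt] at hβ; exact ⟨by linarith, hβ.2⟩)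
  have hκn : ‖κ‖ = 1 := norm_exp_ofReal_mul_I β
  have hκ0 : κ ≠ 0 := exp_ne_zero _
  have hσre : σ.re = 0 := by simp [hσ]
  have hσim : σ.im = c + β := by simp [hσ]
  have hσe : exp σ = -κ := by rw [hσ, add_mul, exp_add, hc]; ring
  have hc1 : Real.cos (π / 8) < 1 := by
    rw [← Real.cos_zero]
    exact Real.cos_lt_cos_of_nonneg_of_le_pi le_rfl (by linarith [Real.pi_pos])
      (by linarith [Real.pi_pos])
  have hc0 : 0 ≤ Real.cos (π / 8) :=
    Real.cos_nonneg_of_mem_Icc ⟨by linarith [Real.pi_pos], by linarith [Real.pi_pos]⟩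
  have hre : ∀ w ∈ slitPlane, Real.exp ρ < ‖w‖ → ρ < (σ + log w).re := by
    intro w hw hRw
    rw [add_re, hσre, zero_add, log_re]
    exact (Real.lt_log_iff_exp_lt (norm_pos_iff.2 (slitPlane_ne_zero hw))).2 hRw
  have hlog : ∀ w ∈ slitPlane, HasDerivAt (fun w => σ + log w) w⁻¹ w := fun w hw =>
    (hasDerivAt_log hw).const_add σ
  obtain ⟨a, C', R', hC', hmain⟩ := exists_asymptotic_of_hasDerivAt (c := Real.cos (π / 8))
    (F := fun w => h (σ + log w)) (l := fun w => l (σ + log w))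
    (l' := fun w => deriv l (σ + log w) * w⁻¹) (R := Real.exp ρ) hκre hC hc0 hc1
    (Real.exp_pos ρ).le
    (fun w hw hRw => by
      refine ((hh _ (hre w hw hRw)).comp w (hlog w hw)).congr_deriv ?_
      rw [exp_add σ, hσe, exp_log (slitPlane_ne_zero hw), div_eq_mul_inv]
      ring_nf)
    (fun w hw hRw => by
      have hd := (hl.differentiableAt ((isOpen_reGt ρ).mem_nhds (hre w hw hRw))).hasDerivAt
      refine ⟨HasDerivAt.comp w (h₂ := l) hd (hlog w hw), ?_⟩
      rw [norm_mul, norm_inv, ← div_eq_mul_inv]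
      gcongr
      exact hlC _ (hre w hw hRw))
  refine ⟨a, C', Real.log (max R' 1), hC', fun τ hτ hτi => ?_⟩
  have hn : ‖exp (τ - σ)‖ = Real.exp τ.re := by rw [norm_exp, sub_re, hσre, sub_zero]
  have hlw : log (exp (τ - σ)) = τ - σ := by
    rw [abs_le] at hτi
    apply log_exp <;> rw [sub_im, hσim] <;> linarith [Real.pi_pos]
  have h1 := hmain (exp (τ - σ)) (by
      rw [hn]
      rw [Real.log_le_iff_le_exp (by positivity)] at hτ
      exact (le_max_left _ _).trans hτ) (by
      rw [hn, exp_re, sub_re, hσre, sub_zero, sub_im, hσim]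
      have : Real.cos (7 * π / 8) ≤ Real.cos (τ.im - (c + β)) := by
        rw [← Real.cos_abs (τ.im - (c + β))]
        refine Real.cos_le_cos_of_nonneg_of_le_pi (abs_nonneg _) (by linarith [Real.pi_pos]) ?_
        rwa [← sub_sub]
      have e : 7 * π / 8 = π - π / 8 := by ring
      rw [e, Real.cos_pi_sub] at this
      nlinarith [Real.exp_pos τ.re])
  have hx : exp (l τ - κ * exp (τ - σ)) / exp (τ - σ) = -κ * exp (exp τ + l τ - τ) := by
    rw [exp_sub τ σ, hσe]
    have e : l τ - κ * (exp τ / -κ) = exp τ + l τ := by field_simp; ring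
    rw [e, exp_sub (exp τ + l τ)]
    field_simp
  have e2 : σ + (τ - σ) = τ := by ring
  simp only [hlw, e2] at h1
  rw [hx, hn, norm_mul, norm_neg, hκn, one_mul, div_eq_mul_inv, ← Real.exp_neg] at h1
  refine le_trans (le_of_eq ?_) h1
  congr 1
  field_simp
  ring

theorem norm_le_of_norm_deriv_le (hC : 0 ≤ C) (hl : DifferentiableOn ℂ l {τ | ρ < τ.re})
    (hlC : ∀ τ : ℂ, ρ < τ.re → ‖deriv l τ‖ ≤ C) :
    ∃ M, 0 ≤ M ∧ ∀ τ : ℂ, ρ < τ.re → ‖l τ‖ ≤ M * (1 + ‖τ‖) := by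
  set τ₀ : ℂ := ((ρ + 1 : ℝ) : ℂ)
  have h0 : ρ < τ₀.re := by simp [τ₀]
  refine ⟨‖l τ₀‖ + C * (1 + ‖τ₀‖), by positivity, fun τ hτ => ?_⟩
  have h1 := (convex_halfSpace_re_gt ρ).norm_image_sub_le_of_norm_deriv_le
    (fun x hx => hl.differentiableAt ((isOpen_reGt ρ).mem_nhds hx)) hlC h0 hτ
  have h2 := norm_sub_norm_le (l τ) (l τ₀)
  have h3 : ‖τ - τ₀‖ ≤ ‖τ‖ + ‖τ₀‖ := norm_sub_le _ _
  have h4 : C * ‖τ - τ₀‖ ≤ C * (‖τ‖ + ‖τ₀‖) := by gcongr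
  nlinarith [norm_nonneg τ, norm_nonneg τ₀, mul_nonneg (norm_nonneg (l τ₀)) (norm_nonneg τ),
    mul_nonneg hC (mul_nonneg (norm_nonneg τ) (norm_nonneg τ₀))]

theorem tendsto_mul_exp_neg_atTop (A B : ℝ) :
    Tendsto (fun x : ℝ => (A + B * x) * Real.exp (-x)) atTop (𝓝 0) := by
  have h1 := (Real.tendsto_pow_mul_exp_neg_atTop_nhds_zero 0).const_mul A
  have h2 := (Real.tendsto_pow_mul_exp_neg_atTop_nhds_zero 1).const_mul B
  have := h1.add h2
  simp only [mul_zero, add_zero] at this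
  refine this.congr fun x => ?_
  ring

theorem exists_asymptotic_strip (hC : 0 ≤ C) (hl : DifferentiableOn ℂ l {τ | ρ < τ.re})
    (hlC : ∀ τ : ℂ, ρ < τ.re → ‖deriv l τ‖ ≤ C)
    (hh : ∀ τ : ℂ, ρ < τ.re → HasDerivAt h (exp (l τ + exp τ)) τ)
    (hc : exp (c * I) = -1) :
    ∃ (a : ℂ) (C' ρ' : ℝ), 0 ≤ C' ∧ ∀ τ : ℂ, ρ' ≤ τ.re → |τ.im - c| ≤ 5 * π / 4 →
      ‖h τ - a - exp (exp τ + l τ - τ)‖ ≤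
        C' * Real.exp (-τ.re) * ‖exp (exp τ + l τ - τ)‖ := by
  have hπ := Real.pi_pos
  obtain ⟨a, C₁, ρ₁, hC₁, h₁⟩ := exists_asymptotic_sector (β := 3 * π / 8) hC hl hlC hh hc
    (by rw [abs_of_pos (by positivity)]; linarith)
  obtain ⟨b, C₂, ρ₂, hC₂, h₂⟩ := exists_asymptotic_sector (β := -(3 * π / 8)) hC hl hlC hh hc
    (by rw [abs_neg, abs_of_pos (by positivity)]; linarith)
  obtain ⟨M, hM, hlM⟩ := norm_le_of_norm_deriv_le hC hl hlC
  have key : ∀ (y : ℂ) (C' ρ' : ℝ), 0 ≤ C' → (∀ r : ℝ, ρ' ≤ r →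
      ‖h (r + c * I) - y - exp (exp (r + c * I) + l (r + c * I) - (r + c * I))‖ ≤
        C' * Real.exp (-r) * ‖exp (exp (r + c * I) + l (r + c * I) - (r + c * I))‖) →
      Tendsto (fun r : ℝ => h (r + c * I)) atTop (𝓝 y) := by
    intro y C' ρ' hC' H
    have hG : Tendsto (fun r : ℝ => ‖exp (exp (r + c * I) + l (r + c * I) - (r + c * I))‖) atTop
        (𝓝 0) := by
      have hmaj : Tendsto (fun r : ℝ => Real.exp (-(Real.exp r * (1 -
          (M * (1 + |c|) + M * r) * Real.exp (-r))))) atTop (𝓝 0) := by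
        refine Real.tendsto_exp_neg_atTop_nhds_zero.comp ?_
        refine Real.tendsto_exp_atTop.atTop_mul_pos one_pos ?_
        simpa using (tendsto_mul_exp_neg_atTop (M * (1 + |c|)) M).const_sub 1
      refine squeeze_zero_norm' ?_ hmaj
      filter_upwards [eventually_gt_atTop ρ, eventually_ge_atTop 0] with r hr hr0
      rw [norm_norm, norm_exp, Real.exp_le_exp]
      have e1 : exp (r + c * I) = -(Real.exp r : ℂ) := by
        rw [exp_add, hc, ofReal_exp]; ring
      have e2 : ‖(r : ℂ) + c * I‖ ≤ r + |c| := by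
        refine (norm_add_le _ _).trans ?_
        simp [abs_of_nonneg hr0]
      have e3 := (re_le_norm _).trans (hlM (r + c * I) (by simpa using hr))
      have e4 : M * (1 + ‖(r : ℂ) + c * I‖) ≤ M * (1 + (r + |c|)) := by gcongr
      have e5 : Real.exp r * (1 - (M * (1 + |c|) + M * r) * Real.exp (-r)) =
          Real.exp r - (M * (1 + |c|) + M * r) := by
        rw [Real.exp_neg]; field_simp
      rw [e5, e1]
      simp only [sub_re, add_re, neg_re, ofReal_re, mul_re, I_re, ofReal_im, I_im]
      linarith
    rw [tendsto_iff_norm_sub_tendsto_zero]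
    have hmaj := (hG.const_mul (C' + 1))
    rw [mul_zero] at hmaj
    refine squeeze_zero_norm' ?_ hmaj
    filter_upwards [eventually_ge_atTop ρ', eventually_ge_atTop 0] with r hr hr0
    have h3 := H r hr
    set G := exp (exp (r + c * I) + l (r + c * I) - (r + c * I))
    have h4 : ‖h (r + c * I) - y‖ ≤ ‖h (r + c * I) - y - G‖ + ‖G‖ := by
      simpa using norm_add_le (h (r + c * I) - y - G) G
    have h5 : Real.exp (-r) ≤ 1 := Real.exp_le_one_iff.2 (by linarith)
    have h6 : C' * Real.exp (-r) * ‖G‖ ≤ C' * 1 * ‖G‖ := by gcongr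
    rw [norm_norm]
    linarith
  have hab : a = b := by
    refine tendsto_nhds_unique (key a C₁ ρ₁ hC₁ fun r hr => ?_) (key b C₂ ρ₂ hC₂ fun r hr => ?_)
    · simpa using h₁ (r + c * I) (by simpa using hr) (by
        rw [abs_le]; simp; constructor <;> linarith)
    · simpa using h₂ (r + c * I) (by simpa using hr) (by
        rw [abs_le]; simp; constructor <;> linarith)
  subst hab
  refine ⟨a, max C₁ C₂, max ρ₁ ρ₂, le_max_of_le_left hC₁, fun τ hτ hτi => ?_⟩
  rw [abs_le] at hτi
  rcases le_total c τ.im with h0 | h0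
  · refine (h₁ τ ((le_max_left _ _).trans hτ) (by rw [abs_le]; constructor <;> linarith)).trans ?_
    gcongr; exact le_max_left _ _
  · refine (h₂ τ ((le_max_right _ _).trans hτ) (by rw [abs_le]; constructor <;> linarith)).trans ?_
    gcongr; exact le_max_right _ _

end Center

section Center

variable {h l : ℂ → ℂ} {ρ C c : ℝ}

/-- A half-strip of width `2 * y` around the line of imaginary part `c`. -/
def halfStrip (ρ c y : ℝ) : Set ℂ := {τ | ρ < τ.re ∧ |τ.im - c| < y}

theorem convex_halfStrip (ρ c y : ℝ) : Convex ℝ (halfStrip ρ c y) := by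
  have : halfStrip ρ c y = {τ : ℂ | ρ < τ.re} ∩ ({τ : ℂ | c - y < τ.im} ∩ {τ : ℂ | τ.im < c + y}) := by
    ext τ
    simp only [halfStrip, mem_ofPred_eq, mem_inter_iff, abs_lt]
    constructor
    · rintro ⟨h1, h2, h3⟩; exact ⟨h1, by linarith, by linarith⟩
    · rintro ⟨h1, h2, h3⟩; exact ⟨h1, by linarith, by linarith⟩
  rw [this]
  exact (convex_halfSpace_re_gt _).inter ((convex_halfSpace_im_gt _).inter (convex_halfSpace_im_lt _))

theorem isOpen_halfStrip (ρ c y : ℝ) : IsOpen (halfStrip ρ c y) :=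
  (isOpen_lt continuous_const continuous_re).inter
    (isOpen_lt ((continuous_im.sub continuous_const).abs) continuous_const)

theorem closedBall_subset_halfStrip {ρ c y η : ℝ} {s : ℂ} (hs : s ∈ halfStrip (ρ + η) c (y - η)) :
    closedBall s η ⊆ halfStrip ρ c y := by
  intro τ hτ
  rw [mem_closedBall, dist_eq_norm] at hτ
  have h1 := (abs_re_le_norm (τ - s)).trans hτ
  have h2 := (abs_im_le_norm (τ - s)).trans hτ
  rw [sub_re, abs_le] at h1
  rw [sub_im] at h2
  refine ⟨by linarith [hs.1, h1.1], ?_⟩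
  have h3 := abs_add_le (τ.im - s.im) (s.im - c)
  rw [sub_add_sub_cancel] at h3
  linarith [hs.2]

theorem exists_center_coordinate (hC : 0 ≤ C) (hl : DifferentiableOn ℂ l {τ | ρ < τ.re})
    (hlC : ∀ τ : ℂ, ρ < τ.re → ‖deriv l τ‖ ≤ C)
    (hh : ∀ τ : ℂ, ρ < τ.re → HasDerivAt h (exp (l τ + exp τ)) τ)
    (hc : exp (c * I) = -1) :
    ∃ (a : ℂ) (T S : ℂ → ℂ) (ρ' : ℝ), (∀ τ ∈ halfStrip ρ' c (5 * π / 4),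
      h τ = a + exp (exp (T τ)) ∧ ‖exp (T τ) - (exp τ + l τ - τ)‖ ≤ 1 / 4 ∧ ‖T τ - τ‖ ≤ 1 / 8) ∧
      InjOn T (halfStrip ρ' c (5 * π / 4)) ∧
      ∀ s ∈ halfStrip (ρ' + 1 / 8) c (5 * π / 4 - 1 / 8),
        ‖S s - s‖ ≤ 1 / 8 ∧ T (S s) = s ∧ ContinuousAt S s := by
  have hπ := Real.pi_pos
  obtain ⟨a, C', ρ₁, hC', hasy⟩ := exists_asymptotic_strip hC hl hlC hh hc
  obtain ⟨M, hM, hlM⟩ := norm_le_of_norm_deriv_le hC hl hlC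
  set A : ℝ := 1 / 4 + M * (5 + |c|) + |c| + 4
  obtain ⟨ρ', hρ'⟩ := ((((tendsto_mul_exp_neg_atTop C' 0).eventually_lt_const
    (show (0 : ℝ) < 1 / 16 by norm_num)).and ((tendsto_mul_exp_neg_atTop A (M + 1)).eventually_lt_const
    (show (0 : ℝ) < 1 / 16 by norm_num))).and ((eventually_ge_atTop ρ₁).and
    ((eventually_gt_atTop ρ).and (eventually_ge_atTop 0)))).exists_forall_of_atTop
  set Λ : ℂ → ℂ := fun τ => exp τ + l τ - τ with hΛ
  set q : ℂ → ℂ := fun τ => (h τ - a) / exp (Λ τ) with hq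
  set L : ℂ → ℂ := fun τ => Λ τ + log (q τ) with hL
  set u : ℂ → ℂ := fun τ => L τ * exp (-τ) with hu
  set U := halfStrip ρ' c (5 * π / 4) with hU
  have hq1 : ∀ τ ∈ U, ‖q τ - 1‖ ≤ 1 / 16 := by
    intro τ hτ
    obtain ⟨⟨h1, -⟩, h3, -, -⟩ := hρ' τ.re hτ.1.le
    have h4 := hasy τ h3 hτ.2.le
    have e : q τ - 1 = (h τ - a - exp (Λ τ)) / exp (Λ τ) := by
      rw [sub_div, div_self (exp_ne_zero _)]
    rw [e, norm_div, div_le_iff₀ (norm_pos_iff.2 (exp_ne_zero _))]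
    refine h4.trans ?_
    gcongr
    simpa using h1.le
  have hlogq : ∀ τ ∈ U, ‖log (q τ)‖ ≤ 1 / 8 ∧ q τ ∈ slitPlane := by
    intro τ hτ
    have h1 := hq1 τ hτ
    have h2 := norm_log_one_add_half_le_self (z := q τ - 1) (h1.trans (by norm_num))
    have h3 := mem_slitPlane_of_norm_lt_one (z := q τ - 1) (h1.trans_lt (by norm_num))
    rw [add_sub_cancel] at h2 h3
    exact ⟨by linarith, h3⟩
  have hu1 : ∀ τ ∈ U, ‖u τ - 1‖ ≤ 1 / 16 := by
    intro τ hτ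
    obtain ⟨⟨-, h2⟩, -, h4, h5⟩ := hρ' τ.re hτ.1.le
    have e : u τ - 1 = (log (q τ) + l τ - τ) * exp (-τ) := by
      have : exp τ * exp (-τ) = 1 := by rw [← exp_add]; simp
      simp only [hu, hL, hΛ]
      linear_combination this
    have h6 : ‖τ‖ ≤ τ.re + (|c| + 4) := by
      have h7 := norm_le_abs_re_add_abs_im τ
      rw [abs_of_nonneg h5] at h7
      have h8 := abs_add_le (τ.im - c) c
      rw [sub_add_cancel] at h8
      have := hτ.2
      linarith [Real.pi_lt_d2]
    rw [e, norm_mul, norm_exp, neg_re]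
    refine le_trans ?_ h2.le
    gcongr
    have h9 := hlM τ h4
    have h10 : M * (1 + ‖τ‖) ≤ M * (1 + (τ.re + (|c| + 4))) := by gcongr
    have h11 := norm_sub_le (log (q τ) + l τ) τ
    have h12 := norm_add_le (log (q τ)) (l τ)
    have h13 := (hlogq τ hτ).1
    simp only [A]
    nlinarith
  have hlogu : ∀ τ ∈ U, ‖log (u τ)‖ ≤ 1 / 8 ∧ u τ ∈ slitPlane := by
    intro τ hτ
    have h1 := hu1 τ hτ
    have h2 := norm_log_one_add_half_le_self (z := u τ - 1) (h1.trans (by norm_num))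
    have h3 := mem_slitPlane_of_norm_lt_one (z := u τ - 1) (h1.trans_lt (by norm_num))
    rw [add_sub_cancel] at h2 h3
    exact ⟨by linarith, h3⟩
  have hΛd : ∀ τ ∈ U, HasDerivAt Λ (exp τ + deriv l τ - 1) τ := by
    intro τ hτ
    have hd := (hl.differentiableAt ((isOpen_reGt ρ).mem_nhds (hρ' τ.re hτ.1.le).2.2.1)).hasDerivAt
    exact ((Complex.hasDerivAt_exp τ).add hd).sub (hasDerivAt_id τ)
  have hLd : ∀ τ ∈ U, HasDerivAt L (exp τ / q τ) τ := by
    intro τ hτ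
    have h1 := hh τ (hρ' τ.re hτ.1.le).2.2.1
    have h2 := ((h1.sub_const a).div (hΛd τ hτ).cexp (exp_ne_zero _)).clog (hlogq τ hτ).2
    refine ((hΛd τ hτ).add h2).congr_deriv ?_
    have hq0 := slitPlane_ne_zero (hlogq τ hτ).2
    have hqe : h τ - a = q τ * exp (Λ τ) := by
      rw [hq]; exact (div_mul_cancel₀ _ (exp_ne_zero _)).symm
    have he : exp (l τ + exp τ) = exp (Λ τ) * exp τ := by
      rw [← exp_add]; congr 1; simp only [hΛ]; ring
    have hEq : ((fun x => h x - a) / fun x => exp (Λ x)) τ = q τ := rfl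
    rw [hEq, hqe, he]
    have := exp_ne_zero (Λ τ)
    field_simp
    ring
  have hTd : ∀ τ ∈ U, HasDerivAt (fun τ => τ + log (u τ)) ((q τ * u τ)⁻¹) τ := by
    intro τ hτ
    have h1 := ((hLd τ hτ).mul (hasDerivAt_neg τ).cexp).clog (hlogu τ hτ).2
    refine ((hasDerivAt_id τ).add h1).congr_deriv ?_
    have hq0 := slitPlane_ne_zero (hlogq τ hτ).2
    have hu0 := slitPlane_ne_zero (hlogu τ hτ).2
    have hEq : (L * fun x => exp (-x)) τ = u τ := rfl
    have hue : L τ * exp (-τ) = u τ := rfl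
    have he : exp τ * exp (-τ) = 1 := by rw [← exp_add]; simp
    rw [hEq]
    field_simp
    linear_combination he - q τ * hue
  obtain ⟨hinj, S, hS⟩ := exists_inverse_of_near_id (V := halfStrip (ρ' + 1 / 8) c (5 * π / 4 - 1 / 8))
    (convex_halfStrip ρ' c (5 * π / 4)) (isOpen_halfStrip _ _ _) hTd (fun τ hτ => by
      have h1 := hq1 τ hτ
      have h2 := hu1 τ hτ
      have h3 : ‖q τ * u τ - 1‖ ≤ 1 / 7 := by
        have e : q τ * u τ - 1 = (q τ - 1) * (u τ - 1) + (q τ - 1) + (u τ - 1) := by ring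
        rw [e]
        have := norm_add₃_le (a := (q τ - 1) * (u τ - 1)) (b := q τ - 1) (c := u τ - 1)
        rw [norm_mul] at this
        nlinarith [norm_nonneg (q τ - 1), norm_nonneg (u τ - 1)]
      have h4 : 6 / 7 ≤ ‖q τ * u τ‖ := by
        have := norm_sub_norm_le 1 (q τ * u τ)
        rw [norm_one, norm_sub_rev] at this
        linarith
      have h5 : q τ * u τ ≠ 0 := norm_pos_iff.1 (by linarith)
      have e : (q τ * u τ)⁻¹ - 1 = -(q τ * u τ - 1) / (q τ * u τ) := by
        rw [neg_sub, sub_div, div_self h5, one_div]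
      rw [e, norm_div, norm_neg, div_le_iff₀ (by linarith)]
      linarith) (show (0 : ℝ) ≤ 1 / 8 by norm_num)
    (fun τ hτ => by rw [add_sub_cancel_left]; exact (hlogu τ hτ).1)
    (fun s hs => closedBall_subset_halfStrip hs)
  refine ⟨a, _, S, ρ', fun τ hτ => ?_, hinj, fun s hs => ?_⟩
  · have hT : exp (τ + log (u τ)) = L τ := by
      rw [exp_add, exp_log (slitPlane_ne_zero (hlogu τ hτ).2), hu]
      have he : exp τ * exp (-τ) = 1 := by rw [← exp_add]; simp
      linear_combination L τ * he
    rw [hT]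
    refine ⟨?_, ?_, by rw [add_sub_cancel_left]; exact (hlogu τ hτ).1⟩
    · rw [hL]
      simp only
      rw [exp_add, exp_log (slitPlane_ne_zero (hlogq τ hτ).2), hq]
      simp only
      rw [mul_div_cancel₀ _ (exp_ne_zero _)]; ring
    · have : L τ - (exp τ + l τ - τ) = log (q τ) := by simp only [hL, hΛ]; ring
      rw [this]
      exact (hlogq τ hτ).1.trans (by norm_num)
  · exact ⟨(hS s hs).2.1, (hS s hs).2.2.1, (hS s hs).2.2.2.continuousAt⟩

end Center

theorem norm_le_of_norm_exp_sub_one_le {u : ℂ} (h : ‖exp u - 1‖ ≤ 1 / 16) (hu : |u.im| ≤ 5) :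
    ‖u‖ ≤ 1 / 8 := by
  have h2 := norm_log_one_add_half_le_self (z := exp u - 1) (h.trans (by norm_num))
  rw [add_sub_cancel] at h2
  obtain ⟨n, hn⟩ := exp_eq_exp_iff_exists_int.1 (exp_log (exp_ne_zero u)).symm
  have h3 : u.im = (log (exp u)).im + n * (2 * π) := by
    conv_lhs => rw [hn]
    simp
  have h4 := (abs_im_le_norm (log (exp u)))
  have h5 : n = 0 := by
    by_contra h0
    have h6 : (1 : ℝ) ≤ |(n : ℝ)| := by exact_mod_cast Int.one_le_abs h0
    have h7 : |(n : ℝ) * (2 * π)| ≤ |u.im| + |(log (exp u)).im| := by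
      rw [show (n : ℝ) * (2 * π) = u.im - (log (exp u)).im by rw [h3]; ring]
      exact abs_sub _ _
    rw [abs_mul, abs_of_pos Real.two_pi_pos] at h7
    nlinarith [Real.pi_gt_d2]
  rw [h5] at hn
  simp only [Int.cast_zero, zero_mul, add_zero] at hn
  rw [hn]
  linarith

/-- The imaginary part of the centre line of the `j`-th logarithmic sector. -/
noncomputable def sectorCenter (j : ℤ) : ℝ := (2 * j + 1) * π

theorem exp_sectorCenter (j : ℤ) : exp (sectorCenter j * I) = -1 := by
  have : (sectorCenter j : ℂ) * I = j * (2 * π * I) + π * I := by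
    simp only [sectorCenter]; push_cast; ring
  rw [this, exp_add, exp_int_mul_two_pi_mul_I, exp_pi_mul_I, one_mul]

/-- The leading part of the logarithm of `f` minus an asymptotic value. -/
noncomputable def NormalForm.potential {f : ℂ → ℂ} {d : ℕ} (F : NormalForm f d) (τ : ℂ) : ℂ :=
  exp τ + F.l τ - τ

/-- Coordinates linearising `log (f - a j)` in the logarithmic sectors of `f`. -/
structure SectorCharts {f : ℂ → ℂ} {d : ℕ} (F : NormalForm f d) where
  a : ℤ → ℂ
  T : ℤ → ℂ → ℂ
  S : ℤ → ℂ → ℂ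
  r : ℝ
  le_r : F.ρ ≤ r
  eq_add : ∀ j : ℤ, -1 ≤ j → j ≤ d → ∀ τ ∈ halfStrip r (sectorCenter j) (5 * π / 4),
    f (exp (F.N τ)) = a j + exp (exp (T j τ))
  norm_sub_potential_le : ∀ j : ℤ, -1 ≤ j → j ≤ d →
    ∀ τ ∈ halfStrip r (sectorCenter j) (5 * π / 4), ‖exp (T j τ) - F.potential τ‖ ≤ 1 / 4
  norm_T_sub_le : ∀ j : ℤ, -1 ≤ j → j ≤ d →
    ∀ τ ∈ halfStrip r (sectorCenter j) (5 * π / 4), ‖T j τ - τ‖ ≤ 1 / 8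
  injOn_T : ∀ j : ℤ, -1 ≤ j → j ≤ d → InjOn (T j) (halfStrip r (sectorCenter j) (5 * π / 4))
  norm_S_sub_le : ∀ j : ℤ, -1 ≤ j → j ≤ d →
    ∀ s ∈ halfStrip (r + 1 / 8) (sectorCenter j) (5 * π / 4 - 1 / 8), ‖S j s - s‖ ≤ 1 / 8
  T_S : ∀ j : ℤ, -1 ≤ j → j ≤ d →
    ∀ s ∈ halfStrip (r + 1 / 8) (sectorCenter j) (5 * π / 4 - 1 / 8), T j (S j s) = s
  continuousAt_S : ∀ j : ℤ, -1 ≤ j → j ≤ d →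
    ∀ s ∈ halfStrip (r + 1 / 8) (sectorCenter j) (5 * π / 4 - 1 / 8), ContinuousAt (S j) s
  near : ∀ τ τ' : ℂ, r < τ.re → r < τ'.re → |τ.im| ≤ 2 * π * (d + 2) → |τ'.im| ≤ 2 * π * (d + 2) →
    |τ.im - τ'.im| ≤ 5 → ‖F.potential τ - F.potential τ'‖ ≤ 4 → ‖τ - τ'‖ ≤ 1 / 8

theorem halfStrip_subset {ρ ρ' c y : ℝ} (h : ρ ≤ ρ') : halfStrip ρ' c y ⊆ halfStrip ρ c y :=
  fun _ hτ => ⟨h.trans_lt hτ.1, hτ.2⟩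

theorem NormalForm.exists_near {f : ℂ → ℂ} {d : ℕ} (F : NormalForm f d) (B : ℝ) :
    ∃ r₀, ∀ r, r₀ ≤ r → ∀ τ τ' : ℂ, r < τ.re → r < τ'.re → |τ.im| ≤ B → |τ'.im| ≤ B →
      |τ.im - τ'.im| ≤ 5 → ‖F.potential τ - F.potential τ'‖ ≤ 4 → ‖τ - τ'‖ ≤ 1 / 8 := by
  obtain ⟨M, hM, hlM⟩ := norm_le_of_norm_deriv_le F.C_nonneg F.l_diff F.l_deriv
  obtain ⟨r₀, hr₀⟩ := (((tendsto_mul_exp_neg_atTop (4 + 2 * (M + 1) * (1 + B))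
    (2 * (M + 1))).eventually_lt_const (show (0 : ℝ) < 1 / 16 by norm_num)).and
    ((eventually_ge_atTop F.ρ).and (eventually_ge_atTop 0))).exists_forall_of_atTop
  refine ⟨r₀, fun r hr τ τ' hτ hτ' hi hi' hii hp => ?_⟩
  wlog hle : τ'.re ≤ τ.re generalizing τ τ'
  · rw [norm_sub_rev]
    exact this τ' τ hτ' hτ hi' hi (by rwa [abs_sub_comm]) (by rwa [norm_sub_rev]) (le_of_not_ge hle)
  obtain ⟨-, h1, h2⟩ := hr₀ r hr
  obtain ⟨h3, -, -⟩ := hr₀ τ.re (hr.trans hτ.le)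
  have hpot : ∀ z : ℂ, r < z.re → z.re ≤ τ.re → |z.im| ≤ B →
      ‖F.potential z - exp z‖ ≤ (M + 1) * (1 + (τ.re + B)) := by
    intro z hz hzτ hzi
    have e : F.potential z - exp z = F.l z - z := by rw [NormalForm.potential]; ring
    have h4 := hlM z (h1.trans_lt hz)
    have h5 := norm_le_abs_re_add_abs_im z
    rw [abs_of_nonneg (h2.trans hz.le)] at h5
    have h6 : ‖z‖ ≤ τ.re + B := by linarith
    have h7 : M * (1 + ‖z‖) ≤ M * (1 + (τ.re + B)) := by gcongr
    rw [e]
    have := norm_sub_le (F.l z) z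
    linarith
  rw [norm_sub_rev]
  refine norm_le_of_norm_exp_sub_one_le ?_ (by rwa [sub_im, abs_sub_comm])
  have e : exp (τ' - τ) - 1 = (exp τ' - exp τ) * exp (-τ) := by
    rw [sub_mul, ← exp_add, ← exp_add]; simp [sub_eq_add_neg]
  rw [e, norm_mul, norm_exp, neg_re]
  refine le_trans ?_ h3.le
  gcongr
  have h8 := hpot τ hτ le_rfl hi
  have h9 := hpot τ' hτ' hle hi'
  have e2 : exp τ' - exp τ = (F.potential τ - exp τ) - (F.potential τ' - exp τ') -
      (F.potential τ - F.potential τ') := by ring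
  rw [e2]
  have h10 := norm_sub_le ((F.potential τ - exp τ) - (F.potential τ' - exp τ'))
    (F.potential τ - F.potential τ')
  have h11 := norm_sub_le (F.potential τ - exp τ) (F.potential τ' - exp τ')
  linarith

theorem NormalForm.exists_sectorCharts {f : ℂ → ℂ} {d : ℕ} (F : NormalForm f d) :
    Nonempty (SectorCharts F) := by
  have hc := fun j : ℤ => exists_center_coordinate (h := fun τ => f (exp (F.N τ))) F.C_nonneg
    F.l_diff F.l_deriv F.hasDerivAt (exp_sectorCenter j)
  choose a T S ρ hρ hinj hS using hc
  obtain ⟨r₀, hr₀⟩ := F.exists_near (2 * π * (d + 2))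
  obtain ⟨r₁, hr₁⟩ := ((Finset.Icc (-1 : ℤ) d).image ρ).bddAbove
  set r := max (max r₀ r₁) (max F.ρ 0)
  have hr : ∀ j : ℤ, -1 ≤ j → j ≤ d → ρ j ≤ r := fun j hj hj' =>
    (hr₁ (by simpa using ⟨j, ⟨hj, hj'⟩, rfl⟩)).trans
      ((le_max_right _ _).trans (le_max_left _ _))
  exact ⟨{
    a := a
    T := T
    S := S
    r := r
    le_r := (le_max_left _ _).trans (le_max_right _ _)
    eq_add := fun j hj hj' τ hτ => (hρ j τ (halfStrip_subset (hr j hj hj') hτ)).1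
    norm_sub_potential_le := fun j hj hj' τ hτ => (hρ j τ (halfStrip_subset (hr j hj hj') hτ)).2.1
    norm_T_sub_le := fun j hj hj' τ hτ => (hρ j τ (halfStrip_subset (hr j hj hj') hτ)).2.2
    injOn_T := fun j hj hj' => (hinj j).mono (halfStrip_subset (hr j hj hj'))
    norm_S_sub_le := fun j hj hj' s hs =>
      (hS j s (halfStrip_subset (by linarith [hr j hj hj']) hs)).1
    T_S := fun j hj hj' s hs =>
      (hS j s (halfStrip_subset (by linarith [hr j hj hj']) hs)).2.1
    continuousAt_S := fun j hj hj' s hs =>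
      (hS j s (halfStrip_subset (by linarith [hr j hj hj']) hs)).2.2
    near := hr₀ r ((le_max_left _ _).trans (le_max_left _ _)) }⟩

theorem eq_of_exp_eq_exp {x y : ℂ} (h : exp x = exp y) (hle : ‖x - y‖ ≤ 5) : x = y := by
  obtain ⟨n, hn⟩ := exp_eq_exp_iff_exists_int.1 h
  have h3 : x - y = n * (2 * π * I) := by rw [hn]; ring
  rw [h3] at hle
  have h4 : n = 0 := by
    by_contra h0
    have h6 : (1 : ℝ) ≤ |(n : ℝ)| := by exact_mod_cast Int.one_le_abs h0
    have h7 : ‖(n : ℂ) * (2 * π * I)‖ = |(n : ℝ)| * (2 * π) := by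
      simp [abs_of_pos Real.pi_pos]
    rw [h7] at hle
    nlinarith [Real.pi_gt_three]
  rw [hn, h4]; simp

/-- `log (exp ζ - a)` for `ζ` of large real part. -/
noncomputable def shiftLog (a ζ : ℂ) : ℂ := ζ + log (1 - a * exp (-ζ))

section shiftLog

variable {a ζ : ℂ}

theorem norm_shiftLog_sub_le (h : ‖a * exp (-ζ)‖ ≤ 1 / 16) : ‖shiftLog a ζ - ζ‖ ≤ 1 / 8 := by
  have h2 := norm_log_one_add_half_le_self (z := -(a * exp (-ζ))) (by rw [norm_neg]; linarith)
  rw [norm_neg, ← sub_eq_add_neg] at h2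
  rw [shiftLog, add_sub_cancel_left]
  linarith

theorem one_sub_mem_slitPlane (h : ‖a * exp (-ζ)‖ ≤ 1 / 16) : 1 - a * exp (-ζ) ∈ slitPlane := by
  have := mem_slitPlane_of_norm_lt_one (z := -(a * exp (-ζ))) (by rw [norm_neg]; linarith)
  rwa [← sub_eq_add_neg] at this

theorem exp_shiftLog (h : ‖a * exp (-ζ)‖ ≤ 1 / 16) : exp (shiftLog a ζ) = exp ζ - a := by
  rw [shiftLog, exp_add, exp_log (slitPlane_ne_zero (one_sub_mem_slitPlane h))]
  have : exp ζ * exp (-ζ) = 1 := by rw [← exp_add]; simp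
  linear_combination -a * this

theorem continuousAt_shiftLog (h : ‖a * exp (-ζ)‖ ≤ 1 / 16) : ContinuousAt (shiftLog a) ζ := by
  unfold shiftLog
  refine continuousAt_id.add (ContinuousAt.clog ?_ (one_sub_mem_slitPlane h))
  fun_prop

end shiftLog

theorem neg_half_le_arg {z : ℂ} (h5 : 5 ≤ z.re) (hi : -(5 / 4) ≤ z.im) : -(1 / 2) ≤ arg z := by
  by_contra! h
  have h1 := (abs_le.1 (abs_arg_le_pi_div_two_iff.2 (by linarith : 0 ≤ z.re))).1
  have h2 := Real.mul_le_sin (x := -arg z) (by linarith) (by linarith)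
  rw [Real.sin_neg, sin_arg] at h2
  have h3 : 5 ≤ ‖z‖ := h5.trans (re_le_norm z)
  have h4 : -(z.im / ‖z‖) ≤ 1 / 4 := by
    rw [← neg_div, div_le_iff₀ (by linarith)]; linarith
  have h6 : 2 / π * (1 / 2) ≤ 2 / π * -arg z := by
    have := Real.pi_pos
    gcongr; linarith
  have h7 : 1 / 4 < 2 / π * (1 / 2) := by
    rw [div_mul_div_comm, div_lt_div_iff₀ (by norm_num) (by positivity)]
    linarith [Real.pi_lt_four]
  linarith

theorem arg_le_half {z : ℂ} (h5 : 5 ≤ z.re) (hi : z.im ≤ 5 / 4) : arg z ≤ 1 / 2 := by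
  have h1 := neg_half_le_arg (z := (starRingEnd ℂ) z) (by simpa using h5) (by simpa using hi)
  have h2 : arg z ≠ π := fun h => by
    have := (arg_eq_pi_iff.1 h).1
    linarith
  rw [arg_conj, if_neg h2] at h1
  linarith

namespace SectorCharts

variable {f : ℂ → ℂ} {d : ℕ} {F : NormalForm f d} (D : SectorCharts F) {j : ℤ}

theorem eq_of_near {τ τ' : ℂ} (h : D.r < τ.re) (h' : D.r < τ'.re) (hi : -(2 * π) ≤ τ.im)
    (hi' : -(2 * π) ≤ τ'.im) (hd : τ.im < 2 * π * (d + 1)) (hd' : τ'.im < 2 * π * (d + 1))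
    (hii : |τ.im - τ'.im| ≤ 5) (hp : ‖F.potential τ - F.potential τ'‖ ≤ 4)
    (he : f (exp (F.N τ)) = f (exp (F.N τ'))) : τ = τ' := by
  have hπ := Real.pi_pos
  have hπ3 := Real.pi_gt_three
  have hd0 : (0 : ℝ) ≤ d := Nat.cast_nonneg d
  have hn := D.near τ τ' h h' (abs_le.2 ⟨by nlinarith, by nlinarith⟩)
    (abs_le.2 ⟨by nlinarith, by nlinarith⟩) hii hp
  set j : ℤ := ⌊τ.im / (2 * π)⌋ with hj
  have h1 : (j : ℝ) * (2 * π) ≤ τ.im := (le_div_iff₀ Real.two_pi_pos).1 (Int.floor_le _)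
  have h2 : τ.im < (j + 1) * (2 * π) := (div_lt_iff₀ Real.two_pi_pos).1 (Int.lt_floor_add_one _)
  have hj1 : -1 ≤ j := by
    rw [hj, Int.le_floor, le_div_iff₀ Real.two_pi_pos]; push_cast; linarith
  have hj2 : j ≤ d := by
    have : (j : ℝ) < d + 1 := by
      by_contra! hc
      nlinarith
    have : j < d + 1 := by exact_mod_cast this
    omega
  have hm : τ ∈ halfStrip D.r (sectorCenter j) (5 * π / 4) :=
    ⟨h, by rw [sectorCenter, abs_lt]; constructor <;> linarith⟩
  have him := (abs_im_le_norm (τ - τ')).trans hn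
  rw [sub_im, abs_le] at him
  have hm' : τ' ∈ halfStrip D.r (sectorCenter j) (5 * π / 4) :=
    ⟨h', by rw [sectorCenter, abs_lt]; constructor <;> linarith⟩
  refine D.injOn_T j hj1 hj2 hm hm' ?_
  rw [D.eq_add j hj1 hj2 τ hm, D.eq_add j hj1 hj2 τ' hm', add_right_inj] at he
  have hL := D.norm_sub_potential_le j hj1 hj2 τ hm
  have hL' := D.norm_sub_potential_le j hj1 hj2 τ' hm'
  have hLL : ‖exp (D.T j τ) - exp (D.T j τ')‖ ≤ 5 := by
    have e : exp (D.T j τ) - exp (D.T j τ') = (exp (D.T j τ) - F.potential τ) -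
      (exp (D.T j τ') - F.potential τ') + (F.potential τ - F.potential τ') := by ring
    rw [e]
    refine (norm_add_le _ _).trans ?_
    linarith [norm_sub_le (exp (D.T j τ) - F.potential τ) (exp (D.T j τ') - F.potential τ')]
  have hT := D.norm_T_sub_le j hj1 hj2 τ hm
  have hT' := D.norm_T_sub_le j hj1 hj2 τ' hm'
  refine eq_of_exp_eq_exp (eq_of_exp_eq_exp he hLL) ?_
  have e : D.T j τ - D.T j τ' = (D.T j τ - τ) - (D.T j τ' - τ') + (τ - τ') := by ring
  rw [e]
  refine (norm_add_le _ _).trans ?_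
  linarith [norm_sub_le (D.T j τ - τ) (D.T j τ' - τ')]

theorem S_spec (h1 : -1 ≤ j) (h2 : j ≤ d) {s : ℂ}
    (hs : s ∈ halfStrip (D.r + 1 / 8) (sectorCenter j) (5 * π / 4 - 1 / 8)) :
    D.S j s ∈ halfStrip D.r (sectorCenter j) (5 * π / 4) ∧
    f (exp (F.N (D.S j s))) = D.a j + exp (exp s) ∧ ‖F.potential (D.S j s) - exp s‖ ≤ 1 / 4 ∧
    ‖D.S j s - s‖ ≤ 1 / 8 := by
  have h3 := D.norm_S_sub_le j h1 h2 s hs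
  have h4 : D.S j s ∈ halfStrip D.r (sectorCenter j) (5 * π / 4) :=
    closedBall_subset_halfStrip hs (by rwa [mem_closedBall, dist_eq_norm])
  have h5 := D.eq_add j h1 h2 _ h4
  have h6 := D.norm_sub_potential_le j h1 h2 _ h4
  rw [D.T_S j h1 h2 s hs] at h5 h6
  exact ⟨h4, h5, by rwa [norm_sub_rev], h3⟩

/-- The inverse of `log (f - a j)` in the `j`-th logarithmic sector. -/
noncomputable def J (j : ℤ) (ζ : ℂ) : ℂ := D.S j (log (-ζ) + sectorCenter j * I)

theorem log_mem {ζ : ℂ} (hζ : Real.exp (D.r + 1) < ‖ζ‖) :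
    log (-ζ) + sectorCenter j * I ∈ halfStrip (D.r + 1 / 8) (sectorCenter j) (5 * π / 4 - 1 / 8) := by
  constructor
  · have : D.r + 1 < Real.log ‖ζ‖ := (Real.lt_log_iff_exp_lt ((Real.exp_pos _).trans hζ)).2 hζ
    simp [log_re]
    linarith
  · have := abs_arg_le_pi (-ζ)
    simp [log_im]
    linarith [Real.pi_gt_three]

end SectorCharts

namespace SectorCharts

variable {f : ℂ → ℂ} {d : ℕ} {F : NormalForm f d} (D : SectorCharts F) {j : ℤ}

theorem J_spec (h1 : -1 ≤ j) (h2 : j ≤ d) {ζ : ℂ} (hζ : Real.exp (D.r + 1) < ‖ζ‖) :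
    D.r < (D.J j ζ).re ∧ f (exp (F.N (D.J j ζ))) = D.a j + exp ζ ∧
    ‖F.potential (D.J j ζ) - ζ‖ ≤ 1 / 4 ∧
    |(D.J j ζ).im - (sectorCenter j + arg (-ζ))| ≤ 1 / 8 ∧
    Real.log ‖ζ‖ - 1 / 8 ≤ (D.J j ζ).re := by
  obtain ⟨h3, h4, h5, h6⟩ := D.S_spec h1 h2 (D.log_mem (j := j) hζ)
  have h0 : -ζ ≠ 0 := neg_ne_zero.2 (norm_pos_iff.1 ((Real.exp_pos _).trans hζ))
  have e : exp (log (-ζ) + sectorCenter j * I) = ζ := by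
    rw [exp_add, exp_log h0, exp_sectorCenter]; ring
  rw [e] at h4 h5
  have h7 := (abs_im_le_norm _).trans h6
  have h8 := (abs_re_le_norm _).trans h6
  simp [log_im, log_re] at h7 h8
  refine ⟨h3.1, h4, h5, by rw [J, add_comm (sectorCenter j)]; linarith, ?_⟩
  rw [abs_le] at h8
  rw [J]
  linarith [h8.1]

theorem continuousAt_J (h1 : -1 ≤ j) (h2 : j ≤ d) {ζ : ℂ} (hζ : Real.exp (D.r + 1) < ‖ζ‖)
    (hs : -ζ ∈ slitPlane) : ContinuousAt (D.J j) ζ :=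
  ContinuousAt.comp (g := D.S j) (f := fun ζ => log (-ζ) + sectorCenter j * I)
    (D.continuousAt_S j h1 h2 _ (D.log_mem hζ))
    ((continuousAt_neg.clog hs).add continuousAt_const)

/-- A threshold beyond which all asymptotic values are negligible. -/
def IsThreshold (X : ℝ) : Prop :=
  Real.exp (D.r + 1) + 6 ≤ X ∧
    ∀ j : ℤ, -1 ≤ j → j ≤ d → ∀ ζ : ℂ, X < ζ.re → ‖D.a j * exp (-ζ)‖ ≤ 1 / 16

theorem exists_isThreshold : ∃ X, D.IsThreshold X := by
  obtain ⟨A, hA⟩ := ((Finset.Icc (-1 : ℤ) d).image fun j => ‖D.a j‖).bddAbove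
  obtain ⟨X, hX⟩ := (((Real.tendsto_exp_neg_atTop_nhds_zero.const_mul |A|).eventually_lt_const
    (show |A| * 0 < 1 / 16 by norm_num)).and
    (eventually_ge_atTop (Real.exp (D.r + 1) + 6))).exists_forall_of_atTop
  refine ⟨X, (hX X le_rfl).2, fun j hj hj' ζ hζ => ?_⟩
  have h1 : ‖D.a j‖ ≤ |A| :=
    (hA (by simpa using ⟨j, ⟨hj, hj'⟩, rfl⟩)).trans (le_abs_self A)
  rw [norm_mul, norm_exp, neg_re]
  refine le_trans ?_ (hX ζ.re hζ.le).1.le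
  gcongr

/-- A branch of the inverse of `log f` over a half-plane, computed in the `i`-th sector. -/
noncomputable def P (i j : ℤ) (ζ : ℂ) : ℂ :=
  D.S i (log (shiftLog (D.a i) ζ) + 2 * π * j * I)

variable {D} {X : ℝ}

theorem P_spec (hX : D.IsThreshold X) {i : ℤ} (h1 : -1 ≤ i) (h2 : i ≤ d) {ζ : ℂ} (hζ : X < ζ.re)
    (hij : (i = j ∧ -1 ≤ ζ.im) ∨ (i = j - 1 ∧ ζ.im ≤ 1)) :
    ContinuousAt (D.P i j) ζ ∧ D.r < (D.P i j ζ).re ∧ f (exp (F.N (D.P i j ζ))) = exp ζ ∧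
    ‖F.potential (D.P i j ζ) - ζ‖ ≤ 1 / 2 ∧ |(D.P i j ζ).im - 2 * π * j| ≤ π / 2 + 1 / 8 ∧
    Real.log (‖ζ‖ - 1) - 1 / 8 ≤ (D.P i j ζ).re := by
  have hπ := Real.pi_gt_three
  have ha := hX.2 i h1 h2 ζ hζ
  set κ := shiftLog (D.a i) ζ with hκ
  have hκζ : ‖κ - ζ‖ ≤ 1 / 8 := norm_shiftLog_sub_le ha
  have hre := (abs_re_le_norm _).trans hκζ
  have him := (abs_im_le_norm _).trans hκζ
  rw [sub_re, abs_le] at hre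
  rw [sub_im, abs_le] at him
  have hE := Real.exp_pos (D.r + 1)
  have h5 : Real.exp (D.r + 1) + 5 ≤ κ.re := by linarith [hX.1]
  have hslit : κ ∈ slitPlane := Or.inl (by linarith)
  have hn := re_le_norm κ
  have harg := abs_le.1 (abs_arg_le_pi_div_two_iff.2 (by linarith : 0 ≤ κ.re))
  have hlogn : D.r + 1 < Real.log ‖κ‖ :=
    (Real.lt_log_iff_exp_lt (by linarith)).2 (by linarith)
  have hmem : log κ + 2 * π * j * I ∈
      halfStrip (D.r + 1 / 8) (sectorCenter i) (5 * π / 4 - 1 / 8) := by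
    refine ⟨by simp [log_re]; linarith, ?_⟩
    have e : (log κ + 2 * π * j * I).im = arg κ + 2 * π * j := by simp [log_im]
    rw [e, sectorCenter, abs_lt]
    rcases hij with ⟨rfl, h⟩ | ⟨rfl, h⟩
    · have := neg_half_le_arg (z := κ) (by linarith) (by linarith)
      constructor <;> linarith
    · have := arg_le_half (z := κ) (by linarith) (by linarith)
      push_cast
      constructor <;> linarith
  obtain ⟨h6, h7, h8, h9⟩ := D.S_spec h1 h2 hmem
  have e : exp (log κ + 2 * π * j * I) = κ := by
    have e1 : log κ + 2 * π * j * I = log κ + j * (2 * π * I) := by ring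
    rw [e1, exp_add, exp_log (slitPlane_ne_zero hslit), exp_int_mul_two_pi_mul_I, mul_one]
  rw [e] at h7 h8
  have h10 := (abs_im_le_norm _).trans h9
  have h11 := (abs_re_le_norm _).trans h9
  simp only [sub_im, sub_re, add_im, add_re, log_im, log_re] at h10 h11
  simp at h10 h11
  rw [abs_le] at h10 h11
  refine ⟨?_, h6.1, ?_, ?_, ?_, ?_⟩
  · exact ContinuousAt.comp (g := D.S i) (D.continuousAt_S i h1 h2 _ hmem)
      (((continuousAt_shiftLog ha).clog hslit).add continuousAt_const)
  · rw [P, h7, exp_shiftLog ha]; ring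
  · have e2 : F.potential (D.P i j ζ) - ζ = (F.potential (D.P i j ζ) - κ) + (κ - ζ) := by ring
    rw [e2]
    have := norm_add_le (F.potential (D.P i j ζ) - κ) (κ - ζ)
    rw [P] at this ⊢
    linarith
  · rw [P, abs_le]; constructor <;> linarith [h10.1, h10.2]
  · have h12 : ‖ζ‖ - 1 ≤ ‖κ‖ := by
      have := norm_sub_norm_le ζ κ
      rw [norm_sub_rev] at this
      linarith
    have h13 := Real.log_le_log (by linarith [re_le_norm ζ, hX.1] : 0 < ‖ζ‖ - 1) h12
    rw [P]
    linarith [h11.1]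

variable (D) in
/-- The inverse of `log f` over the right half-plane with values around `2 * π * j * I`. -/
noncomputable def K (j : ℤ) (ζ : ℂ) : ℂ := if 0 ≤ ζ.im then D.P j j ζ else D.P (j - 1) j ζ

theorem P_eq_P (hX : D.IsThreshold X) (h1 : 0 ≤ j) (h2 : j ≤ d) {ζ : ℂ} (hζ : X < ζ.re)
    (hi : |ζ.im| ≤ 1) : D.P j j ζ = D.P (j - 1) j ζ := by
  have hπ := Real.pi_gt_three
  have hπ' := Real.pi_lt_d2
  rw [abs_le] at hi
  obtain ⟨-, a1, a2, a3, a4, -⟩ := P_spec hX (j := j) (by omega) h2 hζ (Or.inl ⟨rfl, hi.1⟩)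
  obtain ⟨-, b1, b2, b3, b4, -⟩ := P_spec hX (i := j - 1) (j := j) (by omega) (by omega) hζ
    (Or.inr ⟨rfl, hi.2⟩)
  rw [abs_le] at a4 b4
  have hj1 : (0 : ℝ) ≤ j := by exact_mod_cast h1
  have hj2 : (j : ℝ) ≤ d := by exact_mod_cast h2
  refine D.eq_of_near a1 b1 ?_ ?_ ?_ ?_ ?_ ?_ (a2.trans b2.symm)
  · nlinarith
  · nlinarith
  · nlinarith
  · nlinarith
  · rw [abs_le]; constructor <;> linarith
  · have e : F.potential (D.P j j ζ) - F.potential (D.P (j - 1) j ζ) =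
      (F.potential (D.P j j ζ) - ζ) - (F.potential (D.P (j - 1) j ζ) - ζ) := by ring
    rw [e]
    exact (norm_sub_le _ _).trans (by linarith)

theorem K_spec (hX : D.IsThreshold X) (h1 : 0 ≤ j) (h2 : j ≤ d) {ζ : ℂ} (hζ : X < ζ.re) :
    ContinuousAt (D.K j) ζ ∧ D.r < (D.K j ζ).re ∧ f (exp (F.N (D.K j ζ))) = exp ζ ∧
    ‖F.potential (D.K j ζ) - ζ‖ ≤ 1 / 2 ∧ |(D.K j ζ).im - 2 * π * j| ≤ π / 2 + 1 / 8 ∧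
    Real.log (‖ζ‖ - 1) - 1 / 8 ≤ (D.K j ζ).re := by
  have hO : IsOpen {z : ℂ | X < z.re} := isOpen_reGt X
  rcases lt_or_ge (-1) ζ.im with h | h
  · have hK : ∀ z : ℂ, X < z.re → -1 < z.im → D.K j z = D.P j j z := by
      intro z hz hzi
      rw [K]
      split_ifs with h0
      · rfl
      · exact (P_eq_P hX h1 h2 hz (abs_le.2 ⟨hzi.le, by linarith⟩)).symm
    obtain ⟨h3, h4⟩ := P_spec hX (j := j) (by omega) h2 hζ (Or.inl ⟨rfl, h.le⟩)
    rw [hK ζ hζ h]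
    refine ⟨h3.congr_of_eventuallyEq ?_, h4⟩
    filter_upwards [hO.mem_nhds hζ, (isOpen_lt continuous_const continuous_im).mem_nhds h]
      with z hz hzi using hK z hz hzi
  · have hK : ∀ z : ℂ, X < z.re → z.im < 0 → D.K j z = D.P (j - 1) j z := by
      intro z hz hzi
      rw [K, if_neg (by linarith)]
    obtain ⟨h3, h4⟩ := P_spec hX (i := j - 1) (j := j) (by omega) (by omega) hζ
      (Or.inr ⟨rfl, by linarith⟩)
    have h' : ζ.im < 0 := by linarith
    rw [hK ζ hζ h']
    refine ⟨h3.congr_of_eventuallyEq ?_, h4⟩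
    filter_upwards [hO.mem_nhds hζ, (isOpen_lt continuous_im continuous_const).mem_nhds h']
      with z hz hzi using hK z hz hzi

end SectorCharts

theorem apply_add_int_mul_eq {G : ℂ → ℂ} {ρ : ℝ} {p q : ℂ} (hp : p.re = 0)
    (hG : ∀ τ : ℂ, ρ < τ.re → G (τ + p) = G τ + q) (m : ℤ) {τ : ℂ} (hτ : ρ < τ.re) :
    G (τ + m * p) = G τ + m * q := by
  have hre : ∀ n : ℤ, ρ < (τ + n * p).re := fun n => by simpa [hp] using hτ
  induction m using Int.induction_on with
  | zero => simp
  | succ i ih =>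
    have := hG _ (hre i)
    rw [ih] at this
    rw [show τ + ((i + 1 : ℤ) : ℂ) * p = τ + (i : ℤ) * p + p by push_cast; ring, this]
    push_cast; ring
  | pred i ih =>
    have := hG _ (hre (-i - 1))
    rw [show τ + ((-i - 1 : ℤ) : ℂ) * p + p = τ + ((-i : ℤ) : ℂ) * p by push_cast; ring, ih] at this
    push_cast at this ⊢
    linear_combination -this

namespace NormalForm

variable {f : ℂ → ℂ} {d : ℕ} (F : NormalForm f d)

theorem N_add_int (m : ℤ) {τ : ℂ} (hτ : F.ρ < τ.re) :
    F.N (τ + m * (2 * π * I * d)) = F.N τ + m * (2 * π * I) :=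
  apply_add_int_mul_eq (by simp) F.N_period m hτ

theorem potential_add_int (m : ℤ) {τ : ℂ} (hτ : F.ρ < τ.re) :
    F.potential (τ + m * (2 * π * I * d)) = F.potential τ + m * (2 * π * I * (F.k - d : ℤ)) := by
  refine apply_add_int_mul_eq (by simp) (fun τ hτ => ?_) m hτ
  have : exp (τ + 2 * π * I * d) = exp τ := by
    rw [mul_comm, exp_add, exp_nat_mul_two_pi_mul_I, mul_one]
  rw [potential, potential, F.l_period τ hτ, this]
  push_cast; ring

theorem exists_int_of_exp_N_eq {τ τ' : ℂ} (hτ : F.ρ < τ.re) (hτ' : F.ρ < τ'.re)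
    (h : exp (F.N τ) = exp (F.N τ')) : ∃ m : ℤ, τ = τ' + m * (2 * π * I * d) := by
  obtain ⟨m, hm⟩ := exp_eq_exp_iff_exists_int.1 h
  refine ⟨m, F.N_inj hτ ?_ ?_⟩
  · simpa using hτ'
  · rw [hm, F.N_add_int m hτ']

theorem exists_shift (y : ℝ) {τ : ℂ} (hτ : F.ρ < τ.re) : ∃ τ' : ℂ, τ'.re = τ.re ∧ y ≤ τ'.im ∧
    τ'.im < y + 2 * π * d ∧ exp (F.N τ') = exp (F.N τ) := by
  have hd : (0 : ℝ) < 2 * π * d := by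
    have : (0 : ℝ) < d := by exact_mod_cast F.d_pos
    positivity
  set m : ℤ := ⌊(τ.im - y) / (2 * π * d)⌋ with hm
  have h1 : (m : ℝ) * (2 * π * d) ≤ τ.im - y := (le_div_iff₀ hd).1 (Int.floor_le _)
  have h2 : τ.im - y < (m + 1) * (2 * π * d) := (div_lt_iff₀ hd).1 (Int.lt_floor_add_one _)
  refine ⟨τ + (-m : ℤ) * (2 * π * I * d), by simp, ?_, ?_, ?_⟩
  · simp; linarith
  · simp; linarith
  · rw [F.N_add_int _ hτ, exp_add, exp_int_mul_two_pi_mul_I, mul_one]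

theorem div_sub_le_re_N {τ : ℂ} (hτ : F.ρ < τ.re) : τ.re / d - F.C ≤ (F.N τ).re := by
  have h1 := (abs_re_le_norm _).trans (F.N_close τ hτ)
  rw [sub_re, div_natCast_re, abs_le] at h1
  linarith [h1.1]

theorem exists_preimage_of_re (r : ℝ) : ∃ R : ℝ, ∀ ω : ℂ, R ≤ ω.re → ∃ τ : ℂ, r < τ.re ∧
    F.ρ < τ.re ∧ F.N τ = ω := by
  obtain ⟨R, hR⟩ := F.N_cover
  have hd : (0 : ℝ) < d := by exact_mod_cast F.d_pos
  refine ⟨max R (F.C + 1 + |r| / d), fun ω hω => ?_⟩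
  obtain ⟨τ, hτ, rfl⟩ := hR ω ((le_max_left _ _).trans hω)
  refine ⟨τ, ?_, hτ, rfl⟩
  have h1 := (abs_re_le_norm _).trans (F.N_close τ hτ)
  rw [sub_re, div_natCast_re, abs_le] at h1
  have h2 := (le_max_right _ _).trans hω
  have h3 : |r| / d < τ.re / d := by linarith [h1.2]
  rw [div_lt_div_iff_of_pos_right hd] at h3
  exact (le_abs_self r).trans_lt h3

end NormalForm

theorem Int.eq_zero_of_eq_add_mul {i j n m : ℤ} (hi : 0 ≤ i) (hi' : i < n) (hj : 0 ≤ j)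
    (hj' : j < n) (h : i = j + n * m) : m = 0 := by
  rcases lt_trichotomy m 0 with h1 | h1 | h1
  · nlinarith
  · exact h1
  · nlinarith

namespace SectorCharts

variable {f : ℂ → ℂ} {d : ℕ} {F : NormalForm f d} {D : SectorCharts F} {j j' : ℤ} {X : ℝ}

/-- Equality of points from equality of their images in the `z`-plane. -/
theorem eq_of_exp_N_eq {τ τ' ζ ζ' y : ℂ} (hj : 0 ≤ j) (hjd : j < d) (hj' : 0 ≤ j') (hjd' : j' < d)
    (hτ : F.ρ < τ.re) (hτ' : F.ρ < τ'.re) (h : exp (F.N τ) = exp (F.N τ'))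
    (him : |(τ.im - 2 * π * j) - (τ'.im - 2 * π * j')| < 2 * π)
    (hζ : ‖F.potential τ - ζ‖ ≤ 1 / 2) (hζ' : ‖F.potential τ' - ζ'‖ ≤ 1 / 2)
    (hf : j = j' → f (exp (F.N τ)) = y + exp ζ) (hf' : f (exp (F.N τ')) = y + exp ζ') :
    j = j' ∧ ζ = ζ' := by
  obtain ⟨m, hm⟩ := F.exists_int_of_exp_N_eq hτ hτ' h
  have h1 : τ.im = τ'.im + m * (2 * π * d) := by
    rw [hm]; simp
  have h2 : |((j - j' - d * m : ℤ) : ℝ)| < 1 := by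
    have e : (τ.im - 2 * π * j) - (τ'.im - 2 * π * j') =
        -((2 * π) * ((j - j' - d * m : ℤ) : ℝ)) := by
      rw [h1]; push_cast; ring
    rw [e, abs_neg, abs_mul, abs_of_pos Real.two_pi_pos] at him
    have := Real.two_pi_pos
    nlinarith
  have h3 : j - j' - d * m = 0 := by
    rw [← Int.cast_abs] at h2
    exact Int.abs_lt_one_iff.1 (by exact_mod_cast h2)
  have hm0 : m = 0 := Int.eq_zero_of_eq_add_mul hj hjd hj' hjd' (by linarith)
  rw [hm0, mul_zero, sub_zero, sub_eq_zero] at h3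
  refine ⟨h3, eq_of_exp_eq_exp ?_ ?_⟩
  · have := hf h3
    rw [h, hf', add_right_inj] at this
    exact this.symm
  · have hττ : τ = τ' := by rw [hm, hm0]; simp
    have e : ζ - ζ' = (F.potential τ' - ζ') - (F.potential τ - ζ) := by rw [hττ]; ring
    rw [e]
    exact (norm_sub_le _ _).trans (by linarith)

theorem norm_sub_le_of_exp_N_eq {τ τ' ζ ζ' : ℂ}
    (hτ : F.ρ < τ.re) (hτ' : F.ρ < τ'.re) (h : exp (F.N τ) = exp (F.N τ'))
    (him : |τ.im - τ'.im| ≤ 2 * π * (d + 2))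
    (hζ : ‖F.potential τ - ζ‖ ≤ 1 / 2) (hζ' : ‖F.potential τ' - ζ'‖ ≤ 1 / 2) :
    ‖ζ - ζ'‖ ≤ 1 + (d + 2) * ‖2 * π * I * (F.k - d : ℤ)‖ := by
  obtain ⟨m, hm⟩ := F.exists_int_of_exp_N_eq hτ hτ' h
  have hd : (1 : ℝ) ≤ d := by exact_mod_cast F.d_pos
  have h1 : τ.im - τ'.im = m * (2 * π * d) := by
    rw [hm]; simp
  have h2 : |(m : ℝ)| ≤ d + 2 := by
    rw [h1, abs_mul, abs_of_nonneg (by positivity : (0 : ℝ) ≤ 2 * π * d)] at him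
    have h3 : |(m : ℝ)| * d ≤ d + 2 :=
      le_of_mul_le_mul_left (by linarith) Real.two_pi_pos
    nlinarith [abs_nonneg (m : ℝ)]
  have h3 := F.potential_add_int m hτ'
  rw [← hm] at h3
  have e : ζ - ζ' = (F.potential τ' - ζ') - (F.potential τ - ζ) + m * (2 * π * I * (F.k - d : ℤ)) := by
    rw [h3]; ring
  rw [e]
  refine (norm_add_le _ _).trans ?_
  have h4 := norm_sub_le (F.potential τ' - ζ') (F.potential τ - ζ)
  have h5 : ‖(m : ℂ) * (2 * π * I * (F.k - d : ℤ))‖ ≤ (d + 2) * ‖2 * π * I * (F.k - d : ℤ)‖ := by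
    rw [norm_mul, Complex.norm_intCast]
    gcongr
  linarith

theorem exists_K_of_large (hX : D.IsThreshold X) : ∃ R : ℝ, ∀ ω : ℂ, R ≤ ω.re →
    R ≤ ‖f (exp ω)‖ → ∃ j : ℤ, 0 ≤ j ∧ j < d ∧ ∃ ζ : ℂ, X < ζ.re ∧
      exp ω = exp (F.N (D.K j ζ)) := by
  have hπ := Real.pi_gt_three
  have hπ' := Real.pi_lt_d2
  obtain ⟨R₁, hR₁⟩ := F.exists_preimage_of_re D.r
  obtain ⟨A, hA⟩ := ((Finset.Icc (-1 : ℤ) d).image fun j => ‖D.a j‖).bddAbove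
  refine ⟨max R₁ (A + Real.exp (X + 1)), fun ω hω hfω => ?_⟩
  obtain ⟨τ₀, h1, h2, rfl⟩ := hR₁ ω ((le_max_left _ _).trans hω)
  obtain ⟨τ, h3, h4, h5, h6⟩ := F.exists_shift (-π) h2
  rw [← h6] at hfω ⊢
  have hr : D.r < τ.re := by rwa [h3]
  set j : ℤ := ⌊τ.im / (2 * π)⌋ with hj
  have g1 : (j : ℝ) * (2 * π) ≤ τ.im := (le_div_iff₀ Real.two_pi_pos).1 (Int.floor_le _)
  have g2 : τ.im < (j + 1) * (2 * π) := (div_lt_iff₀ Real.two_pi_pos).1 (Int.lt_floor_add_one _)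
  have hj1 : -1 ≤ j := by
    rw [hj, Int.le_floor, le_div_iff₀ Real.two_pi_pos]; push_cast; linarith
  have hj2 : j ≤ d := by
    have : (j : ℝ) < d := by nlinarith
    exact (by exact_mod_cast this : j < d).le
  have hm : τ ∈ halfStrip D.r (sectorCenter j) (5 * π / 4) :=
    ⟨hr, by rw [sectorCenter, abs_lt]; constructor <;> linarith⟩
  have hf := D.eq_add j hj1 hj2 τ hm
  have hL := D.norm_sub_potential_le j hj1 hj2 τ hm
  have hT := (abs_im_le_norm _).trans (D.norm_T_sub_le j hj1 hj2 τ hm)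
  rw [sub_im, abs_le] at hT
  set L := exp (D.T j τ) with hLdef
  have hLre : X + 1 ≤ L.re := by
    have g3 := (le_max_right _ _).trans hfω
    have g4 : ‖D.a j‖ ≤ A := hA (by simpa using ⟨j, ⟨hj1, hj2⟩, rfl⟩)
    have g5 := norm_add_le (D.a j) (exp L)
    rw [← hf, norm_exp] at g5
    exact Real.exp_le_exp.1 (by linarith)
  have hX6 : 6 ≤ X := by linarith [hX.1, Real.exp_pos (D.r + 1)]
  set i : ℤ := ⌊((D.T j τ).im + π) / (2 * π)⌋ with hi
  have g6 : (i : ℝ) * (2 * π) ≤ (D.T j τ).im + π :=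
    (le_div_iff₀ Real.two_pi_pos).1 (Int.floor_le _)
  have g7 : (D.T j τ).im + π < (i + 1) * (2 * π) :=
    (div_lt_iff₀ Real.two_pi_pos).1 (Int.lt_floor_add_one _)
  have g8 : |(D.T j τ).im - i * (2 * π)| < π / 2 := by
    by_contra! hc
    have g9 : Real.cos |(D.T j τ).im - i * (2 * π)| ≤ 0 :=
      Real.cos_nonpos_of_pi_div_two_le_of_le hc (by
        have : |(D.T j τ).im - i * (2 * π)| ≤ π := abs_le.2 ⟨by linarith, by linarith⟩
        linarith)
    rw [Real.cos_abs, Real.cos_sub_int_mul_two_pi] at g9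
    have g10 : L.re = Real.exp (D.T j τ).re * Real.cos (D.T j τ).im := exp_re _
    nlinarith [Real.exp_pos (D.T j τ).re]
  rw [abs_lt] at g8
  have hi0 : 0 ≤ i := by
    have : (-1 : ℝ) < i := by nlinarith
    have : -1 < i := by exact_mod_cast this
    omega
  have hid : i < d := by
    have : (i : ℝ) < d := by nlinarith
    exact_mod_cast this
  have ha : ‖-D.a j * exp (-L)‖ ≤ 1 / 16 := by
    rw [neg_mul, norm_neg]; exact hX.2 j hj1 hj2 L (by linarith)
  have hs := norm_shiftLog_sub_le ha
  have hsre := (abs_re_le_norm _).trans hs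
  rw [sub_re, abs_le] at hsre
  have hXs : X < (shiftLog (-D.a j) L).re := by linarith
  refine ⟨i, hi0, hid, shiftLog (-D.a j) L, hXs, ?_⟩
  obtain ⟨-, k1, k2, k3, k4, -⟩ := K_spec hX hi0 hid.le hXs
  rw [abs_le] at k4
  have hi0' : (0 : ℝ) ≤ i := by exact_mod_cast hi0
  have hid' : (i : ℝ) + 1 ≤ d := by exact_mod_cast hid
  rw [D.eq_of_near hr k1 (by linarith) (by nlinarith) (by nlinarith) (by nlinarith)
    (abs_le.2 ⟨by linarith, by linarith⟩) ?_ ?_]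
  · have e : F.potential τ - F.potential (D.K i (shiftLog (-D.a j) L)) =
        -((shiftLog (-D.a j) L - L) + (F.potential (D.K i (shiftLog (-D.a j) L)) -
          shiftLog (-D.a j) L) + (L - F.potential τ)) := by ring
    rw [e, norm_neg]
    exact norm_add₃_le.trans (by linarith)
  · rw [hf, k2, exp_shiftLog ha]; ring

theorem exists_J_of_bounded (B : ℝ) : ∃ B' : ℝ, ∀ M : ℝ, ∃ R : ℝ, ∀ ω : ℂ, R ≤ ω.re →
    ‖f (exp ω)‖ ≤ B → ∃ j : ℤ, 0 ≤ j ∧ j < d ∧ ∃ ζ : ℂ, M ≤ ‖ζ‖ ∧ ζ.re ≤ B' ∧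
      exp ω = exp (F.N (D.J j ζ)) := by
  have hπ := Real.pi_gt_three
  have hπ' := Real.pi_lt_d2
  obtain ⟨A, hA⟩ := ((Finset.Icc (-1 : ℤ) d).image fun j => ‖D.a j‖).bddAbove
  set B' := Real.log (max (B + A) 1) with hB'
  refine ⟨B', fun M => ?_⟩
  set M' := max M (4 * |B'| + 1) with hM'
  have hM'0 : 0 < M' := lt_of_lt_of_le (by positivity) (le_max_right _ _)
  obtain ⟨R₁, hR₁⟩ := F.exists_preimage_of_re (max (D.r + 1 / 4) (Real.log M' + 1 / 8))
  refine ⟨R₁, fun ω hω hfω => ?_⟩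
  obtain ⟨τ₀, h1, h2, rfl⟩ := hR₁ ω hω
  obtain ⟨τ, h3, h4, h5, h6⟩ := F.exists_shift 0 h2
  rw [← h6] at hfω ⊢
  rw [← h3] at h1
  have hr : D.r + 1 / 4 < τ.re := (le_max_left _ _).trans_lt h1
  have hr' : Real.log M' + 1 / 8 < τ.re := (le_max_right _ _).trans_lt h1
  set j : ℤ := ⌊τ.im / (2 * π)⌋ with hj
  have g1 : (j : ℝ) * (2 * π) ≤ τ.im := (le_div_iff₀ Real.two_pi_pos).1 (Int.floor_le _)
  have g2 : τ.im < (j + 1) * (2 * π) := (div_lt_iff₀ Real.two_pi_pos).1 (Int.lt_floor_add_one _)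
  have hj0 : 0 ≤ j := by
    rw [hj, Int.le_floor, le_div_iff₀ Real.two_pi_pos]; push_cast; linarith
  have hjd : j < d := by
    have : (j : ℝ) < d := by nlinarith
    exact_mod_cast this
  have hj1 : -1 ≤ j := by omega
  have hm : τ ∈ halfStrip D.r (sectorCenter j) (5 * π / 4) :=
    ⟨by linarith, by rw [sectorCenter, abs_lt]; constructor <;> linarith⟩
  have hf := D.eq_add j hj1 hjd.le τ hm
  have hTn := D.norm_T_sub_le j hj1 hjd.le τ hm
  have hT := (abs_im_le_norm _).trans hTn
  have hT' := (abs_re_le_norm _).trans hTn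
  rw [sub_im, abs_le] at hT
  rw [sub_re, abs_le] at hT'
  set L := exp (D.T j τ) with hLdef
  have hLre : L.re ≤ B' := by
    have g4 : ‖D.a j‖ ≤ A := hA (by simpa using ⟨j, ⟨hj1, hjd.le⟩, rfl⟩)
    have g5 := norm_sub_le (f (exp (F.N τ))) (D.a j)
    rw [hf, add_sub_cancel_left, norm_exp, ← hf] at g5
    rw [hB', Real.le_log_iff_exp_le (by positivity)]
    exact le_max_of_le_left (by linarith)
  have hLn : M' ≤ ‖L‖ := by
    rw [hLdef, norm_exp, ← Real.log_le_iff_le_exp hM'0]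
    linarith
  have hy : |(D.T j τ).im - sectorCenter j| < π := by
    by_contra! hc
    set y := (D.T j τ).im - sectorCenter j with hy
    have hyle : |y| ≤ π + 1 / 8 := by
      rw [hy, sectorCenter, abs_le]; constructor <;> linarith
    have g6 : Real.cos y ≤ -(1 / 2) := by
      have h7 := Real.one_sub_sq_div_two_le_cos (x := |y| - π)
      rw [Real.cos_sub_pi, Real.cos_abs] at h7
      nlinarith
    have g7 : L = -exp (D.T j τ - sectorCenter j * I) := by
      rw [exp_sub, exp_sectorCenter, div_neg, div_one, neg_neg]
    have g8 : L.re = -(‖L‖ * Real.cos y) := by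
      rw [hLdef, norm_exp, ← hLdef, g7, neg_re, exp_re]
      simp [hy]
    have g9 := (le_max_right _ _).trans hLn
    have g10 := le_abs_self B'
    nlinarith [norm_nonneg L]
  refine ⟨j, hj0, hjd, L, (le_max_left _ _).trans hLn, hLre, ?_⟩
  have hlog : log (-L) + sectorCenter j * I = D.T j τ := by
    have g7 : -L = exp (D.T j τ - sectorCenter j * I) := by
      rw [exp_sub, exp_sectorCenter, div_neg, div_one]
    rw [abs_lt] at hy
    rw [g7, log_exp, sub_add_cancel]
    · simp; linarith
    · simp; linarith
  rw [J, hlog]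
  have hTm : D.T j τ ∈ halfStrip (D.r + 1 / 8) (sectorCenter j) (5 * π / 4 - 1 / 8) :=
    ⟨by linarith, by linarith⟩
  obtain ⟨k1, -⟩ := D.S_spec hj1 hjd.le hTm
  rw [D.injOn_T j hj1 hjd.le k1 hm (D.T_S j hj1 hjd.le _ hTm)]

end SectorCharts

/-- The complement of a right half-strip. -/
def leftDomain (Y : ℝ) : Set ℂ := {ζ | ζ.re < -Y ∨ Y < |ζ.im|}

/-- Charts at infinity for `f` in logarithmic coordinates: `J j` are logarithms of inverse branches
of `log (f - a j)`, and `K j` are logarithms of inverse branches of `log f`. -/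
structure LogCharts (f : ℂ → ℂ) (d : ℕ) where
  a : ℕ → ℂ
  J : ℕ → ℂ → ℂ
  K : ℕ → ℂ → ℂ
  X : ℝ
  Y : ℝ
  C : ℝ
  k : ℤ
  d_pos : 0 < d
  a_small : ∀ j < d, ∀ ζ : ℂ, X < ζ.re → ‖a j * exp (-ζ)‖ ≤ 1 / 16
  J_cont : ∀ j < d, ContinuousOn (J j) (leftDomain Y)
  K_cont : ∀ j < d, ContinuousOn (K j) {ζ | X < ζ.re}
  f_J : ∀ j < d, ∀ ζ ∈ leftDomain Y, f (exp (J j ζ)) = a j + exp ζ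
  f_K : ∀ j < d, ∀ ζ : ℂ, X < ζ.re → f (exp (K j ζ)) = exp ζ
  link_up : ∀ j < d, ∀ ζ : ℂ, X < ζ.re → 1 ≤ ζ.im → K j ζ = J j (shiftLog (a j) ζ)
  link_down : ∀ j, j + 1 < d → ∀ ζ : ℂ, X < ζ.re → ζ.im ≤ -1 →
    K (j + 1) ζ = J j (shiftLog (a j) ζ)
  link_last : ∀ ζ : ℂ, X < ζ.re → ζ.im ≤ -C →
    K 0 (ζ - 2 * π * I * k) + 2 * π * I = J (d - 1) (shiftLog (a (d - 1)) ζ)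
  inj_K : ∀ j < d, ∀ j' < d, ∀ ζ ζ' : ℂ, X < ζ.re → X < ζ'.re →
    exp (K j ζ) = exp (K j' ζ') → j = j' ∧ ζ = ζ'
  inj_J : ∀ j < d, ∀ j' < d, ∀ ζ ζ' : ℂ,
    (ζ.re < -Y ∧ ζ'.re < -Y) ∨ (Y < ζ.im ∧ Y < ζ'.im) ∨ (ζ.im < -Y ∧ ζ'.im < -Y) →
    exp (J j ζ) = exp (J j' ζ') → j = j' ∧ ζ = ζ'
  overlap_KJ : ∀ j < d, ∀ j' < d, ∀ ζ ζ' : ℂ, X < ζ.re → ζ' ∈ leftDomain Y →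
    exp (K j ζ) = exp (J j' ζ') → ‖ζ - ζ'‖ ≤ C
  overlap_JJ : ∀ j < d, ∀ j' < d, ∀ ζ ∈ leftDomain Y, ∀ ζ' ∈ leftDomain Y,
    exp (J j ζ) = exp (J j' ζ') → ‖ζ - ζ'‖ ≤ C
  cover_K : ∃ R : ℝ, ∀ ω : ℂ, R ≤ ω.re → R ≤ ‖f (exp ω)‖ → ∃ j < d, ∃ ζ : ℂ, X < ζ.re ∧
    exp ω = exp (K j ζ)
  cover_J : ∀ B : ℝ, ∃ B' : ℝ, ∀ M : ℝ, ∃ R : ℝ, ∀ ω : ℂ, R ≤ ω.re → ‖f (exp ω)‖ ≤ B →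
    ∃ j < d, ∃ ζ : ℂ, M ≤ ‖ζ‖ ∧ ζ.re ≤ B' ∧ exp ω = exp (J j ζ)
  proper : ∀ M : ℝ, ∃ R : ℝ, ∀ j < d, ∀ ζ : ℂ, R ≤ ‖ζ‖ →
    (ζ ∈ leftDomain Y → M ≤ (J j ζ).re) ∧ (X < ζ.re → M ≤ (K j ζ).re)

theorem lt_norm_of_mem_leftDomain {Y : ℝ} {ζ : ℂ} (h : ζ ∈ leftDomain Y) : Y < ‖ζ‖ := by
  rcases h with h | h
  · have := neg_abs_le ζ.re
    linarith [abs_re_le_norm ζ]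
  · exact h.trans_le (abs_im_le_norm ζ)

theorem neg_mem_slitPlane_of_mem_leftDomain {Y : ℝ} (hY : 0 ≤ Y) {ζ : ℂ} (h : ζ ∈ leftDomain Y) :
    -ζ ∈ slitPlane := by
  rcases h with h | h
  · left; simp; linarith
  · right
    simp only [neg_im, ne_eq, neg_eq_zero]
    intro h0
    simp [h0] at h
    linarith

theorem log_neg_of_im_pos {z : ℂ} (h : 0 < z.im) : log (-z) = log z - π * I := by
  rw [log, log, norm_neg, arg_neg_eq_arg_sub_pi_of_im_pos h]
  push_cast; ring

theorem log_neg_of_im_neg {z : ℂ} (h : z.im < 0) : log (-z) = log z + π * I := by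
  rw [log, log, norm_neg, arg_neg_eq_arg_add_pi_of_im_neg h]
  push_cast; ring

namespace SectorCharts

variable {f : ℂ → ℂ} {d : ℕ} {F : NormalForm f d} {D : SectorCharts F} {j j' : ℤ} {X : ℝ}

theorem K_eq_J (hX : D.IsThreshold X) (h1 : -1 ≤ j) (h2 : j ≤ d) {ζ : ℂ} (hζ : X < ζ.re)
    (h : 1 ≤ ζ.im) : D.K j ζ = D.J j (shiftLog (D.a j) ζ) := by
  have h3 := (abs_im_le_norm _).trans (norm_shiftLog_sub_le (hX.2 j h1 h2 ζ hζ))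
  rw [sub_im, abs_le] at h3
  rw [K, if_pos (by linarith), P, J, log_neg_of_im_pos (by linarith), sectorCenter]
  congr 1
  push_cast; ring

theorem K_add_one_eq_J (hX : D.IsThreshold X) (h1 : -1 ≤ j) (h2 : j ≤ d) {ζ : ℂ} (hζ : X < ζ.re)
    (h : ζ.im ≤ -1) : D.K (j + 1) ζ = D.J j (shiftLog (D.a j) ζ) := by
  have h3 := (abs_im_le_norm _).trans (norm_shiftLog_sub_le (hX.2 j h1 h2 ζ hζ))
  rw [sub_im, abs_le] at h3
  rw [K, if_neg (by linarith), P, J, log_neg_of_im_neg (by linarith), sectorCenter,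
    add_sub_cancel_right]
  congr 1
  push_cast; ring

theorem N_K_zero_add_eq (hX : D.IsThreshold X) {ζ : ℂ} (hζ : X < ζ.re) (h : ζ.im ≤ -1) :
    F.N (D.K 0 (ζ - 2 * π * I * (F.k - d : ℤ))) + 2 * π * I =
      F.N (D.J (d - 1) (shiftLog (D.a (d - 1)) ζ)) := by
  have hd0 : 1 ≤ d := F.d_pos
  have hd : (1 : ℝ) ≤ d := by exact_mod_cast hd0
  have hπ := Real.pi_gt_three
  have hπ' := Real.pi_lt_d2
  have ha := hX.2 (d - 1) (by omega) (by omega) ζ hζ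
  have h3 := norm_shiftLog_sub_le ha
  have h3i := (abs_im_le_norm _).trans h3
  have h3r := (abs_re_le_norm _).trans h3
  rw [sub_im, abs_le] at h3i
  rw [sub_re, abs_le] at h3r
  set κ := shiftLog (D.a (d - 1)) ζ with hκ
  set k : ℤ := F.k - d with hk
  have hκn : Real.exp (D.r + 1) < ‖κ‖ := by
    have := re_le_norm κ
    have := hX.1
    linarith
  have hX' : X < (ζ - 2 * π * I * k).re := by simpa using hζ
  obtain ⟨-, a1, a2, a3, a4, -⟩ := K_spec hX (j := 0) le_rfl (by omega) hX'
  obtain ⟨b1, b2, b3, b4, -⟩ := D.J_spec (j := d - 1) (by omega) (by omega) hκn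
  have harg : arg (-κ) = arg κ + π := arg_neg_eq_arg_add_pi_of_im_neg (by linarith)
  have hκre : 0 ≤ κ.re := by
    have := hX.1
    have := Real.exp_pos (D.r + 1)
    linarith
  have hκa := abs_le.1 (abs_arg_le_pi_div_two_iff.2 hκre)
  rw [harg, sectorCenter, abs_le] at b4
  rw [abs_le] at a4
  push_cast at a4 b4
  have hρ : F.ρ < (D.K 0 (ζ - 2 * π * I * k)).re := D.le_r.trans_lt a1
  have hN := F.N_add_int 1 hρ
  have hp := F.potential_add_int 1 hρ
  set τ := D.K 0 (ζ - 2 * π * I * k) with hτ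
  push_cast at hN hp
  rw [one_mul, one_mul] at hN hp
  rw [← hN]
  congr 1
  have hre : (τ + 2 * π * I * d).re = τ.re := by simp
  have him : (τ + 2 * π * I * d).im = τ.im + 2 * π * d := by simp
  refine D.eq_of_near (by rw [hre]; exact a1) b1 ?_ ?_ ?_ ?_ ?_ ?_ ?_
  · rw [him]; nlinarith
  · nlinarith
  · rw [him]; nlinarith
  · nlinarith
  · rw [him, abs_le]; constructor <;> nlinarith
  · have e : F.potential (τ + 2 * π * I * d) - F.potential (D.J (d - 1) κ) =
        (F.potential τ - (ζ - 2 * π * I * k)) - (F.potential (D.J (d - 1) κ) - κ) - (κ - ζ) := by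
      rw [hp, hk]; push_cast; ring
    rw [e]
    have := norm_sub_le (F.potential τ - (ζ - 2 * π * I * k)) (F.potential (D.J (d - 1) κ) - κ)
    have := norm_sub_le ((F.potential τ - (ζ - 2 * π * I * k)) -
      (F.potential (D.J (d - 1) κ) - κ)) (κ - ζ)
    linarith
  · rw [hN, exp_add, exp_two_pi_mul_I, mul_one, a2, b2, hκ, exp_shiftLog ha, exp_sub,
      mul_comm (2 * π * I : ℂ) k, exp_int_mul_two_pi_mul_I]
    ring

theorem eq_of_exp_K_eq (hX : D.IsThreshold X) (hj : 0 ≤ j) (hjd : j < d) (hj' : 0 ≤ j')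
    (hjd' : j' < d) {ζ ζ' : ℂ} (hζ : X < ζ.re) (hζ' : X < ζ'.re)
    (h : exp (F.N (D.K j ζ)) = exp (F.N (D.K j' ζ'))) : j = j' ∧ ζ = ζ' := by
  have hπ := Real.pi_gt_three
  obtain ⟨-, a1, a2, a3, a4, -⟩ := K_spec hX hj hjd.le hζ
  obtain ⟨-, b1, b2, b3, b4, -⟩ := K_spec hX hj' hjd'.le hζ'
  rw [abs_le] at a4 b4
  refine eq_of_exp_N_eq (y := 0) hj hjd hj' hjd' (D.le_r.trans_lt a1) (D.le_r.trans_lt b1) h ?_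
    a3 b3 (fun _ => by rw [a2, zero_add]) (by rw [b2, zero_add])
  rw [abs_lt]; constructor <;> linarith

theorem eq_of_exp_J_eq (hj : 0 ≤ j) (hjd : j < d) (hj' : 0 ≤ j')
    (hjd' : j' < d) {ζ ζ' : ℂ} (hζ : Real.exp (D.r + 1) < ‖ζ‖) (hζ' : Real.exp (D.r + 1) < ‖ζ'‖)
    (harg : |arg (-ζ) - arg (-ζ')| ≤ π)
    (h : exp (F.N (D.J j ζ)) = exp (F.N (D.J j' ζ'))) : j = j' ∧ ζ = ζ' := by
  have hπ := Real.pi_gt_three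
  obtain ⟨a1, a2, a3, a4, -⟩ := D.J_spec (by omega) hjd.le hζ
  obtain ⟨b1, b2, b3, b4, -⟩ := D.J_spec (by omega) hjd'.le hζ'
  rw [sectorCenter, abs_le] at a4 b4
  rw [abs_le] at harg
  refine eq_of_exp_N_eq (y := D.a j') hj hjd hj' hjd' (D.le_r.trans_lt a1) (D.le_r.trans_lt b1) h
    ?_ (by linarith) (by linarith) (fun e => by rw [a2, e]) b2
  rw [abs_lt]; constructor <;> linarith

theorem abs_arg_neg_sub_le {Y : ℝ} (hY : 0 ≤ Y) {ζ ζ' : ℂ}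
    (h : (ζ.re < -Y ∧ ζ'.re < -Y) ∨ (Y < ζ.im ∧ Y < ζ'.im) ∨ (ζ.im < -Y ∧ ζ'.im < -Y)) :
    |arg (-ζ) - arg (-ζ')| ≤ π := by
  rcases h with ⟨h, h'⟩ | ⟨h, h'⟩ | ⟨h, h'⟩
  · have h1 := abs_le.1 (abs_arg_le_pi_div_two_iff.2 (show 0 ≤ (-ζ).re by simp; linarith))
    have h2 := abs_le.1 (abs_arg_le_pi_div_two_iff.2 (show 0 ≤ (-ζ').re by simp; linarith))
    rw [abs_le]; constructor <;> linarith
  · have h1 := arg_neg_iff.2 (show (-ζ).im < 0 by simp; linarith)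
    have h2 := arg_neg_iff.2 (show (-ζ').im < 0 by simp; linarith)
    have h3 := neg_pi_lt_arg (-ζ)
    have h4 := neg_pi_lt_arg (-ζ')
    rw [abs_le]; constructor <;> linarith
  · have h1 := arg_nonneg_iff.2 (show 0 ≤ (-ζ).im by simp; linarith)
    have h2 := arg_nonneg_iff.2 (show 0 ≤ (-ζ').im by simp; linarith)
    have h3 := arg_le_pi (-ζ)
    have h4 := arg_le_pi (-ζ')
    rw [abs_le]; constructor <;> linarith

theorem J_im_mem (hj : 0 ≤ j) (hjd : j < d) {ζ : ℂ} (hζ : Real.exp (D.r + 1) < ‖ζ‖) :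
    -(π / 2 + 1 / 8) ≤ (D.J j ζ).im ∧ (D.J j ζ).im ≤ 2 * π * d + (π / 2 + 1 / 8) := by
  have hπ := Real.pi_gt_three
  obtain ⟨-, -, -, a4, -⟩ := D.J_spec (by omega) hjd.le hζ
  rw [sectorCenter, abs_le] at a4
  have h1 := neg_pi_lt_arg (-ζ)
  have h2 := arg_le_pi (-ζ)
  have h3 : (0 : ℝ) ≤ j := by exact_mod_cast hj
  have h4 : (j : ℝ) + 1 ≤ d := by exact_mod_cast hjd
  constructor <;> nlinarith

theorem K_im_mem (hX : D.IsThreshold X) (hj : 0 ≤ j) (hjd : j < d) {ζ : ℂ} (hζ : X < ζ.re) :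
    -(π / 2 + 1 / 8) ≤ (D.K j ζ).im ∧ (D.K j ζ).im ≤ 2 * π * d + (π / 2 + 1 / 8) := by
  have hπ := Real.pi_gt_three
  obtain ⟨-, -, -, -, a4, -⟩ := K_spec hX hj hjd.le hζ
  rw [abs_le] at a4
  have h3 : (0 : ℝ) ≤ j := by exact_mod_cast hj
  have h4 : (j : ℝ) + 1 ≤ d := by exact_mod_cast hjd
  constructor <;> nlinarith

theorem nonempty_logCharts (D : SectorCharts F) : Nonempty (LogCharts f d) := by
  obtain ⟨X, hX⟩ := D.exists_isThreshold
  have hπ := Real.pi_gt_three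
  have hY : 0 ≤ Real.exp (D.r + 1) := (Real.exp_pos _).le
  have hdR : (1 : ℝ) ≤ d := by exact_mod_cast F.d_pos
  have hJn : ∀ j : ℕ, j < d → ∀ ζ : ℂ, Real.exp (D.r + 1) < ‖ζ‖ →
      F.ρ < (D.J j ζ).re ∧ ‖F.potential (D.J j ζ) - ζ‖ ≤ 1 / 2 := fun j hj ζ hζ => by
    obtain ⟨h1, h2, h3, -⟩ := D.J_spec (j := j) (by omega) (by omega) hζ
    exact ⟨D.le_r.trans_lt h1, by linarith⟩
  refine ⟨{
    a := fun j => D.a j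
    J := fun j ζ => F.N (D.J j ζ)
    K := fun j ζ => F.N (D.K j ζ)
    X := X
    Y := Real.exp (D.r + 1)
    C := 1 + (d + 2) * ‖2 * π * I * (F.k - d : ℤ)‖
    k := F.k - d
    d_pos := F.d_pos
    a_small := fun j hj => hX.2 j (by omega) (by omega)
    J_cont := ?_
    K_cont := ?_
    f_J := fun j hj ζ hζ =>
      (D.J_spec (by omega) (by omega) (lt_norm_of_mem_leftDomain hζ)).2.1
    f_K := fun j hj ζ hζ => (K_spec hX (by omega) (by omega) hζ).2.2.1
    link_up := fun j hj ζ hζ h => by rw [K_eq_J hX (by omega) (by omega) hζ h]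
    link_down := fun j hj ζ hζ h => by
      rw [Nat.cast_succ, K_add_one_eq_J hX (by omega) (by omega) hζ h]
    link_last := ?_
    inj_K := fun j hj j' hj' ζ ζ' hζ hζ' h => by
      obtain ⟨h1, h2⟩ := eq_of_exp_K_eq hX (by omega) (by omega) (by omega) (by omega) hζ hζ' h
      exact ⟨by omega, h2⟩
    inj_J := ?_
    overlap_KJ := ?_
    overlap_JJ := ?_
    cover_K := ?_
    cover_J := ?_
    proper := ?_ }⟩
  · intro j hj ζ hζ
    have hn := lt_norm_of_mem_leftDomain hζ
    have h1 := (hJn j hj ζ hn).1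
    exact (ContinuousAt.comp (g := F.N) (f := D.J j)
      (F.N_cont.continuousAt ((isOpen_reGt F.ρ).mem_nhds h1))
      (D.continuousAt_J (by omega) (by omega) hn
        (neg_mem_slitPlane_of_mem_leftDomain hY hζ))).continuousWithinAt
  · intro j hj ζ hζ
    obtain ⟨h0, h1, -⟩ := K_spec hX (j := j) (by omega) (by omega) hζ
    exact (ContinuousAt.comp (g := F.N) (f := D.K j)
      (F.N_cont.continuousAt ((isOpen_reGt F.ρ).mem_nhds (D.le_r.trans_lt h1))) h0).continuousWithinAt
  · intro ζ hζ h
    have h1 : 0 ≤ (d + 2 : ℝ) * ‖2 * π * I * (F.k - d : ℤ)‖ := by positivity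
    have h2 := N_K_zero_add_eq hX hζ (by linarith)
    rw [Nat.cast_sub F.d_pos]
    exact_mod_cast h2
  · intro j hj j' hj' ζ ζ' h he
    have hl : Real.exp (D.r + 1) < ‖ζ‖ ∧ Real.exp (D.r + 1) < ‖ζ'‖ := by
      rcases h with ⟨h, h'⟩ | ⟨h, h'⟩ | ⟨h, h'⟩
      · exact ⟨lt_norm_of_mem_leftDomain (Or.inl h), lt_norm_of_mem_leftDomain (Or.inl h')⟩
      · exact ⟨h.trans_le (im_le_norm _), h'.trans_le (im_le_norm _)⟩
      · exact ⟨lt_norm_of_mem_leftDomain (Or.inr (by linarith [neg_le_abs ζ.im])),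
          lt_norm_of_mem_leftDomain (Or.inr (by linarith [neg_le_abs ζ'.im]))⟩
    obtain ⟨h1, h2⟩ := eq_of_exp_J_eq (by omega) (by omega) (by omega) (by omega) hl.1 hl.2
      (abs_arg_neg_sub_le hY h) he
    exact ⟨by omega, h2⟩
  · intro j hj j' hj' ζ ζ' hζ hζ' h
    obtain ⟨-, h1, -, h2, -⟩ := K_spec hX (j := j) (by omega) (by omega) hζ
    have hn := lt_norm_of_mem_leftDomain hζ'
    obtain ⟨h3, h4⟩ := hJn j' hj' ζ' hn
    have h5 := K_im_mem hX (j := j) (by omega) (by omega) hζ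
    have h6 := J_im_mem (j := j') (by omega) (by omega) hn
    refine norm_sub_le_of_exp_N_eq (D.le_r.trans_lt h1) h3 h ?_ h2 h4
    rw [abs_le]; constructor <;> linarith
  · intro j hj j' hj' ζ hζ ζ' hζ' h
    have hn := lt_norm_of_mem_leftDomain hζ'
    have hn' := lt_norm_of_mem_leftDomain hζ
    obtain ⟨h1, h2⟩ := hJn j hj ζ hn'
    obtain ⟨h3, h4⟩ := hJn j' hj' ζ' hn
    have h5 := J_im_mem (j := j) (by omega) (by omega) hn'
    have h6 := J_im_mem (j := j') (by omega) (by omega) hn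
    refine norm_sub_le_of_exp_N_eq h1 h3 h ?_ h2 h4
    rw [abs_le]; constructor <;> linarith
  · obtain ⟨R, hR⟩ := exists_K_of_large hX
    refine ⟨R, fun ω h h' => ?_⟩
    obtain ⟨j, h1, h2, ζ, h3, h4⟩ := hR ω h h'
    lift j to ℕ using h1
    exact ⟨j, by omega, ζ, h3, h4⟩
  · intro B
    obtain ⟨B', hB'⟩ := D.exists_J_of_bounded B
    refine ⟨B', fun M => ?_⟩
    obtain ⟨R, hR⟩ := hB' M
    refine ⟨R, fun ω h h' => ?_⟩
    obtain ⟨j, h1, h2, ζ, h3⟩ := hR ω h h'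
    lift j to ℕ using h1
    exact ⟨j, by omega, ζ, h3⟩
  · intro M
    have hd0 : (0 : ℝ) < d := by linarith
    have key : ∀ τ : ℂ, D.r < τ.re → (M + F.C) * d ≤ τ.re → M ≤ (F.N τ).re := fun τ h h' => by
      have h1 := F.div_sub_le_re_N (D.le_r.trans_lt h)
      rw [← le_div_iff₀ hd0] at h'
      linarith
    refine ⟨Real.exp ((M + F.C) * d + 1) + 1, fun j hj ζ hζ => ⟨fun h => ?_, fun h => ?_⟩⟩
    · obtain ⟨h1, -, -, -, h2⟩ :=
        D.J_spec (j := j) (by omega) (by omega) (lt_norm_of_mem_leftDomain h)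
      refine key _ h1 ?_
      have h3 : (M + F.C) * d + 1 ≤ Real.log ‖ζ‖ := by
        rw [Real.le_log_iff_exp_le (by linarith [Real.exp_pos ((M + F.C) * d + 1)])]
        linarith
      linarith
    · obtain ⟨-, h1, -, -, -, h2⟩ := K_spec hX (j := j) (by omega) (by omega) h
      refine key _ h1 ?_
      have h3 : (M + F.C) * d + 1 ≤ Real.log (‖ζ‖ - 1) := by
        rw [Real.le_log_iff_exp_le (by linarith [Real.exp_pos ((M + F.C) * d + 1)])]
        linarith
      linarith

end SectorCharts

theorem NormalForm.nonempty_logCharts {f : ℂ → ℂ} {d : ℕ} (F : NormalForm f d) :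
    Nonempty (LogCharts f d) :=
  F.exists_sectorCharts.elim fun D => D.nonempty_logCharts

/-- `E` is a logarithmic lift of the plane homeomorphism `κ` fixing the origin, and `κ` preserves
or reverses the orientation according to `σ`. -/
structure IsLogLift (κ E : ℂ ≃ₜ ℂ) (σ : ℤ) : Prop where
  map_zero : κ 0 = 0
  sign : σ = 1 ∨ σ = -1
  exp_apply : ∀ ω : ℂ, exp (E ω) = κ (exp ω)
  period : ∀ ω : ℂ, E (ω + 2 * π * I) = E ω + 2 * π * I * σ

theorem Homeomorph.exists_le_norm (κ : ℂ ≃ₜ ℂ) (M : ℝ) :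
    ∃ M', ∀ z : ℂ, M' ≤ ‖z‖ → M ≤ ‖κ z‖ := by
  obtain ⟨C, hC⟩ := (isCompact_closedBall (0 : ℂ) M).exists_bound_of_continuousOn
    κ.symm.continuous.continuousOn
  refine ⟨C + 1, fun z hz => ?_⟩
  by_contra! h
  have := hC (κ z) (by simpa using h.le)
  rw [κ.symm_apply_apply] at this
  linarith

theorem exists_continuous_exp_lift (κ : ℂ ≃ₜ ℂ) (h0 : κ 0 = 0) :
    ∃ E : ℂ → ℂ, Continuous E ∧ ∀ ω, exp (E ω) = κ (exp ω) := by
  obtain ⟨E, hE, h⟩ := exists_continuousOn_eqOn_exp_comp (U := univ) (g := fun ω => κ (exp ω))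
    (convex_univ.isSimplyConnected univ_nonempty) isOpen_univ
    (κ.continuous.comp continuous_exp).continuousOn (by
      rintro ⟨ω, -, hω⟩
      exact exp_ne_zero ω (κ.injective (hω.trans h0.symm)))
  exact ⟨E, continuousOn_univ.1 hE, fun ω => h (mem_univ ω)⟩

theorem exists_int_of_exp_eq {E E' : ℂ → ℂ} (hE : Continuous E) (hE' : Continuous E')
    (h : ∀ ω, exp (E ω) = exp (E' ω)) : ∃ k : ℤ, ∀ ω, E ω = E' ω + k * (2 * π * I) := by
  obtain ⟨k, hk⟩ := exists_int_of_exp_eq_one isPreconnected_univ (hE.sub hE').continuousOn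
    (fun ω _ => by simp [exp_sub, h])
  exact ⟨k, fun ω => by rw [← hk ω (mem_univ _)]; simp⟩

theorem exp_add_int_mul (z : ℂ) (k : ℤ) : exp (z + k * (2 * π * I)) = exp z := by
  rw [exp_add, exp_int_mul_two_pi_mul_I, mul_one]

theorem exp_sub_int_mul (z : ℂ) (k : ℤ) : exp (z - k * (2 * π * I)) = exp z := by
  rw [exp_sub, exp_int_mul_two_pi_mul_I, div_one]

theorem exists_isLogLift (κ : ℂ ≃ₜ ℂ) (h0 : κ 0 = 0) : ∃ E σ, IsLogLift κ E σ := by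
  obtain ⟨E, hE, h⟩ := exists_continuous_exp_lift κ h0
  obtain ⟨E', hE', h'⟩ := exists_continuous_exp_lift κ.symm (κ.symm_apply_eq.2 h0.symm)
  obtain ⟨k, hk⟩ := exists_int_of_exp_eq (hE'.comp hE) continuous_id fun ω => by simp [h, h']
  obtain ⟨k', hk'⟩ := exists_int_of_exp_eq (E := fun ω => E (E' ω - k * (2 * π * I)))
    (hE.comp (hE'.sub continuous_const)) continuous_id fun ω => by
      simp [h, exp_sub_int_mul, h']
  have hl : ∀ ω, E' (E ω) - k * (2 * π * I) = ω := fun ω => by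
    have := hk ω
    simp only [Function.comp_apply, id] at this
    rw [this]; ring
  have hr : ∀ ω, E (E' ω - k * (2 * π * I)) = ω := fun ω => by
    have h1 := hk' (E 0)
    simp only [id, hl] at h1
    have h2 := hk' ω
    simp only [id] at h2
    rw [h2, left_eq_add.1 h1, add_zero]
  obtain ⟨σ, hσ⟩ := exists_int_of_exp_eq (E := fun ω => E (ω + 2 * π * I))
    (hE.comp (continuous_id.add continuous_const)) hE fun ω => by simp [h, exp_add]
  obtain ⟨σ', hσ'⟩ := exists_int_of_exp_eq (E := fun ω => E' (ω + 2 * π * I))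
    (hE'.comp (continuous_id.add continuous_const)) hE' fun ω => by simp [h', exp_add]
  have hss : σ * σ' = 1 := by
    have h1 := hl (0 + 2 * π * I)
    have h2 := apply_add_int_mul_eq (G := E') (ρ := (E 0).re - 1) (p := 2 * π * I)
      (q := σ' * (2 * π * I)) (by simp) (fun τ _ => hσ' τ) σ (τ := E 0) (by linarith)
    have h3 := hl 0
    rw [hσ, h2] at h1
    have h4 : (σ * σ' : ℂ) * (2 * π * I) = 1 * (2 * π * I) := by linear_combination h1 - h3
    have h5 := mul_right_cancel₀ two_pi_I_ne_zero h4
    exact_mod_cast h5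
  refine ⟨⟨⟨E, fun ω => E' ω - k * (2 * π * I), hl, hr⟩, hE, hE'.sub continuous_const⟩, σ, h0,
    Int.eq_one_or_neg_one_of_mul_eq_one hss, h, fun ω => ?_⟩
  have := hσ ω
  change E (ω + 2 * π * I) = E ω + _
  rw [this]; ring

namespace IsLogLift

variable {κ E : ℂ ≃ₜ ℂ} {σ : ℤ}

theorem symm (h : IsLogLift κ E σ) : IsLogLift κ.symm E.symm σ := by
  have hp : ∀ ω, E.symm (ω + 2 * π * I * σ) = E.symm ω + 2 * π * I := fun ω => by
    rw [E.symm_apply_eq, h.period, E.apply_symm_apply]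
  refine ⟨κ.symm_apply_eq.2 h.map_zero.symm, h.sign, fun ω => ?_, fun ω => ?_⟩
  · rw [eq_comm, κ.symm_apply_eq, ← h.exp_apply, E.apply_symm_apply]
  · rcases h.sign with rfl | rfl
    · simpa using hp ω
    · have := hp (ω + 2 * π * I)
      push_cast at this ⊢
      rw [mul_neg_one, add_neg_cancel_right] at this
      rw [this]; ring

theorem add_int (h : IsLogLift κ E σ) (k : ℤ) :
    IsLogLift κ (E.trans (Homeomorph.addRight (k * (2 * π * I)))) σ := by
  refine ⟨h.map_zero, h.sign, fun ω => ?_, fun ω => ?_⟩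
  · simp only [Homeomorph.trans_apply, Homeomorph.coe_addRight, exp_add_int_mul, h.exp_apply]
  · simp only [Homeomorph.trans_apply, Homeomorph.coe_addRight, h.period]; ring

theorem re_top (h : IsLogLift κ E σ) (M : ℝ) : ∃ M', ∀ ω : ℂ, M' ≤ ω.re → M ≤ (E ω).re := by
  obtain ⟨R, hR⟩ := κ.exists_le_norm (Real.exp M)
  refine ⟨Real.log (max R 1), fun ω hω => ?_⟩
  rw [Real.log_le_iff_le_exp (by positivity)] at hω
  have := hR (exp ω) (by rw [norm_exp]; exact (le_max_left _ _).trans hω)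
  rwa [← h.exp_apply, norm_exp, Real.exp_le_exp] at this

theorem re_bot (h : IsLogLift κ E σ) (M : ℝ) : ∃ M', ∀ ω : ℂ, ω.re ≤ M' → (E ω).re ≤ M := by
  have h1 : Tendsto κ (𝓝 0) (𝓝 0) := by
    have := κ.continuous.tendsto 0
    rwa [h.map_zero] at this
  obtain ⟨ε, hε, h2⟩ := Metric.eventually_nhds_iff.1
    (h1.eventually (Metric.ball_mem_nhds 0 (Real.exp_pos M)))
  refine ⟨Real.log ε - 1, fun ω hω => ?_⟩
  have h3 := @h2 (exp ω) (by
    rw [dist_zero_right, norm_exp, ← Real.lt_log_iff_exp_lt hε]; linarith)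
  rw [← h.exp_apply, dist_zero_right, norm_exp, Real.exp_lt_exp] at h3
  exact h3.le

theorem norm_sub_le (h : IsLogLift κ E 1) (M : ℝ) :
    ∃ C, ∀ ω : ℂ, |ω.re| ≤ M → ‖E ω - ω‖ ≤ C := by
  obtain ⟨C, hC⟩ := ((isCompact_Icc (a := -M) (b := M)).reProdIm
    (isCompact_Icc (a := 0) (b := 2 * π))).exists_bound_of_continuousOn
    (f := fun ω => E ω - ω) (E.continuous.sub continuous_id).continuousOn
  refine ⟨C, fun ω hω => ?_⟩
  set m : ℤ := ⌊ω.im / (2 * π)⌋ with hm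
  have h1 : (m : ℝ) * (2 * π) ≤ ω.im := (le_div_iff₀ Real.two_pi_pos).1 (Int.floor_le _)
  have h2 : ω.im < (m + 1) * (2 * π) := (div_lt_iff₀ Real.two_pi_pos).1 (Int.lt_floor_add_one _)
  have h3 := apply_add_int_mul_eq (G := E) (ρ := ω.re - 1) (p := 2 * π * I)
    (q := 2 * π * I) (by simp) (fun τ _ => by simpa using h.period τ) m
    (τ := ω - m * (2 * π * I)) (by simp)
  rw [sub_add_cancel] at h3
  have h4 := hC (ω - m * (2 * π * I)) (by
    rw [abs_le] at hω
    refine ⟨?_, ?_⟩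
    · simpa using hω
    · simp; constructor <;> linarith)
  rw [h3]
  rwa [sub_sub_eq_add_sub] at h4

end IsLogLift

/-- The homeomorphism `w ↦ ψ (a + w) - ψ a`, which fixes the origin. -/
noncomputable def Homeomorph.recenter (ψ : ℂ ≃ₜ ℂ) (a : ℂ) : ℂ ≃ₜ ℂ :=
  ((Homeomorph.addLeft a).trans ψ).trans (Homeomorph.addRight (-ψ a))

theorem Homeomorph.recenter_apply (ψ : ℂ ≃ₜ ℂ) (a w : ℂ) : ψ.recenter a w = ψ (a + w) - ψ a := by
  simp [recenter, sub_eq_add_neg]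

theorem Homeomorph.recenter_zero (ψ : ℂ ≃ₜ ℂ) (a : ℂ) : ψ.recenter a 0 = 0 := by
  rw [recenter_apply, add_zero, sub_self]

theorem Homeomorph.recenter_symm_zero (ψ : ℂ ≃ₜ ℂ) (a : ℂ) : (ψ.recenter a).symm 0 = 0 :=
  (Homeomorph.symm_apply_eq _).2 (ψ.recenter_zero a).symm

theorem apply_add_exp_of_isLogLift {ψ E : ℂ ≃ₜ ℂ} {a : ℂ} {σ : ℤ}
    (h : IsLogLift (ψ.recenter a).symm E σ) (w : ℂ) : ψ (a + exp (E w)) = ψ a + exp w := by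
  have h1 := h.exp_apply w
  rw [Homeomorph.eq_symm_apply, Homeomorph.recenter_apply] at h1
  rw [← h1]; ring

theorem shiftLog_add_two_pi (a ζ : ℂ) : shiftLog a (ζ + 2 * π * I) = shiftLog a ζ + 2 * π * I := by
  rw [shiftLog, shiftLog, neg_add, exp_add, exp_neg (2 * π * I), exp_two_pi_mul_I]
  ring_nf

theorem exists_isLogLift_shiftLog {ψ E : ℂ ≃ₜ ℂ} (a : ℂ) (hE : IsLogLift (ψ.recenter 0).symm E 1)
    {X : ℝ} (hb : ∀ w : ℂ, X < w.re → ‖(ψ a - ψ 0) * exp (-w)‖ ≤ 1 / 16)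
    (ha : ∀ w : ℂ, X < w.re → ‖a * exp (-E w)‖ ≤ 1 / 16) :
    ∃ E', IsLogLift (ψ.recenter a).symm E' 1 ∧
      ∀ w : ℂ, X < w.re → E' (shiftLog (ψ a - ψ 0) w) = shiftLog a (E w) := by
  obtain ⟨E₁, σ, h₁⟩ := exists_isLogLift _ (ψ.recenter_symm_zero a)
  set b := ψ a - ψ 0 with hbdef
  obtain ⟨k, hk⟩ := exists_int_of_exp_eq_one (s := {w : ℂ | X < w.re})
    (convex_halfSpace_re_gt X).isPreconnected
    (D := fun w => shiftLog a (E w) - E₁ (shiftLog b w))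
    (fun w hw => (((continuousAt_shiftLog (ha w hw)).comp (f := E) E.continuous.continuousAt).sub
      (E₁.continuous.continuousAt.comp (continuousAt_shiftLog (hb w hw)))).continuousWithinAt) (by
      intro w hw
      rw [exp_sub, exp_shiftLog (ha w hw), div_eq_one_iff_eq (exp_ne_zero _)]
      refine add_left_cancel (a := a) (ψ.injective ?_)
      rw [apply_add_exp_of_isLogLift h₁, exp_shiftLog (hb w hw), add_sub_cancel,
        ← zero_add (exp (E w)), apply_add_exp_of_isLogLift hE, hbdef]
      ring)
  have h₂ := h₁.add_int k
  set E' := E₁.trans (Homeomorph.addRight (k * (2 * π * I))) with hE'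
  have key : ∀ w : ℂ, X < w.re → E' (shiftLog b w) = shiftLog a (E w) := fun w hw => by
    have := hk w hw
    simp only [hE', Homeomorph.trans_apply, Homeomorph.coe_addRight]
    rw [← this]; ring
  refine ⟨E', ?_, key⟩
  have hX : X < ((X + 1 : ℝ) : ℂ).re := by simp
  have h3 := key (((X + 1 : ℝ) : ℂ) + 2 * π * I) (by simp)
  rw [shiftLog_add_two_pi, h₂.period, hE.period, Int.cast_one, mul_one, shiftLog_add_two_pi,
    key _ hX, add_right_inj] at h3
  have h4 : ((σ : ℤ) : ℂ) = 1 := by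
    have : (2 * π * I : ℂ) * σ = 2 * π * I * 1 := by rw [h3, mul_one]
    exact mul_left_cancel₀ two_pi_I_ne_zero this
  have h5 : σ = 1 := by exact_mod_cast h4
  rwa [h5] at h₂

/-- Data lifting a topological equivalence between `f` and `g` to logarithmic coordinates. -/
structure LiftedCharts (f g : ℂ → ℂ) (d : ℕ) where
  L : LogCharts f d
  φ : ℂ ≃ₜ ℂ
  ψ : ℂ ≃ₜ ℂ
  Φ : ℂ ≃ₜ ℂ
  E₀ : ℂ ≃ₜ ℂ
  E : ℕ → ℂ ≃ₜ ℂ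
  s : ℤ
  X₁ : ℝ
  X₂ : ℝ
  conj : ∀ z, ψ (f z) = g (φ z)
  diff_g : Differentiable ℂ g
  lift_Φ : IsLogLift (φ.recenter 0) Φ s
  lift_E₀ : IsLogLift (ψ.recenter 0).symm E₀ 1
  lift_E : ∀ j < d, IsLogLift (ψ.recenter (L.a j)).symm (E j) 1
  X₁_nonneg : 0 ≤ X₁
  X₂_nonneg : 0 ≤ X₂
  small : ∀ j < d, ∀ w : ℂ, X₁ - 2 < w.re → ‖(ψ (L.a j) - ψ 0) * exp (-w)‖ ≤ 1 / 16
  re_E₀ : ∀ w : ℂ, X₁ - 2 < w.re → L.X < (E₀ w).re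
  E_shiftLog : ∀ j < d, ∀ w : ℂ, X₁ - 2 < w.re →
    E j (shiftLog (ψ (L.a j) - ψ 0) w) = shiftLog (L.a j) (E₀ w)
  re_E : ∀ j < d, ∀ w : ℂ, w.re < 1 - X₂ → (E j w).re < -L.Y
  sep : ∀ j < d, ‖ψ 0‖ + ‖ψ (L.a j)‖ + Real.exp 1 < Real.exp (X₁ - 1)

theorem exists_forall_lt_of_mono {P : ℕ → ℝ → Prop} (hP : ∀ j R R', R ≤ R' → P j R → P j R')
    (d : ℕ) (h : ∀ j < d, ∃ R, P j R) : ∃ R, ∀ j < d, P j R := by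
  choose! R hR using h
  obtain ⟨M, hM⟩ := ((Finset.range d).image R).bddAbove
  exact ⟨M, fun j hj => hP j _ _ (hM (by simpa using ⟨j, hj, rfl⟩)) (hR j hj)⟩

theorem LogCharts.exists_liftedCharts {f g : ℂ → ℂ} {d : ℕ} (L : LogCharts f d)
    (hg : Differentiable ℂ g) {φ ψ E₀ : ℂ ≃ₜ ℂ} (h : ∀ z, ψ (f z) = g (φ z))
    (hE₀ : IsLogLift (ψ.recenter 0).symm E₀ 1) : Nonempty (LiftedCharts f g d) := by
  obtain ⟨Φ, s, hΦ⟩ := exists_isLogLift _ (φ.recenter_zero 0)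
  obtain ⟨M, hM⟩ := hE₀.re_top (L.X + 1)
  have hsmall : ∃ R, ∀ j < d, ∀ w : ℂ, R < w.re → ‖(ψ (L.a j) - ψ 0) * exp (-w)‖ ≤ 1 / 16 := by
    refine exists_forall_lt_of_mono (fun j R R' hRR' h w hw => h w (hRR'.trans_lt hw)) d
      fun j hj => ?_
    have h1 := (Real.tendsto_exp_neg_atTop_nhds_zero.const_mul ‖ψ (L.a j) - ψ 0‖).eventually_lt_const
      (show ‖ψ (L.a j) - ψ 0‖ * 0 < 1 / 16 by norm_num)
    obtain ⟨R, hR⟩ := h1.exists_forall_of_atTop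
    refine ⟨R, fun w hw => ?_⟩
    rw [norm_mul, norm_exp, neg_re]
    exact (hR _ hw.le).le
  obtain ⟨R₁, hR₁⟩ := hsmall
  obtain ⟨R₂, hR₂⟩ := exists_forall_lt_of_mono
    (P := fun j R => ‖ψ 0‖ + ‖ψ (L.a j)‖ + Real.exp 1 < Real.exp (R - 1))
    (fun j R R' hRR' h => h.trans_le (Real.exp_le_exp.2 (by linarith))) d
    fun j hj => by
      obtain ⟨R, hR⟩ := (Real.tendsto_exp_atTop.eventually_gt_atTop
        (‖ψ 0‖ + ‖ψ (L.a j)‖ + Real.exp 1)).exists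
      exact ⟨R + 1, by simpa using hR⟩
  set X₁ := max (max 0 (M + 2)) (max (R₁ + 2) R₂) with hX₁
  have h1 : 0 ≤ X₁ := (le_max_left _ _).trans (le_max_left _ _)
  have h2 : M + 2 ≤ X₁ := (le_max_right _ _).trans (le_max_left _ _)
  have h3 : R₁ + 2 ≤ X₁ := (le_max_left _ _).trans (le_max_right _ _)
  have h4 : R₂ ≤ X₁ := (le_max_right _ _).trans (le_max_right _ _)
  have hre : ∀ w : ℂ, X₁ - 2 < w.re → L.X < (E₀ w).re := fun w hw => by
    have := hM w (by linarith)
    linarith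
  have hE : ∀ j, ∃ E' : ℂ ≃ₜ ℂ, j < d → IsLogLift (ψ.recenter (L.a j)).symm E' 1 ∧
      ∀ w : ℂ, X₁ - 2 < w.re → E' (shiftLog (ψ (L.a j) - ψ 0) w) = shiftLog (L.a j) (E₀ w) := by
    intro j
    by_cases hj : j < d
    · obtain ⟨E', hE'⟩ := exists_isLogLift_shiftLog (L.a j) hE₀
        (fun w hw => hR₁ j hj w (by linarith)) (fun w hw => L.a_small j hj _ (hre w hw))
      exact ⟨E', fun _ => hE'⟩
    · exact ⟨Homeomorph.refl ℂ, fun h => absurd h hj⟩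
  choose E hE using hE
  obtain ⟨R₃, hR₃⟩ := exists_forall_lt_of_mono
    (P := fun j R => ∀ w : ℂ, w.re ≤ -R → (E j w).re ≤ -L.Y - 1)
    (fun j R R' hRR' h w hw => h w (by linarith)) d fun j hj => by
      obtain ⟨M', hM'⟩ := (hE j hj).1.re_bot (-L.Y - 1)
      exact ⟨-M', fun w hw => hM' w (by linarith)⟩
  exact ⟨{
    L := L
    φ := φ
    ψ := ψ
    Φ := Φ
    E₀ := E₀
    E := E
    s := s
    X₁ := X₁
    X₂ := max 0 (R₃ + 1)
    conj := h
    diff_g := hg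
    lift_Φ := hΦ
    lift_E₀ := hE₀
    lift_E := fun j hj => (hE j hj).1
    X₁_nonneg := h1
    X₂_nonneg := le_max_left _ _
    small := fun j hj w hw => hR₁ j hj w (by linarith)
    re_E₀ := hre
    E_shiftLog := fun j hj => (hE j hj).2
    re_E := fun j hj w hw => by
      have := hR₃ j hj w (by linarith [le_max_right 0 (R₃ + 1)])
      linarith
    sep := fun j hj => (hR₂ j hj).trans_le (Real.exp_le_exp.2 (by linarith)) }⟩

namespace LiftedCharts

variable {f g : ℂ → ℂ} {d : ℕ} (T : LiftedCharts f g d)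

noncomputable def U (j : ℕ) (ζ : ℂ) : ℂ := T.Φ (T.L.K j (T.E₀ (ζ + T.X₁)))

noncomputable def V (j : ℕ) (w : ℂ) : ℂ := T.Φ (T.L.J j (T.E j w))

theorem g_exp_Φ (ω : ℂ) : g (T.φ 0 + exp (T.Φ ω)) = T.ψ (f (exp ω)) := by
  rw [T.lift_Φ.exp_apply, Homeomorph.recenter_apply, T.conj]
  congr 1
  rw [zero_add]; ring

theorem exp_Φ_eq_iff {ω ω' : ℂ} : exp (T.Φ ω) = exp (T.Φ ω') ↔ exp ω = exp ω' := by
  rw [T.lift_Φ.exp_apply, T.lift_Φ.exp_apply, (T.φ.recenter 0).injective.eq_iff]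

theorem lt_re_E₀_add {ζ : ℂ} (hζ : -1 < ζ.re) : T.L.X < (T.E₀ (ζ + T.X₁)).re :=
  T.re_E₀ _ (by simp; linarith)

theorem g_exp_U {j : ℕ} (hj : j < d) {ζ : ℂ} (hζ : -1 < ζ.re) :
    g (T.φ 0 + exp (T.U j ζ)) = T.ψ 0 + exp (ζ + T.X₁) := by
  rw [U, T.g_exp_Φ, T.L.f_K j hj _ (T.lt_re_E₀_add hζ), ← apply_add_exp_of_isLogLift T.lift_E₀,
    zero_add]

theorem g_exp_V {j : ℕ} (hj : j < d) {w : ℂ} (hw : T.E j w ∈ leftDomain T.L.Y) :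
    g (T.φ 0 + exp (T.V j w)) = T.ψ (T.L.a j) + exp w := by
  rw [V, T.g_exp_Φ, T.L.f_J j hj _ hw, ← apply_add_exp_of_isLogLift (T.lift_E j hj)]

theorem differentiableOn_U {j : ℕ} (hj : j < d) : DifferentiableOn ℂ (T.U j) {ζ | -1 < ζ.re} := by
  refine differentiableOn_of_comp (G := fun w => g (T.φ 0 + exp w))
    (H := fun ζ => T.ψ 0 + exp (ζ + T.X₁)) (isOpen_reGt (-1)) ?_ ?_ (by fun_prop) ?_
    fun ζ hζ => T.g_exp_U hj hζ
  · refine T.Φ.continuous.comp_continuousOn ((T.L.K_cont j hj).comp ?_ ?_)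
    · exact (T.E₀.continuous.comp (by fun_prop)).continuousOn
    · exact fun ζ hζ => T.lt_re_E₀_add hζ
  · have := T.diff_g
    fun_prop
  · intro ζ _
    have : HasDerivAt (fun ζ => T.ψ 0 + exp (ζ + T.X₁)) (exp (ζ + T.X₁)) ζ := by
      have := (((hasDerivAt_id ζ).add_const (T.X₁ : ℂ)).cexp).const_add (T.ψ 0)
      simpa using this
    rw [this.deriv]
    exact exp_ne_zero _

theorem differentiableOn_V {j : ℕ} (hj : j < d) {s : Set ℂ} (hs : IsOpen s)
    (h : ∀ w ∈ s, T.E j w ∈ leftDomain T.L.Y) : DifferentiableOn ℂ (T.V j) s := by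
  refine differentiableOn_of_comp (G := fun w => g (T.φ 0 + exp w))
    (H := fun ζ => T.ψ (T.L.a j) + exp ζ) hs ?_ ?_ (by fun_prop) ?_
    fun ζ hζ => T.g_exp_V hj (h ζ hζ)
  · exact T.Φ.continuous.comp_continuousOn ((T.L.J_cont j hj).comp (T.E j).continuous.continuousOn h)
  · have := T.diff_g
    fun_prop
  · intro ζ _
    have : HasDerivAt (fun ζ => T.ψ (T.L.a j) + exp ζ) (exp ζ) ζ :=
      (hasDerivAt_exp ζ).const_add _
    rw [this.deriv]
    exact exp_ne_zero _

theorem U_injective {j j' : ℕ} (hj : j < d) (hj' : j' < d) {ζ ζ' : ℂ} (hζ : -1 < ζ.re)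
    (hζ' : -1 < ζ'.re) (h : exp (T.U j ζ) = exp (T.U j' ζ')) : j = j' ∧ ζ = ζ' := by
  obtain ⟨h1, h2⟩ := T.L.inj_K j hj j' hj' _ _ (T.lt_re_E₀_add hζ) (T.lt_re_E₀_add hζ')
    (T.exp_Φ_eq_iff.1 h)
  exact ⟨h1, add_right_cancel (T.E₀.injective h2)⟩

theorem V_injective {j j' : ℕ} (hj : j < d) (hj' : j' < d) {w w' : ℂ}
    (hw : ((T.E j w).re < -T.L.Y ∧ (T.E j' w').re < -T.L.Y) ∨
      (T.L.Y < (T.E j w).im ∧ T.L.Y < (T.E j' w').im) ∨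
      ((T.E j w).im < -T.L.Y ∧ (T.E j' w').im < -T.L.Y))
    (h : exp (T.V j w) = exp (T.V j' w')) : j = j' ∧ w = w' := by
  obtain ⟨h1, h2⟩ := T.L.inj_J j hj j' hj' _ _ hw (T.exp_Φ_eq_iff.1 h)
  subst h1
  exact ⟨rfl, (T.E j).injective h2⟩

theorem exp_U_ne_exp_V {j j' : ℕ} (hj : j < d) (hj' : j' < d) {ζ w : ℂ} (hζ : -1 < ζ.re)
    (hw : w.re < 1 - T.X₂) : exp (T.U j ζ) ≠ exp (T.V j' w) := by
  intro h
  have h1 := T.g_exp_U hj hζ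
  rw [h, T.g_exp_V hj' (Or.inl (T.re_E j' hj' w hw))] at h1
  have h2 : exp (ζ + T.X₁) = T.ψ (T.L.a j') + exp w - T.ψ 0 := by rw [h1]; ring
  have h3 := norm_exp (ζ + T.X₁)
  have h4 : Real.exp (T.X₁ - 1) ≤ Real.exp (ζ + T.X₁).re :=
    Real.exp_le_exp.2 (by simp; linarith)
  have h5 : Real.exp w.re ≤ Real.exp 1 := Real.exp_le_exp.2 (by linarith [T.X₂_nonneg])
  rw [h2] at h3
  have h6 := norm_sub_le (T.ψ (T.L.a j') + exp w) (T.ψ 0)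
  have h7 := norm_add_le (T.ψ (T.L.a j')) (exp w)
  rw [norm_exp] at h7
  have := T.sep j' hj'
  linarith

theorem exists_norm_E_sub_le (M : ℝ) : ∃ C, ∀ j < d, ∀ w : ℂ, |w.re| ≤ M → ‖T.E j w - w‖ ≤ C :=
  exists_forall_lt_of_mono (fun _ _ _ hR h w hw => (h w hw).trans hR) d
    fun j hj => (T.lift_E j hj).norm_sub_le M

theorem exists_norm_E_sub_le_of_re (M : ℝ) :
    ∃ C, ∀ j < d, ∀ w : ℂ, |(T.E j w).re| ≤ M → ‖T.E j w - w‖ ≤ C := by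
  refine exists_forall_lt_of_mono (fun _ _ _ hR h w hw => (h w hw).trans hR) d fun j hj => ?_
  obtain ⟨C, hC⟩ := (T.lift_E j hj).symm.norm_sub_le M
  refine ⟨C, fun w hw => ?_⟩
  have := hC _ hw
  rwa [Homeomorph.symm_apply_apply, norm_sub_rev] at this

theorem overlap_UV (X : ℝ) : ∃ C, ∀ j < d, ∀ j' < d, ∀ ζ w : ℂ, -1 < ζ.re → |w.re| ≤ X →
    T.E j' w ∈ leftDomain T.L.Y → exp (T.U j ζ) = exp (T.V j' w) → ‖ζ - w‖ ≤ C := by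
  obtain ⟨C₁, hC₁⟩ := T.exists_norm_E_sub_le X
  obtain ⟨C₂, hC₂⟩ := T.lift_E₀.symm.norm_sub_le (T.L.C + C₁ + X)
  refine ⟨T.L.C + C₁ + C₂ + T.X₁, fun j hj j' hj' ζ w hζ hw hm h => ?_⟩
  have h1 := T.L.overlap_KJ j hj j' hj' _ _ (T.lt_re_E₀_add hζ) hm (T.exp_Φ_eq_iff.1 h)
  have h2 := hC₁ j' hj' w hw
  set x := T.E₀ (ζ + T.X₁) with hx
  have h3 : ‖x - w‖ ≤ T.L.C + C₁ := by
    have := norm_add_le (x - T.E j' w) (T.E j' w - w)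
    rw [sub_add_sub_cancel] at this
    linarith
  have h4 := hC₂ x (by
    have h5 := (abs_re_le_norm _).trans h3
    rw [sub_re] at h5
    have := abs_add_le (x.re - w.re) w.re
    rw [sub_add_cancel] at this
    linarith)
  rw [hx, Homeomorph.symm_apply_apply, ← hx] at h4
  have h6 : ζ - w = (ζ + T.X₁ - x) + (x - w) - T.X₁ := by ring
  have h7 := norm_sub_le ((ζ + T.X₁ - x) + (x - w)) T.X₁
  have h8 := norm_add_le (ζ + T.X₁ - x) (x - w)
  rw [norm_real, Real.norm_of_nonneg T.X₁_nonneg, ← h6] at h7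
  linarith

theorem overlap_VV (X : ℝ) : ∃ C, ∀ j < d, ∀ j' < d, ∀ w w' : ℂ, |w'.re| ≤ X →
    T.E j w ∈ leftDomain T.L.Y → T.E j' w' ∈ leftDomain T.L.Y →
    exp (T.V j w) = exp (T.V j' w') → ‖w - w'‖ ≤ C := by
  obtain ⟨C₁, hC₁⟩ := T.exists_norm_E_sub_le X
  obtain ⟨C₂, hC₂⟩ := T.exists_norm_E_sub_le_of_re (T.L.C + C₁ + X)
  refine ⟨T.L.C + C₁ + C₂, fun j hj j' hj' w w' hw hm hm' h => ?_⟩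
  have h1 := T.L.overlap_JJ j hj j' hj' _ hm _ hm' (T.exp_Φ_eq_iff.1 h)
  have h2 := hC₁ j' hj' w' hw
  set x := T.E j w with hx
  have h3 : ‖x - w'‖ ≤ T.L.C + C₁ := by
    have := norm_add_le (x - T.E j' w') (T.E j' w' - w')
    rw [sub_add_sub_cancel] at this
    linarith
  have h4 := hC₂ j hj w (by
    have h5 := (abs_re_le_norm _).trans h3
    rw [sub_re] at h5
    have := abs_add_le (x.re - w'.re) w'.re
    rw [sub_add_cancel] at this
    linarith)
  have h8 := norm_add_le (w - x) (x - w')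
  rw [sub_add_sub_cancel, norm_sub_rev w x] at h8
  linarith

theorem exists_leftDomain (X : ℝ) : ∃ Y, 0 ≤ Y ∧ ∀ j < d, ∀ w : ℂ, |w.re| < X →
    (Y < w.im → T.L.Y < (T.E j w).im) ∧ (w.im < -Y → (T.E j w).im < -T.L.Y) := by
  obtain ⟨C, hC⟩ := T.exists_norm_E_sub_le X
  refine ⟨max 0 (T.L.Y + C), le_max_left _ _, fun j hj w hw => ?_⟩
  have h1 := (abs_im_le_norm _).trans (hC j hj w hw.le)
  have h2 := le_max_right 0 (T.L.Y + C)
  rw [sub_im, abs_le] at h1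
  constructor <;> intro h <;> linarith

theorem cover_U : ∃ R, ∀ ω : ℂ, R ≤ ω.re → R ≤ ‖f (exp ω)‖ →
    ∃ j < d, ∃ ζ : ℂ, 0 < ζ.re ∧ exp (T.Φ ω) = exp (T.U j ζ) := by
  obtain ⟨R, hR⟩ := T.L.cover_K
  obtain ⟨M, hM⟩ := T.lift_E₀.symm.re_top (T.X₁ + 1)
  refine ⟨max R (Real.exp M), fun ω h h' => ?_⟩
  obtain ⟨j, hj, x, hx, he⟩ := hR ω ((le_max_left _ _).trans h) ((le_max_left _ _).trans h')
  rw [he, T.L.f_K j hj x hx, norm_exp] at h'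
  have h1 := hM x (Real.exp_le_exp.1 ((le_max_right _ _).trans h'))
  refine ⟨j, hj, T.E₀.symm x - T.X₁, by simp; linarith, ?_⟩
  rw [U, exp_Φ_eq_iff, sub_add_cancel, Homeomorph.apply_symm_apply, he]

theorem cover_V (B : ℝ) : ∃ B', ∀ M : ℝ, ∃ R : ℝ, ∀ ω : ℂ, R ≤ ω.re → ‖f (exp ω)‖ ≤ B →
    ∃ j < d, ∃ w : ℂ, M ≤ ‖w‖ ∧ w.re ≤ B' ∧ exp (T.Φ ω) = exp (T.V j w) := by
  obtain ⟨B₁, hB₁⟩ := T.L.cover_J B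
  obtain ⟨B', hB'⟩ := exists_forall_lt_of_mono
    (P := fun j R => ∀ w : ℂ, R ≤ w.re → B₁ + 1 ≤ (T.E j w).re)
    (fun _ _ _ hR h w hw => h w (hR.trans hw)) d fun j hj => (T.lift_E j hj).re_top (B₁ + 1)
  refine ⟨B', fun M => ?_⟩
  obtain ⟨M', hM'⟩ := exists_forall_lt_of_mono
    (P := fun j R => ∀ w : ℂ, R ≤ ‖w‖ → M ≤ ‖(T.E j).symm w‖)
    (fun _ _ _ hR h w hw => h w (hR.trans hw)) d fun j _ => (T.E j).symm.exists_le_norm M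
  obtain ⟨R, hR⟩ := hB₁ M'
  refine ⟨R, fun ω h h' => ?_⟩
  obtain ⟨j, hj, y, h1, h2, h3⟩ := hR ω h h'
  refine ⟨j, hj, (T.E j).symm y, hM' j hj y h1, ?_, ?_⟩
  · by_contra! hc
    have := hB' j hj _ hc.le
    rw [Homeomorph.apply_symm_apply] at this
    linarith
  · rw [V, exp_Φ_eq_iff, Homeomorph.apply_symm_apply, h3]

theorem exists_eq_exp_Φ (R : ℝ) : ∃ R', 1 ≤ R' ∧ ∀ z : ℂ, R' ≤ ‖z‖ →
    ∃ ω : ℂ, R ≤ ω.re ∧ z = exp (T.Φ ω) := by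
  obtain ⟨M, hM⟩ := T.lift_Φ.symm.re_top R
  refine ⟨max 1 (Real.exp M), le_max_left _ _, fun z hz => ?_⟩
  have h0 : 0 < ‖z‖ := by linarith [(le_max_left _ _).trans hz]
  refine ⟨T.Φ.symm (log z), hM _ ?_, ?_⟩
  · rw [log_re, Real.le_log_iff_exp_le h0]
    exact (le_max_right _ _).trans hz
  · rw [Homeomorph.apply_symm_apply, exp_log (norm_pos_iff.1 h0)]

theorem proper_UV (M : ℝ) : ∃ R, ∀ j < d, ∀ w : ℂ, R ≤ ‖w‖ →
    (-1 < w.re → M ≤ (T.U j w).re) ∧ (T.E j w ∈ leftDomain T.L.Y → M ≤ (T.V j w).re) := by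
  obtain ⟨M₁, hM₁⟩ := T.lift_Φ.re_top M
  obtain ⟨M₂, hM₂⟩ := T.L.proper M₁
  obtain ⟨M₃, hM₃⟩ := T.E₀.exists_le_norm M₂
  obtain ⟨M₄, hM₄⟩ := exists_forall_lt_of_mono
    (P := fun j R => ∀ w : ℂ, R ≤ ‖w‖ → M₂ ≤ ‖T.E j w‖)
    (fun _ _ _ hR h w hw => h w (hR.trans hw)) d fun j _ => (T.E j).exists_le_norm M₂
  refine ⟨max (M₃ + T.X₁) M₄, fun j hj w hw => ⟨fun h => ?_, fun h => ?_⟩⟩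
  · refine hM₁ _ ((hM₂ j hj _ (hM₃ _ ?_)).2 (T.lt_re_E₀_add h))
    have h1 := norm_sub_le (w + T.X₁) T.X₁
    rw [norm_real, Real.norm_of_nonneg T.X₁_nonneg, add_sub_cancel_right] at h1
    linarith [(le_max_left _ _).trans hw]
  · exact hM₁ _ ((hM₂ j hj _ (hM₄ j hj _ ((le_max_right _ _).trans hw))).1 h)

end LiftedCharts

namespace LiftedCharts

variable {f g : ℂ → ℂ} {d : ℕ} (T : LiftedCharts f g d)

theorem U_mul_I_eq_V {j : ℕ} (hj : j < d) {r : ℝ} (h : 1 ≤ (T.E₀ (T.X₁ + r * I)).im) :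
    T.U j (r * I) = T.V j (shiftLog (T.ψ (T.L.a j) - T.ψ 0) (T.X₁ + r * I)) := by
  have h1 : T.X₁ - 2 < (T.X₁ + r * I : ℂ).re := by simp
  rw [U, V, T.E_shiftLog j hj _ h1, add_comm, T.L.link_up j hj _ (T.re_E₀ _ h1) h]

theorem U_succ_neg_mul_I_eq_V {j : ℕ} (hj : j + 1 < d) {r : ℝ}
    (h : (T.E₀ (T.X₁ - r * I)).im ≤ -1) :
    T.U (j + 1) (-(r * I)) = T.V j (shiftLog (T.ψ (T.L.a j) - T.ψ 0) (T.X₁ - r * I)) := by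
  have h1 : T.X₁ - 2 < (T.X₁ - r * I : ℂ).re := by simp
  rw [U, V, T.E_shiftLog j (by omega) _ h1, neg_add_eq_sub, T.L.link_down j hj _ (T.re_E₀ _ h1) h]

theorem U_zero_neg_mul_I_eq_V {r : ℝ}
    (h : (T.E₀ (T.X₁ - r * I + T.L.k * (2 * π * I))).im ≤ -T.L.C) :
    T.U 0 (-(r * I)) + 2 * π * I * T.s = T.V (d - 1)
      (shiftLog (T.ψ (T.L.a (d - 1)) - T.ψ 0) (T.X₁ - r * I + T.L.k * (2 * π * I))) := by
  have hd := T.L.d_pos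
  have h1 : T.X₁ - 2 < (T.X₁ - r * I + T.L.k * (2 * π * I) : ℂ).re := by simp
  have h2 := apply_add_int_mul_eq (G := T.E₀) (ρ := T.X₁ - 2) (p := 2 * π * I)
    (q := 2 * π * I) (by simp) (fun τ _ => by simpa using T.lift_E₀.period τ) T.L.k
    (τ := T.X₁ - r * I) (by simp)
  rw [V, T.E_shiftLog (d - 1) (by omega) _ h1, ← T.L.link_last _ (T.re_E₀ _ h1) h,
    T.lift_Φ.period, h2, U, neg_add_eq_sub]
  congr 4
  ring

noncomputable def A (i : ℕ) (ζ : ℂ) : ℂ :=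
  if i = 2 * d then T.U 0 ζ + 2 * π * I * T.s
  else if Even i then T.U (i / 2) ζ else T.V (i / 2) (-ζ - T.X₂)

noncomputable def B (i : ℕ) (ξ : ℂ) : ℂ :=
  if Even i then T.V (i / 2) ξ else T.V (i / 2) (-ξ)

theorem A_even {j : ℕ} (hj : j < d) (ζ : ℂ) : T.A (2 * j) ζ = T.U j ζ := by
  rw [A, if_neg (by omega), if_pos (by simp)]
  congr 1; omega

theorem A_odd (j : ℕ) (ζ : ℂ) : T.A (2 * j + 1) ζ = T.V j (-ζ - T.X₂) := by
  rw [A, if_neg (by omega), if_neg (by simp)]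
  congr 1; omega

theorem A_last (ζ : ℂ) : T.A (2 * d) ζ = T.U 0 ζ + 2 * π * I * T.s := if_pos rfl

theorem B_even (j : ℕ) (ξ : ℂ) : T.B (2 * j) ξ = T.V j ξ := by
  rw [B, if_pos (by simp)]
  congr 1; omega

theorem B_odd (j : ℕ) (ξ : ℂ) : T.B (2 * j + 1) ξ = T.V j (-ξ) := by
  rw [B, if_neg (by simp)]
  congr 1; omega

theorem exists_half {i d : ℕ} (hi : i < 2 * d) : ∃ j < d, i = 2 * j ∨ i = 2 * j + 1 :=
  ⟨i / 2, by omega, by omega⟩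

/-- A strip coordinate is, up to sign, an argument of one of the functions `V j`. -/
theorem B_eq {i : ℕ} (hi : i < 2 * d) (ξ : ℂ) :
    ∃ j < d, ∃ ε : ℝ, (ε = 1 ∨ ε = -1) ∧ T.B i ξ = T.V j (ε * ξ) := by
  obtain ⟨j, hj, rfl | rfl⟩ := exists_half hi
  · exact ⟨j, hj, 1, Or.inl rfl, by simp [B_even]⟩
  · exact ⟨j, hj, -1, Or.inr rfl, by simp [B_odd]⟩

theorem re_neg_sub_lt {ζ : ℂ} (hζ : -1 < ζ.re) : (-ζ - T.X₂).re < 1 - T.X₂ := by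
  simp; linarith

theorem mem_leftDomain_of_re {j : ℕ} (hj : j < d) {ζ : ℂ} (hζ : -1 < ζ.re) :
    T.E j (-ζ - T.X₂) ∈ leftDomain T.L.Y :=
  Or.inl (T.re_E j hj _ (T.re_neg_sub_lt hζ))

theorem differentiableOn_A {i : ℕ} (hi : i < 2 * d) : DifferentiableOn ℂ (T.A i) {ζ | -1 < ζ.re} := by
  obtain ⟨j, hj, rfl | rfl⟩ := exists_half hi
  · exact (T.differentiableOn_U hj).congr fun ζ _ => T.A_even hj ζ
  · refine DifferentiableOn.congr ?_ fun ζ _ => T.A_odd j ζ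
    refine (T.differentiableOn_V hj (s := {w | w.re < 1 - T.X₂})
      (isOpen_lt continuous_re continuous_const)
      fun w hw => Or.inl (T.re_E j hj w hw)).comp (by fun_prop) fun ζ hζ => T.re_neg_sub_lt hζ

theorem A_injective {i i' : ℕ} (hi : i < 2 * d) (hi' : i' < 2 * d) {ζ ζ' : ℂ} (hζ : -1 < ζ.re)
    (hζ' : -1 < ζ'.re) (h : exp (T.A i ζ) = exp (T.A i' ζ')) : i = i' ∧ ζ = ζ' := by
  obtain ⟨j, hj, rfl | rfl⟩ := exists_half hi <;> obtain ⟨j', hj', rfl | rfl⟩ := exists_half hi'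
  · rw [T.A_even hj, T.A_even hj'] at h
    obtain ⟨h1, h2⟩ := T.U_injective hj hj' hζ hζ' h
    exact ⟨by omega, h2⟩
  · rw [T.A_even hj, T.A_odd] at h
    exact (T.exp_U_ne_exp_V hj hj' hζ (T.re_neg_sub_lt hζ') h).elim
  · rw [T.A_even hj', T.A_odd] at h
    exact (T.exp_U_ne_exp_V hj' hj hζ' (T.re_neg_sub_lt hζ) h.symm).elim
  · rw [T.A_odd, T.A_odd] at h
    obtain ⟨h1, h2⟩ := T.V_injective hj hj' (Or.inl ⟨T.re_E j hj _ (T.re_neg_sub_lt hζ),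
      T.re_E j' hj' _ (T.re_neg_sub_lt hζ')⟩) h
    exact ⟨by omega, by simpa using h2⟩

theorem abs_abs_im_sub_le {ε ε' : ℝ} (hε : ε = 1 ∨ ε = -1) (hε' : ε' = 1 ∨ ε' = -1) {z w : ℂ}
    {C : ℝ} (h : ‖(ε * z - ε' * w : ℂ)‖ ≤ C) : |‖z‖ - ‖w‖| ≤ C := by
  have h1 := (abs_norm_sub_norm_le _ _).trans h
  have h2 : ∀ x : ℝ, x = 1 ∨ x = -1 → ‖(x : ℂ)‖ = 1 := by
    rintro x (rfl | rfl) <;> simp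
  rwa [norm_mul, norm_mul, h2 _ hε, h2 _ hε', one_mul, one_mul] at h1

theorem abs_norm_sub_im_le {ξ : ℂ} (h : 0 ≤ ξ.im) : |‖ξ‖ - ξ.im| ≤ |ξ.re| := by
  have h1 := norm_le_abs_re_add_abs_im ξ
  have h2 := im_le_norm ξ
  rw [abs_of_nonneg h] at h1
  rw [abs_of_nonneg (by linarith)]
  linarith

theorem exists_link (X : ℝ) (h₁ : T.X₁ + 3 ≤ X) (h₂ : T.X₂ + 3 ≤ X) : ∃ C, ∀ C', C ≤ C' →
    ∃ r₀ : ℝ, ∀ i < 2 * d, ∀ r : ℝ, r₀ ≤ r → ∃ ξ ξ' : ℂ,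
    (|ξ.re| ≤ X - 2 ∧ |ξ.im - r| ≤ C') ∧ (|ξ'.re| ≤ X - 2 ∧ |ξ'.im - r| ≤ C') ∧
    T.A i (r * I) = T.B i ξ ∧ T.A (i + 1) (-(r * I)) = T.B i ξ' := by
  have hX₁ := T.X₁_nonneg
  have hX₂ := T.X₂_nonneg
  obtain ⟨C₀, hC₀⟩ := T.lift_E₀.norm_sub_le T.X₁
  have hE₀ : ∀ w : ℂ, w.re = T.X₁ → |(T.E₀ w).im - w.im| ≤ C₀ := fun w hw => by
    rw [← sub_im]
    exact (abs_im_le_norm _).trans (hC₀ w (by rw [hw, abs_of_nonneg hX₁]))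
  set k₀ := |(T.L.k : ℝ) * (2 * π)| with hk₀
  have hs : ∀ j < d, ∀ w : ℂ, w.re = T.X₁ → |(shiftLog (T.ψ (T.L.a j) - T.ψ 0) w).re| ≤ X - 2 ∧
      |(shiftLog (T.ψ (T.L.a j) - T.ψ 0) w).im - w.im| ≤ 1 / 8 := fun j hj w hw => by
    have h1 := norm_shiftLog_sub_le (T.small j hj w (by linarith))
    have h2 := (abs_re_le_norm _).trans h1
    rw [sub_re, hw, abs_le] at h2
    refine ⟨abs_le.2 ⟨by linarith, by linarith⟩, ?_⟩
    rw [← sub_im]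
    exact (abs_im_le_norm _).trans h1
  have hk0 : 0 ≤ k₀ := abs_nonneg _
  refine ⟨1 / 8 + k₀, fun C' hC' => ⟨C₀ + 1 + |T.L.C| + k₀, fun i hi r hr => ?_⟩⟩
  have hLC := abs_nonneg T.L.C
  have hLC' := le_abs_self T.L.C
  obtain ⟨j, hj, rfl | rfl⟩ := exists_half hi
  · have h1 : (T.X₁ + r * I : ℂ).re = T.X₁ := by simp
    have h2 := hE₀ _ h1
    have h3 : (T.X₁ + r * I : ℂ).im = r := by simp
    rw [h3, abs_le] at h2
    obtain ⟨h4, h5⟩ := hs j hj _ h1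
    rw [h3] at h5
    refine ⟨_, r * I - T.X₂, ⟨h4, h5.trans (by linarith)⟩, ⟨?_, ?_⟩, ?_, ?_⟩
    · simp [abs_of_nonneg hX₂]; linarith
    · simp; linarith
    · rw [T.A_even hj, T.B_even, T.U_mul_I_eq_V hj (by linarith)]
    · rw [T.A_odd, T.B_even, neg_neg]
  · have h1 : (T.X₁ - r * I : ℂ).re = T.X₁ := by simp
    have h2 := hE₀ _ h1
    have h3 : (T.X₁ - r * I : ℂ).im = -r := by simp
    rw [h3, abs_le] at h2
    obtain ⟨h4, h5⟩ := hs j hj _ h1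
    rw [h3] at h5
    have hξ : T.A (2 * j + 1) (r * I) = T.B (2 * j + 1) (r * I + T.X₂) := by
      rw [T.A_odd, T.B_odd, neg_add, sub_eq_add_neg]
    have hneg : ∀ w : ℂ, |(-w).im - r| = |w.im - -r| := fun w => by
      rw [neg_im, ← abs_neg]; ring_nf
    rcases Nat.lt_or_ge (j + 1) d with hjd | hjd
    · refine ⟨r * I + T.X₂, -shiftLog (T.ψ (T.L.a j) - T.ψ 0) (T.X₁ - r * I), ⟨?_, ?_⟩, ⟨?_, ?_⟩,
        hξ, ?_⟩
      · simp [abs_of_nonneg hX₂]; linarith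
      · simp; linarith
      · rwa [neg_re, abs_neg]
      · rw [hneg]; linarith
      · rw [show 2 * j + 1 + 1 = 2 * (j + 1) by ring, T.A_even hjd, T.B_odd, neg_neg,
          T.U_succ_neg_mul_I_eq_V hjd (by linarith)]
    · obtain rfl : j = d - 1 := by omega
      have g1 : (T.X₁ - r * I + T.L.k * (2 * π * I) : ℂ).re = T.X₁ := by simp
      have g3 : (T.X₁ - r * I + T.L.k * (2 * π * I) : ℂ).im = -r + T.L.k * (2 * π) := by simp
      have g2 := hE₀ _ g1
      obtain ⟨g4, g5⟩ := hs (d - 1) hj _ g1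
      rw [g3, abs_le] at g2 g5
      have g6 := neg_abs_le ((T.L.k : ℝ) * (2 * π))
      have g7 := le_abs_self ((T.L.k : ℝ) * (2 * π))
      refine ⟨r * I + T.X₂, -shiftLog (T.ψ (T.L.a (d - 1)) - T.ψ 0)
        (T.X₁ - r * I + T.L.k * (2 * π * I)), ⟨?_, ?_⟩, ⟨?_, ?_⟩, hξ, ?_⟩
      · simp [abs_of_nonneg hX₂]; linarith
      · simp; linarith
      · rwa [neg_re, abs_neg]
      · rw [hneg, abs_le]; constructor <;> linarith
      · rw [show 2 * (d - 1) + 1 + 1 = 2 * d by omega, T.A_last, T.B_odd, neg_neg,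
          T.U_zero_neg_mul_I_eq_V (by linarith)]

theorem exists_tractSystem : ∃ S : TractSystem d, S.A = T.A := by
  have hX₁ := T.X₁_nonneg
  have hX₂ := T.X₂_nonneg
  have hd := T.L.d_pos
  obtain ⟨R₁, hR₁⟩ := T.cover_U
  obtain ⟨B', hB'⟩ := T.cover_V R₁
  set X := max (T.X₁ + 3) (T.X₂ + 3) + |B'| with hX
  have hB0 := abs_nonneg B'
  have hB1 := le_abs_self B'
  have hX1 := le_max_left (T.X₁ + 3) (T.X₂ + 3)
  have hX2 := le_max_right (T.X₁ + 3) (T.X₂ + 3)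
  obtain ⟨C₁, hC₁⟩ := T.exists_link X (by linarith) (by linarith)
  obtain ⟨C₂, hC₂⟩ := T.overlap_UV X
  obtain ⟨C₃, hC₃⟩ := T.overlap_VV X
  obtain ⟨Y, hY0, hY⟩ := T.exists_leftDomain X
  have hB : ∀ i < 2 * d, ∀ ξ : ℂ, |ξ.re| < X → Y < ξ.im → ∃ j < d, ∃ ε : ℝ, (ε = 1 ∨ ε = -1) ∧
      T.B i ξ = T.V j (ε * ξ) ∧ T.E j (ε * ξ) ∈ leftDomain T.L.Y ∧ |((ε : ℂ) * ξ).re| < X := by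
    intro i hi ξ h1 h2
    obtain ⟨j, hj, ε, hε, he⟩ := T.B_eq hi ξ
    have h3 : |((ε : ℂ) * ξ).re| < X := by
      rcases hε with rfl | rfl <;> simpa using h1
    refine ⟨j, hj, ε, hε, he, Or.inr ?_, h3⟩
    rcases hε with rfl | rfl
    · exact lt_abs.2 (Or.inl ((hY j hj _ h3).1 (by simpa using h2)))
    · refine lt_abs.2 (Or.inr ?_)
      have := (hY j hj _ h3).2 (by simpa using h2)
      linarith
  refine ⟨{
    A := T.A
    B := T.B
    X := X
    Y := Y
    C := |C₁| + |C₂| + |C₃| + X + T.X₂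
    s := T.s
    d_pos := hd
    two_lt_X := by linarith
    C_nonneg := by
      have := abs_nonneg C₁
      have := abs_nonneg C₂
      have := abs_nonneg C₃
      linarith
    s_ne := by rcases T.lift_Φ.sign with h | h <;> rw [h] <;> decide
    A_diff := fun i hi => T.differentiableOn_A hi
    A_inj := fun i hi i' hi' ζ ζ' hζ hζ' h => T.A_injective hi hi' hζ hζ' h
    B_diff := ?_
    B_inj := ?_
    A_close := fun ζ => by rw [T.A_last, ← T.A_even hd]
    link := hC₁ _ (by
      have := le_abs_self C₁
      have := abs_nonneg C₂
      have := abs_nonneg C₃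
      linarith)
    cover := ?_
    overlapAB := ?_
    overlapBB := ?_
    properA := ?_
    properB := ?_ }, rfl⟩
  · intro i hi
    obtain ⟨j, hj, rfl | rfl⟩ := exists_half hi
    · refine DifferentiableOn.congr ?_ fun ξ _ => T.B_even j ξ
      exact T.differentiableOn_V hj (TractSystem.isOpen_strip X Y) fun w hw =>
        Or.inr (lt_abs.2 (Or.inl ((hY j hj w hw.1).1 hw.2)))
    · refine DifferentiableOn.congr ?_ fun ξ _ => T.B_odd j ξ
      refine (T.differentiableOn_V hj (s := Neg.neg ⁻¹' {ξ | |ξ.re| < X ∧ Y < ξ.im})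
        ((TractSystem.isOpen_strip X Y).preimage continuous_neg) fun w hw => ?_).comp
        (by fun_prop) fun ξ hξ => by simpa using hξ
      have := (hY j hj w (by simpa using hw.1)).2 (by have := hw.2; simp at this; linarith)
      exact Or.inr (lt_abs.2 (Or.inr (by linarith)))
  · intro i hi ξ hξ ξ' hξ' h
    obtain ⟨j, hj, rfl | rfl⟩ := exists_half hi
    · simp only [T.B_even] at h
      exact (T.V_injective hj hj (Or.inr (Or.inl ⟨(hY j hj _ hξ.1).1 hξ.2,
        (hY j hj _ hξ'.1).1 hξ'.2⟩)) h).2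
    · simp only [T.B_odd] at h
      have h0 : ∀ ξ : ℂ, |ξ.re| < X ∧ Y < ξ.im → (T.E j (-ξ)).im < -T.L.Y := fun ξ hξ =>
        (hY j hj _ (by simpa using hξ.1)).2 (by simpa using hξ.2)
      exact neg_injective (T.V_injective hj hj (Or.inr (Or.inr ⟨h0 ξ hξ, h0 ξ' hξ'⟩)) h).2
  · obtain ⟨R₂, hR₂⟩ := hB' (X + Y + 1 + X)
    obtain ⟨R₀, -, hR₀⟩ := T.exists_eq_exp_Φ (max R₁ R₂)
    refine ⟨R₀, fun z hz => ?_⟩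
    obtain ⟨ω, hω, rfl⟩ := hR₀ z hz
    rcases le_total R₁ ‖f (exp ω)‖ with h | h
    · obtain ⟨j, hj, ζ, h1, h2⟩ := hR₁ ω ((le_max_left _ _).trans hω) h
      exact Or.inl ⟨2 * j, by omega, ζ, h1, by rw [T.A_even hj, h2]⟩
    · obtain ⟨j, hj, w, h1, h2, h3⟩ := hR₂ ω ((le_max_right _ _).trans hω) h
      rcases lt_or_ge w.re (-T.X₂) with h4 | h4
      · refine Or.inl ⟨2 * j + 1, by omega, -w - T.X₂, by simp; linarith, ?_⟩
        rw [T.A_odd, h3]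
        congr 2; ring
      · have h5 : |w.re| < X - 2 := abs_lt.2 ⟨by linarith, by linarith⟩
        have h6 := norm_le_abs_re_add_abs_im w
        have h7 : Y + 1 < |w.im| := by linarith
        rcases lt_abs.1 h7 with h8 | h8
        · exact Or.inr ⟨2 * j, by omega, w, h5, h8, by rw [T.B_even, h3]⟩
        · exact Or.inr ⟨2 * j + 1, by omega, -w, by simpa using h5, by simpa using h8,
            by rw [T.B_odd, neg_neg, h3]⟩
  · intro i hi i' hi' ζ ξ hζ h1 h2 h
    obtain ⟨j', hj', ε, hε, he, hm, hre⟩ := hB i' hi' ξ (by linarith) (by linarith)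
    rw [he] at h
    have h3 := abs_norm_sub_im_le (ξ := ξ) (by linarith)
    have a1 := abs_nonneg C₁
    have a2 := abs_nonneg C₂
    have a3 := abs_nonneg C₃
    have a4 := le_abs_self C₂
    have a5 := le_abs_self C₃
    have h4 : |‖ζ‖ - ‖ξ‖| ≤ |C₂| + |C₃| + T.X₂ := by
      obtain ⟨j, hj, rfl | rfl⟩ := exists_half hi
      · rw [T.A_even hj] at h
        have := hC₂ j hj j' hj' ζ _ (by linarith) hre.le hm h
        refine abs_abs_im_sub_le (ε := 1) (Or.inl rfl) hε ?_
        rw [ofReal_one, one_mul]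
        linarith
      · rw [T.A_odd] at h
        have := hC₃ j hj j' hj' _ _ hre.le (T.mem_leftDomain_of_re hj (by linarith)) hm h
        refine abs_abs_im_sub_le (ε := -1) (Or.inr rfl) hε ?_
        have h5 := norm_add_le (-ζ - T.X₂ - ε * ξ) (T.X₂ : ℂ)
        rw [norm_real, Real.norm_of_nonneg hX₂] at h5
        have h6 : ((-1 : ℝ) : ℂ) * ζ - ε * ξ = -ζ - T.X₂ - ε * ξ + T.X₂ := by push_cast; ring
        rw [h6]
        linarith
    have h5 := abs_sub_le ‖ζ‖ ‖ξ‖ ξ.im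
    linarith
  · intro i hi i' hi' ξ ξ' h1 h2 h1' h2' h
    obtain ⟨j, hj, ε, hε, he, hm, hre⟩ := hB i hi ξ (by linarith) (by linarith)
    obtain ⟨j', hj', ε', hε', he', hm', hre'⟩ := hB i' hi' ξ' (by linarith) (by linarith)
    rw [he, he'] at h
    have h3 := (abs_im_le_norm _).trans (hC₃ j hj j' hj' _ _ hre'.le hm hm' h)
    have h4 : |ξ.im - ξ'.im| ≤ |(ε * ξ - ε' * ξ' : ℂ).im| := by
      have h5 := abs_abs_sub_abs_le (ε * ξ : ℂ).im (ε' * ξ' : ℂ).im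
      have h6 : |(ε * ξ : ℂ).im| = ξ.im := by
        rw [← abs_of_nonneg (by linarith : 0 ≤ ξ.im)]
        rcases hε with rfl | rfl <;> simp
      have h6' : |(ε' * ξ' : ℂ).im| = ξ'.im := by
        rw [← abs_of_nonneg (by linarith : 0 ≤ ξ'.im)]
        rcases hε' with rfl | rfl <;> simp
      rwa [← sub_im, h6, h6'] at h5
    have := abs_nonneg C₁
    have := abs_nonneg C₂
    have := le_abs_self C₃
    linarith
  · intro M
    obtain ⟨R, hR⟩ := T.proper_UV M
    refine ⟨|R| + T.X₂, fun i hi ζ hζ h => ?_⟩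
    have hRa := le_abs_self R
    obtain ⟨j, hj, rfl | rfl⟩ := exists_half hi
    · rw [T.A_even hj]
      exact (hR j hj ζ (by linarith)).1 hζ
    · rw [T.A_odd]
      refine (hR j hj _ ?_).2 (T.mem_leftDomain_of_re hj hζ)
      have h5 := norm_add_le (-ζ - T.X₂) (T.X₂ : ℂ)
      rw [norm_real, Real.norm_of_nonneg hX₂, sub_add_cancel, norm_neg] at h5
      linarith
  · intro M
    obtain ⟨R, hR⟩ := T.proper_UV M
    refine ⟨R, fun i hi ξ h1 h2 h => ?_⟩
    obtain ⟨j, hj, ε, hε, he, hm, hre⟩ := hB i hi ξ h1 h2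
    rw [he]
    refine (hR j hj _ ?_).2 hm
    have : ‖((ε : ℂ) * ξ)‖ = ‖ξ‖ := by
      rcases hε with rfl | rfl <;> simp
    rw [this]
    exact h.trans (im_le_norm ξ)

theorem entireOrder_eq (T : LiftedCharts f g d) : entireOrder g = d := by
  have hd := T.L.d_pos
  obtain ⟨S, hS⟩ := T.exists_tractSystem
  obtain ⟨R₁, hR₁⟩ := T.cover_U
  obtain ⟨R₂, hR₂⟩ := T.ψ.symm.exists_le_norm R₁
  obtain ⟨R₃, -, hR₃⟩ := T.exists_eq_exp_Φ R₁
  refine S.entireOrder_eq (z₀ := T.φ 0) (b := T.ψ 0) (X₁ := T.X₁) ⟨max R₂ R₃, ?_⟩ ?_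
  · intro z hz hgz
    obtain ⟨ω, hω, rfl⟩ := hR₃ z ((le_max_right _ _).trans hz)
    rw [T.g_exp_Φ] at hgz
    have h1 := hR₂ _ ((le_max_left _ _).trans hgz)
    rw [Homeomorph.symm_apply_apply] at h1
    obtain ⟨j, hj, ζ, h2, h3⟩ := hR₁ ω hω h1
    refine ⟨2 * j, by omega, ζ, h2, ?_, ?_⟩
    · rw [hS, T.A_even hj, h3]
    · rw [h3, T.g_exp_U hj (by linarith)]
  · intro ζ hζ
    rw [hS, show (0 : ℕ) = 2 * 0 from rfl, T.A_even hd, T.g_exp_U hd (by linarith)]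

end LiftedCharts

theorem NormalForm.entireOrder_eq {f g : ℂ → ℂ} {d : ℕ} (F : NormalForm f d)
    (hg : Differentiable ℂ g) {φ ψ : ℂ ≃ₜ ℂ} (h : ∀ z, ψ (f z) = g (φ z)) : entireOrder g = d := by
  obtain ⟨E, σ, hE⟩ := exists_isLogLift _ (ψ.recenter_symm_zero 0)
  rcases hE.sign with rfl | rfl
  · obtain ⟨L⟩ := F.nonempty_logCharts
    obtain ⟨T⟩ := L.exists_liftedCharts hg h hE
    exact T.entireOrder_eq
  · obtain ⟨L⟩ := F.conj.nonempty_logCharts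
    let c : ℂ ≃ₜ ℂ := conjLIE.toHomeomorph
    have hc : ∀ z, c z = (starRingEnd ℂ) z := fun z => rfl
    have hE' : IsLogLift ((c.trans ψ).recenter 0).symm (E.trans c) 1 := by
      refine ⟨Homeomorph.recenter_symm_zero _ _, Or.inl rfl, fun ω => ?_, fun ω => ?_⟩
      · rw [Homeomorph.eq_symm_apply, Homeomorph.recenter_apply, zero_add, Homeomorph.trans_apply,
          Homeomorph.trans_apply, Homeomorph.trans_apply, hc, hc, hc, exp_conj, map_zero,
          Complex.conj_conj]
        simpa using sub_eq_of_eq_add' (apply_add_exp_of_isLogLift hE ω)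
      · rw [Homeomorph.trans_apply, Homeomorph.trans_apply, hc, hc, hE.period]
        simp [Complex.conj_ofNat]
    obtain ⟨T⟩ := L.exists_liftedCharts (φ := c.trans φ) hg (fun z => by simp [hc, h]) hE'
    exact T.entireOrder_eq

theorem order_invariant_rational_nonlinearity (f g : ℂ → ℂ)
    (hf : TranscendentalEntire f) (hg : TranscendentalEntire g)
    (P Q : Polynomial ℂ) (hQ : Q ≠ 0)
    (heq : ∀ z : ℂ, deriv (deriv f) z * Q.eval z = deriv f z * P.eval z)
    (htop : TopEquiv f g) : entireOrder g = entireOrder f := by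
  obtain ⟨d, ⟨F⟩⟩ := exists_normalForm hf hQ heq
  obtain ⟨φ, ψ, h⟩ := htop
  rw [F.entireOrder_eq hg.1 h,
    F.entireOrder_eq hf.1 (φ := Homeomorph.refl ℂ) (ψ := Homeomorph.refl ℂ) fun _ => rfl]
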